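/- (Hildebrand, 1986) For every ε ∈ (0, 3/5) there exists a constant C_ε > 0 such that for all integers n ≥ 2 and m ≥ 2 with Υ(n,m) ≤ exp((log m)^{3/5 − ε}), one has |Ψ(n,m) − n·ρ(Υ(n,m))| ≤ C_ε · n·ρ(Υ(n,m)) · log(Υ(n,m) + 1)/log(m). -/

import Mathlib

open Real
open scoped Classical

/-- `Psi n m` is the number of `m`-smooth integers in `{1,…,n}`. -/
noncomputable def Psi (n m : ℕ) : ℕ :=
  ((Finset.Icc 1 n).filter (fun k => ∀ p : ℕ, p.Prime → p ∣ k → p ≤ m)).card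

/-- `Upsilon n m = log n / log m`. -/
noncomputable def Upsilon (n m : ℕ) : ℝ := Real.log n / Real.log m

namespace Vinogradov

open Finset MvPolynomial in
/-- Equal power sums force equal elementary symmetric functions when `1, …, k` are invertible. -/
theorem aeval_esymm_eq_of_psum_eq {R : Type*} [CommRing R] {k : ℕ} (x y : Fin k → R)
    (hunit : ∀ j : ℕ, 1 ≤ j → j ≤ k → IsUnit (j : R))
    (h : ∀ j : ℕ, 1 ≤ j → j ≤ k → ∑ i, x i ^ j = ∑ i, y i ^ j) (j : ℕ) (hj : j ≤ k) :
    aeval x (esymm (Fin k) R j) = aeval y (esymm (Fin k) R j) := by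
  induction j using Nat.strong_induction_on with
  | _ j ih =>
    rcases Nat.eq_zero_or_pos j with rfl | hpos
    · simp
    · have key : ∀ z : Fin k → R, (j : R) * aeval z (esymm (Fin k) R j) =
          (-1) ^ (j + 1) * ∑ a ∈ antidiagonal j with a.1 < j,
            (-1) ^ a.1 * aeval z (esymm (Fin k) R a.1) * ∑ i, z i ^ a.2 := by
        intro z
        have := congrArg (aeval z) (mul_esymm_eq_sum (Fin k) R j)
        simpa [psum, map_sum] using this
      apply (hunit j hpos hj).mul_left_cancel
      rw [key x, key y]
      congr 1
      refine Finset.sum_congr rfl fun a ha => ?_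
      simp only [mem_filter, Finset.HasAntidiagonal.mem_antidiagonal] at ha
      rw [ih a.1 ha.2 (by omega), h a.2 (by omega) (by omega)]

open Finset MvPolynomial in
theorem prod_sub_eq_of_psum_eq {R : Type*} [CommRing R] {k : ℕ} (x y : Fin k → R)
    (hunit : ∀ j : ℕ, 1 ≤ j → j ≤ k → IsUnit (j : R))
    (h : ∀ j : ℕ, 1 ≤ j → j ≤ k → ∑ i, x i ^ j = ∑ i, y i ^ j) (z : R) :
    ∏ i, (z - x i) = ∏ i, (z - y i) := by
  have key : ∀ w : Fin k → R, ∏ i, (z - w i) =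
      ∑ j ∈ range (k + 1), (-1) ^ j * (aeval w (esymm (Fin k) R j) * z ^ (k - j)) := by
    intro w
    have h1 := Multiset.prod_X_sub_X_eq_sum_esymm ((univ : Finset (Fin k)).val.map w)
    have h2 := congrArg (Polynomial.eval z) h1
    simp only [Multiset.map_map, Multiset.card_map, Finset.card_val, Finset.card_univ,
      Fintype.card_fin, Polynomial.eval_finsetSum, Polynomial.eval_mul, Polynomial.eval_pow,
      Polynomial.eval_neg, Polynomial.eval_one, Polynomial.eval_C, Polynomial.eval_X] at h2
    rw [Polynomial.eval_multiset_prod, Multiset.map_map] at h2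
    simp only [Function.comp_def, Polynomial.eval_sub, Polynomial.eval_X, Polynomial.eval_C] at h2
    simpa [aeval_esymm_eq_multiset_esymm, List.prod_ofFn] using h2
  rw [key x, key y]
  refine Finset.sum_congr rfl fun j hj => ?_
  rw [aeval_esymm_eq_of_psum_eq x y hunit h j (by simpa [Nat.lt_succ_iff] using hj)]

/-- A tuple with pairwise invertible differences is determined up to permutation by its first
`k` power sums. -/
theorem exists_perm_of_psum_eq {R : Type*} [CommRing R] [IsLocalRing R]
    {k : ℕ} (x y : Fin k → R)
    (hunit : ∀ j : ℕ, 1 ≤ j → j ≤ k → IsUnit (j : R))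
    (hx : ∀ i j, i ≠ j → IsUnit (x i - x j)) (hy : ∀ i j, i ≠ j → IsUnit (y i - y j))
    (h : ∀ j : ℕ, 1 ≤ j → j ≤ k → ∑ i, x i ^ j = ∑ i, y i ^ j) :
    ∃ σ : Equiv.Perm (Fin k), y = x ∘ σ := by
  have hex : ∀ i, ∃ l, y i = x l := by
    intro i
    have h0 : ∏ l, (y i - x l) = 0 := by
      rw [prod_sub_eq_of_psum_eq x y hunit h]
      exact Finset.prod_eq_zero (Finset.mem_univ i) (sub_self _)
    have hnu : ∃ l, ¬ IsUnit (y i - x l) := by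
      by_contra hcon
      push Not at hcon
      have : IsUnit (∏ l, (y i - x l)) :=
        (IsUnit.prod_univ_iff).2 hcon
      rw [h0] at this
      exact not_isUnit_zero this
    obtain ⟨l, hl⟩ := hnu
    refine ⟨l, ?_⟩
    have hu : IsUnit (∏ m ∈ Finset.univ.erase l, (y i - x m)) := by
      refine (IsUnit.prod_iff).2 fun m hm => ?_
      have hml : m ≠ l := (Finset.mem_erase.1 hm).1
      by_contra hm'
      have := IsLocalRing.nonunits_add (a := y i - x l) (b := -(y i - x m)) hl
        (by simpa [mem_nonunits_iff] using (fun hh => hm' (by simpa using hh.neg)))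
      apply this
      have e : y i - x l + -(y i - x m) = x m - x l := by ring
      rw [e]
      exact hx m l hml
    rw [← Finset.mul_prod_erase _ _ (Finset.mem_univ l)] at h0
    exact sub_eq_zero.1 ((hu.mul_left_eq_zero).1 h0)
  choose σ hσ using hex
  have hinj : Function.Injective σ := by
    intro a b hab
    by_contra hne
    have := hy a b hne
    rw [hσ a, hσ b, hab, sub_self] at this
    exact not_isUnit_zero this
  exact ⟨Equiv.ofBijective σ (Finite.injective_iff_bijective.1 hinj), funext fun i => hσ i⟩

theorem isUnit_intCast_zmod_prime_pow {p k : ℕ} (hp : p.Prime) (hk : 0 < k) (z : ℤ) :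
    IsUnit ((z : ℤ) : ZMod (p ^ k)) ↔ ¬ (p : ℤ) ∣ z := by
  rw [ZMod.coe_int_isUnit_iff_isCoprime]
  push_cast
  rw [IsCoprime.pow_left_iff hk, Prime.coprime_iff_not_dvd (Nat.prime_iff_prime_int.1 hp)]

theorem isLocalRing_zmod_prime_pow {p k : ℕ} (hp : p.Prime) (hk : 0 < k) :
    IsLocalRing (ZMod (p ^ k)) := by
  have : Fact (1 < p ^ k) := ⟨Nat.one_lt_pow hk.ne' hp.one_lt⟩
  refine IsLocalRing.of_nonunits_add fun a b ha hb => ?_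
  obtain ⟨a, rfl⟩ := ZMod.intCast_surjective a
  obtain ⟨b, rfl⟩ := ZMod.intCast_surjective b
  rw [mem_nonunits_iff, isUnit_intCast_zmod_prime_pow hp hk, not_not] at ha hb
  rw [mem_nonunits_iff, ← Int.cast_add, isUnit_intCast_zmod_prime_pow hp hk, not_not]
  exact dvd_add ha hb

theorem intCast_mem_image_of_modEq {p k j : ℕ} (hp : p.Prime) (hj : j ≤ k) {S c : ℤ}
    (h : S ≡ c [ZMOD (p : ℤ) ^ j]) :
    (S : ZMod (p ^ k)) ∈ (Finset.range (p ^ (k - j))).image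
      (fun m : ℕ => ((c + (p : ℤ) ^ j * m : ℤ) : ZMod (p ^ k))) := by
  obtain ⟨m, hm⟩ := h.symm.dvd
  have hpos : (0 : ℤ) < (p : ℤ) ^ (k - j) := by have := hp.pos; positivity
  refine Finset.mem_image.2 ⟨(m % (p : ℤ) ^ (k - j)).toNat, ?_, ?_⟩
  · rw [Finset.mem_range]
    have h1 := Int.emod_lt_of_pos m hpos
    have h0 := Int.emod_nonneg m hpos.ne'
    zify
    rwa [Int.toNat_of_nonneg h0]
  · have h0 := Int.emod_nonneg m hpos.ne'
    rw [Int.toNat_of_nonneg h0, ZMod.intCast_eq_intCast_iff_dvd_sub]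
    have hpk : (p : ℤ) ^ k = (p : ℤ) ^ j * (p : ℤ) ^ (k - j) := by
      rw [← pow_add]; congr 1; omega
    refine ⟨m / (p : ℤ) ^ (k - j), ?_⟩
    push_cast
    rw [hpk]
    have := Int.emod_add_mul_ediv m ((p : ℤ) ^ (k - j))
    have h2 : S = c + (p : ℤ) ^ j * m := by linarith
    rw [h2]
    linear_combination (-(p : ℤ) ^ j) * this

/-- Tuples in `[1, X]^k`, pairwise distinct modulo `p`, whose shifted `j`-th power sums are
prescribed modulo `p ^ j`. -/
noncomputable def linnikSet (p k X : ℕ) (a : ℤ) (c : Fin k → ℤ) : Finset (Fin k → ℕ) :=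
  (Fintype.piFinset fun _ : Fin k => Finset.Icc 1 X).filter fun x =>
    (∀ i j, i ≠ j → ¬ ((x i : ℤ) ≡ x j [ZMOD p])) ∧
    ∀ j : Fin k, (∑ i, ((x i : ℤ) - a) ^ (j + 1 : ℕ)) ≡ c j [ZMOD (p : ℤ) ^ (j + 1 : ℕ)]

/-- **Linnik's lemma.** -/
theorem card_linnikSet_le {p k X : ℕ} (hp : p.Prime) (hkp : k < p) (hX : X ≤ p ^ k) (a : ℤ)
    (c : Fin k → ℤ) :
    (linnikSet p k X a c).card ≤ k.factorial * p ^ (k * (k - 1) / 2) := by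
  rcases Nat.eq_zero_or_pos k with rfl | hk
  · refine (Finset.card_le_univ _).trans ?_
    simp
  have : IsLocalRing (ZMod (p ^ k)) := isLocalRing_zmod_prime_pow hp hk
  have hunit : ∀ j : ℕ, 1 ≤ j → j ≤ k → IsUnit (j : ZMod (p ^ k)) := fun j h1 h2 =>
    (ZMod.isUnit_natCast_iff_not_dvd_pow hp hk).2
      fun h => absurd (Nat.le_of_dvd h1 h) (by omega)
  let red : (Fin k → ℕ) → Fin k → ZMod (p ^ k) := fun x i => (((x i : ℤ) - a : ℤ) : ZMod (p ^ k))
  let F : (Fin k → ℕ) → Fin k → ZMod (p ^ k) := fun x j => ∑ i, red x i ^ (j + 1 : ℕ)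
  let T : Finset (Fin k → ZMod (p ^ k)) := Fintype.piFinset fun j : Fin k =>
    (Finset.range (p ^ (k - (j + 1)))).image
      (fun m : ℕ => ((c j + (p : ℤ) ^ (j + 1 : ℕ) * m : ℤ) : ZMod (p ^ k)))
  have hT : T.card ≤ p ^ (k * (k - 1) / 2) := by
    calc T.card = ∏ j : Fin k, _ := Fintype.card_piFinset _
      _ ≤ ∏ j : Fin k, p ^ (k - (j + 1)) :=
          Finset.prod_le_prod' fun j _ => Finset.card_image_le.trans (by simp)
      _ = p ^ (k * (k - 1) / 2) := by
          rw [Finset.prod_pow_eq_pow_sum, Fin.sum_univ_eq_sum_range (fun j => k - (j + 1)),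
            ← Finset.sum_range_id, ← Finset.sum_range_reflect]
          congr 1
          refine Finset.sum_congr rfl fun j hj => ?_
          have := Finset.mem_range.1 hj
          omega
  have hmaps : ∀ x ∈ linnikSet p k X a c, F x ∈ T := by
    intro x hx
    simp only [linnikSet, Finset.mem_filter] at hx
    refine Fintype.mem_piFinset.2 fun j => ?_
    have := intCast_mem_image_of_modEq (k := k) (j := j + 1) hp (by omega) (hx.2.2 j)
    simpa [F, red] using this
  have hinj : Set.InjOn red (linnikSet p k X a c : Set (Fin k → ℕ)) := by
    intro x hx y hy hxy
    simp only [linnikSet, Finset.coe_filter, Set.mem_ofPred_eq, Fintype.mem_piFinset,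
      Finset.mem_Icc] at hx hy
    funext i
    have h1 := congrFun hxy i
    simp only [red] at h1
    rw [ZMod.intCast_eq_intCast_iff_dvd_sub] at h1
    have hxi := hx.1 i
    have hyi := hy.1 i
    have h2 : ((y i : ℤ) - a - (x i - a)) = 0 := by
      apply Int.eq_zero_of_abs_lt_dvd h1
      rw [abs_lt]
      push_cast
      have : (X : ℤ) ≤ (p : ℤ) ^ k := by exact_mod_cast hX
      constructor <;> omega
    omega
  have hdiff : ∀ x ∈ linnikSet p k X a c, ∀ i j, i ≠ j → IsUnit (red x i - red x j) := by
    intro x hx i j hij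
    simp only [linnikSet, Finset.mem_filter] at hx
    have h1 := hx.2.1 j i hij.symm
    simp only [red]
    rw [← Int.cast_sub, isUnit_intCast_zmod_prime_pow hp hk]
    intro h2
    exact h1 (Int.modEq_iff_dvd.2 (by simpa using h2))
  refine (Finset.card_le_mul_card_image_of_maps_to hmaps k.factorial fun v _ => ?_).trans
    (Nat.mul_le_mul_left _ hT)
  rcases ((linnikSet p k X a c).filter fun x => F x = v).eq_empty_or_nonempty with h0 | ⟨x, hx⟩
  · rw [h0]; simp
  have hcard : (Finset.univ.image fun σ : Equiv.Perm (Fin k) => red x ∘ σ).card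
      ≤ k.factorial := by
    refine Finset.card_image_le.trans ?_
    simp [Fintype.card_perm]
  refine le_trans (Finset.card_le_card_of_injOn red ?_ ?_) hcard
  · intro y hy
    simp only [Finset.coe_filter, Set.mem_ofPred_eq] at hy
    rw [Finset.mem_filter] at hx
    obtain ⟨σ, hσ⟩ := exists_perm_of_psum_eq (red x) (red y) hunit (hdiff x hx.1) (hdiff y hy.1)
      (fun j h1 h2 => by
        have := congrFun (hx.2.trans hy.2.symm) ⟨j - 1, by omega⟩
        simp only [F] at this
        rwa [Nat.sub_add_cancel h1] at this)
    simp only [Finset.coe_image, Finset.coe_univ, Set.image_univ, Set.mem_range]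
    exact ⟨σ, hσ.symm⟩
  · exact hinj.mono (by intro y hy; simp at hy ⊢; exact hy.1)

section Energy

variable {α β V ι : Type*}

/-- The number of representations of `v` by `φ` on `Z`. -/
noncomputable def rep (Z : Finset α) (φ : α → V) (v : V) : ℕ := (Z.filter fun z => φ z = v).card

/-- The number of coincidences `φ z = φ z'` on `Z`. -/
noncomputable def energy (Z : Finset α) (φ : α → V) : ℕ :=
  ((Z ×ˢ Z).filter fun z => φ z.1 = φ z.2).card

theorem card_coincidence_eq (Z : Finset α) (W : Finset β) (φ : α → V) (ψ : β → V) (T : Finset V)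
    (hT : ∀ z ∈ Z, φ z ∈ T) :
    ((Z ×ˢ W).filter fun z => φ z.1 = ψ z.2).card = ∑ v ∈ T, rep Z φ v * rep W ψ v := by
  rw [Finset.card_eq_sum_card_fiberwise (f := fun z => φ z.1) (t := T)]
  · refine Finset.sum_congr rfl fun v _ => ?_
    rw [rep, rep, ← Finset.card_product]
    congr 1
    ext ⟨z, w⟩
    simp only [Finset.mem_filter, Finset.mem_product]
    constructor
    · rintro ⟨⟨⟨h1, h2⟩, h3⟩, h4⟩
      exact ⟨⟨h1, h4⟩, h2, h3 ▸ h4⟩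
    · rintro ⟨⟨h1, h4⟩, h2, h3⟩
      exact ⟨⟨⟨h1, h2⟩, h4.trans h3.symm⟩, h4⟩
  · intro z hz
    simp only [Finset.coe_filter, Finset.mem_product, Set.mem_ofPred_eq] at hz
    exact hT _ hz.1.1

theorem energy_eq_sum (Z : Finset α) (φ : α → V) (T : Finset V) (hT : ∀ z ∈ Z, φ z ∈ T) :
    energy Z φ = ∑ v ∈ T, rep Z φ v ^ 2 := by
  rw [energy, card_coincidence_eq Z Z φ φ T hT]
  simp [sq]

theorem two_mul_card_coincidence_le (Z : Finset α) (W : Finset β) (φ : α → V) (ψ : β → V) :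
    2 * ((Z ×ˢ W).filter fun z => φ z.1 = ψ z.2).card ≤ energy Z φ + energy W ψ := by
  set T := Z.image φ ∪ W.image ψ
  have hZ : ∀ z ∈ Z, φ z ∈ T := fun z hz =>
    Finset.mem_union_left _ (Finset.mem_image_of_mem _ hz)
  have hW : ∀ z ∈ W, ψ z ∈ T := fun z hz =>
    Finset.mem_union_right _ (Finset.mem_image_of_mem _ hz)
  rw [card_coincidence_eq Z W φ ψ T hZ, energy_eq_sum Z φ T hZ, energy_eq_sum W ψ T hW,
    Finset.mul_sum, ← Finset.sum_add_distrib]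
  refine Finset.sum_le_sum fun v _ => ?_
  have := two_mul_le_add_sq (rep Z φ v) (rep W ψ v)
  rwa [mul_assoc] at this

theorem card_shift_le_energy [AddCommGroup V] (Z : Finset α) (φ : α → V) (l : V) :
    ((Z ×ˢ Z).filter fun z => φ z.1 = φ z.2 + l).card ≤ energy Z φ := by
  have h := two_mul_card_coincidence_le Z Z φ (fun z => φ z + l)
  have h2 : energy Z (fun z => φ z + l) = energy Z φ := by
    simp only [energy, add_left_inj]
  omega

theorem energy_le_of_subset_biUnion (I : Finset ι) (Z : Finset α) (W : ι → Finset α) (φ : α → V)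
    (h : ∀ z ∈ Z, ∃ i ∈ I, z ∈ W i) :
    energy Z φ ≤ I.card * ∑ i ∈ I, energy (W i) φ := by
  set T := Z.image φ ∪ I.biUnion fun i => (W i).image φ
  have hZ : ∀ z ∈ Z, φ z ∈ T := fun z hz =>
    Finset.mem_union_left _ (Finset.mem_image_of_mem _ hz)
  have hW : ∀ i ∈ I, ∀ z ∈ W i, φ z ∈ T := fun i hi z hz =>
    Finset.mem_union_right _ (Finset.mem_biUnion.2 ⟨i, hi, Finset.mem_image_of_mem _ hz⟩)
  rw [energy_eq_sum Z φ T hZ, Finset.sum_congr rfl fun i hi => energy_eq_sum (W i) φ T (hW i hi),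
    Finset.sum_comm, Finset.mul_sum]
  refine Finset.sum_le_sum fun v _ => ?_
  have h1 : rep Z φ v ≤ ∑ i ∈ I, rep (W i) φ v := by
    refine le_trans (Finset.card_le_card ?_) Finset.card_biUnion_le
    intro z hz
    rw [Finset.mem_filter] at hz
    obtain ⟨i, hi, hzi⟩ := h z hz.1
    exact Finset.mem_biUnion.2 ⟨i, hi, Finset.mem_filter.2 ⟨hzi, hz.2⟩⟩
  refine (Nat.pow_le_pow_left h1 2).trans ?_
  exact sq_sum_le_card_mul_sum_sq

end Energy

section Characters

variable {k M : ℕ}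

/-- The value at an integer vector of a character of `(ℤ/M)^k`. -/
noncomputable def ech (χ : AddChar (Fin k → ZMod M) ℂ) (v : Fin k → ℤ) : ℂ :=
  χ fun j => (v j : ZMod M)

theorem ech_add (χ : AddChar (Fin k → ZMod M) ℂ) (v w : Fin k → ℤ) :
    ech χ (v + w) = ech χ v * ech χ w := by
  rw [ech, ech, ech, ← AddChar.map_add_eq_mul]
  congr 1
  funext j
  simp

theorem ech_sum {ι : Type*} (χ : AddChar (Fin k → ZMod M) ℂ) (S : Finset ι) (v : ι → Fin k → ℤ) :
    ech χ (∑ i ∈ S, v i) = ∏ i ∈ S, ech χ (v i) := by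
  induction S using Finset.induction_on with
  | empty =>
    have : (fun j : Fin k => (((∑ i ∈ (∅ : Finset ι), v i) j : ℤ) : ZMod M)) = 0 := by
      funext j; simp
    rw [ech, this]; simp
  | insert a S ha ih => rw [Finset.sum_insert ha, Finset.prod_insert ha, ech_add, ih]

theorem sum_norm_sq_eq [NeZero M] {α : Type*} (Z : Finset α) (φ : α → Fin k → ℤ)
    (hM : ∀ z ∈ Z, ∀ z' ∈ Z, ∀ j, |φ z j - φ z' j| < M) :
    ∑ χ : AddChar (Fin k → ZMod M) ℂ, ‖∑ z ∈ Z, ech χ (φ z)‖ ^ 2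
      = (Fintype.card (Fin k → ZMod M) : ℝ) * energy Z φ := by
  have key : ∀ z ∈ Z, ∀ z' ∈ Z, ∑ χ : AddChar (Fin k → ZMod M) ℂ,
      ech χ (φ z) * (starRingEnd ℂ) (ech χ (φ z')) =
      if φ z = φ z' then (Fintype.card (Fin k → ZMod M) : ℂ) else 0 := by
    intro z hz z' hz'
    have h1 : ∀ χ : AddChar (Fin k → ZMod M) ℂ, ech χ (φ z) * (starRingEnd ℂ) (ech χ (φ z')) =
        χ ((fun j => (φ z j : ZMod M)) - fun j => (φ z' j : ZMod M)) := by
      intro χ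
      rw [ech, ech, sub_eq_add_neg, AddChar.map_add_eq_mul, AddChar.map_neg_eq_conj]
    rw [Finset.sum_congr rfl fun χ _ => h1 χ, AddChar.sum_apply_eq_ite]
    congr 1
    rw [sub_eq_zero, eq_iff_iff]
    constructor
    · intro h
      funext j
      have h2 := congrFun h j
      rw [ZMod.intCast_eq_intCast_iff_dvd_sub] at h2
      have := Int.eq_zero_of_abs_lt_dvd h2 (hM z' hz' z hz j)
      omega
    · intro h; rw [h]
  have h2 : ((∑ χ : AddChar (Fin k → ZMod M) ℂ, ‖∑ z ∈ Z, ech χ (φ z)‖ ^ 2 : ℝ) : ℂ)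
      = (Fintype.card (Fin k → ZMod M) : ℂ) * energy Z φ := by
    push_cast
    have h3 : ∀ χ : AddChar (Fin k → ZMod M) ℂ, ((‖∑ z ∈ Z, ech χ (φ z)‖ : ℂ)) ^ 2 =
        ∑ z ∈ Z, ∑ z' ∈ Z, ech χ (φ z) * (starRingEnd ℂ) (ech χ (φ z')) := by
      intro χ
      rw [← Complex.mul_conj', map_sum, Finset.sum_mul_sum]
    rw [Finset.sum_congr rfl fun χ _ => h3 χ, Finset.sum_comm,
      Finset.sum_congr rfl fun z _ => Finset.sum_comm,
      Finset.sum_congr rfl fun z hz => Finset.sum_congr rfl fun z' hz' => key z hz z' hz',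
      ← Finset.sum_product', ← Finset.sum_filter, Finset.sum_const, energy, nsmul_eq_mul, mul_comm]
    congr!
  exact_mod_cast h2

end Characters

/-- The moment curve `x ↦ (x, x², …, x^k)`. -/
def curve (k : ℕ) (x : ℤ) : Fin k → ℤ := fun j => x ^ (j + 1 : ℕ)

/-- The vector of the first `k` power sums of a tuple of natural numbers. -/
def psums (k : ℕ) {s : ℕ} (x : Fin s → ℕ) : Fin k → ℤ := ∑ i, curve k (x i)

/-- Vinogradov's mean value: the number of solutions of the Vinogradov system of degree `k` in
`2 s` variables from `[1, X]`. -/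
noncomputable def meanValue (k s X : ℕ) : ℕ :=
  energy (Fintype.piFinset fun _ : Fin s => Finset.Icc 1 X) (psums k)

/-- The exponential sum over `S` attached to a character. -/
noncomputable def gen {k M : ℕ} (χ : AddChar (Fin k → ZMod M) ℂ) (S : Finset ℕ) : ℂ :=
  ∑ x ∈ S, ech χ (curve k x)

section Moments

variable {k s : ℕ}

theorem psums_apply (x : Fin s → ℕ) (j : Fin k) :
    psums k x j = ∑ i, (x i : ℤ) ^ (j + 1 : ℕ) := by
  simp [psums, curve]

theorem sum_affine_pow_eq (x y : Fin s → ℤ)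
    (h : ∀ j : Fin k, ∑ i, x i ^ (j + 1 : ℕ) = ∑ i, y i ^ (j + 1 : ℕ)) (c : ℤ) (j : Fin k) :
    ∑ i, (x i - c) ^ (j + 1 : ℕ) = ∑ i, (y i - c) ^ (j + 1 : ℕ) := by
  have h' : ∀ m ≤ (j + 1 : ℕ), ∑ i, x i ^ m = ∑ i, y i ^ m := by
    intro m hm
    rcases Nat.eq_zero_or_pos m with rfl | hpos
    · simp
    · have := h ⟨m - 1, by omega⟩
      simpa [Nat.sub_add_cancel hpos] using this
  simp only [sub_eq_add_neg, add_pow]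
  rw [Finset.sum_comm, Finset.sum_comm (s := Finset.univ)]
  refine Finset.sum_congr rfl fun m hm => ?_
  rw [← Finset.sum_mul, ← Finset.sum_mul, ← Finset.sum_mul, ← Finset.sum_mul,
    h' m (by simpa [Nat.lt_succ_iff] using hm)]

theorem abs_psums_sub_lt {X : ℕ} (x y : Fin s → ℕ)
    (hx : ∀ i, x i ≤ X) (hy : ∀ i, y i ≤ X) (j : Fin k) :
    |psums k x j - psums k y j| < (s * (X + 1) ^ k + 1 : ℕ) := by
  have hb : ∀ z : Fin s → ℕ, (∀ i, z i ≤ X) → 0 ≤ psums k z j ∧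
      psums k z j ≤ s * (X + 1) ^ k := by
    intro z hz
    rw [psums_apply]
    refine ⟨Finset.sum_nonneg fun i _ => by positivity, ?_⟩
    calc ∑ i, (z i : ℤ) ^ (j + 1 : ℕ) ≤ ∑ _i : Fin s, ((X : ℤ) + 1) ^ k := by
          refine Finset.sum_le_sum fun i _ => ?_
          calc (z i : ℤ) ^ (j + 1 : ℕ) ≤ ((X : ℤ) + 1) ^ (j + 1 : ℕ) := by
                have : (z i : ℤ) ≤ X + 1 := by have := hz i; omega
                gcongr
            _ ≤ ((X : ℤ) + 1) ^ k := by
                apply pow_le_pow_right₀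
                · omega
                · omega
      _ = s * (X + 1) ^ k := by simp
  have h1 := hb x hx
  have h2 := hb y hy
  rw [abs_lt]
  push_cast
  constructor <;> linarith

theorem sum_piFinset_ech {M : ℕ} (χ : AddChar (Fin k → ZMod M) ℂ) (S : Fin s → Finset ℕ) :
    ∑ x ∈ Fintype.piFinset S, ech χ (psums k x) = ∏ i, gen χ (S i) := by
  simp only [psums, ech_sum, gen]
  rw [Finset.prod_univ_sum]

theorem sum_norm_gen_pow {M : ℕ} [NeZero M] (S : Finset ℕ) {X : ℕ}
    (hS : ∀ x ∈ S, x ≤ X) (hM : s * (X + 1) ^ k + 1 ≤ M) :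
    ∑ χ : AddChar (Fin k → ZMod M) ℂ, ‖gen χ S‖ ^ (2 * s) =
      (Fintype.card (Fin k → ZMod M) : ℝ) *
        energy (Fintype.piFinset fun _ : Fin s => S) (psums k) := by
  rw [← sum_norm_sq_eq]
  · refine Finset.sum_congr rfl fun χ _ => ?_
    rw [sum_piFinset_ech]
    simp [← pow_mul, mul_comm]
  · intro x hx y hy j
    rw [Fintype.mem_piFinset] at hx hy
    refine (abs_psums_sub_lt x y (fun i => hS _ (hx i)) (fun i => hS _ (hy i)) j).trans_le ?_
    exact_mod_cast hM

/-- The elements of `[1, X]` in the residue class of `a` modulo `p`. -/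
def resClass (p X a : ℕ) : Finset ℕ := (Finset.Icc 1 X).filter fun x => x % p = a

theorem psums_resClass {p X a : ℕ} {x : Fin s → ℕ}
    (hx : ∀ i, x i ∈ resClass p X a) (i : Fin s) :
    (x i : ℤ) - ((a : ℤ) - p) = p * ((x i / p + 1 : ℕ) : ℤ) := by
  have h := (Finset.mem_filter.1 (hx i)).2
  have h2 := Nat.mod_add_div (x i) p
  rw [h] at h2
  push_cast
  have h3 : (x i : ℤ) = a + p * ((x i : ℤ) / p) := by exact_mod_cast h2.symm
  linarith

theorem resClass_div_mem {p X a x : ℕ} (hx : x ∈ resClass p X a) :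
    x / p + 1 ∈ Finset.Icc 1 (X / p + 1) := by
  have h := (Finset.mem_filter.1 hx).1
  rw [Finset.mem_Icc] at h ⊢
  exact ⟨Nat.le_add_left 1 _, Nat.add_le_add_right (Nat.div_le_div_right h.2) 1⟩

theorem resClass_div_injOn {p X a : ℕ} :
    Set.InjOn (fun x : Fin s → ℕ => fun i => x i / p + 1)
      {x | ∀ i, x i ∈ resClass p X a} := by
  intro x hx y hy h
  funext i
  have h1 := congrFun h i
  have hx1 := (Finset.mem_filter.1 (hx i)).2
  have hy1 := (Finset.mem_filter.1 (hy i)).2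
  have e1 := Nat.mod_add_div (x i) p
  have e2 := Nat.mod_add_div (y i) p
  simp only [Nat.add_right_cancel_iff] at h1
  rw [← e1, ← e2, hx1, hy1, h1]

theorem energy_resClass_le {p X a : ℕ} (hp : 0 < p) :
    energy (Fintype.piFinset fun _ : Fin s => resClass p X a) (psums k)
      ≤ meanValue k s (X / p + 1) := by
  have hinj := resClass_div_injOn (s := s) (p := p) (X := X) (a := a)
  refine Finset.card_le_card_of_injOn
    (fun z => (fun i => z.1 i / p + 1, fun i => z.2 i / p + 1)) ?_ ?_
  · rintro ⟨x, y⟩ h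
    simp only [Finset.coe_filter, Finset.mem_product, Fintype.mem_piFinset, Set.mem_ofPred_eq]
      at h ⊢
    refine ⟨⟨fun i => resClass_div_mem (h.1.1 i), fun i => resClass_div_mem (h.1.2 i)⟩, ?_⟩
    funext j
    have h1 := sum_affine_pow_eq (k := k) (fun i => (x i : ℤ)) (fun i => (y i : ℤ))
      (fun j => by simpa [psums_apply] using congrFun h.2 j) ((a : ℤ) - p) j
    simp only [psums_resClass h.1.1, psums_resClass h.1.2, mul_pow, ← Finset.mul_sum] at h1
    rw [psums_apply, psums_apply]
    exact mul_left_cancel₀ (by positivity) h1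
  · rintro ⟨x, y⟩ h ⟨x', y'⟩ h' heq
    simp only [Finset.coe_filter, Finset.mem_product, Fintype.mem_piFinset, Set.mem_ofPred_eq]
      at h h'
    simp only [Prod.mk.injEq] at heq ⊢
    exact ⟨hinj h.1.1 h'.1.1 heq.1, hinj h.1.2 h'.1.2 heq.2⟩

/-- The pairs of tuples from `[1, X]` of lengths `k` and `s` whose first member satisfies `P`. -/
noncomputable def splitTuples (k s X : ℕ) (P : (Fin k → ℕ) → Prop) (S : Finset ℕ) :
    Finset ((Fin k → ℕ) × (Fin s → ℕ)) :=
  ((Fintype.piFinset fun _ : Fin k => Finset.Icc 1 X).filter P) ×ˢ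
    (Fintype.piFinset fun _ : Fin s => S)

/-- The power sums of a pair of tuples. -/
def pairPsums (k : ℕ) {s : ℕ} (z : (Fin k → ℕ) × (Fin s → ℕ)) : Fin k → ℤ :=
  psums k z.1 + psums k z.2

/-- Entries pairwise distinct modulo `p`. -/
def DistinctMod (p : ℕ) {k : ℕ} (x : Fin k → ℕ) : Prop := ∀ i j, i ≠ j → x i % p ≠ x j % p

theorem energy_distinct_resClass_le {p X a : ℕ} (hp : p.Prime) (hkp : k < p) (hX : X ≤ p ^ k) :
    energy (splitTuples k s X (DistinctMod p) (resClass p X a)) (pairPsums k)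
      ≤ meanValue k s (X / p + 1) * (X ^ k * (k.factorial * p ^ (k * (k - 1) / 2))) := by
  set A : ℤ := (a : ℤ) - p with hA
  let c : (Fin k → ℕ) → Fin k → ℤ := fun y j => ∑ i, ((y i : ℤ) - A) ^ (j + 1 : ℕ)
  let T : Finset (Σ _ : Fin k → ℕ, Fin k → ℕ) :=
    (Fintype.piFinset fun _ : Fin k => Finset.Icc 1 X).sigma fun y => linnikSet p k X A (c y)
  have hT : T.card ≤ X ^ k * (k.factorial * p ^ (k * (k - 1) / 2)) := by
    rw [Finset.card_sigma]
    refine (Finset.sum_le_sum fun y _ => card_linnikSet_le hp hkp hX A (c y)).trans ?_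
    simp
  refine le_trans ?_ (Nat.mul_le_mul_left _ hT)
  refine Finset.card_le_mul_card_image_of_maps_to
    (f := fun z : ((Fin k → ℕ) × (Fin s → ℕ)) × ((Fin k → ℕ) × (Fin s → ℕ)) =>
      (⟨z.2.1, z.1.1⟩ : Σ _ : Fin k → ℕ, Fin k → ℕ)) ?_ _ ?_
  · rintro ⟨⟨x, u⟩, ⟨y, v⟩⟩ h
    simp only [splitTuples, Finset.mem_filter, Finset.mem_product, Fintype.mem_piFinset] at h
    obtain ⟨⟨⟨⟨hx, hxd⟩, hu⟩, ⟨⟨hy, -⟩, hv⟩⟩, heq⟩ := h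
    simp only [T, Finset.mem_sigma, Fintype.mem_piFinset, linnikSet, Finset.mem_filter]
    refine ⟨hy, hx, ?_, ?_⟩
    · intro i j hij hcon
      apply hxd i j hij
      exact_mod_cast hcon
    · intro j
      have h1 := sum_affine_pow_eq (k := k) (s := k + s)
        (Fin.append (fun i => (x i : ℤ)) (fun i => (u i : ℤ)))
        (Fin.append (fun i => (y i : ℤ)) (fun i => (v i : ℤ)))
        (fun j => by
          have := congrFun heq j
          simp only [pairPsums, Pi.add_apply, psums_apply] at this
          simpa [Fin.sum_univ_add] using this) A j
      simp only [Fin.sum_univ_add, Fin.append_left, Fin.append_right] at h1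
      have e1 : ∀ w : Fin s → ℕ, (∀ i, w i ∈ resClass p X a) →
          (p : ℤ) ^ (j + 1 : ℕ) ∣ ∑ i, ((w i : ℤ) - A) ^ (j + 1 : ℕ) := by
        intro w hw
        refine Finset.dvd_sum fun i _ => ?_
        rw [hA, psums_resClass hw, mul_pow]
        exact Dvd.intro _ rfl
      refine Int.modEq_iff_dvd.2 ?_
      have h2 : c y j - ∑ i, ((x i : ℤ) - A) ^ (j + 1 : ℕ) =
          ∑ i, ((u i : ℤ) - A) ^ (j + 1 : ℕ) - ∑ i, ((v i : ℤ) - A) ^ (j + 1 : ℕ) := by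
        simp only [c]; linarith
      rw [h2]
      exact dvd_sub (e1 u hu) (e1 v hv)
  · rintro ⟨y, x⟩ -
    refine le_trans ?_ ((card_shift_le_energy _ (psums k) (psums k y - psums k x)).trans
      (energy_resClass_le (k := k) (s := s) (p := p) (X := X) (a := a) hp.pos))
    refine Finset.card_le_card_of_injOn (fun z => (z.1.2, z.2.2)) ?_ ?_
    · rintro ⟨⟨x', u⟩, ⟨y', v⟩⟩ h
      simp only [splitTuples, Finset.coe_filter, Finset.mem_filter, Finset.mem_product,
        Fintype.mem_piFinset, Set.mem_ofPred_eq, Sigma.mk.injEq, heq_eq_eq] at h ⊢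
      obtain ⟨⟨⟨⟨-, hu⟩, ⟨-, hv⟩⟩, heq⟩, rfl, rfl⟩ := h
      refine ⟨⟨hu, hv⟩, ?_⟩
      simp only [pairPsums] at heq
      rw [add_sub, eq_sub_iff_add_eq, add_comm, heq, add_comm]
    · rintro ⟨⟨x', u⟩, ⟨y', v⟩⟩ h ⟨⟨x'', u'⟩, ⟨y'', v'⟩⟩ h' heq
      simp only [Finset.coe_filter, Finset.mem_filter, Set.mem_ofPred_eq, Sigma.mk.injEq,
        heq_eq_eq] at h h'
      simp only [Prod.mk.injEq] at heq ⊢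
      exact ⟨⟨h.2.2.trans h'.2.2.symm, heq.1⟩, h.2.1.trans h'.2.1.symm, heq.2⟩

theorem sum_ech_coincidence {M p X : ℕ} (hp : 0 < p) (χ : AddChar (Fin k → ZMod M) ℂ) {i j : Fin k}
    (hij : i ≠ j) :
    ∑ x ∈ (Fintype.piFinset fun _ : Fin k => Finset.Icc 1 X).filter
        (fun x => x i % p = x j % p), ech χ (psums k x) =
      (∑ b ∈ Finset.range p, gen χ (resClass p X b) ^ 2) * gen χ (Finset.Icc 1 X) ^ (k - 2) := by
  have h1 : ∑ x ∈ (Fintype.piFinset fun _ : Fin k => Finset.Icc 1 X).filter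
        (fun x => x i % p = x j % p), ech χ (psums k x) =
      ∑ b ∈ Finset.range p, ∑ x ∈ Fintype.piFinset
        (fun l : Fin k => if l = i ∨ l = j then resClass p X b else Finset.Icc 1 X),
        ech χ (psums k x) := by
    rw [← Finset.sum_fiberwise_of_maps_to (t := Finset.range p) (g := fun x => x i % p)
      (fun x _ => Finset.mem_range.2 (Nat.mod_lt _ hp))]
    refine Finset.sum_congr rfl fun b _ => ?_
    refine Finset.sum_congr ?_ fun _ _ => rfl
    ext x
    simp only [Finset.mem_filter, Fintype.mem_piFinset]
    constructor
    · rintro ⟨⟨h1, h2⟩, h3⟩ l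
      split_ifs with h
      · refine Finset.mem_filter.2 ⟨h1 l, ?_⟩
        rcases h with rfl | rfl
        · exact h3
        · exact h2 ▸ h3
      · exact h1 l
    · intro h
      have hi := h i
      have hj := h j
      simp only [true_or, or_true, if_true, resClass, Finset.mem_filter] at hi hj
      refine ⟨⟨fun l => ?_, hi.2.trans hj.2.symm⟩, hi.2⟩
      have hl := h l
      split_ifs at hl
      · exact (Finset.mem_filter.1 hl).1
      · exact hl
  rw [h1, Finset.sum_mul]
  refine Finset.sum_congr rfl fun b _ => ?_
  rw [sum_piFinset_ech]
  have h2 : ∀ l : Fin k, gen χ (if l = i ∨ l = j then resClass p X b else Finset.Icc 1 X) =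
      if l = i ∨ l = j then gen χ (resClass p X b) else gen χ (Finset.Icc 1 X) := by
    intro l; split_ifs <;> rfl
  have h3 : (Finset.univ.filter fun l : Fin k => l = i ∨ l = j).card = 2 := by
    rw [← Finset.card_pair hij]
    congr 1
    ext l; simp
  rw [Finset.prod_congr rfl fun l _ => h2 l, Finset.prod_ite, Finset.prod_const, Finset.prod_const,
    h3]
  have h4 := Finset.card_filter_add_card_filter_not (s := (Finset.univ : Finset (Fin k)))
    (fun l => l = i ∨ l = j)
  rw [h3, Finset.card_univ, Fintype.card_fin] at h4
  congr 2
  omega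

end Moments

section Step

variable {k s : ℕ}

theorem mem_splitTuples {X : ℕ} {P : (Fin k → ℕ) → Prop} {S : Finset ℕ}
    {z : (Fin k → ℕ) × (Fin s → ℕ)} : z ∈ splitTuples k s X P S ↔
      (z.1 ∈ (Fintype.piFinset fun _ : Fin k => Finset.Icc 1 X) ∧ P z.1) ∧
        z.2 ∈ Fintype.piFinset fun _ : Fin s => S := by
  rw [splitTuples, Finset.mem_product, Finset.mem_filter]

theorem card_mul_sum_pow_le {ι : Type*} (S : Finset ι) (x : ι → ℝ) (hx : ∀ a ∈ S, 0 ≤ x a) (m : ℕ) :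
    (S.card : ℝ) * (∑ a ∈ S, x a) ^ m ≤ (S.card : ℝ) ^ m * ∑ a ∈ S, x a ^ m := by
  rcases S.eq_empty_or_nonempty with rfl | hS
  · simp
  rcases m with _ | m
  · simp
  have h0 : (0 : ℝ) < S.card := by exact_mod_cast hS.card_pos
  have := pow_sum_div_card_le_sum_pow (s := S) (f := x) hx m
  rw [div_le_iff₀ (by positivity)] at this
  calc (S.card : ℝ) * (∑ a ∈ S, x a) ^ (m + 1)
      ≤ S.card * ((∑ a ∈ S, x a ^ (m + 1)) * (S.card : ℝ) ^ m) := by gcongr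
    _ = _ := by ring

theorem sum_product_ech {M : ℕ} (χ : AddChar (Fin k → ZMod M) ℂ) (A : Finset (Fin k → ℕ))
    (S : Finset ℕ) :
    ∑ z ∈ A ×ˢ (Fintype.piFinset fun _ : Fin s => S), ech χ (pairPsums k z) =
      (∑ x ∈ A, ech χ (psums k x)) * gen χ S ^ s := by
  have h : gen χ S ^ s = ∑ x ∈ Fintype.piFinset (fun _ : Fin s => S), ech χ (psums k x) := by
    rw [sum_piFinset_ech]; simp
  rw [h, Finset.sum_mul_sum, Finset.sum_product]
  simp only [pairPsums, ech_add]

theorem sum_norm_product {M X : ℕ} [NeZero M] (A : Finset (Fin k → ℕ)) (S : Finset ℕ)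
    (hA : ∀ x ∈ A, ∀ i, x i ≤ X) (hS : ∀ x ∈ S, x ≤ X) (hM : (s + k) * (X + 1) ^ k + 2 ≤ M) :
    ∑ χ : AddChar (Fin k → ZMod M) ℂ, ‖∑ x ∈ A, ech χ (psums k x)‖ ^ 2 * ‖gen χ S‖ ^ (2 * s) =
      (Fintype.card (Fin k → ZMod M) : ℝ) *
        energy (A ×ˢ (Fintype.piFinset fun _ : Fin s => S)) (pairPsums k) := by
  rw [← sum_norm_sq_eq]
  · refine Finset.sum_congr rfl fun χ _ => ?_
    rw [sum_product_ech, norm_mul, norm_pow]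
    ring
  · rintro ⟨x, u⟩ hx ⟨y, v⟩ hy j
    rw [Finset.mem_product, Fintype.mem_piFinset] at hx hy
    have h1 := abs_psums_sub_lt x y (hA _ hx.1) (hA _ hy.1) j
    have h2 := abs_psums_sub_lt u v (fun i => hS _ (hx.2 i)) (fun i => hS _ (hy.2 i)) j
    have h3 : pairPsums k (x, u) j - pairPsums k (y, v) j =
        (psums k x j - psums k y j) + (psums k u j - psums k v j) := by
      simp only [pairPsums, Pi.add_apply]; ring
    rw [h3]
    have h4 := abs_add_le (psums k x j - psums k y j) (psums k u j - psums k v j)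
    have h5 : (((s + k) * (X + 1) ^ k + 2 : ℕ) : ℤ) ≤ M := by exact_mod_cast hM
    push_cast at h1 h2 h5
    linarith

theorem energy_split_eq_meanValue {X : ℕ} :
    energy ((Fintype.piFinset fun _ : Fin k => Finset.Icc 1 X) ×ˢ
      (Fintype.piFinset fun _ : Fin s => Finset.Icc 1 X)) (pairPsums k) =
      meanValue k (s + k) X := by
  set M := (s + k) * (X + 1) ^ k + 2 with hM
  have : NeZero M := ⟨by omega⟩
  have hX : ∀ x ∈ Finset.Icc 1 X, x ≤ X := fun x hx => (Finset.mem_Icc.1 hx).2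
  have h1 := sum_norm_product (k := k) (s := s) (M := M) (X := X)
    (Fintype.piFinset fun _ : Fin k => Finset.Icc 1 X) (Finset.Icc 1 X)
    (fun x hx i => hX _ (Fintype.mem_piFinset.1 hx i)) hX le_rfl
  have h2 := sum_norm_gen_pow (k := k) (s := s + k) (M := M) (Finset.Icc 1 X) hX (by omega)
  have h3 : ∀ χ : AddChar (Fin k → ZMod M) ℂ,
      ‖∑ x ∈ Fintype.piFinset fun _ : Fin k => Finset.Icc 1 X, ech χ (psums k x)‖ ^ 2 *
        ‖gen χ (Finset.Icc 1 X)‖ ^ (2 * s) = ‖gen χ (Finset.Icc 1 X)‖ ^ (2 * (s + k)) := by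
    intro χ
    rw [sum_piFinset_ech]
    simp only [Finset.prod_const, Finset.card_univ, Fintype.card_fin, norm_pow]
    ring
  rw [Finset.sum_congr rfl fun χ _ => h3 χ, h2] at h1
  have h4 : (0 : ℝ) < Fintype.card (Fin k → ZMod M) := by exact_mod_cast Fintype.card_pos
  have := mul_left_cancel₀ h4.ne' h1
  rw [meanValue]
  exact_mod_cast this.symm

theorem gen_eq_sum_resClass {M p X : ℕ} (hp : 0 < p) (χ : AddChar (Fin k → ZMod M) ℂ) :
    gen χ (Finset.Icc 1 X) = ∑ a ∈ Finset.range p, gen χ (resClass p X a) := by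
  simp only [gen, resClass]
  rw [Finset.sum_fiberwise_of_maps_to]
  exact fun x _ => Finset.mem_range.2 (Nat.mod_lt _ hp)

theorem resClass_le {p X a x : ℕ} (hx : x ∈ resClass p X a) : x ≤ X :=
  (Finset.mem_Icc.1 (Finset.mem_filter.1 hx).1).2

theorem energy_distinct_le {p X : ℕ} (hp : p.Prime) (hkp : k < p) (hX : X ≤ p ^ k) :
    (energy (splitTuples k s X (DistinctMod p) (Finset.Icc 1 X)) (pairPsums k) : ℝ) ≤
      (p : ℝ) ^ (2 * s) * (meanValue k s (X / p + 1) *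
        (X ^ k * (k.factorial * p ^ (k * (k - 1) / 2)))) := by
  set M := (s + k) * (X + 1) ^ k + 2 with hM
  have : NeZero M := ⟨by omega⟩
  have hX' : ∀ x ∈ Finset.Icc 1 X, x ≤ X := fun x hx => (Finset.mem_Icc.1 hx).2
  have h4 : (0 : ℝ) < Fintype.card (Fin k → ZMod M) := by exact_mod_cast Fintype.card_pos
  have hp0 : (0 : ℝ) < p := by exact_mod_cast hp.pos
  set A := (Fintype.piFinset fun _ : Fin k => Finset.Icc 1 X).filter (DistinctMod p) with hA
  have hA' : ∀ x ∈ A, ∀ i, x i ≤ X := fun x hx i =>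
    hX' _ (Fintype.mem_piFinset.1 (Finset.mem_filter.1 hx).1 i)
  have h1 := sum_norm_product (k := k) (s := s) (M := M) (X := X) A (Finset.Icc 1 X) hA' hX' le_rfl
  have h2 : ∀ a, ∑ χ : AddChar (Fin k → ZMod M) ℂ,
      ‖∑ x ∈ A, ech χ (psums k x)‖ ^ 2 * ‖gen χ (resClass p X a)‖ ^ (2 * s) ≤
      (Fintype.card (Fin k → ZMod M) : ℝ) * (meanValue k s (X / p + 1) *
        (X ^ k * (k.factorial * p ^ (k * (k - 1) / 2)))) := by
    intro a
    rw [sum_norm_product (k := k) (s := s) (M := M) (X := X) A (resClass p X a) hA'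
      (fun x hx => resClass_le hx) le_rfl]
    gcongr
    exact_mod_cast energy_distinct_resClass_le (s := s) (a := a) hp hkp hX
  rw [splitTuples, ← hA]
  set E := (energy (A ×ˢ (Fintype.piFinset fun _ : Fin s => Finset.Icc 1 X)) (pairPsums k) : ℝ)
  set R : ℝ := (meanValue k s (X / p + 1) *
        (X ^ k * (k.factorial * p ^ (k * (k - 1) / 2))))
  have h5 : (p : ℝ) * ((Fintype.card (Fin k → ZMod M) : ℝ) * E) ≤
      p ^ (2 * s) * (p * ((Fintype.card (Fin k → ZMod M) : ℝ) * R)) := by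
    rw [← h1, Finset.mul_sum]
    calc _ ≤ ∑ χ : AddChar (Fin k → ZMod M) ℂ, ∑ a ∈ Finset.range p, (p : ℝ) ^ (2 * s) *
          (‖∑ x ∈ A, ech χ (psums k x)‖ ^ 2 * ‖gen χ (resClass p X a)‖ ^ (2 * s)) := by
          refine Finset.sum_le_sum fun χ _ => ?_
          rw [← Finset.mul_sum, ← Finset.mul_sum]
          have h6 : (p : ℝ) * ‖gen χ (Finset.Icc 1 X)‖ ^ (2 * s) ≤
              p ^ (2 * s) * ∑ a ∈ Finset.range p, ‖gen χ (resClass p X a)‖ ^ (2 * s) := by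
            rw [gen_eq_sum_resClass hp.pos]
            have := card_mul_sum_pow_le (Finset.range p) (fun a => ‖gen χ (resClass p X a)‖)
              (fun a _ => norm_nonneg _) (2 * s)
            rw [Finset.card_range] at this
            refine le_trans ?_ this
            gcongr
            exact norm_sum_le _ _
          calc _ = ‖∑ x ∈ A, ech χ (psums k x)‖ ^ 2 * ((p : ℝ) *
                ‖gen χ (Finset.Icc 1 X)‖ ^ (2 * s)) := by ring
            _ ≤ ‖∑ x ∈ A, ech χ (psums k x)‖ ^ 2 * (p ^ (2 * s) *
                ∑ a ∈ Finset.range p, ‖gen χ (resClass p X a)‖ ^ (2 * s)) := by gcongr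
            _ = _ := by ring
      _ = (p : ℝ) ^ (2 * s) * ∑ a ∈ Finset.range p, ∑ χ : AddChar (Fin k → ZMod M) ℂ,
          (‖∑ x ∈ A, ech χ (psums k x)‖ ^ 2 * ‖gen χ (resClass p X a)‖ ^ (2 * s)) := by
          rw [Finset.sum_comm, Finset.mul_sum]
          simp only [Finset.mul_sum]
      _ ≤ (p : ℝ) ^ (2 * s) * ∑ a ∈ Finset.range p,
          ((Fintype.card (Fin k → ZMod M) : ℝ) * R) := by
          gcongr with a
          exact h2 a
      _ = _ := by simp
  have h6 : ((p : ℝ) * (Fintype.card (Fin k → ZMod M) : ℝ)) * E ≤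
      (p * (Fintype.card (Fin k → ZMod M) : ℝ)) * (p ^ (2 * s) * R) := by linarith
  exact le_of_mul_le_mul_left h6 (by positivity)

theorem energy_coincidence_le {M p X : ℕ} [NeZero M] (hk : 2 ≤ k) (hp : 0 < p)
    (hM : (s + k) * (X + 1) ^ k + 2 ≤ M) :
    (Fintype.card (Fin k → ZMod M) : ℝ) *
      energy (splitTuples k s X (fun x => ¬ DistinctMod p x) (Finset.Icc 1 X)) (pairPsums k) ≤
      k ^ 4 * ∑ χ : AddChar (Fin k → ZMod M) ℂ,
        (∑ b ∈ Finset.range p, ‖gen χ (resClass p X b)‖ ^ 2) ^ 2 *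
          (‖gen χ (Finset.Icc 1 X)‖ ^ 2) ^ (s + k - 2) := by
  have hX' : ∀ x ∈ Finset.Icc 1 X, x ≤ X := fun x hx => (Finset.mem_Icc.1 hx).2
  set Q := ∑ χ : AddChar (Fin k → ZMod M) ℂ,
        (∑ b ∈ Finset.range p, ‖gen χ (resClass p X b)‖ ^ 2) ^ 2 *
          (‖gen χ (Finset.Icc 1 X)‖ ^ 2) ^ (s + k - 2) with hQ
  let I : Finset (Fin k × Fin k) := Finset.univ.offDiag
  let W : Fin k × Fin k → Finset ((Fin k → ℕ) × (Fin s → ℕ)) := fun q =>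
    splitTuples k s X (fun x => x q.1 % p = x q.2 % p) (Finset.Icc 1 X)
  have hI : (I.card : ℝ) ≤ k ^ 2 := by
    have : I.card ≤ k ^ 2 := by
      simp only [I, Finset.offDiag_card, Finset.card_univ, Fintype.card_fin]
      rw [sq]; exact Nat.sub_le _ _
    exact_mod_cast this
  have hcov := energy_le_of_subset_biUnion I
    (splitTuples k s X (fun x => ¬ DistinctMod p x) (Finset.Icc 1 X)) W (pairPsums k) (by
      rintro ⟨x, u⟩ h
      rw [mem_splitTuples, DistinctMod] at h
      obtain ⟨⟨hx, hd⟩, hu⟩ := h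
      push Not at hd
      obtain ⟨i, j, hij, he⟩ := hd
      refine ⟨(i, j), by simpa [I] using hij, ?_⟩
      exact mem_splitTuples.2 ⟨⟨hx, he⟩, hu⟩)
  have hW : ∀ q ∈ I, (Fintype.card (Fin k → ZMod M) : ℝ) * energy (W q) (pairPsums k) ≤ Q := by
    rintro ⟨i, j⟩ hq
    have hij : i ≠ j := by simpa [I] using hq
    simp only [W, splitTuples]
    rw [← sum_norm_product (X := X) _ _ (fun x hx i =>
      hX' _ (Fintype.mem_piFinset.1 (Finset.mem_filter.1 hx).1 i)) hX' hM]
    refine Finset.sum_le_sum fun χ _ => ?_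
    have e := sum_ech_coincidence (X := X) hp χ hij
    have e' : ∑ x ∈ (Fintype.piFinset fun _ : Fin k => Finset.Icc 1 X).filter
        (fun x => x i % p = x j % p), ech χ (psums k x) =
      (∑ b ∈ Finset.range p, gen χ (resClass p X b) ^ 2) * gen χ (Finset.Icc 1 X) ^ (k - 2) := by
      rw [← e]
    rw [e', norm_mul, norm_pow, mul_pow]
    have h1 : ‖∑ b ∈ Finset.range p, gen χ (resClass p X b) ^ 2‖ ≤
        ∑ b ∈ Finset.range p, ‖gen χ (resClass p X b)‖ ^ 2 := by
      refine (norm_sum_le _ _).trans (le_of_eq ?_)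
      simp
    rw [mul_assoc, ← pow_mul, ← pow_add]
    have h2 : (k - 2) * 2 + 2 * s = 2 * (s + k - 2) := by omega
    rw [h2, pow_mul]
    gcongr
  have hcov' : (energy (splitTuples k s X (fun x => ¬ DistinctMod p x) (Finset.Icc 1 X))
      (pairPsums k) : ℝ) ≤ I.card * ∑ q ∈ I, (energy (W q) (pairPsums k) : ℝ) := by
    exact_mod_cast hcov
  have hQ0 : 0 ≤ Q := by positivity
  calc _ ≤ (Fintype.card (Fin k → ZMod M) : ℝ) *
        (I.card * ∑ q ∈ I, (energy (W q) (pairPsums k) : ℝ)) := by gcongr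
    _ = I.card * ∑ q ∈ I, (Fintype.card (Fin k → ZMod M) : ℝ) * energy (W q) (pairPsums k) := by
        rw [← Finset.mul_sum]; ring
    _ ≤ I.card * ∑ q ∈ I, Q := by gcongr with q hq; exact hW q hq
    _ = (I.card : ℝ) ^ 2 * Q := by simp; ring
    _ ≤ ((k : ℝ) ^ 2) ^ 2 * Q := by gcongr
    _ = _ := by ring

theorem sq_mul_pow_le {n : ℕ} (hn : 2 ≤ n) {B F : ℝ} (hB : 0 ≤ B) (hF : 0 ≤ F) :
    B ^ 2 * F ^ (n - 2) ≤ B ^ n + F ^ n := by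
  have e : ∀ z : ℝ, z ^ n = z ^ 2 * z ^ (n - 2) := fun z => by
    rw [← pow_add]; congr 1; omega
  rcases le_total F B with h | h
  · calc B ^ 2 * F ^ (n - 2) ≤ B ^ 2 * B ^ (n - 2) := by gcongr
      _ = B ^ n := (e B).symm
      _ ≤ _ := by have := pow_nonneg hF n; linarith
  · calc B ^ 2 * F ^ (n - 2) ≤ F ^ 2 * F ^ (n - 2) := by gcongr
      _ = F ^ n := (e F).symm
      _ ≤ _ := by have := pow_nonneg hB n; linarith

theorem meanValue_step {p X : ℕ} (hk : 2 ≤ k) (hp : p.Prime) (hkp : k < p) (hX : X ≤ p ^ k) :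
    (meanValue k (s + k) X : ℝ) ≤
      4 * ((p : ℝ) ^ (2 * s) * (meanValue k s (X / p + 1) *
        (X ^ k * (k.factorial * p ^ (k * (k - 1) / 2))))) +
      (2 * k ^ 2 * p : ℝ) ^ (s + k) * meanValue k (s + k) (X / p + 1) := by
  set M := (s + k) * (X + 1) ^ k + 2 with hM
  have : NeZero M := ⟨by omega⟩
  set n := s + k with hn
  have hX' : ∀ x ∈ Finset.Icc 1 X, x ≤ X := fun x hx => (Finset.mem_Icc.1 hx).2
  have hN : (0 : ℝ) < Fintype.card (Fin k → ZMod M) := by exact_mod_cast Fintype.card_pos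
  set N : ℝ := (Fintype.card (Fin k → ZMod M) : ℝ) with hNdef
  have hp0 : (0 : ℝ) < p := by exact_mod_cast hp.pos
  set ED : ℝ := (energy (splitTuples k s X (DistinctMod p) (Finset.Icc 1 X)) (pairPsums k) : ℝ) with hED
  set EE : ℝ := (energy (splitTuples k s X (fun x => ¬ DistinctMod p x) (Finset.Icc 1 X))
    (pairPsums k) : ℝ) with hEE
  have hD : ED ≤ _ := energy_distinct_le (s := s) hp hkp hX
  have hE := energy_coincidence_le (s := s) (M := M) (X := X) hk hp.pos le_rfl
  have hsplit : (meanValue k n X : ℝ) ≤ 2 * (ED + EE) := by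
    have h := energy_le_of_subset_biUnion (Finset.univ : Finset Bool)
      ((Fintype.piFinset fun _ : Fin k => Finset.Icc 1 X) ×ˢ
        (Fintype.piFinset fun _ : Fin s => Finset.Icc 1 X))
      (fun b => if b then splitTuples k s X (DistinctMod p) (Finset.Icc 1 X) else
        splitTuples k s X (fun x => ¬ DistinctMod p x) (Finset.Icc 1 X)) (pairPsums k) (by
        rintro ⟨x, u⟩ h
        rw [Finset.mem_product] at h
        by_cases hd : DistinctMod p x
        · exact ⟨true, Finset.mem_univ _, by
            simp only [if_true]
            exact mem_splitTuples.2 ⟨⟨h.1, hd⟩, h.2⟩⟩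
        · exact ⟨false, Finset.mem_univ _, by
            simp only [Bool.false_eq_true, if_false]
            exact mem_splitTuples.2 ⟨⟨h.1, hd⟩, h.2⟩⟩)
    rw [energy_split_eq_meanValue] at h
    simp only [Fintype.univ_bool, Finset.mem_singleton, Bool.true_eq_false, not_false_eq_true,
      Finset.sum_insert, Finset.sum_singleton, Bool.false_eq_true, if_true, if_false,
      Finset.card_insert_of_notMem, Finset.card_singleton] at h
    have h' := (Nat.cast_le (α := ℝ)).2 h
    push_cast at h'
    rw [hED, hEE]
    linarith
  have hJ := sum_norm_gen_pow (k := k) (s := n) (M := M) (Finset.Icc 1 X) hX' (by omega)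
  have hJ' : ∑ χ : AddChar (Fin k → ZMod M) ℂ, (‖gen χ (Finset.Icc 1 X)‖ ^ 2) ^ n =
      N * meanValue k n X := by
    rw [meanValue, ← hJ]
    simp only [pow_mul]
  set F : AddChar (Fin k → ZMod M) ℂ → ℝ := fun χ => ‖gen χ (Finset.Icc 1 X)‖ ^ 2 with hF
  set A : AddChar (Fin k → ZMod M) ℂ → ℝ := fun χ =>
    ∑ b ∈ Finset.range p, ‖gen χ (resClass p X b)‖ ^ 2 with hA
  have hA0 : ∀ χ, 0 ≤ A χ := fun χ => by positivity
  have hAn : ∑ χ, A χ ^ n ≤ (p : ℝ) ^ n * (N * meanValue k n (X / p + 1)) := by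
    have h1 : ∀ b ∈ Finset.range p, ∑ χ : AddChar (Fin k → ZMod M) ℂ,
        (‖gen χ (resClass p X b)‖ ^ 2) ^ n ≤ N * meanValue k n (X / p + 1) := by
      intro b _
      have := sum_norm_gen_pow (k := k) (s := n) (M := M) (resClass p X b)
        (fun x hx => resClass_le hx) (by omega)
      simp only [pow_mul] at this
      rw [this]
      gcongr
      exact energy_resClass_le hp.pos
    have h2 : (p : ℝ) * ∑ χ, A χ ^ n ≤ p * ((p : ℝ) ^ n * (N * meanValue k n (X / p + 1))) := by
      rw [Finset.mul_sum]
      calc _ ≤ ∑ χ, (p : ℝ) ^ n * ∑ b ∈ Finset.range p, (‖gen χ (resClass p X b)‖ ^ 2) ^ n := by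
            refine Finset.sum_le_sum fun χ _ => ?_
            have := card_mul_sum_pow_le (Finset.range p) (fun a => ‖gen χ (resClass p X a)‖ ^ 2)
              (fun a _ => by positivity) n
            rwa [Finset.card_range] at this
        _ = (p : ℝ) ^ n * ∑ b ∈ Finset.range p, ∑ χ : AddChar (Fin k → ZMod M) ℂ,
            (‖gen χ (resClass p X b)‖ ^ 2) ^ n := by
            rw [← Finset.mul_sum, Finset.sum_comm]
        _ ≤ (p : ℝ) ^ n * ∑ b ∈ Finset.range p, N * meanValue k n (X / p + 1) := by
            gcongr with b hb; exact h1 b hb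
        _ = _ := by simp; ring
    exact le_of_mul_le_mul_left h2 hp0
  have hQ : 2 * (k : ℝ) ^ 4 * ∑ χ, A χ ^ 2 * F χ ^ (n - 2) ≤
      ((2 * k ^ 2 : ℝ) ^ n * ∑ χ, A χ ^ n + ∑ χ, F χ ^ n) / 2 := by
    rw [Finset.mul_sum, Finset.mul_sum, ← Finset.sum_add_distrib, Finset.sum_div]
    refine Finset.sum_le_sum fun χ _ => ?_
    have := sq_mul_pow_le (n := n) (by omega) (B := 2 * k ^ 2 * A χ) (F := F χ)
      (by have := hA0 χ; positivity) (by simp only [hF]; positivity)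
    rw [mul_pow (2 * (k : ℝ) ^ 2) (A χ) n] at this
    nlinarith [this]
  have h1 : N * meanValue k n X ≤ 2 * N * ED + 2 * (k ^ 4 * ∑ χ, A χ ^ 2 * F χ ^ (n - 2)) := by
    calc N * meanValue k n X ≤ N * (2 * (ED + EE)) := by gcongr
      _ = 2 * N * ED + 2 * (N * EE) := by ring
      _ ≤ _ := by gcongr
  have h2 : N * meanValue k n X ≤ 2 * N * ED + ((2 * k ^ 2 : ℝ) ^ n *
      ((p : ℝ) ^ n * (N * meanValue k n (X / p + 1))) + N * meanValue k n X) / 2 := by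
    have h3 : (2 * k ^ 2 : ℝ) ^ n * ∑ χ, A χ ^ n ≤ (2 * k ^ 2 : ℝ) ^ n *
      ((p : ℝ) ^ n * (N * meanValue k n (X / p + 1))) := by gcongr
    rw [hJ'] at hQ
    linarith
  have h4 : N * meanValue k n X ≤ N * (4 * ED + (2 * k ^ 2 * p : ℝ) ^ n *
      meanValue k n (X / p + 1)) := by
    rw [mul_pow (2 * (k : ℝ) ^ 2) (p : ℝ) n]
    linarith
  have h5 := le_of_mul_le_mul_left h4 hN
  linarith

end Step

/-- The exponent of `X` in the bound for `meanValue k (l * k) X`. -/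
noncomputable def mvExp (k l : ℕ) : ℝ :=
  2 * l * k - k * (k + 1) / 2 * (1 - (1 - 1 / (k : ℝ)) ^ l)

theorem mvExp_succ {k : ℕ} (hk : 0 < k) (l : ℕ) :
    2 * (l * k : ℝ) + k * (k - 1) / 2 + k * k + (k - 1) * mvExp k l = k * mvExp k (l + 1) := by
  have : (k : ℝ) ≠ 0 := by positivity
  simp only [mvExp, pow_succ]
  push_cast
  field_simp
  ring

theorem one_sub_pow_le {k : ℕ} (hk : 0 < k) (l : ℕ) :
    0 ≤ 1 - (1 - 1 / (k : ℝ)) ^ l ∧ 1 - (1 - 1 / (k : ℝ)) ^ l ≤ l / k ∧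
      1 - (1 - 1 / (k : ℝ)) ^ l ≤ 1 := by
  have h1 : (1 : ℝ) ≤ k := by exact_mod_cast hk
  have h2 : 1 / (k : ℝ) ≤ 1 := by rw [div_le_one (by linarith)]; exact h1
  have h3 : 0 ≤ 1 / (k : ℝ) := by positivity
  refine ⟨?_, ?_, ?_⟩
  · have := pow_le_one₀ (n := l) (a := 1 - 1 / (k : ℝ)) (by linarith) (by linarith)
    linarith
  · have := one_add_mul_le_pow (a := -(1 / (k : ℝ))) (by linarith) l
    have e : (l : ℝ) / k = l * (1 / k) := by ring
    rw [e, sub_eq_add_neg 1 (1 / (k : ℝ))]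
    linarith
  · have := pow_nonneg (a := 1 - 1 / (k : ℝ)) (by linarith) l
    linarith

theorem mvExp_le {k : ℕ} (hk : 0 < k) (l : ℕ) : mvExp k l ≤ 2 * l * k := by
  have := (one_sub_pow_le hk l).1
  have h2 : 0 ≤ (k : ℝ) * (k + 1) / 2 * (1 - (1 - 1 / (k : ℝ)) ^ l) := by positivity
  rw [mvExp]; linarith

theorem le_mvExp {k : ℕ} (hk : 2 ≤ k) (l : ℕ) : 5 / 4 * (l * k : ℝ) ≤ mvExp k l := by
  have h := (one_sub_pow_le (by omega : 0 < k) l).2.1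
  have hk' : (2 : ℝ) ≤ k := by exact_mod_cast hk
  have h2 : (k : ℝ) * (k + 1) / 2 * (1 - (1 - 1 / (k : ℝ)) ^ l) ≤ k * (k + 1) / 2 * (l / k) := by
    gcongr
  have h3 : (k : ℝ) * (k + 1) / 2 * (l / k) = (k + 1) / 2 * l := by field_simp
  have h4 : (k + 1 : ℝ) / 2 * l ≤ 3 / 4 * k * l := by
    gcongr
    linarith
  rw [mvExp]
  linarith

theorem two_mul_sub_mvExp_le {k : ℕ} (hk : 0 < k) (l : ℕ) :
    2 * l * k - mvExp k l ≤ k * (k + 1) / 2 := by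
  have h := (one_sub_pow_le hk l).2.2
  have : (k : ℝ) * (k + 1) / 2 * (1 - (1 - 1 / (k : ℝ)) ^ l) ≤ k * (k + 1) / 2 * 1 := by gcongr
  rw [mvExp]; linarith

theorem meanValue_le_pow (k s X : ℕ) : meanValue k s X ≤ X ^ (2 * s) := by
  rw [meanValue, energy]
  refine (Finset.card_le_card (t := _ ×ˢ _) fun z hz => by
    simp only [Finset.mem_filter] at hz; exact hz.1).trans ?_
  simp [Fintype.card_piFinset, two_mul, pow_add]

/-- The constant per iteration in the mean value bound. -/
noncomputable def mvConst (k L : ℕ) : ℝ :=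
  (16 * k ^ 2 : ℝ) ^ (2 * k ^ 2 * (k + 1)) * (2 ^ (6 * L * k + 2 * k ^ 2 + 3) * k.factorial)

set_option maxHeartbeats 1600000 in
theorem meanValue_le {k : ℕ} (hk : 2 ≤ k) (L : ℕ) : ∀ l ≤ L, ∀ X : ℕ, 1 ≤ X →
    (meanValue k (l * k) X : ℝ) ≤ mvConst k L ^ l * (X : ℝ) ^ mvExp k l := by
  have hk' : (2 : ℝ) ≤ k := by exact_mod_cast hk
  have hbase : (1 : ℝ) ≤ 16 * k ^ 2 := by nlinarith
  have hC1 : (1 : ℝ) ≤ (16 * k ^ 2 : ℝ) ^ (2 * k ^ 2 * (k + 1)) := one_le_pow₀ hbase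
  have hfac : (1 : ℝ) ≤ k.factorial := by exact_mod_cast Nat.one_le_iff_ne_zero.2 k.factorial_ne_zero
  have hC2 : (1 : ℝ) ≤ 2 ^ (6 * L * k + 2 * k ^ 2 + 3) * k.factorial :=
    one_le_mul_of_one_le_of_one_le (one_le_pow₀ (by norm_num)) hfac
  have hC : 1 ≤ mvConst k L := one_le_mul_of_one_le_of_one_le hC1 hC2
  intro l
  induction l with
  | zero =>
    intro _ X hX
    have h1 : (meanValue k (0 * k) X : ℝ) ≤ 1 := by
      have := meanValue_le_pow k (0 * k) X
      simp only [zero_mul, mul_zero, pow_zero] at this ⊢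
      exact_mod_cast this
    simpa [mvExp] using h1
  | succ l ih =>
    intro hl
    have ih := ih (by omega)
    intro X
    induction X using Nat.strong_induction_on with
    | _ X ihX =>
    intro hX
    have hX0 : (1 : ℝ) ≤ X := by exact_mod_cast hX
    set n := (l + 1) * k with hn
    have hnsk : n = l * k + k := by rw [hn]; ring
    set E := mvExp k (l + 1) with hE
    have hE0 : 5 / 4 * (n : ℝ) ≤ E := by
      have := le_mvExp hk (l + 1)
      rw [hn]; push_cast at this ⊢; linarith
    have hE1 : E ≤ 2 * n := by
      have := mvExp_le (by omega : 0 < k) (l + 1)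
      rw [hn]; push_cast at this ⊢; linarith
    by_cases hsmall : (X : ℝ) < (16 * k ^ 2 : ℝ) ^ (4 * k)
    · have h1 : (meanValue k n X : ℝ) ≤ (X : ℝ) ^ (2 * n) := by
        exact_mod_cast meanValue_le_pow k n X
      have h2 : (X : ℝ) ^ (2 * n) = (X : ℝ) ^ E * (X : ℝ) ^ (2 * n - E) := by
        rw [← Real.rpow_add (by linarith), ← Real.rpow_natCast]
        congr 1; push_cast; ring
      have h3 : (X : ℝ) ^ (2 * n - E) ≤ mvConst k L := by
        calc (X : ℝ) ^ (2 * n - E) ≤ (X : ℝ) ^ ((k : ℝ) * (k + 1) / 2) := by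
              apply Real.rpow_le_rpow_of_exponent_le hX0
              have := two_mul_sub_mvExp_le (by omega : 0 < k) (l + 1)
              rw [hn]; push_cast at this ⊢; linarith
          _ ≤ ((16 * k ^ 2 : ℝ) ^ (4 * k)) ^ ((k : ℝ) * (k + 1) / 2) := by
              gcongr
          _ = (16 * k ^ 2 : ℝ) ^ (2 * k ^ 2 * (k + 1)) := by
              generalize (16 * k ^ 2 : ℝ) = b at hbase
              rw [← Real.rpow_natCast, ← Real.rpow_natCast, ← Real.rpow_mul (by linarith)]
              congr 1; push_cast; ring
          _ ≤ mvConst k L := le_mul_of_one_le_right (by linarith) hC2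
      calc (meanValue k n X : ℝ) ≤ (X : ℝ) ^ E * (X : ℝ) ^ (2 * n - E) := h2 ▸ h1
        _ ≤ (X : ℝ) ^ E * mvConst k L := by gcongr
        _ = mvConst k L * (X : ℝ) ^ E := mul_comm _ _
        _ ≤ mvConst k L ^ (l + 1) * (X : ℝ) ^ E := by
            gcongr
            exact le_self_pow₀ hC (by omega)
    · push Not at hsmall
      set x : ℝ := (X : ℝ) ^ (1 / (k : ℝ)) with hx
      have hxX : x ^ k = X := by
        rw [hx, ← Real.rpow_natCast, ← Real.rpow_mul (by linarith)]
        rw [one_div_mul_cancel (by positivity), Real.rpow_one]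
      have hxbig : (16 * k ^ 2 : ℝ) ^ 4 ≤ x := by
        have h1 : (((16 * k ^ 2 : ℝ) ^ 4) ^ k) ≤ x ^ k := by
          rw [hxX, ← pow_mul]; exact hsmall
        exact le_of_pow_le_pow_left₀ (by omega) (by positivity) h1
      have h16 : (16 * k ^ 2 : ℝ) ≤ (16 * k ^ 2 : ℝ) ^ 4 := le_self_pow₀ hbase (by norm_num)
      have hx64 : (16 * k ^ 2 : ℝ) ≤ x := h16.trans hxbig
      have hxk : (k : ℝ) < x := by nlinarith
      have hx1 : (64 : ℝ) ≤ x := by nlinarith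
      obtain ⟨p, hp, hp1, hp2⟩ := Nat.exists_prime_lt_and_le_two_mul ⌈x⌉₊
        (Nat.ceil_pos.2 (by linarith)).ne'
      have hpx : x < p := (Nat.le_ceil x).trans_lt (by exact_mod_cast hp1)
      have hpx2 : (p : ℝ) ≤ 4 * x := by
        have h1 : (p : ℝ) ≤ 2 * ⌈x⌉₊ := by exact_mod_cast hp2
        have h2 := Nat.ceil_lt_add_one (a := x) (by linarith)
        linarith
      have hkp : k < p := by exact_mod_cast hxk.trans hpx
      have hXp : X ≤ p ^ k := by
        have : (X : ℝ) ≤ (p : ℝ) ^ k := by rw [← hxX]; gcongr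
        exact_mod_cast this
      have hp0 : (0 : ℝ) < p := by linarith
      set Y := X / p + 1 with hY
      have hYX : Y < X := by
        have h2 : 2 ≤ p := hp.two_le
        have h3 : X / p ≤ X / 2 := Nat.div_le_div_left h2 (by norm_num)
        have h4 : 64 ≤ X := by
          have : (64 : ℝ) ≤ X := by
            rw [← hxX]; exact hx1.trans (le_self_pow₀ (by linarith) (by omega))
          exact_mod_cast this
        omega
      have hY1 : 1 ≤ Y := Nat.le_add_left 1 _
      have hYle : (Y : ℝ) ≤ X / p + 1 := by
        rw [hY]; push_cast
        have := Nat.cast_div_le (α := ℝ) (m := X) (n := p)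
        linarith
      have hxle : x * x ≤ X := by
        rw [← hxX, ← sq]
        exact pow_le_pow_right₀ (by linarith) hk
      have hstep := meanValue_step (k := k) (s := l * k) hk hp hkp hXp
      rw [← hnsk] at hstep
      have hfirst : 4 * ((p : ℝ) ^ (2 * (l * k)) * (meanValue k (l * k) (X / p + 1) *
          (X ^ k * (k.factorial * p ^ (k * (k - 1) / 2))))) ≤
          mvConst k L ^ (l + 1) * (X : ℝ) ^ E / 2 := by
        have hE2 : 0 ≤ mvExp k l := by
          have := le_mvExp hk l
          have : 0 ≤ 5 / 4 * (l * k : ℝ) := by positivity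
          linarith
        have hx0 : 0 < x := by linarith
        have hYx : (Y : ℝ) ≤ 2 * x ^ (k - 1) := by
          have h1 : (X : ℝ) / p ≤ x ^ (k - 1) := by
            rw [div_le_iff₀ hp0, ← hxX]
            calc x ^ k = x ^ (k - 1) * x := by rw [← pow_succ]; congr 1; omega
              _ ≤ _ := by gcongr
          have h2 : 1 ≤ x ^ (k - 1) := one_le_pow₀ (by linarith)
          linarith
        have hJ := ih Y hY1
        have h2 : (Y : ℝ) ^ mvExp k l ≤ 2 ^ (2 * (l * k)) * x ^ (((k : ℝ) - 1) * mvExp k l) := by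
          calc (Y : ℝ) ^ mvExp k l ≤ (2 * x ^ (k - 1)) ^ mvExp k l := by gcongr
            _ = 2 ^ mvExp k l * x ^ (((k : ℝ) - 1) * mvExp k l) := by
                rw [Real.mul_rpow (by norm_num) (by positivity), ← Real.rpow_natCast x,
                  ← Real.rpow_mul (by linarith)]
                congr 3; push_cast [Nat.cast_sub (by omega : 1 ≤ k)]; ring
            _ ≤ _ := by
                gcongr
                rw [← Real.rpow_natCast]
                apply Real.rpow_le_rpow_of_exponent_le (by norm_num)
                have := mvExp_le (by omega : 0 < k) l
                push_cast; linarith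
        have h3 : (p : ℝ) ^ (2 * (l * k)) ≤ 4 ^ (2 * (l * k)) * x ^ (2 * (l * k)) := by
          rw [← mul_pow]; gcongr
        have h4 : (p : ℝ) ^ (k * (k - 1) / 2) ≤ 4 ^ (k ^ 2) * x ^ (k * (k - 1) / 2) := by
          calc (p : ℝ) ^ (k * (k - 1) / 2) ≤ (4 * x) ^ (k * (k - 1) / 2) := by gcongr
            _ = 4 ^ (k * (k - 1) / 2) * x ^ (k * (k - 1) / 2) := mul_pow _ _ _
            _ ≤ _ := by
                gcongr
                · norm_num
                · calc k * (k - 1) / 2 ≤ k * (k - 1) := Nat.div_le_self _ _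
                    _ ≤ k * k := by gcongr; omega
                    _ = k ^ 2 := (sq k).symm
        have h5 : (X : ℝ) ^ E = x ^ (2 * (l * k)) * (x ^ (((k : ℝ) - 1) * mvExp k l) *
            ((X : ℝ) ^ k * x ^ (k * (k - 1) / 2))) := by
          have e1 : (X : ℝ) ^ E = x ^ ((k : ℝ) * E) := by
            rw [Real.rpow_mul (by linarith), Real.rpow_natCast, hxX]
          have e2 : (X : ℝ) ^ k = x ^ ((k : ℝ) * k) := by
            rw [← hxX, ← pow_mul, ← Real.rpow_natCast]; push_cast; rfl
          have e3 : x ^ (k * (k - 1) / 2) = x ^ ((k : ℝ) * (k - 1) / 2) := by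
            rw [← Real.rpow_natCast, Nat.cast_div (Nat.even_mul_pred_self k).two_dvd (by norm_num)]
            push_cast [Nat.cast_sub (by omega : 1 ≤ k)]
            rfl
          rw [e1, e2, e3, ← Real.rpow_natCast, ← Real.rpow_add hx0, ← Real.rpow_add hx0,
            ← Real.rpow_add hx0, hE, ← mvExp_succ (by omega)]
          congr 1
          push_cast; ring
        have h6 : (4 : ℝ) * (4 ^ (2 * (l * k)) * (2 ^ (2 * (l * k)) * (k.factorial * 4 ^ (k ^ 2))))
            ≤ mvConst k L / 2 := by
          have e1 : (4 : ℝ) * (4 ^ (2 * (l * k)) * (2 ^ (2 * (l * k)) *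
              (k.factorial * 4 ^ (k ^ 2)))) =
              2 ^ (6 * (l * k) + 2 * k ^ 2 + 2) * k.factorial := by
            rw [show (4 : ℝ) = 2 ^ 2 by norm_num, ← pow_mul, ← pow_mul]
            ring
          have e2 : (2 : ℝ) ^ (6 * (l * k) + 2 * k ^ 2 + 2) * k.factorial ≤
              2 ^ (6 * L * k + 2 * k ^ 2 + 2) * k.factorial := by
            have : l * k ≤ L * k := Nat.mul_le_mul_right k (by omega)
            have h7 : 6 * (l * k) + 2 * k ^ 2 + 2 ≤ 6 * L * k + 2 * k ^ 2 + 2 := by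
              rw [mul_assoc]; omega
            exact mul_le_mul_of_nonneg_right (pow_le_pow_right₀ (by norm_num) h7) (by positivity)
          have e3 : 2 ^ (6 * L * k + 2 * k ^ 2 + 3) * (k.factorial : ℝ) ≤ mvConst k L :=
            le_mul_of_one_le_left (by positivity) hC1
          rw [e1]
          refine e2.trans ?_
          rw [pow_succ _ (6 * L * k + 2 * k ^ 2 + 2)] at e3
          linarith
        calc _ ≤ 4 * ((4 ^ (2 * (l * k)) * x ^ (2 * (l * k))) * ((mvConst k L ^ l *
              (2 ^ (2 * (l * k)) * x ^ (((k : ℝ) - 1) * mvExp k l))) *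
              (X ^ k * (k.factorial * (4 ^ (k ^ 2) * x ^ (k * (k - 1) / 2)))))) := by
              gcongr
              exact hJ.trans (by gcongr)
          _ = (4 * (4 ^ (2 * (l * k)) * (2 ^ (2 * (l * k)) * (k.factorial * 4 ^ (k ^ 2))))) *
              mvConst k L ^ l * (X : ℝ) ^ E := by rw [h5]; ring
          _ ≤ (mvConst k L / 2) * mvConst k L ^ l * (X : ℝ) ^ E := by gcongr
          _ = _ := by ring
      have hsecond : (2 * k ^ 2 * p : ℝ) ^ n * meanValue k n (X / p + 1) ≤
          mvConst k L ^ (l + 1) * (X : ℝ) ^ E / 2 := by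
        have hJ := ihX Y hYX hY1
        have hE' : 0 ≤ E := by
          have : 0 ≤ 5 / 4 * (n : ℝ) := by positivity
          linarith
        have hn1 : 1 ≤ n := by rw [hnsk]; omega
        have hYp : (Y : ℝ) ≤ 2 * X / p := by
          rw [le_div_iff₀ hp0]
          have h1 : (Y : ℝ) * p ≤ (X / p + 1) * p := by gcongr
          have h2 : ((X : ℝ) / p + 1) * p = X + p := by field_simp
          nlinarith
        have h1 : (Y : ℝ) ^ E ≤ 2 ^ (2 * n) * X ^ E / (p : ℝ) ^ E := by
          calc (Y : ℝ) ^ E ≤ (2 * X / p) ^ E := by gcongr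
            _ = 2 ^ E * X ^ E / (p : ℝ) ^ E := by
                rw [Real.div_rpow (by positivity) hp0.le, Real.mul_rpow (by norm_num) (by linarith)]
            _ ≤ _ := by
                gcongr
                rw [← Real.rpow_natCast]
                apply Real.rpow_le_rpow_of_exponent_le (by norm_num)
                push_cast; linarith
        have h2 : (p : ℝ) ^ n * (16 * k ^ 2 : ℝ) ^ n ≤ (p : ℝ) ^ E := by
          have e1 : (p : ℝ) ^ (5 / 4 * (n : ℝ)) ≤ (p : ℝ) ^ E :=
            Real.rpow_le_rpow_of_exponent_le (by linarith) hE0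
          have e2 : (p : ℝ) ^ (5 / 4 * (n : ℝ)) = (p : ℝ) ^ n * ((p : ℝ) ^ (1 / 4 : ℝ)) ^ n := by
            rw [← Real.rpow_natCast, ← Real.rpow_natCast, ← Real.rpow_mul hp0.le,
              ← Real.rpow_add hp0]
            congr 1; ring
          have e3 : (16 * k ^ 2 : ℝ) ≤ (p : ℝ) ^ (1 / 4 : ℝ) := by
            calc (16 * k ^ 2 : ℝ) = ((16 * k ^ 2 : ℝ) ^ 4) ^ (1 / 4 : ℝ) := by
                  generalize (16 * k ^ 2 : ℝ) = b at hbase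
                  rw [← Real.rpow_natCast, ← Real.rpow_mul (by linarith)]
                  norm_num
              _ ≤ _ := by
                  gcongr
                  linarith
          calc _ ≤ (p : ℝ) ^ n * ((p : ℝ) ^ (1 / 4 : ℝ)) ^ n := by gcongr
            _ ≤ _ := e2 ▸ e1
        have hpE : 0 < (p : ℝ) ^ E := by positivity
        have h3 : (2 * k ^ 2 * p : ℝ) ^ n * (2 ^ (2 * n) / (p : ℝ) ^ E) ≤ 1 / 2 := by
          rw [mul_div_assoc', div_le_iff₀ hpE]
          have e1 : (2 * k ^ 2 * p : ℝ) ^ n * 2 ^ (2 * n) * 2 ^ n =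
              (p : ℝ) ^ n * (16 * k ^ 2 : ℝ) ^ n := by
            rw [pow_mul (2 : ℝ) 2 n, ← mul_pow, ← mul_pow, ← mul_pow]
            congr 1; ring
          have e2 : (2 : ℝ) ≤ 2 ^ n := le_self_pow₀ (by norm_num) (by omega)
          have e3 : (2 * k ^ 2 * p : ℝ) ^ n * 2 ^ (2 * n) * 2 ≤
              (2 * k ^ 2 * p : ℝ) ^ n * 2 ^ (2 * n) * 2 ^ n := by gcongr
          linarith
        calc _ ≤ (2 * k ^ 2 * p : ℝ) ^ n * (mvConst k L ^ (l + 1) *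
              (2 ^ (2 * n) * X ^ E / (p : ℝ) ^ E)) := by
              gcongr
              exact hJ.trans (by gcongr)
          _ = ((2 * k ^ 2 * p : ℝ) ^ n * (2 ^ (2 * n) / (p : ℝ) ^ E)) *
              (mvConst k L ^ (l + 1) * X ^ E) := by ring
          _ ≤ 1 / 2 * (mvConst k L ^ (l + 1) * X ^ E) := by gcongr
          _ = _ := by ring
      linarith

/-- The character `v ↦ exp (i ⟨γ, v⟩)` of `ℤ^k`. -/
noncomputable def ph {k : ℕ} (γ : Fin k → ℝ) (v : Fin k → ℤ) : ℂ :=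
  Complex.exp (((∑ j, γ j * v j : ℝ) : ℂ) * Complex.I)

section DoubleHolder

variable {k s : ℕ}

theorem ph_add (γ : Fin k → ℝ) (v w : Fin k → ℤ) : ph γ (v + w) = ph γ v * ph γ w := by
  have h : ∑ j, γ j * ((v + w) j : ℤ) = ∑ j, γ j * v j + ∑ j, γ j * w j := by
    rw [← Finset.sum_add_distrib]
    exact Finset.sum_congr rfl fun j _ => by push_cast [Pi.add_apply]; ring
  rw [ph, ph, ph, ← Complex.exp_add, ← add_mul, ← Complex.ofReal_add, h]

theorem ph_sum {ι : Type*} (γ : Fin k → ℝ) (S : Finset ι) (v : ι → Fin k → ℤ) :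
    ph γ (∑ i ∈ S, v i) = ∏ i ∈ S, ph γ (v i) := by
  induction S using Finset.induction_on with
  | empty => simp [ph]
  | insert a S ha ih => rw [Finset.sum_insert ha, Finset.prod_insert ha, ph_add, ih]

theorem ph_neg (γ : Fin k → ℝ) (v : Fin k → ℤ) : ph γ (-v) = (starRingEnd ℂ) (ph γ v) := by
  rw [ph, ph, ← Complex.exp_conj, map_mul, Complex.conj_ofReal, Complex.conj_I]
  congr 1
  simp

/-- The pairs of `s`-tuples from `[1, q]`. -/
def tuplePairs (s q : ℕ) : Finset ((Fin s → ℕ) × (Fin s → ℕ)) :=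
  (Fintype.piFinset fun _ : Fin s => Finset.Icc 1 q) ×ˢ
    (Fintype.piFinset fun _ : Fin s => Finset.Icc 1 q)

/-- Difference of the power sums of a pair of tuples. -/
def diffPsums (k : ℕ) {s : ℕ} (z : (Fin s → ℕ) × (Fin s → ℕ)) : Fin k → ℤ :=
  psums k z.1 - psums k z.2

/-- The box containing all differences of power sums. -/
noncomputable def psumBox (k s q : ℕ) : Finset (Fin k → ℤ) :=
  Fintype.piFinset fun j => Finset.Icc (-(s * q ^ (j + 1 : ℕ) : ℤ)) (s * q ^ (j + 1 : ℕ))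

theorem card_tuplePairs (s q : ℕ) : (tuplePairs s q).card = q ^ (2 * s) := by
  simp [tuplePairs, two_mul, pow_add]

theorem diffPsums_mem {q : ℕ} {z : (Fin s → ℕ) × (Fin s → ℕ)} (hz : z ∈ tuplePairs s q) :
    diffPsums k z ∈ psumBox k s q := by
  rw [tuplePairs, Finset.mem_product, Fintype.mem_piFinset, Fintype.mem_piFinset] at hz
  have hb : ∀ x : Fin s → ℕ, (∀ i, x i ∈ Finset.Icc 1 q) → ∀ j : Fin k, 0 ≤ psums k x j ∧
      psums k x j ≤ s * q ^ (j + 1 : ℕ) := by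
    intro x hx j
    rw [psums_apply]
    refine ⟨Finset.sum_nonneg fun i _ => by positivity, ?_⟩
    calc ∑ i, (x i : ℤ) ^ (j + 1 : ℕ) ≤ ∑ _i : Fin s, (q : ℤ) ^ (j + 1 : ℕ) := by
          refine Finset.sum_le_sum fun i _ => ?_
          have : (x i : ℤ) ≤ q := by exact_mod_cast (Finset.mem_Icc.1 (hx i)).2
          gcongr
      _ = _ := by simp
  rw [psumBox, Fintype.mem_piFinset]
  intro j
  have h1 := hb z.1 hz.1 j
  have h2 := hb z.2 hz.2 j
  rw [Finset.mem_Icc, diffPsums, Pi.sub_apply]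
  constructor <;> linarith

theorem norm_sum_ph_pow {q : ℕ} (γ : Fin k → ℝ) :
    ((‖∑ y ∈ Finset.Icc 1 q, ph γ (curve k y)‖ ^ (2 * s) : ℝ) : ℂ) =
      ∑ z ∈ tuplePairs s q, ph γ (diffPsums k z) := by
  have h : (∑ y ∈ Finset.Icc 1 q, ph γ (curve k y)) ^ s =
      ∑ x ∈ Fintype.piFinset (fun _ : Fin s => Finset.Icc 1 q), ph γ (psums k x) := by
    simp only [psums, ph_sum]
    rw [Finset.sum_prod_piFinset (Finset.Icc 1 q) (fun (_ : Fin s) y => ph γ (curve k (y : ℕ)))]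
    simp
  have h2 : ((‖∑ y ∈ Finset.Icc 1 q, ph γ (curve k y)‖ ^ (2 * s) : ℝ) : ℂ) =
      (∑ y ∈ Finset.Icc 1 q, ph γ (curve k y)) ^ s *
        (starRingEnd ℂ) ((∑ y ∈ Finset.Icc 1 q, ph γ (curve k y)) ^ s) := by
    rw [Complex.mul_conj', norm_pow]
    push_cast
    ring
  rw [h2, h, map_sum, Finset.sum_mul_sum, tuplePairs, Finset.sum_product]
  simp only [diffPsums, sub_eq_add_neg, ph_add, ph_neg]

theorem sum_norm_sum_ph_le {ι : Type*} {q : ℕ} (I : Finset ι) (γ : ι → Fin k → ℝ) :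
    ∑ i ∈ I, ‖∑ y ∈ Finset.Icc 1 q, ph (γ i) (curve k y)‖ ^ (2 * s) ≤
      ∑ z ∈ tuplePairs s q, ‖∑ i ∈ I, ph (γ i) (diffPsums k z)‖ := by
  have h0 : 0 ≤ ∑ i ∈ I, ‖∑ y ∈ Finset.Icc 1 q, ph (γ i) (curve k y)‖ ^ (2 * s) := by positivity
  have h : ((∑ i ∈ I, ‖∑ y ∈ Finset.Icc 1 q, ph (γ i) (curve k y)‖ ^ (2 * s) : ℝ) : ℂ) =
      ∑ z ∈ tuplePairs s q, ∑ i ∈ I, ph (γ i) (diffPsums k z) := by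
    rw [Complex.ofReal_sum, Finset.sum_congr rfl fun i _ => norm_sum_ph_pow (s := s) (γ i),
      Finset.sum_comm]
  rw [← Complex.norm_of_nonneg h0, h]
  exact norm_sum_le _ _

theorem sum_tuplePairs_le {q : ℕ} (a : (Fin k → ℤ) → ℝ) (ha : ∀ v, 0 ≤ a v) :
    ∑ z ∈ tuplePairs s q, a (diffPsums k z) ≤ meanValue k s q * ∑ v ∈ psumBox k s q, a v := by
  rw [← Finset.sum_fiberwise_of_maps_to (t := psumBox k s q) (g := fun z => diffPsums k z)
    (fun z hz => diffPsums_mem hz), Finset.mul_sum]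
  refine Finset.sum_le_sum fun v _ => ?_
  rw [Finset.sum_congr rfl fun z hz => by
    rw [(Finset.mem_filter.1 hz).2], Finset.sum_const, nsmul_eq_mul]
  refine mul_le_mul_of_nonneg_right ?_ (ha v)
  have h := card_shift_le_energy (Fintype.piFinset fun _ : Fin s => Finset.Icc 1 q) (psums k) v
  rw [meanValue]
  refine Nat.cast_le.2 (le_trans (Finset.card_le_card ?_) h)
  intro z hz
  rw [Finset.mem_filter] at hz
  simp only [Finset.mem_filter]
  refine ⟨hz.1, ?_⟩
  rw [← hz.2, diffPsums]
  abel

/-- The geometric-sum factor in the double Hölder estimate. -/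
noncomputable def geoFactor (H : ℤ) (b : ℝ) : ℝ :=
  ∑ μ ∈ Finset.Icc (-H) H, ‖∑ l ∈ Finset.Icc (-H) H, Complex.exp (((b * l * μ : ℝ) : ℂ) * Complex.I)‖

theorem double_holder {q : ℕ} (b : Fin k → ℝ) :
    (q : ℝ) ^ (2 * (2 * s)) * ‖∑ x ∈ Finset.Icc 1 q, ∑ y ∈ Finset.Icc 1 q,
      ph b (curve k ((x * y : ℕ) : ℤ))‖ ^ (2 * s * (2 * s)) ≤
      (q : ℝ) ^ (2 * (2 * s * (2 * s))) * (meanValue k s q ^ 2 *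
        ∏ j : Fin k, geoFactor (s * q ^ (j + 1 : ℕ)) (b j)) := by
  set m := 2 * s with hm
  set W := ∑ x ∈ Finset.Icc 1 q, ∑ y ∈ Finset.Icc 1 q, ph b (curve k ((x * y : ℕ) : ℤ)) with hW
  let γ : ℕ → Fin k → ℝ := fun x j => b j * (x : ℝ) ^ (j + 1 : ℕ)
  let δ : (Fin k → ℤ) → Fin k → ℝ := fun l j => b j * l j
  have e1 : ∀ x y : ℕ, ph b (curve k ((x * y : ℕ) : ℤ)) = ph (γ x) (curve k y) := by
    intro x y
    simp only [ph, curve, γ]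
    congr 3
    refine Finset.sum_congr rfl fun j _ => ?_
    push_cast
    ring
  have e2 : ∀ (x : ℕ) l, ph (γ x) l = ph (δ l) (curve k x) := by
    intro x l
    simp only [ph, curve, γ, δ]
    congr 3
    refine Finset.sum_congr rfl fun j _ => ?_
    push_cast
    ring
  set a : (Fin k → ℤ) → ℝ := fun l => ‖∑ x ∈ Finset.Icc 1 q, ph (γ x) l‖ with ha
  have h1 : (q : ℝ) * ‖W‖ ^ m ≤ (q : ℝ) ^ m * ∑ z ∈ tuplePairs s q, a (diffPsums k z) := by
    have h2 := card_mul_sum_pow_le (Finset.Icc 1 q)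
      (fun x => ‖∑ y ∈ Finset.Icc 1 q, ph (γ x) (curve k y)‖) (fun _ _ => norm_nonneg _) m
    rw [Nat.card_Icc, Nat.add_sub_cancel] at h2
    calc (q : ℝ) * ‖W‖ ^ m ≤ q * (∑ x ∈ Finset.Icc 1 q,
          ‖∑ y ∈ Finset.Icc 1 q, ph (γ x) (curve k y)‖) ^ m := by
          gcongr
          rw [hW]
          simp only [e1]
          exact norm_sum_le _ _
      _ ≤ _ := h2
      _ ≤ _ := by
          gcongr
          exact sum_norm_sum_ph_le (Finset.Icc 1 q) γ
  have h3 : (q : ℝ) ^ m * (∑ z ∈ tuplePairs s q, a (diffPsums k z)) ^ m ≤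
      ((q : ℝ) ^ m) ^ m * ∑ z ∈ tuplePairs s q, a (diffPsums k z) ^ m := by
    have h2 := card_mul_sum_pow_le (tuplePairs s q) (fun z => a (diffPsums k z))
      (fun _ _ => norm_nonneg _) m
    rw [card_tuplePairs] at h2
    exact_mod_cast h2
  have h4 : ∑ z ∈ tuplePairs s q, a (diffPsums k z) ^ m ≤
      meanValue k s q * ∑ v ∈ psumBox k s q, a v ^ m :=
    sum_tuplePairs_le (fun v => a v ^ m) (fun v => by positivity)
  have h5 : ∑ v ∈ psumBox k s q, a v ^ m ≤ meanValue k s q *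
      ∏ j : Fin k, geoFactor (s * q ^ (j + 1 : ℕ)) (b j) := by
    calc ∑ v ∈ psumBox k s q, a v ^ m =
          ∑ v ∈ psumBox k s q, ‖∑ x ∈ Finset.Icc 1 q, ph (δ v) (curve k x)‖ ^ (2 * s) := by
          simp only [ha, e2, hm]
      _ ≤ ∑ z ∈ tuplePairs s q, ‖∑ v ∈ psumBox k s q, ph (δ v) (diffPsums k z)‖ :=
          sum_norm_sum_ph_le _ δ
      _ ≤ meanValue k s q * ∑ μ ∈ psumBox k s q, ‖∑ v ∈ psumBox k s q, ph (δ v) μ‖ :=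
          sum_tuplePairs_le (fun μ => ‖∑ v ∈ psumBox k s q, ph (δ v) μ‖) (fun v => norm_nonneg _)
      _ = _ := by
          congr 1
          simp only [geoFactor]
          rw [Finset.prod_univ_sum]
          refine Finset.sum_congr rfl fun μ _ => ?_
          rw [← norm_prod, Finset.prod_univ_sum]
          congr 1
          refine Finset.sum_congr rfl fun v _ => ?_
          rw [← Complex.exp_sum, ← Finset.sum_mul, ph]
          simp [δ]
  have hJ : (0 : ℝ) ≤ meanValue k s q := Nat.cast_nonneg _
  have h6 : (q : ℝ) ^ m * (‖W‖ ^ m) ^ m ≤ ((q : ℝ) ^ m) ^ m *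
      (∑ z ∈ tuplePairs s q, a (diffPsums k z)) ^ m := by
    rw [← mul_pow, ← mul_pow]
    gcongr
  calc (q : ℝ) ^ (2 * m) * ‖W‖ ^ (m * m) = (q : ℝ) ^ m * ((q : ℝ) ^ m * (‖W‖ ^ m) ^ m) := by ring
    _ ≤ (q : ℝ) ^ m * (((q : ℝ) ^ m) ^ m *
      (∑ z ∈ tuplePairs s q, a (diffPsums k z)) ^ m) := by gcongr
    _ = ((q : ℝ) ^ m) ^ m * ((q : ℝ) ^ m *
      (∑ z ∈ tuplePairs s q, a (diffPsums k z)) ^ m) := by ring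
    _ ≤ ((q : ℝ) ^ m) ^ m * (((q : ℝ) ^ m) ^ m * (meanValue k s q * (meanValue k s q *
      ∏ j : Fin k, geoFactor (s * q ^ (j + 1 : ℕ)) (b j)))) := by
        refine mul_le_mul_of_nonneg_left (h3.trans ?_) (by positivity)
        refine mul_le_mul_of_nonneg_left (h4.trans ?_) (by positivity)
        exact mul_le_mul_of_nonneg_left h5 hJ
    _ = _ := by ring

end DoubleHolder

theorem geoFactor_le_sq (H : ℕ) (hH : 1 ≤ H) (b : ℝ) : geoFactor H b ≤ (3 * H) ^ 2 := by
  have hc : ((Finset.Icc (-(H : ℤ)) H).card : ℝ) ≤ 3 * H := by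
    rw [Int.card_Icc]
    have : ((H : ℤ) + 1 - -(H : ℤ)).toNat ≤ 3 * H := by omega
    exact_mod_cast this
  rw [geoFactor]
  calc _ ≤ ∑ μ ∈ Finset.Icc (-(H : ℤ)) H, ∑ l ∈ Finset.Icc (-(H : ℤ)) H, (1 : ℝ) := by
        refine Finset.sum_le_sum fun μ _ => (norm_sum_le _ _).trans (le_of_eq ?_)
        simp only [Complex.norm_exp_ofReal_mul_I]
    _ = ((Finset.Icc (-(H : ℤ)) H).card : ℝ) ^ 2 := by
        rw [Finset.sum_const, Finset.sum_const, nsmul_eq_mul, nsmul_eq_mul]; ring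
    _ ≤ _ := by gcongr

theorem norm_sum_exp_le (H : ℕ) {θ : ℝ} (h0 : θ ≠ 0) (h1 : |θ| ≤ π) :
    ‖∑ l ∈ Finset.Icc (-(H : ℤ)) H, Complex.exp (((θ * l : ℝ) : ℂ) * Complex.I)‖ ≤ π / |θ| := by
  have htel : (Complex.exp (Complex.I * θ) - 1) *
      ∑ l ∈ Finset.Icc (-(H : ℤ)) H, Complex.exp (((θ * l : ℝ) : ℂ) * Complex.I) =
      Complex.exp (((θ * (H + 1) : ℝ) : ℂ) * Complex.I) -
        Complex.exp (((θ * (-H) : ℝ) : ℂ) * Complex.I) := by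
    induction H with
    | zero => simp [mul_comm]
    | succ n ih =>
      rw [Nat.cast_add, Nat.cast_one, Finset.Icc_succ_succ, Finset.sum_union (by simp),
        Finset.sum_pair (by omega),
        show ∀ A S u v : ℂ, (A - 1) * (S + (u + v)) = (A - 1) * S + (A * u - u + (A * v - v)) by
          intros; ring, ih]
      have e : ∀ x : ℝ, Complex.exp (Complex.I * θ) * Complex.exp ((x : ℂ) * Complex.I) =
          Complex.exp (((θ + x : ℝ) : ℂ) * Complex.I) := by
        intro x
        rw [← Complex.exp_add]; congr 1; push_cast; ring
      rw [e, e]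
      have e1 : θ + θ * ((-(n + 1 : ℤ) : ℤ) : ℝ) = θ * (-n) := by push_cast; ring
      have e2 : θ + θ * ((n + 1 : ℤ) : ℝ) = θ * (((n + 1 : ℕ) : ℝ) + 1) := by push_cast; ring
      have e3 : θ * ((n + 1 : ℤ) : ℝ) = θ * (n + 1) := by push_cast; ring
      have e4 : θ * ((-(n + 1 : ℤ) : ℤ) : ℝ) = θ * (-((n + 1 : ℕ) : ℝ)) := by push_cast; ring
      rw [e1, e2, e3, e4]
      push_cast
      ring
  have hθ : 0 < |θ| := abs_pos.2 h0
  have hsin : 2 * |θ| / π ≤ ‖Complex.exp (Complex.I * θ) - 1‖ := by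
    rw [Complex.norm_exp_I_mul_ofReal_sub_one, Real.norm_eq_abs, abs_mul, abs_two]
    have h2 : |θ / 2| ≤ π / 2 := by rw [abs_div, abs_two]; linarith
    have := Real.mul_abs_le_abs_sin h2
    rw [abs_div, abs_two] at this
    calc 2 * |θ| / π = 2 * (2 / π * (|θ| / 2)) := by ring
      _ ≤ _ := by linarith
  have h2 : 2 * |θ| / π * ‖∑ l ∈ Finset.Icc (-(H : ℤ)) H,
      Complex.exp (((θ * l : ℝ) : ℂ) * Complex.I)‖ ≤ 2 := by
    calc _ ≤ ‖Complex.exp (Complex.I * θ) - 1‖ * ‖∑ l ∈ Finset.Icc (-(H : ℤ)) H,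
          Complex.exp (((θ * l : ℝ) : ℂ) * Complex.I)‖ := by gcongr
      _ = ‖Complex.exp (((θ * (H + 1) : ℝ) : ℂ) * Complex.I) -
        Complex.exp (((θ * (-H) : ℝ) : ℂ) * Complex.I)‖ := by rw [← norm_mul, htel]
      _ ≤ _ := (norm_sub_le _ _).trans (by
        rw [Complex.norm_exp_ofReal_mul_I, Complex.norm_exp_ofReal_mul_I]; norm_num)
  have h3 : 0 < 2 * |θ| / π := by have := Real.pi_pos; positivity
  rw [← le_div_iff₀' h3] at h2
  refine h2.trans (le_of_eq ?_)
  have := Real.pi_pos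
  field_simp

theorem geoFactor_le_log (H : ℕ) (hH : 1 ≤ H) {b : ℝ} (hb : b ≠ 0) (hbH : |b| * H ≤ π) :
    geoFactor H b ≤ 3 * H + 2 * π / |b| * (1 + Real.log H) := by
  have hb0 : 0 < |b| := abs_pos.2 hb
  set f : ℤ → ℝ := fun μ => ‖∑ l ∈ Finset.Icc (-(H : ℤ)) H,
    Complex.exp (((b * l * μ : ℝ) : ℂ) * Complex.I)‖ with hf
  have hconj : ∀ μ, f (-μ) = f μ := by
    intro μ
    simp only [hf]
    rw [← Complex.norm_conj, map_sum]
    congr 1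
    refine Finset.sum_congr rfl fun l _ => ?_
    rw [← Complex.exp_conj, map_mul, Complex.conj_ofReal, Complex.conj_I]
    congr 1
    push_cast
    ring
  have h0 : f 0 ≤ 3 * H := by
    simp only [hf]
    refine (norm_sum_le _ _).trans ?_
    simp only [Complex.norm_exp_ofReal_mul_I, Finset.sum_const, nsmul_eq_mul, mul_one]
    rw [Int.card_Icc]
    have : ((H : ℤ) + 1 - -(H : ℤ)).toNat ≤ 3 * H := by omega
    exact_mod_cast this
  have hμ : ∀ m ∈ Finset.Icc 1 H, f (m : ℤ) ≤ π / |b| * ((m : ℕ) : ℝ)⁻¹ := by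
    intro m hm
    rw [Finset.mem_Icc] at hm
    have hm0 : (0 : ℝ) < m := by exact_mod_cast hm.1
    have hmH : (m : ℝ) ≤ H := by exact_mod_cast hm.2
    have := norm_sum_exp_le H (θ := b * m) (mul_ne_zero hb hm0.ne') (by
      rw [abs_mul, abs_of_pos hm0]
      exact (mul_le_mul_of_nonneg_left hmH hb0.le).trans hbH)
    rw [abs_mul, abs_of_pos hm0] at this
    calc f (m : ℤ) = _ := by
          simp only [hf]
          congr 1
          refine Finset.sum_congr rfl fun l _ => ?_
          congr 3
          push_cast; ring
      _ ≤ _ := this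
      _ = _ := by field_simp
  have hsum : geoFactor H b = f 0 + 2 * ∑ m ∈ Finset.Icc 1 H, f (m : ℤ) := by
    rw [geoFactor, Finset.sum_Icc_of_even_eq_range (f := f) hconj, Finset.sum_range_succ']
    have e : ∑ m ∈ Finset.Icc 1 H, f (m : ℤ) = ∑ i ∈ Finset.range H, f ((i + 1 : ℕ) : ℤ) := by
      rw [Finset.range_eq_Ico, Finset.sum_Ico_add' (fun i : ℕ => f (i : ℤ)) 0 H 1]
      congr 1
    rw [e]
    simp only [Nat.cast_zero, two_smul]
    ring
  have hharm : ∑ m ∈ Finset.Icc 1 H, ((m : ℕ) : ℝ)⁻¹ ≤ 1 + Real.log H := by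
    have := harmonic_le_one_add_log H
    rw [harmonic_eq_sum_Icc] at this
    push_cast at this
    exact this
  calc geoFactor H b = f 0 + 2 * ∑ m ∈ Finset.Icc 1 H, f (m : ℤ) := hsum
    _ ≤ 3 * H + 2 * ∑ m ∈ Finset.Icc 1 H, π / |b| * ((m : ℕ) : ℝ)⁻¹ := by
        gcongr with m hm
        exact hμ m hm
    _ = 3 * H + 2 * π / |b| * ∑ m ∈ Finset.Icc 1 H, ((m : ℕ) : ℝ)⁻¹ := by
        rw [← Finset.mul_sum]; ring
    _ ≤ _ := by
        have := Real.pi_pos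
        gcongr

theorem norm_sum_shift_sub_le (f : ℕ → ℂ) (hf : ∀ n, ‖f n‖ ≤ 1) (N M h : ℕ) (hNM : N ≤ M) :
    ‖∑ n ∈ Finset.Ioc N M, f n - ∑ n ∈ Finset.Ioc N M, f (n + h)‖ ≤ 2 * h := by
  induction h with
  | zero => simp
  | succ h ih =>
    have htel : ∑ n ∈ Finset.Ioc N M, f (n + h) - ∑ n ∈ Finset.Ioc N M, f (n + (h + 1)) =
        f (N + 1 + h) - f (M + 1 + h) := by
      rw [← Finset.sum_sub_distrib]
      clear ih
      induction M, hNM using Nat.le_induction with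
      | base => simp
      | succ M hM ih =>
        rw [Finset.sum_Ioc_succ_top (by omega), ih]
        rw [show M + 1 + (h + 1) = M + 1 + 1 + h by ring]
        ring
    calc ‖∑ n ∈ Finset.Ioc N M, f n - ∑ n ∈ Finset.Ioc N M, f (n + (h + 1))‖
        = ‖(∑ n ∈ Finset.Ioc N M, f n - ∑ n ∈ Finset.Ioc N M, f (n + h)) +
          (f (N + 1 + h) - f (M + 1 + h))‖ := by rw [← htel]; congr 1; ring
      _ ≤ 2 * h + (1 + 1) := (norm_add_le _ _).trans
          (add_le_add ih ((norm_sub_le _ _).trans (add_le_add (hf _) (hf _))))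
      _ = _ := by push_cast; ring

theorem norm_sum_le_shift (f : ℕ → ℂ) (hf : ∀ n, ‖f n‖ ≤ 1) (N M q : ℕ) (hNM : N ≤ M) :
    (q : ℝ) ^ 2 * ‖∑ n ∈ Finset.Ioc N M, f n‖ ≤
      ∑ n ∈ Finset.Ioc N M, ‖∑ x ∈ Finset.Icc 1 q, ∑ y ∈ Finset.Icc 1 q, f (n + x * y)‖ +
        2 * (q : ℝ) ^ 4 := by
  have h1 : (q : ℂ) ^ 2 * ∑ n ∈ Finset.Ioc N M, f n =
      ∑ n ∈ Finset.Ioc N M, ∑ x ∈ Finset.Icc 1 q, ∑ y ∈ Finset.Icc 1 q, f (n + x * y) +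
      ∑ x ∈ Finset.Icc 1 q, ∑ y ∈ Finset.Icc 1 q,
        (∑ n ∈ Finset.Ioc N M, f n - ∑ n ∈ Finset.Ioc N M, f (n + x * y)) := by
    simp only [Finset.sum_sub_distrib, Finset.sum_const, Nat.card_Icc]
    rw [Finset.sum_comm]
    have : ∀ x, ∑ n ∈ Finset.Ioc N M, ∑ y ∈ Finset.Icc 1 q, f (n + x * y) =
        ∑ y ∈ Finset.Icc 1 q, ∑ n ∈ Finset.Ioc N M, f (n + x * y) := fun x => Finset.sum_comm
    simp only [this]
    simp
    ring
  calc (q : ℝ) ^ 2 * ‖∑ n ∈ Finset.Ioc N M, f n‖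
      = ‖(q : ℂ) ^ 2 * ∑ n ∈ Finset.Ioc N M, f n‖ := by simp
    _ ≤ _ := by
      rw [h1]
      refine (norm_add_le _ _).trans (add_le_add (norm_sum_le _ _) ?_)
      calc _ ≤ ∑ x ∈ Finset.Icc 1 q, ∑ y ∈ Finset.Icc 1 q, 2 * (q : ℝ) ^ 2 := by
            refine norm_sum_le_of_le _ fun x hx => norm_sum_le_of_le _ fun y hy => ?_
            refine (norm_sum_shift_sub_le f hf N M (x * y) hNM).trans ?_
            have hx := (Finset.mem_Icc.1 hx).2
            have hy := (Finset.mem_Icc.1 hy).2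
            push_cast
            rw [pow_two]
            gcongr
        _ = _ := by simp; ring

/-- The linear coefficients attached to the Taylor expansion of `t * log (1 + w / n)`. -/
noncomputable def taylorCoeff (k : ℕ) (t : ℝ) (n : ℕ) : Fin k → ℝ :=
  fun j => t * (-1) ^ ((j : ℕ) + 1) / (((j : ℕ) + 1 : ℝ) * (n : ℝ) ^ ((j : ℕ) + 1))

theorem norm_cpow_sub_le (k : ℕ) {t : ℝ} (ht : 0 ≤ t) (n z : ℕ) (hn : 0 < n) (hz : 2 * z ≤ n) :
    ‖((n + z : ℕ) : ℂ) ^ (-(t * Complex.I)) -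
      (n : ℂ) ^ (-(t * Complex.I)) * ph (taylorCoeff k t n) (curve k (z : ℤ))‖ ≤
      2 * t * ((z : ℝ) / n) ^ (k + 1) := by
  have hn' : (0 : ℝ) < n := by exact_mod_cast hn
  set w : ℝ := (z : ℝ) / n with hw
  have hw0 : 0 ≤ w := by positivity
  have hw1 : w ≤ 1 / 2 := by
    rw [hw, div_le_iff₀ hn']
    have : (2 * z : ℝ) ≤ n := by exact_mod_cast hz
    linarith
  have hlog : Real.log ((n + z : ℕ) : ℝ) = Real.log n + Real.log (1 + w) := by
    rw [← Real.log_mul (by positivity) (by positivity)]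
    congr 1; push_cast; rw [hw]; field_simp
  have hcp : ∀ m : ℕ, 0 < m → (m : ℂ) ^ (-(t * Complex.I)) =
      Complex.exp (((-(t * Real.log m) : ℝ) : ℂ) * Complex.I) := by
    intro m hm
    rw [Complex.cpow_def_of_ne_zero (by exact_mod_cast hm.ne'), ← Complex.natCast_log]
    congr 1; push_cast; ring
  set P : ℝ := ∑ j, taylorCoeff k t n j * ((curve k (z : ℤ) j : ℤ) : ℝ) with hP
  have hP' : P = t * ∑ i ∈ Finset.range k, (-w) ^ (i + 1) / (i + 1) := by
    rw [hP, Finset.mul_sum, ← Fin.sum_univ_eq_sum_range (fun i => t * ((-w) ^ (i + 1) / ((i : ℝ) + 1)))]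
    refine Finset.sum_congr rfl fun j _ => ?_
    simp only [taylorCoeff, curve, hw]
    push_cast
    rw [← neg_one_mul ((z : ℝ) / n), mul_pow, div_pow]
    field_simp
  have hT := Real.abs_log_sub_add_sum_range_le (x := -w) (by rw [abs_neg, abs_of_nonneg hw0]; linarith) k
  rw [sub_neg_eq_add, abs_neg, abs_of_nonneg hw0] at hT
  rw [hcp _ (by omega), hcp _ hn, ph, ← hP, ← Complex.exp_add, ← add_mul, ← Complex.ofReal_add, hlog]
  have key : ∀ a b : ℝ, ‖Complex.exp ((a : ℂ) * Complex.I) - Complex.exp ((b : ℂ) * Complex.I)‖ ≤ |a - b| := by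
    intro a b
    have : Complex.exp ((a : ℂ) * Complex.I) - Complex.exp ((b : ℂ) * Complex.I) =
        Complex.exp ((b : ℂ) * Complex.I) * (Complex.exp (Complex.I * ((a - b : ℝ) : ℂ)) - 1) := by
      rw [mul_sub, ← Complex.exp_add]; congr 2
      · push_cast; ring
      · ring
    rw [this, norm_mul, Complex.norm_exp_ofReal_mul_I, one_mul]
    exact Real.norm_exp_I_mul_ofReal_sub_one_le
  refine (key _ _).trans ?_
  rw [show -(t * (Real.log n + Real.log (1 + w))) - (-(t * Real.log n) + P) =
    -(t * (∑ i ∈ Finset.range k, (-w) ^ (i + 1) / (i + 1) + Real.log (1 + w))) by rw [hP']; ring,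
    abs_neg, abs_mul, abs_of_nonneg ht]
  calc _ ≤ t * (w ^ (k + 1) / (1 - w)) := by gcongr
    _ ≤ t * (w ^ (k + 1) / (1 / 2)) := by gcongr; linarith
    _ = _ := by ring

theorem two_pow_le_exp (j : ℕ) : (2 : ℝ) ^ j ≤ Real.exp j := by
  have : (2 : ℝ) ≤ Real.exp 1 := by linarith [Real.add_one_le_exp (1 : ℝ)]
  calc (2 : ℝ) ^ j ≤ Real.exp 1 ^ j := by gcongr
    _ = _ := by rw [← Real.exp_nat_mul]; simp

set_option maxHeartbeats 1600000 in
theorem geoFactor_le_of_good {T L b : ℝ} {s q n j : ℕ} (hL : 480 ≤ L) (hT : 3 ≤ T)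
    (hbig : 3000 * T ^ 3 ≤ Real.exp (T / 20)) (hs : 1 ≤ s) (hs' : (s : ℝ) ≤ 400 * T ^ 2)
    (hq : Real.exp (2 * L / 5) / 2 ≤ q) (hq' : (q : ℝ) ≤ Real.exp (2 * L / 5))
    (hn : Real.exp L ≤ n) (hn' : (n : ℝ) ≤ 2 * Real.exp L)
    (hj : 2 * T ≤ j * L) (hj' : j * L ≤ 4 * T)
    (hb : |b| = Real.exp T / (j * (n : ℝ) ^ j)) :
    geoFactor (s * q ^ j) b ≤ (3 * (s * q ^ j : ℝ)) ^ 2 * Real.exp (-(T / 10)) := by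
  have hq0 : (0 : ℝ) < q := lt_of_lt_of_le (by positivity) hq
  have hn0 : (0 : ℝ) < n := lt_of_lt_of_le (by positivity) hn
  have hq1 : 1 ≤ q := by exact_mod_cast hq0
  have hj0 : (0 : ℝ) < j := by
    rcases Nat.eq_zero_or_pos j with h | h
    · subst h; simp at hj; linarith
    · exact_mod_cast h
  have hj4 : (j : ℝ) ≤ T / 120 := by nlinarith
  have hs1 : (1 : ℝ) ≤ s := by exact_mod_cast hs
  have hb0 : b ≠ 0 := by
    rw [← abs_pos, hb]; positivity
  set H : ℕ := s * q ^ j with hH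
  have hHr : (H : ℝ) = s * (q : ℝ) ^ j := by rw [hH]; push_cast; ring
  have hH1 : 1 ≤ H := Nat.one_le_iff_ne_zero.2 (by positivity)
  have hpi3 := Real.pi_gt_three
  have hpi4 : π ≤ 3.15 := Real.pi_lt_d2.le
  have hqj : Real.exp (2 * (j * L) / 5) / 2 ^ j ≤ (q : ℝ) ^ j := by
    calc _ = (Real.exp (2 * L / 5) / 2) ^ j := by
          rw [div_pow, ← Real.exp_nat_mul]; congr 2; ring
      _ ≤ _ := by gcongr
  have hqj' : (q : ℝ) ^ j ≤ Real.exp (2 * (j * L) / 5) := by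
    calc (q : ℝ) ^ j ≤ Real.exp (2 * L / 5) ^ j := by gcongr
      _ = _ := by rw [← Real.exp_nat_mul]; congr 1; ring
  have hnj : Real.exp (j * L) ≤ (n : ℝ) ^ j := by
    calc _ = Real.exp L ^ j := by rw [← Real.exp_nat_mul]
      _ ≤ _ := by gcongr
  have hnj' : (n : ℝ) ^ j ≤ 2 ^ j * Real.exp (j * L) := by
    calc _ ≤ (2 * Real.exp L) ^ j := by gcongr
      _ = _ := by rw [mul_pow, ← Real.exp_nat_mul]
  have hbig2 : 400 * T ^ 2 ≤ Real.exp (T / 20) := by nlinarith [sq_nonneg T]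
  have hbH : |b| * H ≤ π := by
    have h1 : (1 : ℝ) ≤ j := by
      have : 0 < j := by exact_mod_cast hj0
      exact_mod_cast this
    calc |b| * H = Real.exp T * (s * (q : ℝ) ^ j) / (j * (n : ℝ) ^ j) := by rw [hb, hHr]; ring
      _ ≤ Real.exp T * (Real.exp (T / 20) * Real.exp (2 * (j * L) / 5)) / (1 * Real.exp (j * L)) := by
          have := hs'.trans hbig2
          gcongr
      _ = Real.exp (T + (T / 20 + 2 * (j * L) / 5) - j * L) := by
          rw [Real.exp_sub, Real.exp_add, Real.exp_add, one_mul]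
      _ ≤ Real.exp 0 := Real.exp_le_exp.2 (by linarith)
      _ ≤ π := by rw [Real.exp_zero]; linarith
  have hmain := geoFactor_le_log H hH1 hb0 hbH
  have hHlow : Real.exp (T / 10) ≤ H := by
    rw [hHr]
    calc Real.exp (T / 10) ≤ Real.exp (2 * (j * L) / 5) / Real.exp j := by
          rw [← Real.exp_sub]; exact Real.exp_le_exp.2 (by linarith)
      _ ≤ Real.exp (2 * (j * L) / 5) / 2 ^ j := by gcongr; exact two_pow_le_exp j
      _ ≤ (q : ℝ) ^ j := hqj
      _ ≤ _ := by nlinarith [show (0 : ℝ) ≤ (q : ℝ) ^ j by positivity]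
  have hlogH : Real.log H ≤ 400 * T ^ 2 + 2 * T := by
    rw [hHr, Real.log_mul (by positivity) (by positivity)]
    have h1 : Real.log s ≤ s := (Real.log_le_sub_one_of_pos (by positivity)).trans (by linarith)
    have h2 : Real.log ((q : ℝ) ^ j) ≤ 2 * (j * L) / 5 := by
      rw [Real.log_le_iff_le_exp (by positivity)]; exact hqj'
    linarith
  have hH2 : Real.exp (4 * (j * L) / 5) / 4 ^ j ≤ (H : ℝ) ^ 2 := by
    calc _ = (Real.exp (2 * (j * L) / 5) / 2 ^ j) ^ 2 := by
          rw [div_pow, ← Real.exp_nat_mul, ← pow_mul, mul_comm j 2, pow_mul]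
          congr 2
          · push_cast; ring
          · norm_num
      _ ≤ ((q : ℝ) ^ j) ^ 2 := by gcongr
      _ ≤ _ := by
        rw [hHr]
        gcongr
        nlinarith [show (0 : ℝ) ≤ (q : ℝ) ^ j by positivity]
  have hA : 3 * (H : ℝ) ≤ 9 / 2 * (H : ℝ) ^ 2 * Real.exp (-(T / 10)) := by
    have : (1 : ℝ) ≤ H * Real.exp (-(T / 10)) := by
      calc (1 : ℝ) = Real.exp (T / 10) * Real.exp (-(T / 10)) := by rw [← Real.exp_add]; simp
        _ ≤ _ := by gcongr
    nlinarith [show (0 : ℝ) ≤ H by positivity]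
  have hB : 2 * π / |b| * (1 + Real.log H) ≤ 9 / 2 * (H : ℝ) ^ 2 * Real.exp (-(T / 10)) := by
    have e1 : (8 : ℝ) ^ j ≤ Real.exp (T / 40) := by
      calc (8 : ℝ) ^ j = (2 ^ j) ^ 3 := by rw [← pow_mul, mul_comm, pow_mul]; norm_num
        _ ≤ (Real.exp j) ^ 3 := by gcongr; exact two_pow_le_exp j
        _ = Real.exp (3 * j) := by rw [← Real.exp_nat_mul]; norm_num
        _ ≤ _ := Real.exp_le_exp.2 (by linarith)
    have e2 : (n : ℝ) ^ j ≤ 8 ^ j * Real.exp (T - T / 5) * (H : ℝ) ^ 2 := by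
      calc (n : ℝ) ^ j ≤ 2 ^ j * Real.exp (j * L) := hnj'
        _ = 8 ^ j * Real.exp (j * L / 5) * (Real.exp (4 * (j * L) / 5) / 4 ^ j) := by
            rw [show (8 : ℝ) = 2 * 4 by norm_num, mul_pow]
            have : Real.exp (j * L) = Real.exp (j * L / 5) * Real.exp (4 * (j * L) / 5) := by
              rw [← Real.exp_add]; congr 1; ring
            rw [this]
            field_simp
        _ ≤ _ := by
            have : Real.exp (j * L / 5) ≤ Real.exp (T - T / 5) := Real.exp_le_exp.2 (by linarith)
            gcongr
    have e3 : 2 * π * j * (1 + Real.log H) ≤ 9 / 2 * Real.exp (T / 20) := by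
      have : 2 * π * j * (1 + Real.log H) ≤ 2 * 3.15 * (T / 120) * (1 + (400 * T ^ 2 + 2 * T)) := by
        have : 0 ≤ Real.log H := Real.log_natCast_nonneg H
        gcongr
      refine this.trans (le_trans ?_ (mul_le_mul_of_nonneg_left hbig (by norm_num)))
      have c1 : 1 + (400 * T ^ 2 + 2 * T) ≤ 500 * T ^ 2 := by nlinarith
      have c2 : 0 ≤ T ^ 3 := by positivity
      calc 2 * 3.15 * (T / 120) * (1 + (400 * T ^ 2 + 2 * T)) ≤ 2 * 3.15 * (T / 120) * (500 * T ^ 2) := by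
            gcongr
        _ = 26.25 * T ^ 3 := by ring
        _ ≤ _ := by linarith
    have hl0 : 0 ≤ Real.log H := Real.log_natCast_nonneg H
    calc 2 * π / |b| * (1 + Real.log H)
        = (2 * π * j * (1 + Real.log H)) * ((n : ℝ) ^ j * Real.exp (-T)) := by
          rw [hb, Real.exp_neg]; field_simp
      _ ≤ (9 / 2 * Real.exp (T / 20)) *
          ((Real.exp (T / 40) * Real.exp (T - T / 5) * (H : ℝ) ^ 2) * Real.exp (-T)) := by
          gcongr
          exact e2.trans (by gcongr)
      _ = 9 / 2 * (H : ℝ) ^ 2 * Real.exp (T / 20 + (T / 40 + (T - T / 5) + -T)) := by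
          rw [Real.exp_add, Real.exp_add, Real.exp_add]; ring
      _ ≤ _ := by
          gcongr
          linarith
  calc geoFactor (s * q ^ j) b = geoFactor H b := by rw [hH]; push_cast; rfl
    _ ≤ _ := hmain.trans (add_le_add hA hB)
    _ = _ := by rw [hHr]; ring

theorem mvConst_bound {k : ℕ} (hk : 3 ≤ k) :
    (mvConst k (8 * k) ^ (8 * k)) ^ 2 * (3 * (8 * k ^ 2) : ℝ) ^ (2 * k) ≤
      ((k : ℝ) ^ 5) ^ (256 * k ^ 4) := by
  have hk3 : (3 : ℝ) ≤ k := by exact_mod_cast hk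
  have hk1 : (1 : ℝ) ≤ k := by linarith
  have h3 : (27 : ℝ) ≤ (k : ℝ) ^ 3 := by
    calc (27 : ℝ) = 3 ^ 3 := by norm_num
      _ ≤ _ := by gcongr
  have h16 : (16 * k ^ 2 : ℝ) ≤ (k : ℝ) ^ 5 := by
    rw [show (k : ℝ) ^ 5 = k ^ 3 * k ^ 2 by ring]; gcongr; linarith
  have h24 : (3 * (8 * k ^ 2) : ℝ) ≤ (k : ℝ) ^ 5 := by
    rw [show (k : ℝ) ^ 5 = k ^ 3 * k ^ 2 by ring, ← mul_assoc]; gcongr; linarith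
  have hmv : mvConst k (8 * k) ≤ (k : ℝ) ^ (72 * k ^ 3) := by
    rw [mvConst]
    have a1 : (16 * k ^ 2 : ℝ) ^ (2 * k ^ 2 * (k + 1)) ≤ (k : ℝ) ^ (20 * k ^ 3) := by
      calc _ ≤ ((k : ℝ) ^ 5) ^ (2 * k ^ 2 * (k + 1)) := by gcongr
        _ = (k : ℝ) ^ (5 * (2 * k ^ 2 * (k + 1))) := by rw [← pow_mul]
        _ ≤ _ := pow_le_pow_right₀ hk1 (by nlinarith [sq_nonneg k])
    have a2 : (2 : ℝ) ^ (6 * (8 * k) * k + 2 * k ^ 2 + 3) ≤ (k : ℝ) ^ (51 * k ^ 3) := by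
      calc _ ≤ (k : ℝ) ^ (6 * (8 * k) * k + 2 * k ^ 2 + 3) := by gcongr; linarith
        _ ≤ _ := pow_le_pow_right₀ hk1 (by nlinarith [sq_nonneg k])
    have a3 : (k.factorial : ℝ) ≤ (k : ℝ) ^ (k ^ 3) := by
      calc (k.factorial : ℝ) ≤ (k : ℝ) ^ k := by exact_mod_cast Nat.factorial_le_pow k
        _ ≤ _ := pow_le_pow_right₀ hk1 (by nlinarith [sq_nonneg k])
    calc _ ≤ (k : ℝ) ^ (20 * k ^ 3) * ((k : ℝ) ^ (51 * k ^ 3) * (k : ℝ) ^ (k ^ 3)) := by gcongr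
      _ = _ := by rw [← pow_add, ← pow_add]; congr 1; ring
  have hmv0 : 0 ≤ mvConst k (8 * k) := by rw [mvConst]; positivity
  calc _ ≤ (((k : ℝ) ^ (72 * k ^ 3)) ^ (8 * k)) ^ 2 * ((k : ℝ) ^ 5) ^ (2 * k) := by gcongr
    _ = (k : ℝ) ^ (1152 * k ^ 4 + 10 * k) := by
        rw [← pow_mul, ← pow_mul, ← pow_mul, ← pow_add]; congr 1; ring
    _ ≤ (k : ℝ) ^ (5 * (256 * k ^ 4)) := by
        apply pow_le_pow_right₀ hk1
        have : k ≤ k ^ 4 := by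
          calc k = k ^ 1 := (pow_one k).symm
            _ ≤ _ := Nat.pow_le_pow_right (by omega) (by norm_num)
        omega
    _ = _ := by rw [pow_mul]

theorem card_good_ge {T L : ℝ} {k : ℕ} (hL : 0 < L) (hT : L ≤ 2 * T) (hk : 5 * T ≤ k * L) :
    T / L ≤ (((Finset.range k).filter
      fun j : ℕ => 2 * T ≤ (j + 1 : ℕ) * L ∧ (j + 1 : ℕ) * L ≤ 4 * T).card : ℝ) := by
  set τ : ℝ := T / L with hτ
  have hT' : T = τ * L := by rw [hτ]; field_simp
  have hτ2 : 1 ≤ 2 * τ := by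
    rw [hT'] at hT
    by_contra h
    push Not at h
    nlinarith
  set a : ℕ := ⌈2 * τ⌉₊ with ha
  set g : ℕ := ⌊2 * τ⌋₊ with hg
  have ha1 : 2 * τ ≤ a := Nat.le_ceil _
  have ha2 : (a : ℝ) < 2 * τ + 1 := Nat.ceil_lt_add_one (by linarith)
  have hg1 : (g : ℝ) ≤ 2 * τ := Nat.floor_le (by linarith)
  have hg2 : 2 * τ < g + 1 := Nat.lt_floor_add_one _
  have hg3 : 1 ≤ g := Nat.le_floor (by simpa using hτ2)
  have hg3' : (1 : ℝ) ≤ g := by exact_mod_cast hg3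
  have ha0 : 1 ≤ a := by
    have : (0 : ℝ) < a := by linarith
    exact_mod_cast this
  have hsub : Finset.Ico (a - 1) (a - 1 + g) ⊆ (Finset.range k).filter
      (fun j : ℕ => 2 * T ≤ (j + 1 : ℕ) * L ∧ (j + 1 : ℕ) * L ≤ 4 * T) := by
    intro j hj
    have hj1 := (Finset.mem_Ico.1 hj).1
    have hj2 := (Finset.mem_Ico.1 hj).2
    have h1 : a ≤ j + 1 := by omega
    have h2 : j + 2 ≤ a + g := by omega
    have h1' : (a : ℝ) ≤ (j + 1 : ℕ) := by exact_mod_cast h1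
    have h2' : ((j + 1 : ℕ) : ℝ) + 1 ≤ a + g := by exact_mod_cast h2
    have h3 : ((j + 1 : ℕ) : ℝ) ≤ 4 * τ := by linarith
    simp only [Finset.mem_filter, Finset.mem_range]
    refine ⟨?_, ?_, ?_⟩
    · have : ((j + 1 : ℕ) : ℝ) ≤ k := by
        have : 5 * τ ≤ k := by
          rw [hT'] at hk
          by_contra h
          push Not at h
          nlinarith
        linarith
      have : j + 1 ≤ k := by exact_mod_cast this
      omega
    · rw [hT', ← mul_assoc]; gcongr; linarith
    · rw [hT', ← mul_assoc]; gcongr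
  have := Finset.card_le_card hsub
  rw [Nat.card_Ico, Nat.add_sub_cancel_left] at this
  have h : (g : ℝ) ≤ _ := Nat.cast_le.2 this
  linarith

set_option maxHeartbeats 1600000 in
theorem norm_weyl_le {T L : ℝ} {k q n : ℕ} (b : Fin k → ℝ) (hL : 480 ≤ L) (hT : L ≤ 2 * T)
    (hbig : 3000 * T ^ 3 ≤ Real.exp (T / 20)) (hk3 : 3 ≤ k)
    (hk : 5 * T ≤ k * L) (hk' : k * L ≤ 7 * T)
    (hq : Real.exp (2 * L / 5) / 2 ≤ q) (hq' : (q : ℝ) ≤ Real.exp (2 * L / 5))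
    (hn : Real.exp L ≤ n) (hn' : (n : ℝ) ≤ 2 * Real.exp L)
    (hb : ∀ j : Fin k, |b j| = Real.exp T / (((j : ℕ) + 1 : ℕ) * (n : ℝ) ^ ((j : ℕ) + 1))) :
    ‖∑ x ∈ Finset.Icc 1 q, ∑ y ∈ Finset.Icc 1 q, ph b (curve k ((x * y : ℕ) : ℤ))‖ ≤
      (q : ℝ) ^ 2 * ((k : ℝ) ^ 5 * Real.exp (-(L ^ 3 / T ^ 2 / 10 ^ 7))) := by
  have hL0 : 0 < L := by linarith
  have hT0 : 0 < T := by linarith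
  have hq0 : (0 : ℝ) < q := lt_of_lt_of_le (by positivity) hq
  have hq1n : 1 ≤ q := by exact_mod_cast hq0
  have hq1 : (1 : ℝ) ≤ q := by exact_mod_cast hq1n
  have hk3' : (3 : ℝ) ≤ k := by exact_mod_cast hk3
  set s : ℕ := 8 * k * k with hs
  have hs1 : 1 ≤ s := Nat.one_le_iff_ne_zero.2 (by positivity)
  have hkT : (k : ℝ) ≤ 7 * T := by nlinarith
  have hsr : (s : ℝ) ≤ 400 * T ^ 2 := by
    rw [hs]; push_cast
    nlinarith
  set W := ∑ x ∈ Finset.Icc 1 q, ∑ y ∈ Finset.Icc 1 q, ph b (curve k ((x * y : ℕ) : ℤ)) with hW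
  have hDH := double_holder (s := s) (q := q) b
  rw [← hW] at hDH
  have hJ := meanValue_le (by omega : 2 ≤ k) (8 * k) (8 * k) le_rfl q hq1n
  rw [← hs] at hJ
  set K := mvConst k (8 * k) ^ (8 * k) with hK
  have hK0 : 0 ≤ K := by rw [hK, mvConst]; positivity
  set good : ℕ → Prop := fun j => 2 * T ≤ (j + 1 : ℕ) * L ∧ (j + 1 : ℕ) * L ≤ 4 * T with hgood
  -- the product of the geometric factors
  have hgeo : ∀ j : Fin k, geoFactor (s * q ^ ((j : ℕ) + 1)) (b j) ≤
      (fun i : ℕ => (3 * (s * (q : ℝ) ^ (i + 1))) ^ 2 * if good i then Real.exp (-(T / 10)) else 1) j := by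
    intro j
    by_cases hj : good j
    · simp only [hj, if_true]
      exact geoFactor_le_of_good hL (by linarith) hbig hs1 hsr hq hq' hn hn' hj.1 hj.2 (hb j)
    · simp only [hj, if_false, mul_one]
      have := geoFactor_le_sq (s * q ^ ((j : ℕ) + 1)) (Nat.one_le_iff_ne_zero.2 (by positivity)) (b j)
      push_cast at this
      exact this
  have hprod : ∏ j : Fin k, geoFactor (s * q ^ ((j : ℕ) + 1)) (b j) ≤
      (3 * s : ℝ) ^ (2 * k) * (q : ℝ) ^ (k * (k + 1)) * Real.exp (-(T ^ 2 / L / 10)) := by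
    calc _ ≤ ∏ j : Fin k, (fun i : ℕ => (3 * (s * (q : ℝ) ^ (i + 1))) ^ 2 *
              if good i then Real.exp (-(T / 10)) else 1) j :=
          Finset.prod_le_prod (fun j _ => by rw [geoFactor]; positivity) fun j _ => hgeo j
      _ = ∏ i ∈ Finset.range k, (3 * (s * (q : ℝ) ^ (i + 1))) ^ 2 *
              if good i then Real.exp (-(T / 10)) else 1 :=
          Fin.prod_univ_eq_prod_range (fun i : ℕ => (3 * (s * (q : ℝ) ^ (i + 1))) ^ 2 *
              if good i then Real.exp (-(T / 10)) else 1) k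
      _ = (3 * s : ℝ) ^ (2 * k) * (q : ℝ) ^ (k * (k + 1)) *
            Real.exp (-(T / 10)) ^ ((Finset.range k).filter good).card := by
          rw [Finset.prod_mul_distrib, Finset.prod_ite, Finset.prod_const, Finset.prod_const_one,
            mul_one]
          congr 1
          have : ∀ i : ℕ, (3 * (s * (q : ℝ) ^ (i + 1))) ^ 2 = (3 * s : ℝ) ^ 2 * (q : ℝ) ^ (2 * (i + 1)) := by
            intro i; rw [pow_mul']; ring
          simp only [this]
          rw [Finset.prod_mul_distrib, Finset.prod_const, Finset.card_range, ← pow_mul,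
            Finset.prod_pow_eq_pow_sum, ← Finset.mul_sum]
          congr 2
          rw [Finset.sum_add_distrib]
          simp only [Finset.sum_const, Finset.card_range, smul_eq_mul, mul_one]
          have := Finset.sum_range_id_mul_two k
          obtain ⟨r, rfl⟩ : ∃ r, k = r + 1 := ⟨k - 1, by omega⟩
          rw [Nat.add_sub_cancel] at this
          nlinarith
      _ ≤ _ := by
          gcongr
          rw [← Real.exp_nat_mul]
          apply Real.exp_le_exp.2
          have h := card_good_ge hL0 hT hk
          have h2 : T / L * T ≤ (((Finset.range k).filter good).card : ℝ) * T := by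
            gcongr
          have h3 : T ^ 2 / L = T / L * T := by ring
          rw [h3]
          linarith
  -- the exponent of `q`
  have hη : 2 * mvExp k (8 * k) + k * (k + 1) ≤ 4 * s + k * (k + 1) / 2000 := by
    have h1 : (1 - 1 / (k : ℝ)) ^ (8 * k) ≤ 1 / 2000 := by
      have h2 : (1 - 1 / (k : ℝ)) ^ k ≤ Real.exp (-1) :=
        Real.one_sub_div_pow_le_exp_neg (by linarith : (1 : ℝ) ≤ k)
      have h0 : 0 ≤ 1 - 1 / (k : ℝ) := by
        rw [sub_nonneg, div_le_one (by linarith)]; linarith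
      calc (1 - 1 / (k : ℝ)) ^ (8 * k) = ((1 - 1 / (k : ℝ)) ^ k) ^ 8 := by rw [← pow_mul]; ring_nf
        _ ≤ (Real.exp (-1)) ^ 8 := by gcongr
        _ = (Real.exp 1 ^ 8)⁻¹ := by rw [Real.exp_neg, inv_pow]
        _ ≤ (2.7 ^ 8 : ℝ)⁻¹ := by
            have := Real.exp_one_gt_d9
            gcongr
            linarith
        _ ≤ _ := by norm_num
    have h3 : (k : ℝ) * (k + 1) * (1 - 1 / (k : ℝ)) ^ (8 * k) ≤ k * (k + 1) * (1 / 2000) := by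
      gcongr
    rw [mvExp, hs]
    push_cast
    linarith
  have hqpow : ((q : ℝ) ^ mvExp k (8 * k)) ^ 2 * (q : ℝ) ^ (k * (k + 1)) ≤
      (q : ℝ) ^ (2 * (2 * s)) * Real.exp (T ^ 2 / L * (63 / 5000)) := by
    calc ((q : ℝ) ^ mvExp k (8 * k)) ^ 2 * (q : ℝ) ^ (k * (k + 1))
        = (q : ℝ) ^ (2 * mvExp k (8 * k) + k * (k + 1)) := by
          rw [← Real.rpow_natCast, ← Real.rpow_natCast, ← Real.rpow_mul hq0.le, ← Real.rpow_add hq0]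
          congr 1; push_cast; ring
      _ ≤ (q : ℝ) ^ (4 * s + k * (k + 1) / 2000 : ℝ) := Real.rpow_le_rpow_of_exponent_le hq1 hη
      _ = (q : ℝ) ^ (2 * (2 * s)) * (q : ℝ) ^ (k * (k + 1) / 2000 : ℝ) := by
          rw [Real.rpow_add hq0, ← Real.rpow_natCast]
          congr 2; push_cast; ring
      _ ≤ (q : ℝ) ^ (2 * (2 * s)) * Real.exp (2 * L / 5) ^ (k * (k + 1) / 2000 : ℝ) := by gcongr
      _ ≤ _ := by
          rw [← Real.exp_mul]
          refine mul_le_mul_of_nonneg_left (Real.exp_le_exp.2 ?_) (by positivity)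
          have h1 : (k + 1 : ℝ) * L ≤ 9 * T := by linarith
          have h2 : (k * L) * ((k + 1 : ℝ) * L) ≤ 7 * T * (9 * T) := by gcongr
          have h3 : T ^ 2 / L * (63 / 5000) = 7 * T * (9 * T) / (5000 * L) := by
            field_simp; ring
          rw [h3, le_div_iff₀ (by positivity)]
          calc _ = (k * L) * ((k + 1 : ℝ) * L) := by ring
            _ ≤ _ := h2
  have hm : 2 * s * (2 * s) = 256 * k ^ 4 := by rw [hs]; ring
  -- assemble
  have hfin : ‖W‖ ^ (256 * k ^ 4) ≤ ((q : ℝ) ^ 2 * ((k : ℝ) ^ 5 *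
      Real.exp (-(L ^ 3 / T ^ 2 / 10 ^ 7)))) ^ (256 * k ^ 4) := by
    rw [hm] at hDH
    have hqq : 0 < (q : ℝ) ^ (2 * (2 * s)) := by positivity
    refine le_of_mul_le_mul_left ?_ hqq
    calc (q : ℝ) ^ (2 * (2 * s)) * ‖W‖ ^ (256 * k ^ 4) ≤ _ := hDH
      _ ≤ (q : ℝ) ^ (2 * (256 * k ^ 4)) * ((K * (q : ℝ) ^ mvExp k (8 * k)) ^ 2 *
          ((3 * s : ℝ) ^ (2 * k) * (q : ℝ) ^ (k * (k + 1)) * Real.exp (-(T ^ 2 / L / 10)))) := by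
          gcongr
          exact Finset.prod_nonneg fun j _ => by rw [geoFactor]; positivity
      _ = (q : ℝ) ^ (2 * (256 * k ^ 4)) * ((K ^ 2 * (3 * s : ℝ) ^ (2 * k)) *
          (((q : ℝ) ^ mvExp k (8 * k)) ^ 2 * (q : ℝ) ^ (k * (k + 1)))
            * Real.exp (-(T ^ 2 / L / 10))) := by ring
      _ ≤ (q : ℝ) ^ (2 * (256 * k ^ 4)) * ((((k : ℝ) ^ 5) ^ (256 * k ^ 4)) *
          ((q : ℝ) ^ (2 * (2 * s)) * Real.exp (T ^ 2 / L * (63 / 5000)))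
            * Real.exp (-(T ^ 2 / L / 10))) := by
          have hc := mvConst_bound hk3
          rw [← hK, show (3 * (8 * k ^ 2) : ℝ) = 3 * s by rw [hs]; push_cast; ring] at hc
          gcongr
      _ = (q : ℝ) ^ (2 * (2 * s)) * ((q : ℝ) ^ (2 * (256 * k ^ 4)) * (((k : ℝ) ^ 5) ^ (256 * k ^ 4) *
            Real.exp (T ^ 2 / L * (63 / 5000) + -(T ^ 2 / L / 10)))) := by
          rw [Real.exp_add]; ring
      _ ≤ (q : ℝ) ^ (2 * (2 * s)) * ((q : ℝ) ^ (2 * (256 * k ^ 4)) * (((k : ℝ) ^ 5) ^ (256 * k ^ 4) *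
            Real.exp ((256 * k ^ 4 : ℕ) * (-(L ^ 3 / T ^ 2 / 10 ^ 7))))) := by
          gcongr
          have h1 : (k : ℝ) ^ 4 * (L ^ 3 / T ^ 2) ≤ 2401 * (T ^ 2 / L) := by
            have h2 : (k * L : ℝ) ^ 4 ≤ (7 * T) ^ 4 := by gcongr
            rw [mul_div_assoc', mul_div_assoc', div_le_div_iff₀ (by positivity) hL0]
            nlinarith
          have h3 : 0 ≤ T ^ 2 / L := by positivity
          push_cast
          nlinarith
      _ = _ := by
          rw [mul_pow ((q : ℝ) ^ 2), mul_pow ((k : ℝ) ^ 5), ← Real.exp_nat_mul, pow_mul (q : ℝ) 2 (256 * k ^ 4)]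
  exact le_of_pow_le_pow_left₀ (by positivity) (by positivity) hfin

theorem norm_natCast_cpow_le {t : ℝ} (ht : t ≠ 0) (n : ℕ) : ‖(n : ℂ) ^ (-(t * Complex.I))‖ ≤ 1 := by
  rcases Nat.eq_zero_or_pos n with rfl | hn
  · rw [Nat.cast_zero, Complex.zero_cpow]
    · simp
    · simp [ht]
  · rw [Complex.norm_natCast_cpow_of_pos hn]; simp

theorem norm_sum_cpow_le_card {t : ℝ} (ht : t ≠ 0) (N M : ℕ) (hM : M ≤ 2 * N) :
    ‖∑ n ∈ Finset.Ioc N M, (n : ℂ) ^ (-(t * Complex.I))‖ ≤ N := by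
  calc _ ≤ ∑ n ∈ Finset.Ioc N M, (1 : ℝ) :=
        norm_sum_le_of_le _ fun n _ => norm_natCast_cpow_le ht n
    _ = ((M - N : ℕ) : ℝ) := by simp
    _ ≤ _ := by exact_mod_cast (by omega : M - N ≤ N)

set_option maxHeartbeats 800000 in
theorem norm_sum_cpow_le_aux {t : ℝ} {N M : ℕ} (ht : 3 ≤ t) (hNM : N ≤ M) (hM : M ≤ 2 * N)
    (hN : 1 ≤ N) (hL : 480 ≤ Real.log N) (hNt : Real.log N ≤ 2 * Real.log t)
    (hbig : 3000 * Real.log t ^ 3 ≤ Real.exp (Real.log t / 20)) :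
    ‖∑ n ∈ Finset.Ioc N M, (n : ℂ) ^ (-(t * Complex.I))‖ ≤
      (7 ^ 5 + 4) * Real.log t ^ 5 * (N * Real.exp (-(Real.log N ^ 3 / Real.log t ^ 2 / 10 ^ 7))) := by
  have ht0 : 0 < t := by linarith
  have hN0 : (0 : ℝ) < N := by exact_mod_cast hN
  set T := Real.log t with hT
  set L := Real.log N with hLdef
  have htT : t = Real.exp T := (Real.exp_log ht0).symm
  have hNL : (N : ℝ) = Real.exp L := (Real.exp_log hN0).symm
  have hL0 : 0 < L := by linarith
  have hT1 : 240 ≤ T := by linarith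
  set q : ℕ := ⌊Real.exp (2 * L / 5)⌋₊ with hq
  set k : ℕ := ⌈5 * T / L⌉₊ with hk
  set E := Real.exp (-(L ^ 3 / T ^ 2 / 10 ^ 7)) with hE
  have hqe : 1 ≤ Real.exp (2 * L / 5) := Real.one_le_exp (by positivity)
  have hq1 : (q : ℝ) ≤ Real.exp (2 * L / 5) := Nat.floor_le (by positivity)
  have hq1n : 1 ≤ q := Nat.le_floor (by simpa using hqe)
  have hq2 : Real.exp (2 * L / 5) / 2 ≤ q := by
    have h1 : Real.exp (2 * L / 5) < q + 1 := Nat.lt_floor_add_one _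
    have h2 : (1 : ℝ) ≤ q := by exact_mod_cast hq1n
    linarith
  have hk1 : 5 * T ≤ k * L := by
    have : 5 * T / L ≤ k := Nat.le_ceil _
    rwa [div_le_iff₀ hL0] at this
  have hk2 : k * L ≤ 7 * T := by
    have : (k : ℝ) < 5 * T / L + 1 := Nat.ceil_lt_add_one (by positivity)
    have h2 : k * L ≤ (5 * T / L + 1) * L := by gcongr
    rw [add_mul, div_mul_cancel₀ _ hL0.ne'] at h2
    linarith
  have hk3 : 3 ≤ k := by
    have : (2 : ℝ) < k := by nlinarith
    exact_mod_cast this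
  have hkT : (k : ℝ) ≤ 7 * T := by nlinarith
  have hq4 : (q : ℝ) ^ 2 ≤ Real.exp (4 * L / 5) := by
    calc (q : ℝ) ^ 2 ≤ Real.exp (2 * L / 5) ^ 2 := by gcongr
      _ = _ := by rw [← Real.exp_nat_mul]; congr 1; push_cast; ring
  have hw : ∀ n ∈ Finset.Ioc N M, (q : ℝ) ^ 2 / n ≤ Real.exp (-(L / 5)) := by
    intro n hn
    have hn1 : (N : ℝ) ≤ n := by exact_mod_cast (Finset.mem_Ioc.1 hn).1.le
    calc (q : ℝ) ^ 2 / n ≤ Real.exp (4 * L / 5) / Real.exp L := by rw [← hNL]; gcongr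
      _ = _ := by rw [← Real.exp_sub]; congr 1; ring
  have hhalf : Real.exp (-(L / 5)) ≤ 1 / 2 := by
    rw [Real.exp_neg, ← one_div]
    gcongr
    linarith [Real.add_one_le_exp (L / 5)]
  have hinner : ∀ n ∈ Finset.Ioc N M, ‖∑ x ∈ Finset.Icc 1 q, ∑ y ∈ Finset.Icc 1 q,
      ((n + x * y : ℕ) : ℂ) ^ (-(t * Complex.I))‖ ≤
      (q : ℝ) ^ 2 * ((k : ℝ) ^ 5 * E) + (q : ℝ) ^ 2 * (2 * Real.exp (-(L / 5))) := by
    intro n hn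
    have hnN := Finset.mem_Ioc.1 hn
    have hn0 : 0 < n := by omega
    have hn0' : (0 : ℝ) < n := by exact_mod_cast hn0
    set b := taylorCoeff k t n with hb
    have hdecomp : ∑ x ∈ Finset.Icc 1 q, ∑ y ∈ Finset.Icc 1 q,
        ((n + x * y : ℕ) : ℂ) ^ (-(t * Complex.I)) =
        (n : ℂ) ^ (-(t * Complex.I)) * (∑ x ∈ Finset.Icc 1 q, ∑ y ∈ Finset.Icc 1 q,
          ph b (curve k ((x * y : ℕ) : ℤ))) +
        ∑ x ∈ Finset.Icc 1 q, ∑ y ∈ Finset.Icc 1 q,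
          (((n + x * y : ℕ) : ℂ) ^ (-(t * Complex.I)) -
            (n : ℂ) ^ (-(t * Complex.I)) * ph b (curve k ((x * y : ℕ) : ℤ))) := by
      simp only [Finset.sum_sub_distrib, Finset.mul_sum]
      ring
    rw [hdecomp]
    refine (norm_add_le _ _).trans (add_le_add ?_ ?_)
    · rw [norm_mul]
      have h1 := norm_natCast_cpow_le ht0.ne' n
      have h2 := norm_weyl_le (n := n) b hL hNt hbig hk3 hk1 hk2 hq2 hq1
        (by rw [← hNL]; exact_mod_cast hnN.1.le)
        (by rw [← hNL]; exact_mod_cast (by omega : n ≤ 2 * N)) (by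
          intro j
          rw [hb, taylorCoeff, abs_div, abs_mul, abs_pow, abs_neg, abs_one, one_pow, mul_one,
            abs_of_pos ht0, htT, abs_of_pos (by positivity)]
          push_cast
          rfl)
      calc _ ≤ 1 * _ := mul_le_mul_of_nonneg_right h1 (norm_nonneg _)
        _ ≤ _ := by rw [one_mul]; exact h2
    · calc _ ≤ ∑ x ∈ Finset.Icc 1 q, ∑ y ∈ Finset.Icc 1 q, 2 * Real.exp (-(L / 5)) := by
            refine norm_sum_le_of_le _ fun x hx => norm_sum_le_of_le _ fun y hy => ?_
            have hx := (Finset.mem_Icc.1 hx).2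
            have hy := (Finset.mem_Icc.1 hy).2
            have hxy : ((x * y : ℕ) : ℝ) ≤ (q : ℝ) ^ 2 := by
              rw [pow_two]; push_cast; gcongr
            have hdiv : ((x * y : ℕ) : ℝ) / n ≤ Real.exp (-(L / 5)) := by
              refine le_trans ?_ (hw n hn)
              gcongr
            have h2 : 2 * (x * y) ≤ n := by
              have := hdiv.trans hhalf
              rw [div_le_iff₀ hn0'] at this
              have : 2 * ((x * y : ℕ) : ℝ) ≤ n := by linarith
              exact_mod_cast this
            refine (norm_cpow_sub_le k ht0.le n (x * y) hn0 h2).trans ?_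
            calc 2 * t * (((x * y : ℕ) : ℝ) / n) ^ (k + 1)
                ≤ 2 * Real.exp T * Real.exp (-(L / 5)) ^ (k + 1) := by rw [← htT]; gcongr
              _ = 2 * Real.exp (T + (k + 1) * (-(L / 5))) := by
                  rw [← Real.exp_nat_mul, Real.exp_add]; push_cast; ring
              _ ≤ _ := by
                  gcongr
                  linarith
        _ = _ := by simp; ring
  have hmain := norm_sum_le_shift (fun n => (n : ℂ) ^ (-(t * Complex.I)))
    (norm_natCast_cpow_le ht0.ne') N M q hNM
  have hqpos : (0 : ℝ) < (q : ℝ) ^ 2 := by positivity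
  have hcard : ((M - N : ℕ) : ℝ) ≤ N := by exact_mod_cast (by omega : M - N ≤ N)
  have hEL : Real.exp (-(L / 5)) ≤ E := by
    rw [hE]
    apply Real.exp_le_exp.2
    have : L ^ 3 / T ^ 2 ≤ 4 * L := by
      rw [div_le_iff₀ (by positivity)]
      have : L ^ 2 ≤ (2 * T) ^ 2 := by gcongr
      nlinarith
    linarith
  have hk5 : (k : ℝ) ^ 5 ≤ 7 ^ 5 * T ^ 5 := by
    calc (k : ℝ) ^ 5 ≤ (7 * T) ^ 5 := by gcongr
      _ = _ := by ring
  have hT5 : 1 ≤ T ^ 5 := one_le_pow₀ (by linarith)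
  have hE0 : 0 < E := Real.exp_pos _
  refine le_of_mul_le_mul_left ?_ hqpos
  calc _ ≤ _ := hmain
    _ ≤ ∑ n ∈ Finset.Ioc N M, ((q : ℝ) ^ 2 * ((k : ℝ) ^ 5 * E) +
          (q : ℝ) ^ 2 * (2 * Real.exp (-(L / 5)))) + 2 * (q : ℝ) ^ 4 :=
        add_le_add (Finset.sum_le_sum hinner) le_rfl
    _ = ((M - N : ℕ) : ℝ) * ((q : ℝ) ^ 2 * ((k : ℝ) ^ 5 * E + 2 * Real.exp (-(L / 5)))) +
          (q : ℝ) ^ 2 * (2 * (q : ℝ) ^ 2) := by simp; ring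
    _ ≤ N * ((q : ℝ) ^ 2 * ((k : ℝ) ^ 5 * E + 2 * Real.exp (-(L / 5)))) +
          (q : ℝ) ^ 2 * (2 * (N * Real.exp (-(L / 5)))) := by
        have : (q : ℝ) ^ 2 ≤ N * Real.exp (-(L / 5)) := by
          rw [hNL, ← Real.exp_add]
          convert hq4 using 2; ring
        gcongr
    _ = (q : ℝ) ^ 2 * (N * ((k : ℝ) ^ 5 * E + 4 * Real.exp (-(L / 5)))) := by ring
    _ ≤ (q : ℝ) ^ 2 * (N * (7 ^ 5 * T ^ 5 * E + 4 * (T ^ 5 * E))) := by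
        have : Real.exp (-(L / 5)) ≤ T ^ 5 * E := hEL.trans (by nlinarith)
        gcongr
    _ = _ := by ring

theorem norm_sum_cpow_le : ∃ C : ℝ, 0 < C ∧ ∀ t : ℝ, 3 ≤ t → ∀ N M : ℕ, 1 ≤ N → N ≤ M →
    M ≤ 2 * N → (N : ℝ) ≤ t ^ 2 →
    ‖∑ n ∈ Finset.Ioc N M, (n : ℂ) ^ (-(t * Complex.I))‖ ≤
      C * Real.log t ^ 5 * (N * Real.exp (-(Real.log N ^ 3 / Real.log t ^ 2 / 10 ^ 7))) := by
  have hev : ∀ᶠ T : ℝ in Filter.atTop, 3000 * T ^ 3 ≤ Real.exp (T / 20) := by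
    have h1 := (Real.tendsto_exp_div_pow_atTop 3).comp
      (Filter.tendsto_id.atTop_div_const (by norm_num : (0 : ℝ) < 20))
    filter_upwards [h1.eventually_ge_atTop (3000 * 20 ^ 3), Filter.eventually_gt_atTop 0] with T hT h0
    simp only [Function.comp, id] at hT
    rw [le_div_iff₀ (by positivity)] at hT
    calc _ = 3000 * 20 ^ 3 * (T / 20) ^ 3 := by ring
      _ ≤ _ := hT
  obtain ⟨T₀, hT₀⟩ := Filter.eventually_atTop.1 hev
  refine ⟨7 ^ 5 + 4 + Real.exp 12 + Real.exp (|T₀|), by positivity, fun t ht N M hN hNM hM hNt => ?_⟩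
  have ht0 : 0 < t := by linarith
  have hN0 : (0 : ℝ) < N := by exact_mod_cast hN
  have hN1 : (1 : ℝ) ≤ N := by exact_mod_cast hN
  have hT1 : 1 ≤ Real.log t := by
    rw [Real.le_log_iff_exp_le ht0]
    linarith [Real.exp_one_lt_d9]
  have hLT : Real.log N ≤ 2 * Real.log t := by
    rw [← Nat.cast_two, ← Real.log_pow]; exact Real.log_le_log hN0 hNt
  have hL0 : 0 ≤ Real.log N := Real.log_nonneg hN1
  have hT5 : 1 ≤ Real.log t ^ 5 := one_le_pow₀ hT1
  have hX : Real.log N ^ 3 / Real.log t ^ 2 ≤ 4 * Real.log N := by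
    rw [div_le_iff₀ (by positivity)]
    have : Real.log N ^ 2 ≤ (2 * Real.log t) ^ 2 := by gcongr
    nlinarith
  have htriv := norm_sum_cpow_le_card ht0.ne' N M hM
  have e12 := Real.exp_pos 12
  have e0 := Real.exp_pos |T₀|
  have key : ∀ A : ℝ, Real.log N ^ 3 / Real.log t ^ 2 / 10 ^ 7 ≤ A →
      Real.exp A ≤ 7 ^ 5 + 4 + Real.exp 12 + Real.exp (|T₀|) →
      ‖∑ n ∈ Finset.Ioc N M, (n : ℂ) ^ (-(t * Complex.I))‖ ≤
      (7 ^ 5 + 4 + Real.exp 12 + Real.exp (|T₀|)) * Real.log t ^ 5 *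
        (N * Real.exp (-(Real.log N ^ 3 / Real.log t ^ 2 / 10 ^ 7))) := by
    intro A hA hA'
    refine htriv.trans ?_
    calc (N : ℝ) = Real.exp A * 1 * (N * Real.exp (-A)) := by
          have : Real.exp A * Real.exp (-A) = 1 := by rw [← Real.exp_add]; simp
          linear_combination (-(N : ℝ)) * this
      _ ≤ _ := by gcongr
  by_cases hbig : 3000 * Real.log t ^ 3 ≤ Real.exp (Real.log t / 20)
  · by_cases hL : 480 ≤ Real.log N
    · refine (norm_sum_cpow_le_aux ht hNM hM hN hL hLT hbig).trans ?_
      refine mul_le_mul_of_nonneg_right (mul_le_mul_of_nonneg_right ?_ (by linarith)) (by positivity)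
      linarith
    · push Not at hL
      exact key 12 (by linarith) (by linarith)
  · have hlt : Real.log t < T₀ := by
      by_contra h
      exact hbig (hT₀ _ (not_lt.1 h))
    refine key |T₀| ?_ (by linarith)
    have := le_abs_self T₀
    linarith

theorem norm_sum_mul_le_of_antitone (c : ℕ → ℝ) (a : ℕ → ℂ) (A : ℕ) {B : ℕ} {P : ℝ} (hAB : A ≤ B)
    (hc : ∀ n, A < n → c (n + 1) ≤ c n) (hc0 : ∀ n, A < n → 0 ≤ c n)
    (hP : ∀ m, A ≤ m → m ≤ B → ‖∑ n ∈ Finset.Ioc A m, a n‖ ≤ P) :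
    ‖∑ n ∈ Finset.Ioc A B, (c n : ℂ) * a n‖ ≤ c (A + 1) * P := by
  have hid : ∑ n ∈ Finset.Ioc A B, (c n : ℂ) * a n =
      (c (B + 1) : ℂ) * ∑ n ∈ Finset.Ioc A B, a n +
      ∑ n ∈ Finset.Ioc A B, ((c n - c (n + 1) : ℝ) : ℂ) * ∑ j ∈ Finset.Ioc A n, a j := by
    clear hP
    induction B, hAB using Nat.le_induction with
    | base => simp
    | succ B hB ih =>
      rw [Finset.sum_Ioc_succ_top (by omega), Finset.sum_Ioc_succ_top (by omega), ih,
        Finset.sum_Ioc_succ_top (by omega)]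
      rw [Finset.sum_Ioc_succ_top (by omega)]
      push_cast
      ring
  have htel : ∑ n ∈ Finset.Ioc A B, (c n - c (n + 1)) = c (A + 1) - c (B + 1) := by
    clear hP hid
    induction B, hAB using Nat.le_induction with
    | base => simp
    | succ B hB ih => rw [Finset.sum_Ioc_succ_top (by omega), ih]; ring
  rw [hid]
  calc _ ≤ c (B + 1) * P + ∑ n ∈ Finset.Ioc A B, (c n - c (n + 1)) * P := by
        refine (norm_add_le _ _).trans (add_le_add ?_ (norm_sum_le_of_le _ fun n hn => ?_))
        · rw [norm_mul, Complex.norm_real, Real.norm_of_nonneg (hc0 _ (by omega))]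
          exact mul_le_mul_of_nonneg_left (hP B hAB le_rfl) (hc0 _ (by omega))
        · have hn := Finset.mem_Ioc.1 hn
          have h0 : 0 ≤ c n - c (n + 1) := sub_nonneg.2 (hc n hn.1)
          rw [norm_mul, Complex.norm_real, Real.norm_of_nonneg h0]
          exact mul_le_mul_of_nonneg_left (hP n hn.1.le hn.2) h0
    _ = _ := by rw [← Finset.sum_mul, htel]; ring

theorem natCast_cpow_neg_eq {n : ℕ} (hn : 0 < n) (σ t : ℝ) :
    (n : ℂ) ^ (-(σ + t * Complex.I)) =
      (((n : ℝ) ^ (-σ) : ℝ) : ℂ) * (n : ℂ) ^ (-(t * Complex.I)) := by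
  rw [neg_add, Complex.cpow_add _ _ (by exact_mod_cast hn.ne'), Complex.ofReal_cpow (by positivity)]
  push_cast
  rfl

theorem norm_dirichlet_block_le : ∃ C : ℝ, 0 < C ∧ ∀ t : ℝ, 3 ≤ t → ∀ σ : ℝ, 0 ≤ σ →
    1 - Real.log t ^ (-(2 / 3) : ℝ) ≤ σ → ∀ N M : ℕ, 1 ≤ N → N ≤ M →
    M ≤ 2 * N → (N : ℝ) ≤ t ^ 2 →
    ‖∑ n ∈ Finset.Ioc N M, (n : ℂ) ^ (-(σ + t * Complex.I))‖ ≤ C * Real.log t ^ 5 := by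
  obtain ⟨C, hC, h⟩ := norm_sum_cpow_le
  refine ⟨C * Real.exp 3163, by positivity, fun t ht σ hσ0 hσ N M hN hNM hM hNt => ?_⟩
  have ht0 : 0 < t := by linarith
  have hN0 : (0 : ℝ) < N := by exact_mod_cast hN
  have hT1 : 1 ≤ Real.log t := by
    rw [Real.le_log_iff_exp_le ht0]
    linarith [Real.exp_one_lt_d9]
  set T := Real.log t with hT
  set L := Real.log N with hL
  have hL0 : 0 ≤ L := Real.log_natCast_nonneg N
  have hNL : (N : ℝ) = Real.exp L := (Real.exp_log hN0).symm
  set P := C * T ^ 5 * (N * Real.exp (-(L ^ 3 / T ^ 2 / 10 ^ 7))) with hP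
  have h1 : ‖∑ n ∈ Finset.Ioc N M, (n : ℂ) ^ (-(σ + t * Complex.I))‖ ≤
      ((N + 1 : ℕ) : ℝ) ^ (-σ) * P := by
    rw [Finset.sum_congr rfl fun n hn => natCast_cpow_neg_eq
      (by have := Finset.mem_Ioc.1 hn; omega : 0 < n) σ t]
    refine norm_sum_mul_le_of_antitone (fun n => (n : ℝ) ^ (-σ)) _ N hNM ?_ ?_ ?_
    · intro n hn
      have : (0 : ℝ) < n := by exact_mod_cast (by omega : 0 < n)
      exact Real.rpow_le_rpow_of_nonpos this (by push_cast; linarith) (by linarith)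
    · intro n _; positivity
    · intro m hm1 hm2
      exact h t ht N m hN hm1 (by omega) hNt
  have h2 : ((N + 1 : ℕ) : ℝ) ^ (-σ) ≤ Real.exp (-(L * σ)) := by
    calc ((N + 1 : ℕ) : ℝ) ^ (-σ) ≤ (N : ℝ) ^ (-σ) :=
          Real.rpow_le_rpow_of_nonpos hN0 (by push_cast; linarith) (by linarith)
      _ = _ := by rw [hNL, ← Real.exp_mul]; ring_nf
  have hP0 : 0 ≤ P := by positivity
  refine h1.trans ((mul_le_mul_of_nonneg_right h2 hP0).trans ?_)
  set u := L * T ^ (-(2 / 3) : ℝ) with hu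
  have hu0 : 0 ≤ u := by positivity
  have hu3 : L ^ 3 / T ^ 2 = u ^ 3 := by
    rw [hu, mul_pow, ← Real.rpow_natCast (T ^ _), ← Real.rpow_mul (by linarith)]
    norm_num
    rw [div_eq_mul_inv]
  have hu4 : u - u ^ 3 / 10 ^ 7 ≤ 3163 := by
    by_cases hle : u ≤ 3163
    · have : 0 ≤ u ^ 3 / 10 ^ 7 := by positivity
      linarith
    · push Not at hle
      have h1 : (10 : ℝ) ^ 7 ≤ u ^ 2 := by nlinarith
      have h2 : 10 ^ 7 * u ≤ u ^ 3 := by nlinarith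
      linarith
  have h5 : -(L * σ) + L ≤ u := by
    rw [hu]; nlinarith
  calc Real.exp (-(L * σ)) * P
      = C * T ^ 5 * Real.exp (-(L * σ) + L + -(u ^ 3 / 10 ^ 7)) := by
        rw [hP, hu3, Real.exp_add, Real.exp_add, ← hNL]; ring
    _ ≤ C * T ^ 5 * Real.exp 3163 := by
        gcongr
        linarith
    _ = _ := by ring

theorem norm_dirichlet_sum_le : ∃ C : ℝ, 0 < C ∧ ∀ t : ℝ, 3 ≤ t → ∀ σ : ℝ, 0 ≤ σ →
    1 - Real.log t ^ (-(2 / 3) : ℝ) ≤ σ → ∀ N : ℕ, 1 ≤ N → (N : ℝ) ≤ t ^ 2 →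
    ‖∑ n ∈ Finset.Ioc 0 N, (n : ℂ) ^ (-(σ + t * Complex.I))‖ ≤ C * Real.log t ^ 6 := by
  obtain ⟨C, hC, h⟩ := norm_dirichlet_block_le
  refine ⟨1 + 5 * C, by positivity, fun t ht σ hσ0 hσ N hN hNt => ?_⟩
  have ht0 : 0 < t := by linarith
  have hT1 : 1 ≤ Real.log t := by
    rw [Real.le_log_iff_exp_le ht0]
    linarith [Real.exp_one_lt_d9]
  have key : ∀ i : ℕ, ∀ N : ℕ, 1 ≤ N → N ≤ 2 ^ i → (N : ℝ) ≤ t ^ 2 →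
      ‖∑ n ∈ Finset.Ioc 0 N, (n : ℂ) ^ (-(σ + t * Complex.I))‖ ≤ 1 + i * (C * Real.log t ^ 5) := by
    intro i
    induction i with
    | zero =>
      intro N hN hN2 _
      obtain rfl : N = 1 := by simp at hN2; omega
      simp
    | succ i ih =>
      intro N hN hN2 hNt
      have hpos : 0 ≤ C * Real.log t ^ 5 := by positivity
      by_cases hle : N ≤ 2 ^ i
      · refine (ih N hN hle hNt).trans ?_
        push_cast; nlinarith
      · push Not at hle
        have h2i : ((2 ^ i : ℕ) : ℝ) ≤ t ^ 2 := le_trans (by exact_mod_cast hle.le) hNt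
        rw [← Finset.sum_Ioc_consecutive _ (Nat.zero_le (2 ^ i)) hle.le]
        refine (norm_add_le _ _).trans ?_
        have h1 := ih (2 ^ i) Nat.one_le_two_pow le_rfl h2i
        have h2 := h t ht σ hσ0 hσ (2 ^ i) N Nat.one_le_two_pow hle.le (by rw [pow_succ] at hN2; omega) h2i
        push_cast at *
        linarith
  set i := Nat.clog 2 N with hi
  have h1 := key i N hN (Nat.le_pow_clog (by norm_num) N) hNt
  have hiT : (i : ℝ) ≤ 5 * Real.log t := by
    rcases Nat.eq_or_lt_of_le hN with h1 | h1
    · rw [hi, ← h1]; simp; linarith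
    · have := Nat.pow_pred_clog_lt_self (b := 2) (by norm_num) h1
      rw [← hi] at this
      have h3 : (2 : ℝ) ^ (i - 1) ≤ t ^ 2 := le_trans (by exact_mod_cast this.le) hNt
      have h4 := Real.log_le_log (by positivity) h3
      rw [Real.log_pow, Real.log_pow] at h4
      have hi1 : 1 ≤ i := Nat.clog_pos (by norm_num) h1
      rw [Nat.cast_sub hi1] at h4
      have := Real.log_two_gt_d9
      push_cast at h4
      have hi1' : (1 : ℝ) ≤ i := by exact_mod_cast hi1
      nlinarith
  calc _ ≤ _ := h1
    _ ≤ Real.log t ^ 6 + 5 * Real.log t * (C * Real.log t ^ 5) := by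
        gcongr
        exact one_le_pow₀ hT1
    _ = _ := by ring

/-- The difference between `n ^ (-s)` and the integral of `x ^ (-s)` over `[n, n + 1]`. -/
noncomputable def zetaTerm (n : ℕ) (s : ℂ) : ℂ :=
  (n : ℂ) ^ (-s) - (((n + 1 : ℕ) : ℂ) ^ (1 - s) - (n : ℂ) ^ (1 - s)) / (1 - s)

theorem norm_zetaTerm_le {n : ℕ} (hn : 0 < n) {s : ℂ} (hs : 0 ≤ s.re) (hs1 : s ≠ 1) :
    ‖zetaTerm n s‖ ≤ ‖s‖ * (n : ℝ) ^ (-s.re - 1) := by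
  have hn0 : (0 : ℝ) < n := by exact_mod_cast hn
  have h1s : 1 - s ≠ 0 := sub_ne_zero.2 (Ne.symm hs1)
  set B := ‖s‖ * (n : ℝ) ^ (-s.re - 1) with hB
  have hB0 : 0 ≤ B := by positivity
  by_cases hs0 : s = 0
  · have : zetaTerm n s = 0 := by rw [zetaTerm, hs0]; simp
    rw [this]; simpa using hB0
  have hconv : Convex ℝ (Set.Icc (n : ℝ) (n + 1)) := convex_Icc _ _
  have h1 : ∀ x ∈ Set.Icc (n : ℝ) (n + 1), ‖(x : ℂ) ^ (-s) - (n : ℂ) ^ (-s)‖ ≤ B := by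
    intro x hx
    have hd : ∀ y ∈ Set.Icc (n : ℝ) (n + 1), HasDerivWithinAt (fun y : ℝ => (y : ℂ) ^ (-s))
        (-s * (y : ℂ) ^ (-s - 1)) (Set.Icc (n : ℝ) (n + 1)) y := by
      intro y hy
      have hy0 : y ≠ 0 := (hn0.trans_le hy.1).ne'
      exact (hasDerivAt_ofReal_cpow_const hy0 (neg_ne_zero.2 hs0)).hasDerivWithinAt
    have := hconv.norm_image_sub_le_of_norm_hasDerivWithin_le (C := B) hd (fun y hy => by
      have hy0 : 0 < y := hn0.trans_le hy.1
      rw [norm_mul, norm_neg, Complex.norm_cpow_eq_rpow_re_of_pos hy0, hB]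
      refine mul_le_mul_of_nonneg_left ?_ (norm_nonneg _)
      simp only [Complex.sub_re, Complex.neg_re, Complex.one_re]
      exact Real.rpow_le_rpow_of_nonpos hn0 hy.1 (by linarith)) (Set.left_mem_Icc.2 (by linarith)) hx
    refine this.trans ?_
    rw [Real.norm_of_nonneg (by linarith [hx.1])]
    have := hx.2
    nlinarith [hx.1]
  have hd : ∀ y ∈ Set.Icc (n : ℝ) (n + 1), HasDerivWithinAt
      (fun y : ℝ => (n : ℂ) ^ (-s) * y - (y : ℂ) ^ (1 - s) / (1 - s))
      ((n : ℂ) ^ (-s) - (y : ℂ) ^ (-s)) (Set.Icc (n : ℝ) (n + 1)) y := by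
    intro y hy
    have hy0 : y ≠ 0 := (hn0.trans_le hy.1).ne'
    have e1 := hasDerivAt_ofReal_cpow_const' (r := -s) hy0 (by
        intro h; apply hs1; linear_combination -h)
    have e2 : HasDerivAt (fun y : ℝ => (n : ℂ) ^ (-s) * (y : ℂ)) ((n : ℂ) ^ (-s) * 1) y :=
      (Complex.ofRealCLM.hasDerivAt (x := y)).const_mul _
    rw [mul_one] at e2
    refine ((e2.sub e1).hasDerivWithinAt).congr_of_mem (fun z _ => ?_) hy
    simp only [Pi.sub_apply, neg_add_eq_sub]
  have := hconv.norm_image_sub_le_of_norm_hasDerivWithin_le (C := B) hd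
    (fun y hy => by rw [norm_sub_rev]; exact h1 y hy)
    (Set.left_mem_Icc.2 (by linarith)) (Set.right_mem_Icc.2 (by linarith))
  calc ‖zetaTerm n s‖ = _ := by
        congr 1
        rw [zetaTerm]
        push_cast
        ring
    _ ≤ _ := this
    _ = B := by simp

theorem differentiableAt_zetaTerm {n : ℕ} (hn : 0 < n) {s : ℂ} (hs : s ≠ 1) :
    DifferentiableAt ℂ (zetaTerm n) s := by
  have h1s : 1 - s ≠ 0 := sub_ne_zero.2 (Ne.symm hs)
  have hn' : (n : ℂ) ≠ 0 := by exact_mod_cast hn.ne'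
  have hn1 : ((n + 1 : ℕ) : ℂ) ≠ 0 := by exact_mod_cast (Nat.succ_ne_zero n)
  unfold zetaTerm
  refine DifferentiableAt.sub ?_ (DifferentiableAt.div (DifferentiableAt.sub ?_ ?_) ?_ h1s)
  · exact (differentiableAt_id.neg).const_cpow (Or.inl hn')
  · exact ((differentiableAt_const 1).sub differentiableAt_id).const_cpow (Or.inl hn1)
  · exact ((differentiableAt_const 1).sub differentiableAt_id).const_cpow (Or.inl hn')
  · exact (differentiableAt_const 1).sub differentiableAt_id

theorem rpow_neg_le_telescope (m : ℕ) :
    ((m + 2 : ℕ) : ℝ) ^ (-(3 / 2) : ℝ) ≤ 2 * (1 / √((m + 1 : ℕ) : ℝ) - 1 / √((m + 2 : ℕ) : ℝ)) := by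
  set a := √((m + 1 : ℕ) : ℝ) with ha
  set b := √((m + 2 : ℕ) : ℝ) with hb
  have ha0 : 0 < a := Real.sqrt_pos.2 (by positivity)
  have hb0 : 0 < b := Real.sqrt_pos.2 (by positivity)
  have ha2 : a ^ 2 = m + 1 := by rw [ha, Real.sq_sqrt (by positivity)]; push_cast; ring
  have hb2 : b ^ 2 = m + 2 := by rw [hb, Real.sq_sqrt (by positivity)]; push_cast; ring
  have hab : a ≤ b := Real.sqrt_le_sqrt (by push_cast; linarith)
  have hpow : ((m + 2 : ℕ) : ℝ) ^ (-(3 / 2) : ℝ) = 1 / b ^ 3 := by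
    have : ((m + 2 : ℕ) : ℝ) = b ^ 2 := by rw [hb2]; push_cast; ring
    rw [this, ← Real.rpow_natCast b 2, ← Real.rpow_mul hb0.le]
    rw [show ((2 : ℕ) : ℝ) * -(3 / 2) = -((3 : ℕ) : ℝ) by norm_num, Real.rpow_neg hb0.le,
      Real.rpow_natCast, one_div]
  rw [hpow, div_sub_div _ _ ha0.ne' hb0.ne', mul_div_assoc', div_le_div_iff₀ (by positivity) (by positivity)]
  have h1 : (b - a) * (b + a) = 1 := by nlinarith
  have h2 : 0 ≤ b - a := by linarith
  have h3 : 1 ≤ 2 * b * (b - a) := by nlinarith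
  have h4 : a * b ≤ b ^ 2 := by nlinarith
  nlinarith [sq_nonneg b, mul_nonneg (sq_nonneg b) (sub_nonneg.2 h3)]

theorem hasSum_telescope (N : ℕ) : HasSum
    (fun n : ℕ => 2 * (1 / √((N + n + 1 : ℕ) : ℝ) - 1 / √((N + n + 2 : ℕ) : ℝ))) (2 / √((N + 1 : ℕ) : ℝ)) := by
  rw [hasSum_iff_tendsto_nat_of_nonneg]
  · have : ∀ K : ℕ, ∑ n ∈ Finset.range K, 2 * (1 / √((N + n + 1 : ℕ) : ℝ) - 1 / √((N + n + 2 : ℕ) : ℝ)) =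
        2 / √((N + 1 : ℕ) : ℝ) - 2 * (1 / √((K + (N + 1) : ℕ) : ℝ)) := by
      intro K
      induction K with
      | zero => simp; ring
      | succ K ih =>
        rw [Finset.sum_range_succ, ih, show K + 1 + (N + 1) = N + K + 2 by ring,
          show K + (N + 1) = N + K + 1 by ring]
        ring
    simp only [this]
    have h0 : Filter.Tendsto (fun K : ℕ => 2 * (1 / √((K + (N + 1) : ℕ) : ℝ))) Filter.atTop (nhds (2 * 0)) := by
      refine Filter.Tendsto.const_mul _ ?_
      simp only [one_div]
      exact (Real.tendsto_sqrt_atTop.comp (tendsto_natCast_atTop_atTop.comp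
        (Filter.tendsto_add_atTop_nat (N + 1)))).inv_tendsto_atTop
    simpa using h0.const_sub (2 / √((N + 1 : ℕ) : ℝ))
  · intro n
    refine mul_nonneg (by norm_num) (sub_nonneg.2 ?_)
    have : (0 : ℝ) < √((N + n + 1 : ℕ) : ℝ) := Real.sqrt_pos.2 (by positivity)
    gcongr
    omega

theorem norm_zetaTerm_le_telescope (N n : ℕ) {s : ℂ} (hs : 1 / 2 ≤ s.re) (hs1 : s ≠ 1) :
    ‖zetaTerm (N + n + 2) s‖ ≤ ‖s‖ * (2 * (1 / √((N + n + 1 : ℕ) : ℝ) - 1 / √((N + n + 2 : ℕ) : ℝ))) := by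
  refine (norm_zetaTerm_le (by omega) (by linarith) hs1).trans ?_
  refine mul_le_mul_of_nonneg_left (le_trans ?_ (rpow_neg_le_telescope (N + n))) (norm_nonneg _)
  exact Real.rpow_le_rpow_of_exponent_le (by exact_mod_cast (by omega : 1 ≤ N + n + 2)) (by linarith)

theorem summable_zetaTerm (N : ℕ) {s : ℂ} (hs : 1 / 2 ≤ s.re) (hs1 : s ≠ 1) :
    Summable fun n => zetaTerm (N + n + 2) s :=
  Summable.of_norm_bounded ((hasSum_telescope N).summable.mul_left ‖s‖)
    fun n => norm_zetaTerm_le_telescope N n hs hs1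

theorem norm_tsum_zetaTerm_le (N : ℕ) {s : ℂ} (hs : 1 / 2 ≤ s.re) (hs1 : s ≠ 1) :
    ‖∑' n, zetaTerm (N + n + 2) s‖ ≤ ‖s‖ * (2 / √((N + 1 : ℕ) : ℝ)) :=
  tsum_of_norm_bounded ((hasSum_telescope N).mul_left ‖s‖)
    fun n => norm_zetaTerm_le_telescope N n hs hs1

theorem zeta_eq_of_one_lt_re (N : ℕ) {s : ℂ} (hs : 1 < s.re) :
    riemannZeta s = ∑ n ∈ Finset.Ioc 0 (N + 1), (n : ℂ) ^ (-s) + ((N + 2 : ℕ) : ℂ) ^ (1 - s) / (s - 1) +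
      ∑' n, zetaTerm (N + n + 2) s := by
  have hs1 : s ≠ 1 := by rintro rfl; simp at hs
  have h1s : 1 - s ≠ 0 := sub_ne_zero.2 (Ne.symm hs1)
  have h1s' : s - 1 ≠ 0 := sub_ne_zero.2 hs1
  have hZ : HasSum (fun n : ℕ => ((n + 1 : ℕ) : ℂ) ^ (-s)) (riemannZeta s) := by
    rw [zeta_eq_tsum_one_div_nat_add_one_cpow hs]
    have hsum : Summable (fun n : ℕ => 1 / ((n : ℂ) + 1) ^ s) := by
      have := (summable_nat_add_iff 1).2 (Complex.summable_one_div_nat_cpow.2 hs)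
      simpa using this
    convert hsum.hasSum using 2 with n
    rw [Complex.cpow_neg, one_div]; push_cast; rfl
  have hZ' := ((hasSum_nat_add_iff' (N + 1)).2 hZ).tendsto_sum_nat
  have hT := (summable_zetaTerm N (by linarith : 1 / 2 ≤ s.re) hs1).hasSum.tendsto_sum_nat
  have hid : ∀ K : ℕ, ∑ n ∈ Finset.range K, zetaTerm (N + n + 2) s =
      ∑ n ∈ Finset.range K, ((n + (N + 1) + 1 : ℕ) : ℂ) ^ (-s) -
        (((K + (N + 2) : ℕ) : ℂ) ^ (1 - s) - ((N + 2 : ℕ) : ℂ) ^ (1 - s)) / (1 - s) := by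
    intro K
    induction K with
    | zero => simp
    | succ K ih =>
      rw [Finset.sum_range_succ, ih, Finset.sum_range_succ, zetaTerm,
        show K + (N + 1) + 1 = N + K + 2 by ring, show K + 1 + (N + 2) = N + K + 2 + 1 by ring,
        show K + (N + 2) = N + K + 2 by ring]
      ring
  have h0 : Filter.Tendsto (fun K : ℕ => ((K + (N + 2) : ℕ) : ℂ) ^ (1 - s)) Filter.atTop (nhds 0) := by
    rw [tendsto_zero_iff_norm_tendsto_zero]
    have e : ∀ K : ℕ, ‖((K + (N + 2) : ℕ) : ℂ) ^ (1 - s)‖ = ((K + (N + 2) : ℕ) : ℝ) ^ (-(s.re - 1)) := by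
      intro K
      rw [Complex.norm_natCast_cpow_of_pos (by omega)]
      congr 1; simp
    simp only [e]
    exact (tendsto_rpow_neg_atTop (by linarith)).comp (tendsto_natCast_atTop_atTop.comp
        (Filter.tendsto_add_atTop_nat (N + 2)))
  have hlim := hZ'.sub ((h0.sub_const (((N + 2 : ℕ) : ℂ) ^ (1 - s))).div_const (1 - s))
  have huniq := tendsto_nhds_unique hT (hlim.congr fun K => (hid K).symm)
  rw [huniq]
  have e2 : ∑ n ∈ Finset.Ioc 0 (N + 1), (n : ℂ) ^ (-s) =
      ∑ i ∈ Finset.range (N + 1), ((i + 1 : ℕ) : ℂ) ^ (-s) := by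
    rw [Finset.range_eq_Ico, Finset.sum_Ico_add' (fun i : ℕ => (i : ℂ) ^ (-s)) 0 (N + 1) 1]
    congr 1
  rw [e2]
  have : ∀ z : ℂ, z / (s - 1) = -(z / (1 - s)) := by
    intro z; rw [← div_neg, neg_sub]
  rw [this]
  ring

theorem zeta_eq (N : ℕ) {s : ℂ} (hs : 1 / 2 < s.re) (him : 0 < s.im) :
    riemannZeta s = ∑ n ∈ Finset.Ioc 0 (N + 1), (n : ℂ) ^ (-s) + ((N + 2 : ℕ) : ℂ) ^ (1 - s) / (s - 1) +
      ∑' n, zetaTerm (N + n + 2) s := by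
  set R : ℝ := ‖s‖ + 3 with hR
  have hsR : ‖s‖ < R := by linarith
  have hR0 := norm_nonneg s
  set U : Set ℂ := {z | 1 / 2 < z.re} ∩ {z | 0 < z.im} ∩ Metric.ball 0 R with hU
  have hne : ∀ z ∈ U, z ≠ 1 := by
    rintro z hz rfl
    have : 0 < (1 : ℂ).im := hz.1.2
    simp at this
  have hUo : IsOpen U := ((isOpen_lt continuous_const Complex.continuous_re).inter
    (isOpen_lt continuous_const Complex.continuous_im)).inter Metric.isOpen_ball
  have hUc : Convex ℝ U := ((convex_halfSpace_re_gt _).inter (convex_halfSpace_im_gt _)).inter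
    (convex_ball _ _)
  have hsU : s ∈ U := ⟨⟨hs, him⟩, by simpa using hsR⟩
  have hw : (2 + Complex.I : ℂ) ∈ U := by
    refine ⟨⟨by simp; norm_num, by simp⟩, ?_⟩
    rw [mem_ball_zero_iff]
    have h1 : ‖(2 + Complex.I : ℂ)‖ ≤ 2 + 1 := (norm_add_le _ _).trans (by simp)
    have h2 : 0 < ‖s‖ := norm_pos_iff.2 (by rintro rfl; simp at him)
    linarith
  have hf : DifferentiableOn ℂ riemannZeta U := fun z hz =>
    (differentiableAt_riemannZeta (hne z hz)).differentiableWithinAt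
  have hg : DifferentiableOn ℂ (fun s => ∑ n ∈ Finset.Ioc 0 (N + 1), (n : ℂ) ^ (-s) +
      ((N + 2 : ℕ) : ℂ) ^ (1 - s) / (s - 1) + ∑' n, zetaTerm (N + n + 2) s) U := by
    refine DifferentiableOn.add (DifferentiableOn.add ?_ ?_) ?_
    · refine DifferentiableOn.fun_sum fun n hn => ?_
      have : (n : ℂ) ≠ 0 := by
        have := Finset.mem_Ioc.1 hn
        exact_mod_cast (by omega : n ≠ 0)
      exact fun z _ => ((differentiableAt_id.neg).const_cpow (Or.inl this)).differentiableWithinAt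
    · intro z hz
      have h1s' : z - 1 ≠ 0 := sub_ne_zero.2 (hne z hz)
      refine (DifferentiableAt.div (c := fun s : ℂ => ((N + 2 : ℕ) : ℂ) ^ (1 - s))
        (d := fun s : ℂ => s - 1) ?_ (differentiableAt_id.sub (differentiableAt_const 1))
        h1s').differentiableWithinAt
      exact ((differentiableAt_const 1).sub differentiableAt_id).const_cpow
        (Or.inl (Nat.cast_ne_zero.2 (Nat.succ_ne_zero (N + 1))))
    · refine Complex.differentiableOn_tsum_of_summable_norm
        ((hasSum_telescope N).summable.mul_left R) (fun n z hz =>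
          (differentiableAt_zetaTerm (by omega) (hne z hz)).differentiableWithinAt) hUo ?_
      intro n z hz
      refine (norm_zetaTerm_le_telescope N n (le_of_lt hz.1.1) (hne z hz)).trans ?_
      have h1 : ‖z‖ ≤ R := by simpa using (le_of_lt (mem_ball_zero_iff.1 hz.2))
      refine mul_le_mul_of_nonneg_right h1 ?_
      exact le_trans (by positivity) (rpow_neg_le_telescope (N + n))
  have heq := (hf.analyticOnNhd hUo).eqOn_of_preconnected_of_eventuallyEq (hg.analyticOnNhd hUo)
    hUc.isPreconnected hw (by
      have : {z : ℂ | 1 < z.re} ∈ nhds (2 + Complex.I) :=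
        (isOpen_lt continuous_const Complex.continuous_re).mem_nhds (by simp)
      filter_upwards [this] with z hz
      exact zeta_eq_of_one_lt_re N hz)
  exact heq hsU

theorem zeta_growth : ∃ C : ℝ, 0 < C ∧ ∀ t : ℝ, 3 ≤ t → ∀ σ : ℝ, 1 / 2 < σ → σ ≤ 3 →
    1 - Real.log t ^ (-(2 / 3) : ℝ) ≤ σ →
    ‖riemannZeta (σ + t * Complex.I)‖ ≤ C * Real.log t ^ 6 := by
  obtain ⟨C, hC, h⟩ := norm_dirichlet_sum_le
  refine ⟨C + 14, by positivity, fun t ht σ hσ0 hσ3 hσ => ?_⟩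
  have ht0 : 0 < t := by linarith
  have hT1 : 1 ≤ Real.log t := by
    rw [Real.le_log_iff_exp_le ht0]
    linarith [Real.exp_one_lt_d9]
  have hT6 : 1 ≤ Real.log t ^ 6 := one_le_pow₀ hT1
  set s : ℂ := σ + t * Complex.I with hs
  have hre : s.re = σ := by simp [hs]
  have him : s.im = t := by simp [hs]
  have hs1 : s ≠ 1 := by
    intro h; rw [h] at him; simp at him; linarith
  obtain ⟨N, hN⟩ : ∃ N, ⌊t ^ 2⌋₊ = N + 1 :=
    ⟨⌊t ^ 2⌋₊ - 1, by have : 1 ≤ ⌊t ^ 2⌋₊ := Nat.le_floor (by push_cast; nlinarith)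
                      omega⟩
  have hN1 : ((N + 1 : ℕ) : ℝ) ≤ t ^ 2 := by rw [← hN]; exact Nat.floor_le (by positivity)
  have hN2 : t ^ 2 < ((N + 1 : ℕ) : ℝ) + 1 := by rw [← hN]; exact Nat.lt_floor_add_one _
  rw [zeta_eq N (by rw [hre]; exact hσ0) (by rw [him]; exact ht0)]
  have e1 := h t ht σ (by linarith) hσ (N + 1) (by omega) hN1
  have hsn : ‖s‖ ≤ 2 * t := by
    calc ‖s‖ ≤ |s.re| + |s.im| := Complex.norm_le_abs_re_add_abs_im s
      _ ≤ _ := by rw [hre, him, abs_of_pos (by linarith), abs_of_pos ht0]; linarith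
  have hsq : t / 2 ≤ √((N + 1 : ℕ) : ℝ) := by
    apply Real.le_sqrt_of_sq_le
    nlinarith
  have e3 : ‖∑' n, zetaTerm (N + n + 2) s‖ ≤ 8 := by
    refine (norm_tsum_zetaTerm_le N (by rw [hre]; linarith) hs1).trans ?_
    calc ‖s‖ * (2 / √((N + 1 : ℕ) : ℝ)) ≤ (2 * t) * (2 / (t / 2)) := by gcongr
      _ = 8 := by field_simp; norm_num
  have e2 : ‖((N + 2 : ℕ) : ℂ) ^ (1 - s) / (s - 1)‖ ≤ 2 := by
    rw [norm_div, Complex.norm_natCast_cpow_of_pos (by omega)]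
    have h1 : t ≤ ‖s - 1‖ := by
      have := Complex.abs_im_le_norm (s - 1)
      simp only [Complex.sub_im, him, Complex.one_im, sub_zero] at this
      exact (le_abs_self t).trans this
    have h2 : ((N + 2 : ℕ) : ℝ) ^ (1 - s).re ≤ 2 * t := by
      calc ((N + 2 : ℕ) : ℝ) ^ (1 - s).re ≤ ((N + 2 : ℕ) : ℝ) ^ (1 / 2 : ℝ) := by
            refine Real.rpow_le_rpow_of_exponent_le (by exact_mod_cast (by omega : 1 ≤ N + 2)) ?_
            simp [hre]; linarith
        _ ≤ ((2 * t) ^ 2) ^ (1 / 2 : ℝ) := by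
            refine Real.rpow_le_rpow (by positivity) ?_ (by norm_num)
            push_cast at *
            nlinarith
        _ = 2 * t := by
            rw [← Real.sqrt_eq_rpow, Real.sqrt_sq (by linarith)]
    rw [div_le_iff₀ (by linarith)]
    linarith
  calc _ ≤ C * Real.log t ^ 6 + 2 + 8 :=
        (norm_add_le _ _).trans (add_le_add ((norm_add_le _ _).trans (add_le_add e1 e2)) e3)
    _ ≤ _ := by nlinarith

open Metric in
/-- Borel–Carathéodory for logarithmic derivatives of nonvanishing functions on a disc. -/
theorem norm_logDeriv_le_of_ne_zero {f : ℂ → ℂ} {r M : ℝ} (hr : 0 < r) (hM : 0 < M)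
    (hf : DifferentiableOn ℂ f (ball 0 r)) (hne : ∀ z ∈ ball (0 : ℂ) r, f z ≠ 0)
    (hb : ∀ z ∈ ball (0 : ℂ) r, ‖f z‖ ≤ ‖f 0‖ * Real.exp M) {z : ℂ} (hz : ‖z‖ ≤ r / 2) :
    ‖deriv f z / f z‖ ≤ 24 * M / r := by
  have h0 : (0 : ℂ) ∈ ball (0 : ℂ) r := mem_ball_self hr
  have hfd : ∀ z ∈ ball (0 : ℂ) r, HasDerivAt f (deriv f z) z := fun z hz =>
    (hf.differentiableAt (isOpen_ball.mem_nhds hz)).hasDerivAt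
  have hφ : DifferentiableOn ℂ (fun z => deriv f z / f z) (ball 0 r) :=
    (hf.deriv isOpen_ball).div hf hne
  obtain ⟨G, hG⟩ := hφ.isExactOn_ball
  set g : ℂ → ℂ := fun z => G z - G 0 with hg
  have hgd : ∀ z ∈ ball (0 : ℂ) r, HasDerivAt g (deriv f z / f z) z := fun z hz =>
    (hG z hz).sub_const _
  have hg0 : g 0 = 0 := sub_self _
  have hk : ∀ z ∈ ball (0 : ℂ) r, HasDerivAt (fun z => f z * Complex.exp (-g z)) 0 z := by
    intro z hz
    have := (hfd z hz).mul ((hgd z hz).neg.cexp)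
    refine this.congr_deriv ?_
    have := hne z hz
    field_simp
    ring
  have hconst : ∀ z ∈ ball (0 : ℂ) r, f z * Complex.exp (-g z) = f 0 := by
    intro z hz
    have := isOpen_ball.is_const_of_deriv_eq_zero (convex_ball (0 : ℂ) r).isPreconnected
      (fun z hz => (hk z hz).differentiableAt.differentiableWithinAt)
      (fun z hz => (hk z hz).deriv) hz h0
    rw [this, hg0]; simp
  have hre : Set.MapsTo g (ball 0 r) {z | z.re ≤ M} := by
    intro z hz
    have h1 : f z = f 0 * Complex.exp (g z) := by
      rw [← hconst z hz, mul_assoc, ← Complex.exp_add]; simp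
    have h2 := hb z hz
    rw [h1, norm_mul, Complex.norm_exp] at h2
    exact Real.exp_le_exp.1 (le_of_mul_le_mul_left h2 (norm_pos_iff.2 (hne 0 h0)))
  have hdiff : DifferentiableOn ℂ g (ball 0 r) := fun z hz =>
    (hgd z hz).differentiableAt.differentiableWithinAt
  have hzr : z ∈ ball (0 : ℂ) r := by rw [mem_ball_zero_iff]; linarith
  have hsub : closedBall z (r / 4) ⊆ ball 0 r := by
    intro w hw
    rw [mem_ball_zero_iff]
    have : ‖w‖ ≤ ‖w - z‖ + ‖z‖ := by simpa using norm_add_le (w - z) z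
    have h2 : ‖w - z‖ ≤ r / 4 := by simpa [dist_eq_norm] using hw
    linarith
  have hC : ∀ w ∈ sphere z (r / 4), ‖g w‖ ≤ 6 * M := by
    intro w hw
    have hwb := hsub (sphere_subset_closedBall hw)
    have hw' : ‖w‖ ≤ 3 / 4 * r := by
      have : ‖w‖ ≤ ‖w - z‖ + ‖z‖ := by simpa using norm_add_le (w - z) z
      have h2 : ‖w - z‖ = r / 4 := by simpa [dist_eq_norm] using hw
      linarith
    refine (Complex.borelCaratheodory_zero hM hdiff hre hr hwb hg0).trans ?_
    rw [div_le_iff₀ (by linarith)]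
    nlinarith
  have hdc : DiffContOnCl ℂ g (ball z (r / 4)) :=
    (hdiff.mono hsub).diffContOnCl_ball subset_rfl
  have := Complex.norm_deriv_le_of_forall_mem_sphere_norm_le (by positivity : 0 < r / 4) hdc hC
  rw [(hgd z hzr).deriv] at this
  refine this.trans (le_of_eq ?_)
  field_simp; norm_num

open Metric ComplexConjugate in
/-- Dividing out a zero by a Blaschke factor. -/
theorem exists_blaschke_div {f : ℂ → ℂ} {U : Set ℂ} {R B : ℝ} (hU : IsOpen U)
    (hRU : closedBall 0 R ⊆ U) (hf : DifferentiableOn ℂ f U)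
    (hb : ∀ z ∈ closedBall (0 : ℂ) R, ‖f z‖ ≤ B) {ρ : ℂ} (hρ : f ρ = 0) (hρ0 : ρ ≠ 0)
    (hρR : ‖ρ‖ < R) :
    ∃ g : ℂ → ℂ, DifferentiableOn ℂ g U ∧ (∀ z ∈ closedBall (0 : ℂ) R, ‖g z‖ ≤ B) ∧
      (∀ z ∈ closedBall (0 : ℂ) R, g z = 0 → f z = 0) ∧
      ‖g 0‖ * ‖ρ‖ = ‖f 0‖ * R ∧
      (f 0 ≠ 0 → deriv f 0 / f 0 = deriv g 0 / g 0 + (conj ρ / (R : ℂ) ^ 2 - 1 / ρ)) := by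
  have hR : 0 < R := (norm_nonneg ρ).trans_lt hρR
  have hRc : (R : ℂ) ≠ 0 := by exact_mod_cast hR.ne'
  have hρU : ρ ∈ U := hRU (by simpa using hρR.le)
  have h0U : (0 : ℂ) ∈ U := hRU (by simpa using hR.le)
  set g : ℂ → ℂ := fun z => dslope f ρ z * (((R : ℂ) ^ 2 - conj ρ * z) / R) with hg
  have hgd : DifferentiableOn ℂ g U := by
    refine ((Complex.differentiableOn_dslope (hU.mem_nhds hρU)).2 hf).mul ?_
    fun_prop
  have hid : ∀ z, f z * ((R : ℂ) ^ 2 - conj ρ * z) = g z * (R * (z - ρ)) := by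
    intro z
    have := sub_smul_dslope f ρ z
    rw [hρ, sub_zero, smul_eq_mul] at this
    rw [← this, hg]
    field_simp
  clear_value g
  have h0 : ‖g 0‖ * ‖ρ‖ = ‖f 0‖ * R := by
    have := congrArg norm (hid 0)
    simp only [mul_zero, sub_zero, zero_sub, norm_mul, norm_neg, norm_pow, Complex.norm_real,
      Real.norm_of_nonneg hR.le] at this
    have h2 : R * (‖g 0‖ * ‖ρ‖) = R * (‖f 0‖ * R) := by linarith
    exact mul_left_cancel₀ hR.ne' h2
  refine ⟨g, hgd, ?_, fun z hzR hgz => ?_, h0, ?_⟩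
  · have hsph : ∀ z ∈ frontier (ball (0 : ℂ) R), ‖g z‖ ≤ B := by
      intro z hz
      rw [frontier_ball _ hR.ne'] at hz
      have hzR : ‖z‖ = R := by simpa using hz
      have hzρ : 0 < ‖z - ρ‖ := by
        rw [norm_pos_iff, sub_ne_zero]; rintro rfl; linarith
      have h1 := congrArg norm (hid z)
      have h2 : ‖(R : ℂ) ^ 2 - conj ρ * z‖ = R * ‖z - ρ‖ := by
        have : (R : ℂ) ^ 2 = conj z * z := by
          rw [← hzR, mul_comm, Complex.mul_conj, Complex.normSq_eq_norm_sq]; norm_cast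
        rw [this, ← sub_mul, norm_mul, hzR, ← map_sub, Complex.norm_conj, mul_comm]
      rw [norm_mul, h2, norm_mul, norm_mul, Complex.norm_real, Real.norm_of_nonneg hR.le] at h1
      have h3 := hb z (by simpa using hzR.le)
      have : ‖f z‖ = ‖g z‖ := mul_right_cancel₀ (by positivity : R * ‖z - ρ‖ ≠ 0) h1
      linarith
    intro z hz
    refine Complex.norm_le_of_forall_mem_frontier_norm_le isBounded_ball
      (hgd.diffContOnCl_ball hRU) hsph ?_
    rwa [closure_ball _ hR.ne']
  · have h3 := hid z
    rw [hgz, zero_mul, mul_eq_zero] at h3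
    refine h3.resolve_right fun h3 => ?_
    have h5 := congrArg norm (sub_eq_zero.1 h3)
    rw [norm_pow, Complex.norm_real, Real.norm_of_nonneg hR.le, norm_mul, Complex.norm_conj] at h5
    have h6 : ‖z‖ ≤ R := by simpa using hzR
    nlinarith [norm_nonneg z, mul_le_mul_of_nonneg_left h6 (norm_nonneg ρ)]
  · intro hf0
    have hg0 : g 0 ≠ 0 := by
      intro h
      rw [h, norm_zero, zero_mul] at h0
      have := mul_pos (norm_pos_iff.2 hf0) hR
      linarith
    have hfD := (hf.differentiableAt (hU.mem_nhds h0U)).hasDerivAt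
    have hgD := (hgd.differentiableAt (hU.mem_nhds h0U)).hasDerivAt
    have e1 := hfD.mul (((hasDerivAt_id (0 : ℂ)).const_mul (conj ρ)).const_sub ((R : ℂ) ^ 2))
    have e2 := hgD.mul (((hasDerivAt_id (0 : ℂ)).sub_const ρ).const_mul (R : ℂ))
    have e3 := e1.congr_of_eventuallyEq (f₁ := fun z => g z * (R * (z - ρ)))
      (Filter.Eventually.of_forall fun z => by simpa using (hid z).symm)
    have e4 := e3.unique e2
    have e5 := hid 0
    simp only [id, mul_zero, sub_zero, mul_one, zero_sub] at e4 e5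
    have e6 : g 0 = - (f 0 * R / ρ) := by
      field_simp
      have : (R : ℂ) * (g 0 * ρ) = R * (-(f 0 * R)) := by linear_combination e5
      linear_combination mul_left_cancel₀ hRc this
    have e7 : deriv g 0 = g 0 / ρ - deriv f 0 * R / ρ + f 0 * conj ρ / (R * ρ) := by
      field_simp
      linear_combination e4
    rw [e7, e6]
    field_simp
    ring

open ComplexConjugate in
theorem re_conj_div_sub_inv (ρ : ℂ) (R : ℝ) :
    (conj ρ / (R : ℂ) ^ 2 - 1 / ρ).re = ρ.re * (1 / R ^ 2 - 1 / ‖ρ‖ ^ 2) := by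
  have h : conj ρ / (R : ℂ) ^ 2 - 1 / ρ = conj ρ * ((1 / R ^ 2 - 1 / ‖ρ‖ ^ 2 : ℝ) : ℂ) := by
    rw [one_div ρ, Complex.inv_def, Complex.normSq_eq_norm_sq]
    push_cast
    ring
  rw [h, Complex.re_mul_ofReal, Complex.conj_re]

open Metric ComplexConjugate in
/-- Landau's inequality: if all zeros in the disc lie in the left half plane, then the real part of
the logarithmic derivative at the centre is bounded below. -/
theorem neg_re_logDeriv_le {U : Set ℂ} {R B M : ℝ} (hU : IsOpen U) (hR : 0 < R)
    (hRU : closedBall 0 R ⊆ U) (hM : 0 < M) (n : ℕ) :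
    ∀ f : ℂ → ℂ, DifferentiableOn ℂ f U → (∀ z ∈ closedBall (0 : ℂ) R, ‖f z‖ ≤ B) →
      f 0 ≠ 0 → B ≤ ‖f 0‖ * Real.exp M → B < 2 ^ n * ‖f 0‖ →
      (∀ z ∈ closedBall (0 : ℂ) R, f z = 0 → z.re ≤ 0) →
      -(deriv f 0 / f 0).re ≤ 48 * M / R := by
  induction n with
  | zero =>
    intro f hf hb h0 _ hB _
    have := hb 0 (by simpa using hR.le)
    rw [pow_zero, one_mul] at hB
    linarith
  | succ n ih =>
    intro f hf hb h0 hBM hB hz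
    by_cases hne : ∀ z ∈ ball (0 : ℂ) (R / 2), f z ≠ 0
    · have hsub : ball (0 : ℂ) (R / 2) ⊆ closedBall 0 R :=
        ball_subset_closedBall.trans (closedBall_subset_closedBall (by linarith))
      have := norm_logDeriv_le_of_ne_zero (by positivity : 0 < R / 2) hM
        (hf.mono (hsub.trans hRU)) hne (fun z hz => (hb z (hsub hz)).trans hBM)
        (z := 0) (by simp; positivity)
      calc -(deriv f 0 / f 0).re ≤ ‖deriv f 0 / f 0‖ :=
            (neg_le_abs _).trans (Complex.abs_re_le_norm _)
        _ ≤ _ := this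
        _ = _ := by field_simp; norm_num
    · push Not at hne
      obtain ⟨ρ, hρR, hρ⟩ := hne
      rw [mem_ball_zero_iff] at hρR
      have hρ0 : ρ ≠ 0 := by rintro rfl; exact h0 hρ
      have hρn : 0 < ‖ρ‖ := norm_pos_iff.2 hρ0
      have hre : ρ.re ≤ 0 := hz ρ (by simp; linarith) hρ
      obtain ⟨g, hgd, hgb, hid, hg0, hld⟩ := exists_blaschke_div hU hRU hf hb hρ hρ0 (by linarith)
      have hf0 : 0 < ‖f 0‖ := norm_pos_iff.2 h0
      have h2 : 2 * ‖f 0‖ ≤ ‖g 0‖ := by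
        by_contra h
        push Not at h
        nlinarith [norm_nonneg (g 0)]
      have hg0' : g 0 ≠ 0 := norm_pos_iff.1 (by linarith)
      have := ih g hgd hgb hg0' (hBM.trans (by gcongr; linarith))
        (hB.trans_le (by rw [pow_succ, mul_assoc]; gcongr)) (fun z hzR hgz => hz z hzR (hid z hzR hgz))
      rw [hld h0, Complex.add_re, neg_add]
      have h7 := re_conj_div_sub_inv ρ R
      rw [h7]
      have h8 : 1 / R ^ 2 - 1 / ‖ρ‖ ^ 2 ≤ 0 := by
        rw [sub_nonpos]
        exact one_div_le_one_div_of_le (by positivity) (by nlinarith)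
      nlinarith
open Metric ComplexConjugate in
/-- Landau's inequality with the contribution of one zero `-l` on the real axis retained. -/
theorem neg_re_logDeriv_le_sub {U : Set ℂ} {R B M l : ℝ} (hU : IsOpen U) (hR : 0 < R)
    (hRU : closedBall 0 R ⊆ U) (hM : 0 < M) {f : ℂ → ℂ} (hf : DifferentiableOn ℂ f U)
    (hb : ∀ z ∈ closedBall (0 : ℂ) R, ‖f z‖ ≤ B) (h0 : f 0 ≠ 0) (hBM : B ≤ ‖f 0‖ * Real.exp M)
    (hz : ∀ z ∈ closedBall (0 : ℂ) R, f z = 0 → z.re ≤ 0) (hl : 0 < l) (hlR : l ≤ R / 2)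
    (hfl : f (-l) = 0) :
    -(deriv f 0 / f 0).re ≤ 49 * M / R + 1 / R - 1 / l := by
  have hln : ‖(-l : ℂ)‖ = l := by rw [norm_neg, Complex.norm_real, Real.norm_of_nonneg hl.le]
  have hl0 : (-l : ℂ) ≠ 0 := norm_pos_iff.1 (by rw [hln]; exact hl)
  obtain ⟨g, hgd, hgb, hgz, hg0, hld⟩ := exists_blaschke_div hU hRU hf hb hfl hl0
    (by rw [hln]; linarith)
  rw [hln] at hg0
  have hf0 : 0 < ‖f 0‖ := norm_pos_iff.2 h0
  have h2 : ‖f 0‖ ≤ ‖g 0‖ := by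
    by_contra h
    push Not at h
    nlinarith [norm_nonneg (g 0)]
  have hg0' : 0 < ‖g 0‖ := by linarith
  obtain ⟨n, hn⟩ := pow_unbounded_of_one_lt (B / ‖g 0‖) (one_lt_two)
  rw [div_lt_iff₀ hg0'] at hn
  have := neg_re_logDeriv_le hU hR hRU hM n g hgd hgb (norm_pos_iff.1 hg0')
    (hBM.trans (by gcongr)) hn (fun z hzR hgz0 => hz z hzR (hgz z hzR hgz0))
  rw [hld h0, Complex.add_re, neg_add, re_conj_div_sub_inv, hln]
  have e1 : -((-l : ℂ).re * (1 / R ^ 2 - 1 / l ^ 2)) = l / R ^ 2 - 1 / l := by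
    simp only [Complex.neg_re, Complex.ofReal_re]
    field_simp
  have e2 : l / R ^ 2 ≤ 1 / R := by
    rw [div_le_div_iff₀ (by positivity) hR]
    nlinarith
  have e3 : 48 * M / R ≤ 49 * M / R := by gcongr; norm_num
  rw [e1]
  linarith

/-- The continuation of `-ζ'/ζ - ζ`, which is regular at `1`. -/
noncomputable def vonMangoldtDiff (s : ℂ) : ℂ :=
  -(deriv riemannZeta₁ s / riemannZeta₁ s) - riemannZeta₀ s

theorem riemannZeta₁_ne_zero {s : ℂ} (hs : s ≠ 1) (h : riemannZeta s ≠ 0) :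
    riemannZeta₁ s ≠ 0 := by
  rw [riemannZeta_eq_inv_sub_mul hs] at h
  exact right_ne_zero_of_mul h

theorem riemannZeta₁_ne_zero_of_one_le_re {s : ℂ} (hs : 1 ≤ s.re) : riemannZeta₁ s ≠ 0 := by
  by_cases h : s = 1
  · rw [h, riemannZeta₁_one]; exact one_ne_zero
  · exact riemannZeta₁_ne_zero h (riemannZeta_ne_zero_of_one_le_re hs)

theorem logDeriv_riemannZeta₁ {s : ℂ} (hs : s ≠ 1) (h : riemannZeta s ≠ 0) :
    deriv riemannZeta₁ s / riemannZeta₁ s = deriv riemannZeta s / riemannZeta s + 1 / (s - 1) := by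
  have h1 : s - 1 ≠ 0 := sub_ne_zero.2 hs
  have hd : HasDerivAt riemannZeta₁ (1 * riemannZeta s + (s - 1) * deriv riemannZeta s) s := by
    have := ((hasDerivAt_id s).sub_const 1).mul (differentiableAt_riemannZeta hs).hasDerivAt
    refine this.congr_of_eventuallyEq ?_
    filter_upwards [isOpen_ne.mem_nhds hs] with z hz
    have hz1 : z - 1 ≠ 0 := sub_ne_zero.2 hz
    simp only [Pi.mul_apply, id, riemannZeta_eq_inv_sub_mul hz]
    field_simp
  have h2 : riemannZeta₁ s = (s - 1) * riemannZeta s := by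
    rw [riemannZeta_eq_inv_sub_mul hs]; field_simp
  rw [hd.deriv, h2]
  field_simp
  ring

theorem vonMangoldtDiff_eq {s : ℂ} (hs : s ≠ 1) (h : riemannZeta s ≠ 0) :
    vonMangoldtDiff s = -(deriv riemannZeta s / riemannZeta s) - riemannZeta s := by
  rw [vonMangoldtDiff, logDeriv_riemannZeta₁ hs h, riemannZeta_eq_inv_sub_add hs]
  ring

theorem differentiableAt_vonMangoldtDiff {s : ℂ} (h : riemannZeta₁ s ≠ 0) :
    DifferentiableAt ℂ vonMangoldtDiff s := by
  have h1 : DifferentiableAt ℂ (deriv riemannZeta₁) s :=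
    (differentiable_riemannZeta₁.contDiff (n := 2)).differentiable_deriv_two s
  exact ((h1.div (differentiable_riemannZeta₁ s) h).neg).sub (differentiable_riemannZeta₀ s)

/-- Real zeta sum bound. -/
theorem exists_tsum_rpow_le : ∃ K : ℝ, 0 < K ∧ ∀ σ : ℝ, 1 < σ → σ ≤ 3 →
    ∑' n : ℕ, 1 / (n : ℝ) ^ σ ≤ K / (σ - 1) := by
  obtain ⟨K, hK⟩ := (isCompact_Icc (a := (1 : ℝ)) (b := 3)).exists_bound_of_continuousOn
    (f := fun σ : ℝ => riemannZeta₁ σ)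
    ((differentiable_riemannZeta₁.continuous.comp Complex.continuous_ofReal).continuousOn)
  refine ⟨|K| + 1, by positivity, fun σ h1 h3 => ?_⟩
  have hs : (σ : ℂ) ≠ 1 := by exact_mod_cast h1.ne'
  have e1 : ((∑' n : ℕ, 1 / (n : ℝ) ^ σ : ℝ) : ℂ) = riemannZeta σ := by
    rw [zeta_eq_tsum_one_div_nat_cpow (by simpa using h1), Complex.ofReal_tsum]
    refine tsum_congr fun n => ?_
    push_cast
    rw [Complex.ofReal_cpow (Nat.cast_nonneg n)]
    simp
  have e2 := hK σ ⟨h1.le, h3⟩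
  have e3 : ‖riemannZeta σ‖ ≤ (|K| + 1) / (σ - 1) := by
    rw [riemannZeta_eq_inv_sub_mul hs, norm_mul, norm_inv]
    have : ‖(σ : ℂ) - 1‖ = σ - 1 := by
      rw [← Complex.ofReal_one, ← Complex.ofReal_sub, Complex.norm_real,
        Real.norm_of_nonneg (by linarith)]
    rw [this, inv_mul_eq_div]
    have : 0 < σ - 1 := by linarith
    gcongr
    exact e2.trans ((le_abs_self K).trans (by linarith))
  rw [← e1, Complex.norm_real] at e3
  exact (le_abs_self _).trans e3

theorem exists_le_norm_zeta : ∃ c : ℝ, 0 < c ∧ ∀ σ : ℝ, 1 < σ → σ ≤ 3 → ∀ t : ℝ,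
    c * (σ - 1) ≤ ‖riemannZeta (σ + t * Complex.I)‖ := by
  obtain ⟨K, hK, h⟩ := exists_tsum_rpow_le
  refine ⟨1 / K, by positivity, fun σ h1 h3 t => ?_⟩
  set s : ℂ := σ + t * Complex.I with hs
  have hre : s.re = σ := by simp [hs]
  have hs1 : 1 < s.re := by rw [hre]; exact h1
  have e1 := LSeries_one_mul_Lseries_moebius hs1
  rw [LSeries_one_eq_riemannZeta hs1] at e1
  have hsum : Summable fun n : ℕ => 1 / (n : ℝ) ^ σ := Real.summable_one_div_nat_rpow.2 h1
  have e2 : ‖LSeries (fun n => ((ArithmeticFunction.moebius n : ℤ) : ℂ)) s‖ ≤ K / (σ - 1) := by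
    refine le_trans ?_ (h σ h1 h3)
    refine tsum_of_norm_bounded hsum.hasSum fun n => ?_
    rcases eq_or_ne n 0 with rfl | hn
    · simp; positivity
    rw [LSeries.norm_term_eq, if_neg hn, hre]
    gcongr
    have := ArithmeticFunction.abs_moebius_le_one (n := n)
    rw [Complex.norm_intCast]
    exact_mod_cast this
  have h0 : 0 < σ - 1 := by linarith
  have e3 := congrArg norm e1
  rw [norm_mul, norm_one] at e3
  have e4 : 1 ≤ ‖riemannZeta s‖ * (K / (σ - 1)) :=
    e3.symm.le.trans (mul_le_mul_of_nonneg_left e2 (norm_nonneg _))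
  rw [mul_div_assoc', le_div_iff₀ h0] at e4
  rw [one_div, inv_mul_le_iff₀ hK]
  linarith

theorem neg_re_logDeriv_zeta_eq {s : ℂ} (hs : 1 < s.re) :
    HasSum (fun n : ℕ => ArithmeticFunction.vonMangoldt n * (n : ℝ) ^ (-s.re) *
      Real.cos (s.im * Real.log n)) (-(deriv riemannZeta s / riemannZeta s)).re := by
  have h1 := (ArithmeticFunction.LSeriesSummable_vonMangoldt hs).hasSum
  rw [show (∑' n, LSeries.term (fun n => (ArithmeticFunction.vonMangoldt n : ℂ)) s n) =
    -(deriv riemannZeta s / riemannZeta s) by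
      rw [← neg_div]; exact ArithmeticFunction.LSeries_vonMangoldt_eq_deriv_riemannZeta_div hs] at h1
  refine (Complex.hasSum_re h1).congr_fun fun n => ?_
  rcases eq_or_ne n 0 with rfl | hn
  · simp
  have hn0 : (0 : ℝ) < n := by positivity
  rw [LSeries.term_of_ne_zero hn, div_eq_mul_inv, ← Complex.cpow_neg, Complex.re_ofReal_mul,
    mul_assoc]
  congr 1
  rw [Complex.cpow_def_of_ne_zero (by exact_mod_cast hn), Complex.exp_re, Real.rpow_def_of_pos hn0,
    ← Complex.natCast_log]
  simp only [Complex.mul_re, Complex.mul_im, Complex.ofReal_re, Complex.ofReal_im, Complex.neg_re,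
    Complex.neg_im, zero_mul, sub_zero, add_zero]
  rw [show Real.log n * -s.im = -(s.im * Real.log n) by ring, Real.cos_neg]

theorem three_four_one {σ : ℝ} (hσ : 1 < σ) (t : ℝ) :
    0 ≤ 3 * (-(deriv riemannZeta σ / riemannZeta σ)).re +
      4 * (-(deriv riemannZeta (σ + t * Complex.I) / riemannZeta (σ + t * Complex.I))).re +
      (-(deriv riemannZeta (σ + (2 * t : ℝ) * Complex.I) /
        riemannZeta (σ + (2 * t : ℝ) * Complex.I))).re := by
  have h0 := neg_re_logDeriv_zeta_eq (s := σ) (by simpa using hσ)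
  have h1 := neg_re_logDeriv_zeta_eq (s := σ + t * Complex.I) (by simpa using hσ)
  have h2 := neg_re_logDeriv_zeta_eq (s := σ + (2 * t : ℝ) * Complex.I) (by simpa using hσ)
  refine ((((h0.mul_left 3).add (h1.mul_left 4)).add h2)).nonneg fun n => ?_
  simp only [Complex.add_re, Complex.ofReal_re, Complex.mul_re, Complex.I_re, Complex.ofReal_im,
    Complex.I_im, Complex.add_im, Complex.mul_im, mul_zero, mul_one, zero_mul, sub_zero, add_zero,
    zero_add, Real.cos_zero]
  have hΛ := ArithmeticFunction.vonMangoldt_nonneg (n := n)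
  have hp : 0 ≤ (n : ℝ) ^ (-σ) := by positivity
  rw [show 2 * t * Real.log n = 2 * (t * Real.log n) by ring, Real.cos_two_mul]
  set x := Real.cos (t * Real.log n)
  have : 0 ≤ ArithmeticFunction.vonMangoldt n * (n : ℝ) ^ (-σ) * (2 * (1 + x) ^ 2) := by positivity
  linarith

theorem exists_neg_logDeriv_zeta_le : ∃ A : ℝ, 0 < A ∧ ∀ σ : ℝ, 1 < σ → σ ≤ 3 →
    (-(deriv riemannZeta σ / riemannZeta σ)).re ≤ 1 / (σ - 1) + A := by
  obtain ⟨K, hK⟩ := (isCompact_Icc (a := (1 : ℝ)) (b := 3)).exists_bound_of_continuousOn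
    (f := fun σ : ℝ => deriv riemannZeta₁ σ / riemannZeta₁ σ) (by
      refine ContinuousOn.div ?_ ?_ ?_
      · exact (((differentiable_riemannZeta₁.contDiff (n := 2)).differentiable_deriv_two).continuous.comp
          Complex.continuous_ofReal).continuousOn
      · exact (differentiable_riemannZeta₁.continuous.comp Complex.continuous_ofReal).continuousOn
      · exact fun σ hσ => riemannZeta₁_ne_zero_of_one_le_re (by simpa using hσ.1))
  refine ⟨|K| + 1, by positivity, fun σ h1 h3 => ?_⟩
  have hs : (σ : ℂ) ≠ 1 := by exact_mod_cast h1.ne'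
  have e1 := logDeriv_riemannZeta₁ hs (riemannZeta_ne_zero_of_one_le_re (by simpa using h1.le))
  have e2 : -(deriv riemannZeta σ / riemannZeta σ) = ((1 / (σ - 1) : ℝ) : ℂ) -
      deriv riemannZeta₁ σ / riemannZeta₁ σ := by
    rw [e1]; push_cast; ring
  have e3 := hK σ ⟨h1.le, h3⟩
  rw [e2, Complex.sub_re, Complex.ofReal_re]
  have e4 := (neg_le_abs _).trans
    (Complex.abs_re_le_norm (deriv riemannZeta₁ σ / riemannZeta₁ σ))
  have := le_abs_self K
  linarith

theorem exists_norm_zeta_add_le : ∃ C : ℝ, 0 < C ∧ ∀ t : ℝ, 4 ≤ t → ∀ T : ℝ, t ≤ T → T ≤ 2 * t →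
    ∀ R η : ℝ, 0 ≤ η → η ≤ 1 → R < 1 / 2 → R ≤ (2 * Real.log t) ^ (-(2 / 3) : ℝ) → ∀ z : ℂ,
    ‖z‖ ≤ R → ‖riemannZeta ((1 + η : ℝ) + T * Complex.I + z)‖ ≤ C * Real.log t ^ 6 := by
  obtain ⟨C, hC, h⟩ := zeta_growth
  refine ⟨C * 64, by positivity, fun t ht T hT1 hT2 R η hη0 hη1 hR hR2 z hz => ?_⟩
  have hre := (abs_le.1 ((Complex.abs_re_le_norm z).trans hz))
  have him := (abs_le.1 ((Complex.abs_im_le_norm z).trans hz))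
  have h1 : ((1 + η : ℝ) : ℂ) + T * Complex.I + z =
      ((1 + η + z.re : ℝ) : ℂ) + ((T + z.im : ℝ) : ℂ) * Complex.I := by
    apply Complex.ext <;> simp
  have hlt : 1 ≤ Real.log t := by
    rw [Real.le_log_iff_exp_le (by linarith)]
    linarith [Real.exp_one_lt_d9]
  have h3 : 3 ≤ T + z.im := by linarith
  have hlog1 : 1 ≤ Real.log (T + z.im) := by
    rw [Real.le_log_iff_exp_le (by linarith)]
    linarith [Real.exp_one_lt_d9]
  have hlog : Real.log (T + z.im) ≤ 2 * Real.log t := by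
    rw [show 2 * Real.log t = Real.log (t ^ 2) by rw [Real.log_pow]; norm_num]
    exact Real.log_le_log (by linarith) (by nlinarith)
  have hle : (2 * Real.log t) ^ (-(2 / 3) : ℝ) ≤ Real.log (T + z.im) ^ (-(2 / 3) : ℝ) :=
    Real.rpow_le_rpow_of_nonpos (by linarith) hlog (by norm_num)
  rw [h1]
  refine (h _ h3 _ (by linarith [hre.1]) (by linarith [hre.2]) (by linarith [hre.1])).trans ?_
  calc C * Real.log (T + z.im) ^ 6 ≤ C * (2 * Real.log t) ^ 6 := by gcongr
    _ = _ := by ring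

theorem eventually_mul_rpow_le_rpow (C : ℝ) {a b : ℝ} (h : a < b) :
    ∀ᶠ L : ℝ in Filter.atTop, C * L ^ a ≤ L ^ b := by
  filter_upwards [(tendsto_rpow_atTop (sub_pos.2 h)).eventually_ge_atTop C,
    Filter.eventually_gt_atTop 0] with L hL hL0
  calc C * L ^ a ≤ L ^ (b - a) * L ^ a := by gcongr
    _ = L ^ b := by rw [← Real.rpow_add hL0]; congr 1; ring

theorem eventually_mul_rpow_le_exp (C a : ℝ) {b : ℝ} (hb : 0 < b) :
    ∀ᶠ L : ℝ in Filter.atTop, C * L ^ a ≤ Real.exp (L ^ b) := by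
  have h1 : ∀ᶠ x : ℝ in Filter.atTop, (|C| + 1) * x ^ (a / b) ≤ Real.exp x := by
    have := tendsto_rpow_mul_exp_neg_mul_atTop_nhds_zero (a / b) 1 one_pos
    filter_upwards [this.eventually_le_const (show 0 < 1 / (|C| + 1) by positivity)] with x hx
    rw [neg_one_mul, Real.exp_neg, le_div_iff₀ (by positivity)] at hx
    have := Real.exp_pos x
    calc (|C| + 1) * x ^ (a / b) = (x ^ (a / b) * (Real.exp x)⁻¹ * (|C| + 1)) * Real.exp x := by
          field_simp
      _ ≤ 1 * Real.exp x := by gcongr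
      _ = _ := one_mul _
  filter_upwards [(tendsto_rpow_atTop hb).eventually h1, Filter.eventually_gt_atTop 0] with L hL hL0
  rw [← Real.rpow_mul hL0.le, mul_div_cancel₀ _ hb.ne'] at hL
  refine le_trans (mul_le_mul_of_nonneg_right ?_ (by positivity)) hL
  linarith [le_abs_self C]

/-- Parameters of the zero-free region are eventually admissible. -/
theorem eventually_zero_free_params {C c A δ : ℝ} (hc : 0 < c) (hδ : 0 < δ) :
    ∀ᶠ L : ℝ in Filter.atTop, 2 ≤ L ∧ 9 * L ^ (-(2 / 3 + δ)) ≤ L ^ (-(2 / 3) : ℝ) / 4 ∧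
      ∃ M : ℝ, 0 < M ∧ C * L ^ 6 ≤ c * (8 * L ^ (-(2 / 3 + δ))) * Real.exp M ∧
      (A + (244 * M + 4) / (L ^ (-(2 / 3) : ℝ) / 2)) * L ^ (-(2 / 3 + δ)) < 5 / 72 ∧
      M ≤ L := by
  set d := min δ 1 / 2 with hd
  have hd0 : 0 < d := by positivity
  have hd1 : d ≤ 1 := by linarith [min_le_right δ 1]
  have hdδ : d ≤ δ / 2 := by linarith [min_le_left δ 1]
  filter_upwards [Filter.eventually_ge_atTop 2,
    eventually_mul_rpow_le_rpow 36 (show -(2 / 3 + δ) < -(2 / 3) by linarith),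
    eventually_mul_rpow_le_exp (C / (8 * c)) (6 + (2 / 3 + δ)) hd0,
    eventually_mul_rpow_le_rpow ((|A| + 496) * 15) (show -(δ / 2) < 0 by linarith)]
    with L hL2 h1 h2 h3
  have hL0 : 0 < L := by linarith
  refine ⟨hL2, by linarith, L ^ d, by positivity, ?_, ?_, ?_⟩
  · rw [Real.rpow_add hL0, div_mul_eq_mul_div, div_le_iff₀ (by positivity)] at h2
    have e1 : L ^ (2 / 3 + δ) * L ^ (-(2 / 3 + δ)) = 1 := by
      rw [← Real.rpow_add hL0]; simp
    have e2 : L ^ (6 : ℝ) = L ^ 6 := by norm_cast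
    calc C * L ^ 6 = C * (L ^ (6 : ℝ) * L ^ (2 / 3 + δ)) * L ^ (-(2 / 3 + δ)) := by
          rw [e2]; linear_combination (-C * L ^ 6) * e1
      _ ≤ (Real.exp (L ^ d) * (8 * c)) * L ^ (-(2 / 3 + δ)) := by gcongr
      _ = _ := by ring
  · have e0 : 1 ≤ L ^ d := Real.one_le_rpow (by linarith) hd0.le
    have e1 : (244 * L ^ d + 4) / (L ^ (-(2 / 3) : ℝ) / 2) =
        (244 * L ^ d + 4) * 2 * L ^ (2 / 3 : ℝ) := by
      rw [Real.rpow_neg hL0.le]; field_simp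
    have e2 : 1 ≤ L ^ (2 / 3 : ℝ) := Real.one_le_rpow (by linarith) (by norm_num)
    rw [e1]
    calc (A + (244 * L ^ d + 4) * 2 * L ^ (2 / 3 : ℝ)) * L ^ (-(2 / 3 + δ))
        ≤ ((|A| + 496) * (L ^ d * L ^ (2 / 3 : ℝ))) * L ^ (-(2 / 3 + δ)) := by
          refine mul_le_mul_of_nonneg_right ?_ (by positivity)
          have e3 : 1 ≤ L ^ d * L ^ (2 / 3 : ℝ) := one_le_mul_of_one_le_of_one_le e0 e2
          nlinarith [le_abs_self A, abs_nonneg A]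
      _ = (|A| + 496) * L ^ (d + 2 / 3 + -(2 / 3 + δ)) := by
          rw [Real.rpow_add hL0, Real.rpow_add hL0]; ring
      _ ≤ (|A| + 496) * L ^ (-(δ / 2)) := by
          gcongr
          · linarith
          · linarith
      _ < _ := by
          rw [Real.rpow_zero] at h3
          nlinarith
  · calc L ^ d ≤ L ^ (1 : ℝ) := Real.rpow_le_rpow_of_exponent_le (by linarith) hd1
      _ = L := Real.rpow_one L

/-- The Vinogradov–Korobov zero-free region, up to an arbitrarily small power loss. -/
theorem exists_zeta_ne_zero {δ : ℝ} (hδ : 0 < δ) : ∃ T₀ : ℝ, 4 ≤ T₀ ∧ ∀ t : ℝ, T₀ ≤ t →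
    ∀ σ : ℝ, 1 - Real.log t ^ (-(2 / 3 + δ)) ≤ σ → riemannZeta (σ + t * Complex.I) ≠ 0 := by
  obtain ⟨C, hC, hg⟩ := exists_norm_zeta_add_le
  obtain ⟨c, hc, hlow⟩ := exists_le_norm_zeta
  obtain ⟨A, hA, h1A⟩ := exists_neg_logDeriv_zeta_le
  obtain ⟨L₀, hL₀⟩ := Filter.eventually_atTop.1
    (eventually_zero_free_params (A := 3 * A) (C := C) hc hδ)
  refine ⟨max 4 (Real.exp L₀), le_max_left _ _, fun t ht σ hσ hzero => ?_⟩
  have ht4 : 4 ≤ t := (le_max_left _ _).trans ht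
  set L := Real.log t with hL
  obtain ⟨hL2, hη, M, hM, hCM, hsmall, -⟩ := hL₀ L (by
    rw [hL, Real.le_log_iff_exp_le (by linarith)]; exact (le_max_right _ _).trans ht)
  set η := L ^ (-(2 / 3 + δ)) with hηd
  set P := L ^ (-(2 / 3) : ℝ) with hP
  have hη0 : 0 < η := by positivity
  have hP0 : 0 < P := by positivity
  have hP1 : P < 1 := Real.rpow_lt_one_of_one_lt_of_neg (by linarith) (by norm_num)
  have hR2 : P / 2 ≤ (2 * L) ^ (-(2 / 3) : ℝ) := by
    rw [Real.mul_rpow (by norm_num) (by linarith), ← hP]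
    have : (1 / 2 : ℝ) ≤ 2 ^ (-(2 / 3) : ℝ) := by
      calc (1 / 2 : ℝ) = 2 ^ (-1 : ℝ) := by rw [Real.rpow_neg_one]; norm_num
        _ ≤ _ := Real.rpow_le_rpow_of_exponent_le (by norm_num) (by norm_num)
    nlinarith
  have hσ1 : σ < 1 := by
    by_contra hcon
    push Not at hcon
    exact riemannZeta_ne_zero_of_one_le_re (by simpa using hcon) hzero
  have hkey : ∀ T : ℝ, t ≤ T → T ≤ 2 * t → ∃ f : ℂ → ℂ,
      (∀ z, f z = riemannZeta ((1 + 8 * η : ℝ) + T * Complex.I + z)) ∧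
      DifferentiableOn ℂ f (Metric.ball 0 1) ∧
      (∀ z ∈ Metric.closedBall (0 : ℂ) (P / 2), ‖f z‖ ≤ C * L ^ 6) ∧ f 0 ≠ 0 ∧
      C * L ^ 6 ≤ ‖f 0‖ * Real.exp M ∧
      (∀ z ∈ Metric.closedBall (0 : ℂ) (P / 2), f z = 0 → z.re ≤ 0) ∧
      deriv f 0 / f 0 = deriv riemannZeta ((1 + 8 * η : ℝ) + T * Complex.I) /
        riemannZeta ((1 + 8 * η : ℝ) + T * Complex.I) := by
    intro T hT1 hT2
    refine ⟨fun z => riemannZeta ((1 + 8 * η : ℝ) + T * Complex.I + z), fun _ => rfl, ?_, ?_, ?_,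
      ?_, ?_, ?_⟩
    · intro z hz
      have hz1 : ((1 + 8 * η : ℝ) : ℂ) + T * Complex.I + z ≠ 1 := by
        intro h
        have := congrArg Complex.im h
        simp at this
        have h2 := (abs_le.1 (Complex.abs_im_le_norm z)).1
        rw [mem_ball_zero_iff] at hz
        linarith
      exact ((differentiableAt_riemannZeta hz1).comp z
        (differentiableAt_id.const_add _)).differentiableWithinAt
    · intro z hz
      exact hg t ht4 T hT1 hT2 (P / 2) (8 * η) (by positivity) (by linarith) (by linarith) hR2 z
        (by simpa using hz)
    · exact riemannZeta_ne_zero_of_one_le_re (by simp; positivity)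
    · have := hlow (1 + 8 * η) (by linarith) (by linarith) T
      simp only [add_zero]
      refine hCM.trans (mul_le_mul_of_nonneg_right ?_ (Real.exp_pos _).le)
      refine le_trans (le_of_eq ?_) this
      ring
    · intro z _ hz
      by_contra hcon
      push Not at hcon
      exact riemannZeta_ne_zero_of_one_le_re (by simp; linarith) hz
    · simp only [deriv_comp_const_add, add_zero]
  have hRU : Metric.closedBall (0 : ℂ) (P / 2) ⊆ Metric.ball 0 1 :=
    Metric.closedBall_subset_ball (by linarith)
  have h341 := three_four_one (σ := 1 + 8 * η) (by linarith) t
  have e0 := h1A (1 + 8 * η) (by linarith) (by linarith)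
  have e1 : (-(deriv riemannZeta ((1 + 8 * η : ℝ) + t * Complex.I) /
        riemannZeta ((1 + 8 * η : ℝ) + t * Complex.I))).re ≤
        49 * M / (P / 2) + 1 / (P / 2) - 1 / (1 + 8 * η - σ) := by
    obtain ⟨f, hf, hfd, hfb, hf0, hfM, hfz, hfl⟩ := hkey t le_rfl (by linarith)
    rw [← hfl, Complex.neg_re]
    refine neg_re_logDeriv_le_sub Metric.isOpen_ball (by positivity) hRU hM hfd hfb hf0 hfM hfz
      (by linarith) (by linarith) ?_
    rw [hf, ← hzero]
    congr 1
    push_cast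
    ring
  have e2 : (-(deriv riemannZeta ((1 + 8 * η : ℝ) + (2 * t : ℝ) * Complex.I) /
        riemannZeta ((1 + 8 * η : ℝ) + (2 * t : ℝ) * Complex.I))).re ≤ 48 * M / (P / 2) := by
    obtain ⟨f, hf, hfd, hfb, hf0, hfM, hfz, hfl⟩ := hkey (2 * t) (by linarith) le_rfl
    rw [← hfl, Complex.neg_re]
    have hf0' : 0 < ‖f 0‖ := norm_pos_iff.2 hf0
    obtain ⟨n, hn⟩ := pow_unbounded_of_one_lt (C * L ^ 6 / ‖f 0‖) (one_lt_two)
    rw [div_lt_iff₀ hf0'] at hn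
    exact neg_re_logDeriv_le Metric.isOpen_ball (by positivity) hRU hM n f hfd hfb hf0 hfM hn hfz
  have e3 : 1 / (9 * η) ≤ 1 / (1 + 8 * η - σ) :=
    one_div_le_one_div_of_le (by linarith) (by linarith)
  have e4 : 0 ≤ 3 * (1 / (8 * η)) - 4 * (1 / (9 * η)) +
      (3 * A + (244 * M + 4) / (P / 2)) := by
    have e5 : (244 * M + 4) / (P / 2) =
        4 * (49 * M / (P / 2) + 1 / (P / 2)) + 48 * M / (P / 2) := by ring
    have e6 : (1 + 8 * η - 1) = 8 * η := by ring
    rw [e6] at e0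
    linarith
  have e5 : 3 * (1 / (8 * η)) - 4 * (1 / (9 * η)) = -(5 / 72) / η := by field_simp; norm_num
  rw [e5] at e4
  have e6 : 0 ≤ (-(5 / 72) / η + (3 * A + (244 * M + 4) / (P / 2))) * η := by positivity
  rw [add_mul, div_mul_cancel₀ _ hη0.ne'] at e6
  linarith

theorem exists_zeta_logDeriv_le {δ : ℝ} (hδ : 0 < δ) (hδ1 : δ ≤ 1) : ∃ T₀ C : ℝ, 4 ≤ T₀ ∧ 0 < C ∧
    ∀ t : ℝ, T₀ ≤ t → ∀ z : ℂ, ‖z - (1 + t * Complex.I)‖ ≤ Real.log t ^ (-(2 / 3 + δ)) →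
      z ≠ 1 ∧ riemannZeta z ≠ 0 ∧ ‖riemannZeta z‖ ≤ C * Real.log t ^ 6 ∧
      ‖deriv riemannZeta z / riemannZeta z‖ ≤ 3 * Real.log t ^ 3 := by
  obtain ⟨C, hC, hg⟩ := exists_norm_zeta_add_le
  obtain ⟨c, hc, hlow⟩ := exists_le_norm_zeta
  obtain ⟨T₀, hT₀, hzf⟩ := exists_zeta_ne_zero (half_pos hδ)
  obtain ⟨L₀, hL₀⟩ := Filter.eventually_atTop.1
    ((eventually_zero_free_params (A := 0) (C := 8 * C) hc hδ).and
      (eventually_mul_rpow_le_rpow (7 * 2 ^ (2 / 3 + δ / 2))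
        (show -(2 / 3 + δ) < -(2 / 3 + δ / 2) by linarith)))
  refine ⟨max (T₀ + 1) (Real.exp L₀), C, (by linarith : (4 : ℝ) ≤ T₀ + 1).trans (le_max_left _ _),
    hC, fun t ht => ?_⟩
  have htT : T₀ + 1 ≤ t := (le_max_left _ _).trans ht
  set L := Real.log t with hL
  obtain ⟨⟨hL2, hη, M, hM, hCM, -, hML⟩, h7⟩ := hL₀ L (by
    rw [hL, Real.le_log_iff_exp_le (by linarith)]; exact (le_max_right _ _).trans ht)
  set η := L ^ (-(2 / 3 + δ)) with hηd
  set P := L ^ (-(2 / 3) : ℝ) with hP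
  have hη0 : 0 < η := by positivity
  have hP0 : 0 < P := by positivity
  have hP1 : P < 1 := Real.rpow_lt_one_of_one_lt_of_neg (by linarith) (by norm_num)
  have hR2 : P / 2 ≤ (2 * L) ^ (-(2 / 3) : ℝ) := by
    rw [Real.mul_rpow (by norm_num) (by linarith), ← hP]
    have : (1 / 2 : ℝ) ≤ 2 ^ (-(2 / 3) : ℝ) := by
      calc (1 / 2 : ℝ) = 2 ^ (-1 : ℝ) := by rw [Real.rpow_neg_one]; norm_num
        _ ≤ _ := Real.rpow_le_rpow_of_exponent_le (by norm_num) (by norm_num)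
    nlinarith
  have h7' : 7 * η ≤ (2 * L) ^ (-(2 / 3 + δ / 2)) := by
    rw [Real.mul_rpow (by norm_num) (by linarith), Real.rpow_neg (by norm_num : (0 : ℝ) ≤ 2),
      inv_mul_eq_div, le_div_iff₀ (by positivity)]
    linarith
  set s₀ : ℂ := (1 + η : ℝ) + t * Complex.I with hs₀
  have hfb : ∀ w : ℂ, ‖w‖ ≤ 8 * η → ‖riemannZeta (s₀ + w)‖ ≤ C * L ^ 6 := fun w hw =>
    hg t (by linarith) t le_rfl (by linarith) (8 * η) η hη0.le (by linarith) (by linarith)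
      (by linarith) w hw
  have hre : ∀ w : ℂ, (s₀ + w).re = 1 + η + w.re := fun w => by simp [hs₀]
  have him : ∀ w : ℂ, (s₀ + w).im = t + w.im := fun w => by simp [hs₀]
  have hne1 : ∀ w : ℂ, ‖w‖ ≤ 8 * η → s₀ + w ≠ 1 := by
    intro w hw h
    have h1 := congrArg Complex.im h
    rw [him, Complex.one_im] at h1
    have h2 := (abs_le.1 (Complex.abs_im_le_norm w)).1
    linarith
  have hne : ∀ w : ℂ, ‖w‖ ≤ 8 * η → riemannZeta (s₀ + w) ≠ 0 := by
    intro w hw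
    have h1 := (abs_le.1 ((Complex.abs_im_le_norm w).trans hw))
    have h2 := (abs_le.1 ((Complex.abs_re_le_norm w).trans hw))
    rw [← Complex.re_add_im (s₀ + w), hre, him]
    refine hzf _ (by linarith) _ ?_
    have h3 : Real.log (t + w.im) ≤ 2 * L := by
      rw [hL, show 2 * Real.log t = Real.log (t ^ 2) by rw [Real.log_pow]; norm_num]
      exact Real.log_le_log (by linarith) (by nlinarith)
    have h4 : 0 < Real.log (t + w.im) := Real.log_pos (by linarith)
    have h5 : (2 * L) ^ (-(2 / 3 + δ / 2)) ≤ Real.log (t + w.im) ^ (-(2 / 3 + δ / 2)) :=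
      Real.rpow_le_rpow_of_nonpos h4 h3 (by linarith)
    linarith [h2.1]
  intro z hz
  set w := z - s₀ with hw
  have hzw : z = s₀ + w := by rw [hw]; ring
  have hw2 : ‖w‖ ≤ 2 * η := by
    have : w = (z - (1 + t * Complex.I)) - (η : ℂ) := by rw [hw, hs₀]; push_cast; ring
    rw [this]
    refine (norm_sub_le _ _).trans ?_
    rw [Complex.norm_real, Real.norm_of_nonneg hη0.le]
    linarith
  have hw8 : ‖w‖ ≤ 8 * η := by linarith
  rw [hzw]
  refine ⟨hne1 w hw8, hne w hw8, hfb w hw8, ?_⟩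
  have hsub : ∀ w ∈ Metric.ball (0 : ℂ) (8 * η), ‖w‖ ≤ 8 * η := fun w hw =>
    (mem_ball_zero_iff.1 hw).le
  have := norm_logDeriv_le_of_ne_zero (f := fun w => riemannZeta (s₀ + w)) (r := 8 * η)
    (by positivity) hM
    (fun w hw => ((differentiableAt_riemannZeta (hne1 w (hsub w hw))).comp w
        (differentiableAt_id.const_add _)).differentiableWithinAt)
    (fun w hw => hne w (hsub w hw))
    (fun w hw => (hfb w (hsub w hw)).trans (by
      have h1 := hlow (1 + η) (by linarith) (by linarith) t
      simp only [add_zero]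
      have h2 : C * L ^ 6 ≤ c * η * Real.exp M := by linarith
      refine h2.trans (mul_le_mul_of_nonneg_right ?_ (Real.exp_pos _).le)
      refine le_trans (le_of_eq ?_) h1
      ring))
    (z := w) (by linarith)
  simp only [deriv_comp_const_add] at this
  refine this.trans ?_
  have e1 : 1 / η ≤ L ^ 2 := by
    rw [hηd, Real.rpow_neg (by linarith), one_div, inv_inv, ← Real.rpow_natCast]
    exact Real.rpow_le_rpow_of_exponent_le (by linarith) (by push_cast; linarith)
  calc 24 * M / (8 * η) = 3 * M * (1 / η) := by field_simp; norm_num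
    _ ≤ 3 * L * L ^ 2 := by gcongr
    _ = _ := by ring

open ComplexConjugate in
theorem deriv_riemannZeta_conj (s : ℂ) :
    deriv riemannZeta (conj s) = conj (deriv riemannZeta s) := by
  have : riemannZeta = conj ∘ riemannZeta ∘ conj := by
    funext z
    simp [riemannZeta_conj]
  conv_lhs => rw [this]
  rw [deriv_conj_conj]
  simp only [Function.comp_apply, Complex.conj_conj]

open ComplexConjugate in
theorem exists_vonMangoldtDiff_le {δ : ℝ} (hδ : 0 < δ) (hδ1 : δ ≤ 1) : ∃ c C : ℝ, 0 < c ∧ 0 < C ∧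
    ∀ (t : ℝ) (z : ℂ), ‖z - (1 + t * Complex.I)‖ ≤ c * Real.log (|t| + 3) ^ (-(2 / 3 + δ)) →
      DifferentiableAt ℂ vonMangoldtDiff z ∧
      ‖vonMangoldtDiff z‖ ≤ C * Real.log (|t| + 3) ^ 6 := by
  obtain ⟨T₀, C, hT₀, hC, h⟩ := exists_zeta_logDeriv_le hδ hδ1
  set K : Set ℂ := {z : ℂ | z.re = 1 ∧ |z.im| ≤ T₀} with hK
  have hKc : IsCompact K := by
    refine Metric.isCompact_of_isClosed_isBounded ?_ ?_
    · exact (isClosed_eq Complex.continuous_re continuous_const).inter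
        (isClosed_le (Complex.continuous_im.abs) continuous_const)
    · refine (Metric.isBounded_closedBall (x := (0 : ℂ)) (r := 1 + T₀)).subset fun z hz => ?_
      rw [mem_closedBall_zero_iff]
      refine (Complex.norm_le_abs_re_add_abs_im z).trans ?_
      rw [hz.1, abs_one]
      linarith [hz.2]
  have hUo : IsOpen {z : ℂ | riemannZeta₁ z ≠ 0} :=
    isOpen_ne_fun differentiable_riemannZeta₁.continuous continuous_const
  obtain ⟨e, he, heK⟩ := hKc.exists_cthickening_subset_open hUo
    (fun z hz => riemannZeta₁_ne_zero_of_one_le_re hz.1.ge)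
  obtain ⟨B, hB⟩ := (hKc.cthickening (r := e)).exists_bound_of_continuousOn
    (f := vonMangoldtDiff) (fun z hz =>
      (differentiableAt_vonMangoldtDiff (heK hz)).continuousAt.continuousWithinAt)
  refine ⟨min e 1, |B| + C + 3, lt_min he one_pos, by positivity, fun t z hz => ?_⟩
  set L := Real.log (|t| + 3) with hL
  have hL1 : 1 ≤ L := by
    rw [hL, Real.le_log_iff_exp_le (by positivity)]
    linarith [Real.exp_one_lt_d9, abs_nonneg t]
  have hL6 : 1 ≤ L ^ 6 := one_le_pow₀ hL1
  by_cases ht : |t| ≤ T₀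
  · have hzK : z ∈ Metric.cthickening e K := by
      refine Metric.mem_cthickening_of_dist_le z (1 + t * Complex.I) e K (by simp [hK, ht]) ?_
      rw [dist_eq_norm]
      refine hz.trans ?_
      calc min e 1 * L ^ (-(2 / 3 + δ)) ≤ e * 1 := by
            refine mul_le_mul (min_le_left _ _) ?_ (by positivity) he.le
            exact Real.rpow_le_one_of_one_le_of_nonpos hL1 (by linarith)
        _ = e := mul_one e
    refine ⟨differentiableAt_vonMangoldtDiff (heK hzK), (hB z hzK).trans ?_⟩
    nlinarith [le_abs_self B, abs_nonneg B]
  push Not at ht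
  have hlog : 0 < Real.log |t| := Real.log_pos (by linarith)
  have hlogL : Real.log |t| ≤ L := Real.log_le_log (by linarith) (by linarith)
  have hmain : ∀ w : ℂ, ‖w - (1 + (|t| : ℝ) * Complex.I)‖ ≤ min e 1 * L ^ (-(2 / 3 + δ)) →
      w ≠ 1 ∧ riemannZeta w ≠ 0 ∧ ‖riemannZeta w‖ ≤ C * L ^ 6 ∧
      ‖deriv riemannZeta w / riemannZeta w‖ ≤ 3 * L ^ 6 := by
    intro w hw
    obtain ⟨h1, h2, h3, h4⟩ := h |t| ht.le w (hw.trans (by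
      calc min e 1 * L ^ (-(2 / 3 + δ)) ≤ 1 * L ^ (-(2 / 3 + δ)) := by
            exact mul_le_mul_of_nonneg_right (min_le_right _ _) (by positivity)
        _ = L ^ (-(2 / 3 + δ)) := one_mul _
        _ ≤ _ := Real.rpow_le_rpow_of_nonpos hlog hlogL (by linarith)))
    refine ⟨h1, h2, h3.trans (by gcongr), h4.trans ?_⟩
    calc 3 * Real.log |t| ^ 3 ≤ 3 * L ^ 3 := by gcongr
      _ ≤ 3 * L ^ 6 :=
        mul_le_mul_of_nonneg_left (pow_le_pow_right₀ hL1 (by norm_num)) (by norm_num)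
  have hmain2 : z ≠ 1 ∧ riemannZeta z ≠ 0 ∧ ‖riemannZeta z‖ ≤ C * L ^ 6 ∧
      ‖deriv riemannZeta z / riemannZeta z‖ ≤ 3 * L ^ 6 := by
    rcases le_or_gt 0 t with h0 | h0
    · rw [abs_of_nonneg h0] at hmain
      exact hmain z hz
    · rw [abs_of_neg h0] at hmain
      have := hmain (conj z) (by
        refine le_trans (le_of_eq ?_) hz
        rw [← Complex.norm_conj]
        congr 1
        simp)
      rw [riemannZeta_conj, deriv_riemannZeta_conj, ← map_div₀, Complex.norm_conj,
        Complex.norm_conj] at this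
      refine ⟨fun hz1 => this.1 (by rw [hz1]; simp), fun hz0 => this.2.1 (by rw [hz0]; simp),
        this.2.2.1, this.2.2.2⟩
  obtain ⟨h1, h2, h3, h4⟩ := hmain2
  refine ⟨differentiableAt_vonMangoldtDiff (riemannZeta₁_ne_zero h1 h2), ?_⟩
  rw [vonMangoldtDiff_eq h1 h2]
  refine (norm_sub_le _ _).trans ?_
  rw [norm_neg]
  nlinarith [abs_nonneg B]

theorem norm_inv_sub_inv_le {s : ℂ} (hs : 1 ≤ s.re) :
    ‖1 / s - 1 / (s + 1)‖ ≤ (1 + s.im ^ 2)⁻¹ := by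
  have h0 : s ≠ 0 := fun h => by simp [h] at hs; linarith
  have h1 : s + 1 ≠ 0 := fun h => by
    have := congrArg Complex.re h
    simp at this; linarith
  rw [show 1 / s - 1 / (s + 1) = (s * (s + 1))⁻¹ by field_simp; ring, norm_inv]
  refine inv_anti₀ (by positivity) ?_
  rw [norm_mul]
  have e1 : 1 + s.im ^ 2 ≤ ‖s‖ ^ 2 := by
    rw [Complex.sq_norm, Complex.normSq_apply]; nlinarith
  have e2 : ‖s‖ ≤ ‖s + 1‖ := by
    refine le_of_sq_le_sq ?_ (norm_nonneg _)
    rw [Complex.sq_norm, Complex.sq_norm, Complex.normSq_apply, Complex.normSq_apply]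
    simp only [Complex.add_re, Complex.one_re, Complex.add_im, Complex.one_im]
    nlinarith
  nlinarith [norm_nonneg s]

theorem continuous_vertical_kernel {c : ℝ} (hc : 0 < c) :
    Continuous fun t : ℝ => 1 / ((c : ℂ) + t * Complex.I) - 1 / ((c : ℂ) + t * Complex.I + 1) := by
  have h0 (t : ℝ) : (c : ℂ) + t * Complex.I ≠ 0 := fun h => by
    have := congrArg Complex.re h
    simp at this; linarith
  have h1 (t : ℝ) : (c : ℂ) + t * Complex.I + 1 ≠ 0 := fun h => by
    have := congrArg Complex.re h
    simp at this; linarith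
  refine Continuous.sub (Continuous.div (by fun_prop) (by fun_prop) h0)
    (Continuous.div (by fun_prop) (by fun_prop) h1)

theorem integral_cpow_mul_kernel {c x : ℝ} (hc : 1 ≤ c) (hx : 0 < x) :
    ∫ t : ℝ, (x : ℂ) ^ (-((c : ℂ) + t * Complex.I)) *
      (1 / ((c : ℂ) + t * Complex.I) - 1 / ((c : ℂ) + t * Complex.I + 1)) =
    ((2 * π * max (1 - x) 0 : ℝ) : ℂ) := by
  set f : ℝ → ℂ := fun u => (Set.Ioc (0 : ℝ) 1).indicator (fun _ => (1 : ℂ)) u -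
    (Set.Ioc (0 : ℝ) 1).indicator (fun t : ℝ => (t : ℂ) ^ (1 : ℂ)) u with hf
  have hm (s : ℂ) (hs : 0 < s.re) : HasMellin f s (1 / s - 1 / (s + 1)) := by
    have h1 := hasMellin_one_Ioc hs
    have h2 := hasMellin_cpow_Ioc 1 (s := s) (by simp; linarith)
    have := hasMellin_sub h1.1 h2.1
    rwa [h1.2, h2.2] at this
  have hre (t : ℝ) : ((c : ℂ) + t * Complex.I).re = c := by simp
  have him (t : ℝ) : ((c : ℂ) + t * Complex.I).im = t := by simp
  have hmel (t : ℝ) : mellin f ((c : ℂ) + t * Complex.I) =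
      1 / ((c : ℂ) + t * Complex.I) - 1 / ((c : ℂ) + t * Complex.I + 1) :=
    (hm _ (by rw [hre]; linarith)).2
  have hfe : ∀ u : ℝ, 0 < u → f u = ((max (1 - u) 0 : ℝ) : ℂ) := by
    intro u hu
    simp only [hf, Set.indicator_apply, Set.mem_Ioc, hu, true_and, Complex.cpow_one]
    split_ifs with h
    · rw [max_eq_left (by linarith)]; push_cast; ring
    · rw [max_eq_right (by linarith)]; simp
  have key := mellinInv_mellin_eq c f hx (hm c (by simpa using by linarith)).1 ?_ ?_
  · rw [mellinInv, hfe x hx] at key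
    simp only [hmel, smul_eq_mul] at key
    rw [Complex.real_smul] at key
    have hpi : ((1 / (2 * π) : ℝ) : ℂ) * ((2 * π : ℝ) : ℂ) = 1 := by
      rw [← Complex.ofReal_mul]
      have : 1 / (2 * π) * (2 * π) = 1 := by field_simp
      rw [this]; simp
    rw [Complex.ofReal_mul, ← key, ← mul_assoc, mul_comm _ ((1 / (2 * π) : ℝ) : ℂ), hpi, one_mul]
  · rw [Complex.VerticalIntegrable]
    simp only [hmel]
    refine integrable_inv_one_add_sq.mono'
      (continuous_vertical_kernel (by linarith)).aestronglyMeasurable (.of_forall fun t => ?_)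
    have := norm_inv_sub_inv_le (s := (c : ℂ) + t * Complex.I) (by rw [hre]; exact hc)
    rwa [him] at this
  · have : ContinuousAt (fun u : ℝ => ((max (1 - u) 0 : ℝ) : ℂ)) x := by fun_prop
    refine this.congr ?_
    filter_upwards [lt_mem_nhds hx] with u hu using (hfe u hu).symm

theorem integral_LSeries_mul_kernel {a : ℕ → ℂ} {c X : ℝ} (hc : 1 ≤ c) (hX : 0 < X)
    (ha : LSeriesSummable a c) :
    ∫ t : ℝ, LSeries a ((c : ℂ) + t * Complex.I) * (X : ℂ) ^ ((c : ℂ) + t * Complex.I) *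
      (1 / ((c : ℂ) + t * Complex.I) - 1 / ((c : ℂ) + t * Complex.I + 1)) =
    2 * π * ∑ n ∈ Finset.Icc 1 ⌊X⌋₊, a n * (1 - n / X) := by
  have hre (t : ℝ) : ((c : ℂ) + t * Complex.I).re = c := by simp
  have him (t : ℝ) : ((c : ℂ) + t * Complex.I).im = t := by simp
  set G : ℕ → ℝ → ℂ := fun n t => LSeries.term a ((c : ℂ) + t * Complex.I) n *
    (X : ℂ) ^ ((c : ℂ) + t * Complex.I) *
      (1 / ((c : ℂ) + t * Complex.I) - 1 / ((c : ℂ) + t * Complex.I + 1)) with hG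
  have hGn (n : ℕ) (hn : n ≠ 0) (t : ℝ) : G n t = a n * (((n / X : ℝ) : ℂ) ^
      (-((c : ℂ) + t * Complex.I)) *
      (1 / ((c : ℂ) + t * Complex.I) - 1 / ((c : ℂ) + t * Complex.I + 1))) := by
    simp only [hG]
    rw [LSeries.term_of_ne_zero hn, div_eq_mul_inv (n : ℝ) X, Complex.ofReal_mul,
      Complex.mul_cpow_ofReal_nonneg (by positivity) (by positivity), Complex.ofReal_inv,
      Complex.inv_cpow, Complex.cpow_neg, Complex.cpow_neg, inv_inv]
    · push_cast; ring
    · rw [Complex.arg_ofReal_of_nonneg hX.le]; exact pi_pos.ne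
  have hG0 (t : ℝ) : G 0 t = 0 := by simp [hG]
  have hbd (n : ℕ) (t : ℝ) : ‖G n t‖ ≤ ‖LSeries.term a c n‖ * X ^ c * (1 + t ^ 2)⁻¹ := by
    simp only [hG]
    rw [norm_mul, norm_mul, Complex.norm_cpow_eq_rpow_re_of_pos hX, hre, LSeries.norm_term_eq,
      LSeries.norm_term_eq, hre, Complex.ofReal_re]
    have := norm_inv_sub_inv_le (s := (c : ℂ) + t * Complex.I) (by rw [hre]; exact hc)
    rw [him] at this
    refine mul_le_mul_of_nonneg_left this ?_
    split_ifs <;> positivity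
  have hcont (n : ℕ) : Continuous (G n) := by
    rcases eq_or_ne n 0 with rfl | hn
    · rw [show G 0 = fun _ => 0 from funext hG0]; exact continuous_const
    rw [show G n = _ from funext (hGn n hn)]
    have hnX : ((n / X : ℝ) : ℂ) ≠ 0 := by
      rw [Complex.ofReal_ne_zero]; positivity
    exact continuous_const.mul ((Continuous.const_cpow (by fun_prop) (Or.inl hnX)).mul
      (continuous_vertical_kernel (by linarith)))
  have hInt (n : ℕ) : MeasureTheory.Integrable (G n) :=
    (integrable_inv_one_add_sq.const_mul (‖LSeries.term a c n‖ * X ^ c)).mono'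
      (hcont n).aestronglyMeasurable (.of_forall (hbd n))
  have hS : Summable fun n => ∫ t, ‖G n t‖ := by
    refine Summable.of_nonneg_of_le (fun n => MeasureTheory.integral_nonneg fun t => norm_nonneg _)
      (fun n => ?_) (ha.norm.mul_right (X ^ c * π))
    calc ∫ t, ‖G n t‖ ≤ ∫ t : ℝ, ‖LSeries.term a c n‖ * X ^ c * (1 + t ^ 2)⁻¹ :=
          MeasureTheory.integral_mono (hInt n).norm (integrable_inv_one_add_sq.const_mul _) (hbd n)
      _ = _ := by rw [MeasureTheory.integral_const_mul, integral_univ_inv_one_add_sq]; ring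
  have key := MeasureTheory.integral_tsum_of_summable_integral_norm hInt hS
  have e1 (t : ℝ) : ∑' n, G n t = LSeries a ((c : ℂ) + t * Complex.I) *
      (X : ℂ) ^ ((c : ℂ) + t * Complex.I) *
      (1 / ((c : ℂ) + t * Complex.I) - 1 / ((c : ℂ) + t * Complex.I + 1)) := by
    simp only [hG]
    rw [tsum_mul_right, tsum_mul_right, LSeries]
  simp only [e1] at key
  rw [← key]
  have e2 (n : ℕ) (hn : n ≠ 0) : ∫ t, G n t =
      2 * π * (a n * ((max (1 - n / X) 0 : ℝ) : ℂ)) := by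
    simp only [hGn n hn]
    rw [MeasureTheory.integral_const_mul, integral_cpow_mul_kernel hc (by positivity)]
    push_cast; ring
  rw [tsum_eq_sum (s := Finset.Icc 1 ⌊X⌋₊), Finset.mul_sum]
  · refine Finset.sum_congr rfl fun n hn => ?_
    rw [Finset.mem_Icc] at hn
    have : (n : ℝ) ≤ X := (Nat.le_floor_iff hX.le).1 hn.2
    rw [e2 n (by omega), max_eq_left]
    · push_cast; ring
    · rw [sub_nonneg, div_le_one hX]; exact this
  · intro n hn
    rcases eq_or_ne n 0 with rfl | hn0
    · simp [hG0]
    rw [e2 n hn0, max_eq_right]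
    · simp
    · rw [sub_nonpos, one_le_div hX]
      by_contra! h
      exact hn (Finset.mem_Icc.2 ⟨by omega, Nat.le_floor h.le⟩)

theorem LSeries_vonMangoldt_sub_one {s : ℂ} (hs : 1 < s.re) :
    LSeriesSummable (fun n => (ArithmeticFunction.vonMangoldt n : ℂ) - 1) s ∧
    LSeries (fun n => (ArithmeticFunction.vonMangoldt n : ℂ) - 1) s = vonMangoldtDiff s := by
  have h1 := ArithmeticFunction.LSeriesSummable_vonMangoldt hs
  have h2 : LSeriesSummable 1 s := LSeriesSummable_one_iff.2 hs
  have hs1 : s ≠ 1 := fun h => by simp [h] at hs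
  refine ⟨h1.sub h2, ?_⟩
  have := LSeries_sub h1 h2
  rw [LSeries_one_eq_riemannZeta hs,
    ArithmeticFunction.LSeries_vonMangoldt_eq_deriv_riemannZeta_div hs] at this
  rw [vonMangoldtDiff_eq hs1 (riemannZeta_ne_zero_of_one_le_re hs.le), ← neg_div, ← this]
  rfl

theorem exists_norm_vonMangoldtDiff_le : ∃ K : ℝ, 0 < K ∧ ∀ c : ℝ, 1 < c → c ≤ 3 → ∀ t : ℝ,
    ‖vonMangoldtDiff ((c : ℂ) + t * Complex.I)‖ ≤ K / (c - 1) := by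
  obtain ⟨K, hK, h⟩ := exists_tsum_rpow_le
  obtain ⟨A, hA, h'⟩ := exists_neg_logDeriv_zeta_le
  refine ⟨K + 1 + 2 * A, by positivity, fun c h1 h3 t => ?_⟩
  have hre : ((c : ℂ) + t * Complex.I).re = c := by simp
  have hre' : 1 < ((c : ℂ) + t * Complex.I).re := by rw [hre]; exact h1
  rw [← (LSeries_vonMangoldt_sub_one hre').2]
  have e1 := neg_re_logDeriv_zeta_eq (s := (c : ℂ)) (by simpa using h1)
  have e2 : Summable fun n : ℕ => 1 / (n : ℝ) ^ c := Real.summable_one_div_nat_rpow.2 h1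
  have e3 := e1.add e2.hasSum
  have e4 : ‖LSeries (fun n => (ArithmeticFunction.vonMangoldt n : ℂ) - 1)
      ((c : ℂ) + t * Complex.I)‖ ≤ (-(deriv riemannZeta c / riemannZeta c)).re +
        ∑' n : ℕ, 1 / (n : ℝ) ^ c := by
    refine tsum_of_norm_bounded e3 fun n => ?_
    rw [LSeries.norm_term_eq, hre]
    rcases eq_or_ne n 0 with rfl | hn
    · simp; positivity
    rw [if_neg hn]
    have hΛ := ArithmeticFunction.vonMangoldt_nonneg (n := n)
    simp only [Complex.ofReal_re, Complex.ofReal_im, zero_mul, Real.cos_zero, mul_one]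
    rw [Real.rpow_neg (Nat.cast_nonneg n), ← div_eq_mul_inv, ← add_div]
    gcongr
    refine (norm_sub_le _ _).trans ?_
    rw [norm_one, Complex.norm_real, Real.norm_of_nonneg hΛ]
  refine e4.trans ((add_le_add (h' c h1 h3) (h c h1 h3)).trans ?_)
  have h0 : 0 < c - 1 := by linarith
  rw [div_add' _ _ _ h0.ne', ← add_div]
  refine div_le_div_of_nonneg_right ?_ h0.le
  nlinarith

theorem norm_inv_sub_inv_le_four_mul {s : ℂ} (hs : 1 / 2 ≤ s.re) :
    ‖1 / s - 1 / (s + 1)‖ ≤ 4 * (1 + s.im ^ 2)⁻¹ := by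
  have h0 : s ≠ 0 := fun h => by simp [h] at hs; linarith
  have h1 : s + 1 ≠ 0 := fun h => by
    have := congrArg Complex.re h
    simp at this; linarith
  rw [show 1 / s - 1 / (s + 1) = (s * (s + 1))⁻¹ by field_simp; ring, norm_inv,
    show 4 * (1 + s.im ^ 2)⁻¹ = ((1 + s.im ^ 2) / 4)⁻¹ by rw [inv_div]; rfl]
  refine inv_anti₀ (by positivity) ?_
  rw [norm_mul]
  have e1 : (1 + s.im ^ 2) / 4 ≤ ‖s‖ ^ 2 := by
    rw [Complex.sq_norm, Complex.normSq_apply]; nlinarith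
  have e2 : ‖s‖ ≤ ‖s + 1‖ := by
    refine le_of_sq_le_sq ?_ (norm_nonneg _)
    rw [Complex.sq_norm, Complex.sq_norm, Complex.normSq_apply, Complex.normSq_apply]
    simp only [Complex.add_re, Complex.one_re, Complex.add_im, Complex.one_im]
    nlinarith
  nlinarith [norm_nonneg s]

theorem norm_integral_sub_intervalIntegral_le {g : ℝ → ℂ} (hg : Continuous g) {D T : ℝ}
    (hT : 0 < T) (hD : ∀ t, ‖g t‖ ≤ D * (1 + t ^ 2)⁻¹) :
    ‖(∫ t, g t) - ∫ t in -T..T, g t‖ ≤ 2 * D / T := by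
  have hInt : MeasureTheory.Integrable g :=
    (integrable_inv_one_add_sq.const_mul D).mono' hg.aestronglyMeasurable (.of_forall hD)
  have hD0 : 0 ≤ D := by simpa using (norm_nonneg _).trans (hD 0)
  rw [intervalIntegral.integral_of_le (by linarith),
    ← MeasureTheory.setIntegral_compl₀ measurableSet_Ioc.nullMeasurableSet hInt]
  calc ‖∫ t in (Set.Ioc (-T) T)ᶜ, g t‖ ≤ ∫ t in (Set.Ioc (-T) T)ᶜ, D * (1 + t ^ 2)⁻¹ :=
        MeasureTheory.norm_integral_le_of_norm_le
          (integrable_inv_one_add_sq.const_mul D).integrableOn (.of_forall hD)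
    _ = D * (π - (arctan T - arctan (-T))) := by
        rw [MeasureTheory.setIntegral_compl₀ measurableSet_Ioc.nullMeasurableSet
          (integrable_inv_one_add_sq.const_mul D), ← intervalIntegral.integral_of_le (by linarith),
          MeasureTheory.integral_const_mul, intervalIntegral.integral_const_mul,
          integral_univ_inv_one_add_sq, integral_inv_one_add_sq]
        ring
    _ = 2 * D * arctan T⁻¹ := by rw [arctan_inv_of_pos hT, arctan_neg]; ring
    _ ≤ 2 * D * T⁻¹ := by
        refine mul_le_mul_of_nonneg_left ?_ (by positivity)
        have := Real.le_tan (arctan_nonneg.2 (inv_nonneg.2 hT.le)) (arctan_lt_pi_div_two T⁻¹)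
        rwa [tan_arctan] at this
    _ = _ := by rw [div_eq_mul_inv]

theorem norm_sum_vonMangoldt_sub_one_le {K : ℝ}
    (hK : ∀ c : ℝ, 1 < c → c ≤ 3 → ∀ t : ℝ,
      ‖vonMangoldtDiff ((c : ℂ) + t * Complex.I)‖ ≤ K / (c - 1))
    {X r T M : ℝ} (hX : 1 ≤ X) (hr : 0 < r) (hr2 : r ≤ 1 / 2) (hT : 1 ≤ T)
    (hF : ∀ z : ℂ, |z.re - 1| ≤ r → |z.im| ≤ T →
      DifferentiableAt ℂ vonMangoldtDiff z ∧ ‖vonMangoldtDiff z‖ ≤ M) :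
    |∑ n ∈ Finset.Icc 1 ⌊X⌋₊, (ArithmeticFunction.vonMangoldt n - 1) * (1 - n / X)| ≤
      K * X ^ (1 + r) / (r * T) + 2 * M * X ^ (1 - r) + 2 * M * X ^ (1 + r) / T ^ 2 := by
  have hX0 : 0 < X := by linarith
  have hre (c t : ℝ) : ((c : ℂ) + t * Complex.I).re = c := by simp
  have him (c t : ℝ) : ((c : ℂ) + t * Complex.I).im = t := by simp
  have hM : 0 ≤ M := (norm_nonneg _).trans (hF 1 (by simpa using hr.le) (by simp; linarith)).2
  set G : ℂ → ℂ := fun s => vonMangoldtDiff s * (X : ℂ) ^ s * (1 / s - 1 / (s + 1)) with hG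
  have hXc : (X : ℂ) ≠ 0 := by exact_mod_cast hX0.ne'
  have hGd (z : ℂ) (hz : 0 < z.re) (hz' : DifferentiableAt ℂ vonMangoldtDiff z) :
      DifferentiableAt ℂ G z := by
    have h0 : z ≠ 0 := fun h => by simp [h] at hz
    have h1 : z + 1 ≠ 0 := fun h => by
      have := congrArg Complex.re h
      simp at this; linarith
    have hp : DifferentiableAt ℂ (fun s : ℂ => (X : ℂ) ^ s) z :=
      differentiableAt_id.const_cpow (Or.inl hXc)
    have h3 : DifferentiableAt ℂ (fun s : ℂ => 1 / s) z :=
      (differentiableAt_const _).div differentiableAt_id h0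
    have h4 : DifferentiableAt ℂ (fun s : ℂ => 1 / (s + 1)) z :=
      (differentiableAt_const _).div (differentiableAt_id.add_const 1) h1
    exact (hz'.mul hp).mul (h3.sub h4)
  have hGb (z : ℂ) (hz : |z.re - 1| ≤ r) (hz' : |z.im| ≤ T) :
      ‖G z‖ ≤ 4 * M * X ^ z.re * (1 + z.im ^ 2)⁻¹ := by
    simp only [hG]
    rw [norm_mul, norm_mul, Complex.norm_cpow_eq_rpow_re_of_pos hX0]
    have h1 := (hF z hz hz').2
    have h2 := norm_inv_sub_inv_le_four_mul (s := z) (by linarith [(abs_le.1 hz).1])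
    calc _ ≤ M * X ^ z.re * (4 * (1 + z.im ^ 2)⁻¹) := by
          refine mul_le_mul ?_ h2 (norm_nonneg _) (by positivity)
          exact mul_le_mul_of_nonneg_right h1 (by positivity)
      _ = _ := by ring
  have hv : ∫ t : ℝ, G ((1 + r : ℝ) + t * Complex.I) =
      2 * π * ∑ n ∈ Finset.Icc 1 ⌊X⌋₊,
        ((ArithmeticFunction.vonMangoldt n : ℂ) - 1) * (1 - n / X) := by
    rw [← integral_LSeries_mul_kernel (c := 1 + r) (by linarith) hX0
      (LSeries_vonMangoldt_sub_one (s := ((1 + r : ℝ) : ℂ))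
        (by rw [Complex.ofReal_re]; linarith)).1]
    congr 1
    funext t
    simp only [hG]
    rw [(LSeries_vonMangoldt_sub_one (s := ((1 + r : ℝ) : ℂ) + t * Complex.I)
      (by rw [hre]; linarith)).2]
  have htail := norm_integral_sub_intervalIntegral_le
    (g := fun t : ℝ => G ((1 + r : ℝ) + t * Complex.I)) (D := K / r * X ^ (1 + r)) (T := T) ?_
    (by linarith) ?_
  rotate_left
  · refine continuous_iff_continuousAt.2 fun t => ?_
    have := (hGd ((1 + r : ℝ) + t * Complex.I) (by rw [hre]; linarith)
      (differentiableAt_vonMangoldtDiff (riemannZeta₁_ne_zero_of_one_le_re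
        (by rw [hre]; linarith)))).continuousAt
    exact ContinuousAt.comp (f := fun t : ℝ => ((1 + r : ℝ) : ℂ) + t * Complex.I) this
      (by fun_prop)
  · intro t
    simp only [hG]
    rw [norm_mul, norm_mul, Complex.norm_cpow_eq_rpow_re_of_pos hX0, hre]
    have h1 := hK (1 + r) (by linarith) (by linarith) t
    rw [add_sub_cancel_left] at h1
    have h2 := norm_inv_sub_inv_le (s := ((1 + r : ℝ) : ℂ) + t * Complex.I)
      (by rw [hre]; linarith)
    rw [him] at h2
    have h3 : 0 ≤ K / r := (norm_nonneg _).trans h1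
    refine mul_le_mul ?_ h2 (norm_nonneg _) (by positivity)
    exact mul_le_mul_of_nonneg_right h1 (by positivity)
  have hrect := Complex.integral_boundary_rect_eq_zero_of_differentiableOn G
    (((1 - r : ℝ) : ℂ) + (-T : ℝ) * Complex.I) (((1 + r : ℝ) : ℂ) + (T : ℝ) * Complex.I) (by
      intro z hz
      rw [Complex.mem_reProdIm, hre, hre, him, him, Set.uIcc_of_le (by linarith),
        Set.uIcc_of_le (by linarith)] at hz
      refine (hGd z (by linarith [hz.1.1]) (hF z ?_ ?_).1).differentiableWithinAt
      · rw [abs_le]; constructor <;> linarith [hz.1.1, hz.1.2]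
      · rw [abs_le]; exact hz.2)
  simp only [hre, him] at hrect
  have hhor (τ : ℝ) (hτ : |τ| = T) :
      ‖∫ x in (1 - r)..(1 + r), G (x + τ * Complex.I)‖ ≤ 4 * M * X ^ (1 + r) / T ^ 2 := by
    have := intervalIntegral.norm_integral_le_of_norm_le_const (a := 1 - r) (b := 1 + r)
      (f := fun x : ℝ => G (x + τ * Complex.I)) (C := 4 * M * X ^ (1 + r) / T ^ 2) (by
        intro x hx
        rw [Set.uIoc_of_le (by linarith)] at hx
        refine (hGb _ (by rw [hre, abs_le]; constructor <;> linarith [hx.1, hx.2])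
          (by rw [him, hτ])).trans ?_
        rw [hre, him, ← sq_abs, hτ, div_eq_mul_inv]
        have h1 : X ^ x ≤ X ^ (1 + r) := Real.rpow_le_rpow_of_exponent_le hX hx.2
        have h2 : (1 + T ^ 2)⁻¹ ≤ (T ^ 2)⁻¹ := inv_anti₀ (by positivity) (by linarith)
        gcongr)
    refine this.trans (mul_le_of_le_one_right (by positivity) ?_)
    rw [abs_of_nonneg (by linarith)]
    linarith
  have hleft : ‖∫ y in -T..T, G (((1 - r : ℝ) : ℂ) + y * Complex.I)‖ ≤
      4 * M * X ^ (1 - r) * π := by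
    have h1 := intervalIntegral.norm_integral_le_of_norm_le (a := -T) (b := T)
      (f := fun y : ℝ => G (((1 - r : ℝ) : ℂ) + y * Complex.I))
      (g := fun y : ℝ => 4 * M * X ^ (1 - r) * (1 + y ^ 2)⁻¹) (μ := MeasureTheory.volume)
      (by linarith) (.of_forall fun y hy => by
        have := hGb (((1 - r : ℝ) : ℂ) + y * Complex.I)
          (by rw [hre, abs_le]; constructor <;> linarith)
          (by rw [him, abs_le]; exact ⟨hy.1.le, hy.2⟩)
        rwa [hre, him] at this)
      ((integrable_inv_one_add_sq.const_mul _).intervalIntegrable)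
    refine h1.trans ?_
    rw [intervalIntegral.integral_const_mul, integral_inv_one_add_sq, arctan_neg]
    refine mul_le_mul_of_nonneg_left ?_ (by positivity)
    linarith [arctan_lt_pi_div_two T]
  have h1 := hhor (-T) (by rw [abs_neg, abs_of_nonneg (by linarith)])
  have h2 := hhor T (abs_of_nonneg (by linarith))
  have hmid : ‖∫ y in -T..T, G (((1 + r : ℝ) : ℂ) + y * Complex.I)‖ ≤
      4 * M * X ^ (1 - r) * π + 8 * M * X ^ (1 + r) / T ^ 2 := by
    set A := ∫ x in (1 - r)..(1 + r), G (x + (-T : ℝ) * Complex.I)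
    set B := ∫ x in (1 - r)..(1 + r), G (x + T * Complex.I)
    set R := ∫ y in -T..T, G (((1 + r : ℝ) : ℂ) + y * Complex.I)
    set L := ∫ y in -T..T, G (((1 - r : ℝ) : ℂ) + y * Complex.I)
    have e : Complex.I * R = Complex.I * L + B - A := by
      simp only [smul_eq_mul] at hrect
      linear_combination hrect
    have e2 := congrArg norm e
    rw [norm_mul, Complex.norm_I, one_mul] at e2
    rw [e2]
    have e3 := norm_sub_le (Complex.I * L + B) A
    have e4 := norm_add_le (Complex.I * L) B
    rw [norm_mul, Complex.norm_I, one_mul] at e4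
    have e5 : 8 * M * X ^ (1 + r) / T ^ 2 =
      4 * M * X ^ (1 + r) / T ^ 2 + 4 * M * X ^ (1 + r) / T ^ 2 := by ring
    linarith
  rw [hv] at htail
  set S := ∑ n ∈ Finset.Icc 1 ⌊X⌋₊, (ArithmeticFunction.vonMangoldt n - 1) * (1 - n / X) with hS
  have hSc : ∑ n ∈ Finset.Icc 1 ⌊X⌋₊,
      ((ArithmeticFunction.vonMangoldt n : ℂ) - 1) * (1 - n / X) = (S : ℂ) := by
    rw [hS]; push_cast; rfl
  rw [hSc] at htail
  have hfin : ‖(2 * π * S : ℂ)‖ ≤ 2 * (K / r * X ^ (1 + r)) / T +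
      (4 * M * X ^ (1 - r) * π + 8 * M * X ^ (1 + r) / T ^ 2) :=
    (norm_le_norm_sub_add _ _).trans (add_le_add htail hmid)
  have hn : ‖(2 * π * S : ℂ)‖ = 2 * π * |S| := by
    rw [norm_mul, norm_mul, Complex.norm_real, Complex.norm_real, Real.norm_of_nonneg pi_pos.le]
    simp
  rw [hn] at hfin
  have hp := Real.pi_gt_three
  have e1 : 0 ≤ K * X ^ (1 + r) / (r * T) := by
    have : 0 ≤ K / r := by
      have := (norm_nonneg _).trans (hK (1 + r) (by linarith) (by linarith) 0)
      rwa [add_sub_cancel_left] at this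
    rw [show K * X ^ (1 + r) / (r * T) = K / r * (X ^ (1 + r) / T) by field_simp]
    positivity
  have e2 : 2 * (K / r * X ^ (1 + r)) / T = 2 * (K * X ^ (1 + r) / (r * T)) := by field_simp
  have e3 : 0 ≤ M * X ^ (1 + r) / T ^ 2 := by positivity
  have e4 : 0 ≤ M * X ^ (1 - r) := by positivity
  rw [e2] at hfin
  have e5 : 8 * M * X ^ (1 + r) / T ^ 2 = 8 * (M * X ^ (1 + r) / T ^ 2) := by ring
  have e6 : 2 * M * X ^ (1 + r) / T ^ 2 = 2 * (M * X ^ (1 + r) / T ^ 2) := by ring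
  rw [e5] at hfin
  rw [e6]
  refine le_of_mul_le_mul_left (hfin.trans ?_) (by positivity : (0 : ℝ) < 2 * π)
  nlinarith

theorem eventually_sum_vonMangoldt_sub_one_le {δ : ℝ} (hδ : 0 < δ) (hδ1 : δ < 3 / 5) :
    ∀ᶠ X : ℝ in Filter.atTop,
      |∑ n ∈ Finset.Icc 1 ⌊X⌋₊, (ArithmeticFunction.vonMangoldt n - 1) * (1 - n / X)| ≤
        X * Real.exp (-(Real.log X) ^ (3 / 5 - δ)) := by
  obtain ⟨K, hK, hK'⟩ := exists_norm_vonMangoldtDiff_le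
  obtain ⟨c, C, hc, hC, hF⟩ := exists_vonMangoldtDiff_le hδ (by linarith)
  set κ : ℝ := c * 2 ^ (-(2 / 3 + δ)) with hκ
  have hκ0 : 0 < κ := by positivity
  set b : ℝ := 3 / 5 - δ with hb
  have hb0 : 0 < b := by rw [hb]; linarith
  set e : ℝ := 3 / 5 - 3 * δ / 5 with he
  have hbe : b < e := by rw [hb, he]; linarith
  have he35 : e < 3 / 5 := by rw [he]; linarith
  have hevL : ∀ᶠ ℓ : ℝ in Filter.atTop, 8 ≤ ℓ ∧ 3 * (K / κ) * ℓ ^ (1 - e) ≤ Real.exp (ℓ ^ b) ∧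
      (κ + 2) * ℓ ^ e ≤ ℓ ^ (3 / 5 : ℝ) ∧ 3 * (128 * C) * ℓ ^ (18 / 5 : ℝ) ≤ Real.exp (ℓ ^ b) ∧
      2 / κ * ℓ ^ b ≤ ℓ ^ e ∧ κ * ℓ ^ (e - 1) ≤ ℓ ^ (0 : ℝ) / 2 := by
    filter_upwards [Filter.eventually_ge_atTop 8, eventually_mul_rpow_le_exp (3 * (K / κ)) (1 - e) hb0,
      eventually_mul_rpow_le_rpow (κ + 2) he35,
      eventually_mul_rpow_le_exp (3 * (128 * C)) (18 / 5) hb0,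
      eventually_mul_rpow_le_rpow (2 / κ) hbe,
      eventually_mul_rpow_le_rpow (2 * κ) (show e - 1 < 0 by linarith)] with ℓ h1 h2 h3 h4 h5 h6
    exact ⟨h1, h2, h3, h4, h5, by linarith⟩
  filter_upwards [Real.tendsto_log_atTop.eventually hevL, Filter.eventually_ge_atTop 1]
    with X ⟨h1, h2, h3, h4, h5, h6⟩ hX1
  set ℓ := Real.log X with hℓ
  have hX0 : 0 < X := by linarith
  have hℓ0 : 0 < ℓ := by linarith
  have hXe : Real.exp ℓ = X := Real.exp_log hX0
  set v : ℝ := ℓ ^ (3 / 5 : ℝ) with hv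
  have hv2 : 2 ≤ v := by
    have : (8 : ℝ) ^ (3 / 5 : ℝ) ≤ v := Real.rpow_le_rpow (by norm_num) h1 (by norm_num)
    refine le_trans ?_ this
    have h8 : (8 : ℝ) ^ (1 / 3 : ℝ) = 2 := by
      rw [show (8 : ℝ) = 2 ^ (3 : ℝ) by norm_num, ← Real.rpow_mul (by norm_num)]
      norm_num
    calc (2 : ℝ) = 8 ^ (1 / 3 : ℝ) := h8.symm
      _ ≤ _ := Real.rpow_le_rpow_of_exponent_le (by norm_num) (by norm_num)
  set T : ℝ := Real.exp v with hT
  have hT3 : 3 ≤ T := by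
    have := Real.add_one_le_exp v
    rw [hT]; linarith
  have hlogT : Real.log (T + 3) ≤ 2 * v := by
    rw [Real.log_le_iff_le_exp (by linarith), two_mul, Real.exp_add, ← hT]
    nlinarith
  set r : ℝ := κ * ℓ ^ (e - 1) with hr
  have hr0 : 0 < r := by positivity
  rw [Real.rpow_zero] at h6
  have hrc : r = c * (2 * v) ^ (-(2 / 3 + δ)) := by
    rw [hr, hκ, hv, Real.mul_rpow (by norm_num) (by positivity), ← Real.rpow_mul hℓ0.le, mul_assoc]
    congr 3
    rw [he]; ring
  have hrl : r * ℓ = κ * ℓ ^ e := by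
    rw [hr, mul_assoc, ← Real.rpow_add_one hℓ0.ne']
    congr 2; ring
  have hbd := norm_sum_vonMangoldt_sub_one_le hK' hX1 hr0 (by linarith) (T := T) (by linarith)
    (M := C * (2 * v) ^ 6) (by
      intro z hz1 hz2
      have hlog1 : 1 ≤ Real.log (|z.im| + 3) := by
        rw [Real.le_log_iff_exp_le (by positivity)]
        linarith [Real.exp_one_lt_d9, abs_nonneg z.im]
      have hlog2 : Real.log (|z.im| + 3) ≤ 2 * v :=
        (Real.log_le_log (by positivity) (by linarith)).trans hlogT
      have := hF z.im z (by
        have e1 : z - (1 + z.im * Complex.I) = ((z.re - 1 : ℝ) : ℂ) := by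
          apply Complex.ext <;> simp
        rw [e1, Complex.norm_real, Real.norm_eq_abs]
        refine hz1.trans ?_
        rw [hrc]
        refine mul_le_mul_of_nonneg_left ?_ hc.le
        exact Real.rpow_le_rpow_of_nonpos (by linarith) hlog2 (by linarith))
      refine ⟨this.1, this.2.trans (mul_le_mul_of_nonneg_left ?_ hC.le)⟩
      exact pow_le_pow_left₀ (by linarith) hlog2 6)
  refine hbd.trans ?_
  have hXp : X ^ (1 + r) = X * Real.exp (κ * ℓ ^ e) := by
    rw [Real.rpow_add hX0, Real.rpow_one, Real.rpow_def_of_pos hX0, ← hℓ, ← hrl, mul_comm ℓ]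
  have hXm : X ^ (1 - r) = X * Real.exp (-(κ * ℓ ^ e)) := by
    rw [sub_eq_add_neg, Real.rpow_add hX0, Real.rpow_one, Real.rpow_def_of_pos hX0, ← hℓ, ← hrl]
    congr 2; ring
  have hv6 : (2 * v) ^ 6 = 64 * ℓ ^ (18 / 5 : ℝ) := by
    rw [mul_pow, hv, ← Real.rpow_natCast, ← Real.rpow_natCast, ← Real.rpow_mul hℓ0.le]
    norm_num
  have hbe' : ℓ ^ b ≤ ℓ ^ e := Real.rpow_le_rpow_of_exponent_le (by linarith) hbe.le
  have h5' : 2 * ℓ ^ b ≤ κ * ℓ ^ e := by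
    rw [div_mul_eq_mul_div, div_le_iff₀ hκ0] at h5
    linarith
  have hKr : K / r = K / κ * ℓ ^ (1 - e) := by
    rw [hr, show e - 1 = -(1 - e) by ring, Real.rpow_neg hℓ0.le]
    field_simp
  have t1 : K * X ^ (1 + r) / (r * T) ≤ X * Real.exp (-ℓ ^ b) / 3 := by
    rw [hXp, show K * (X * Real.exp (κ * ℓ ^ e)) / (r * T) =
      X * ((K / r) * (Real.exp (κ * ℓ ^ e) / T)) by field_simp, mul_div_assoc]
    refine mul_le_mul_of_nonneg_left ?_ hX0.le
    rw [hKr, hT, ← Real.exp_sub]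
    have e1 : Real.exp (κ * ℓ ^ e - v) ≤ Real.exp (-ℓ ^ b) * Real.exp (-ℓ ^ b) := by
      rw [← Real.exp_add]
      refine Real.exp_le_exp.2 ?_
      linarith
    have e2 : Real.exp (ℓ ^ b) * Real.exp (-ℓ ^ b) = 1 := by rw [← Real.exp_add]; simp
    calc K / κ * ℓ ^ (1 - e) * Real.exp (κ * ℓ ^ e - v)
        ≤ (Real.exp (ℓ ^ b) / 3) * (Real.exp (-ℓ ^ b) * Real.exp (-ℓ ^ b)) :=
          mul_le_mul (by linarith) e1 (Real.exp_pos _).le (by positivity)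
      _ = (Real.exp (ℓ ^ b) * Real.exp (-ℓ ^ b)) * Real.exp (-ℓ ^ b) / 3 := by ring
      _ = _ := by rw [e2, one_mul]
  have hcore : 128 * C * ℓ ^ (18 / 5 : ℝ) * Real.exp (-(κ * ℓ ^ e)) ≤ Real.exp (-ℓ ^ b) / 3 := by
    have e1 : Real.exp (-(κ * ℓ ^ e)) ≤ Real.exp (-ℓ ^ b) * Real.exp (-ℓ ^ b) := by
      rw [← Real.exp_add]
      refine Real.exp_le_exp.2 ?_
      linarith
    have e2 : Real.exp (ℓ ^ b) * Real.exp (-ℓ ^ b) = 1 := by rw [← Real.exp_add]; simp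
    calc 128 * C * ℓ ^ (18 / 5 : ℝ) * Real.exp (-(κ * ℓ ^ e))
        ≤ (Real.exp (ℓ ^ b) / 3) * (Real.exp (-ℓ ^ b) * Real.exp (-ℓ ^ b)) :=
          mul_le_mul (by linarith) e1 (Real.exp_pos _).le (by positivity)
      _ = (Real.exp (ℓ ^ b) * Real.exp (-ℓ ^ b)) * Real.exp (-ℓ ^ b) / 3 := by ring
      _ = _ := by rw [e2, one_mul]
  have t2 : 2 * (C * (2 * v) ^ 6) * X ^ (1 - r) ≤ X * Real.exp (-ℓ ^ b) / 3 := by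
    rw [hXm, hv6]
    calc _ = X * (128 * C * ℓ ^ (18 / 5 : ℝ) * Real.exp (-(κ * ℓ ^ e))) := by ring
      _ ≤ X * (Real.exp (-ℓ ^ b) / 3) := mul_le_mul_of_nonneg_left hcore hX0.le
      _ = _ := by ring
  have t3 : 2 * (C * (2 * v) ^ 6) * X ^ (1 + r) / T ^ 2 ≤ X * Real.exp (-ℓ ^ b) / 3 := by
    rw [hXp, hv6, hT, ← Real.exp_nat_mul]
    have e1 : Real.exp (κ * ℓ ^ e) / Real.exp ((2 : ℕ) * v) ≤ Real.exp (-(κ * ℓ ^ e)) := by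
      rw [← Real.exp_sub]
      refine Real.exp_le_exp.2 ?_
      have : 0 < ℓ ^ e := by positivity
      push_cast
      linarith
    calc _ = X * (128 * C * ℓ ^ (18 / 5 : ℝ) *
          (Real.exp (κ * ℓ ^ e) / Real.exp ((2 : ℕ) * v))) := by ring
      _ ≤ X * (128 * C * ℓ ^ (18 / 5 : ℝ) * Real.exp (-(κ * ℓ ^ e))) := by
          refine mul_le_mul_of_nonneg_left ?_ hX0.le
          exact mul_le_mul_of_nonneg_left e1 (by positivity)
      _ ≤ X * (Real.exp (-ℓ ^ b) / 3) := mul_le_mul_of_nonneg_left hcore hX0.le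
      _ = _ := by ring
  linarith

theorem sum_Icc_sub_nat_cast (N : ℕ) (z : ℝ) :
    ∑ n ∈ Finset.Icc 1 N, (z - n) = N * z - N * (N + 1) / 2 := by
  induction N with
  | zero => simp
  | succ N ih => rw [Finset.sum_Icc_succ_top (by omega), ih]; push_cast; ring

theorem abs_sum_vonMangoldt_mul_sub_le {z : ℝ} (hz : 1 ≤ z) :
    |∑ n ∈ Finset.Icc 1 ⌊z⌋₊, ArithmeticFunction.vonMangoldt n * (z - n) - z ^ 2 / 2| ≤
      z * |∑ n ∈ Finset.Icc 1 ⌊z⌋₊, (ArithmeticFunction.vonMangoldt n - 1) * (1 - n / z)| + z := by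
  have hz0 : 0 < z := by linarith
  have e1 : z * ∑ n ∈ Finset.Icc 1 ⌊z⌋₊, (ArithmeticFunction.vonMangoldt n - 1) * (1 - n / z) =
      ∑ n ∈ Finset.Icc 1 ⌊z⌋₊, ArithmeticFunction.vonMangoldt n * (z - n) -
      ∑ n ∈ Finset.Icc 1 ⌊z⌋₊, (z - n) := by
    rw [Finset.mul_sum, ← Finset.sum_sub_distrib]
    refine Finset.sum_congr rfl fun n _ => ?_
    field_simp
  rw [sum_Icc_sub_nat_cast] at e1
  rw [← abs_of_pos hz0, ← abs_mul, abs_of_pos hz0]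
  have h1 := Nat.floor_le hz0.le
  have h2 := Nat.lt_floor_add_one z
  set N : ℝ := (⌊z⌋₊ : ℝ)
  set A := ∑ n ∈ Finset.Icc 1 ⌊z⌋₊, ArithmeticFunction.vonMangoldt n * (z - n)
  rw [e1]
  have h3 : A - z ^ 2 / 2 = (A - (N * z - N * (N + 1) / 2)) - ((z - N) ^ 2 + N) / 2 := by ring
  rw [h3]
  refine (abs_sub _ _).trans (add_le_add le_rfl ?_)
  have hN : 0 ≤ N := Nat.cast_nonneg _
  rw [abs_of_nonneg (by positivity)]
  nlinarith

/-- The smoothed Chebyshev function. -/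
noncomputable def psiOne (z : ℝ) : ℝ :=
  ∑ n ∈ Finset.Icc 1 ⌊z⌋₊, ArithmeticFunction.vonMangoldt n * (z - n)

theorem psi_mul_le_psiOne_sub {x h : ℝ} (hx : 0 ≤ x) (hh : 0 ≤ h) :
    Chebyshev.psi x * h ≤ psiOne (x + h) - psiOne x := by
  have hsub : Finset.Icc 1 ⌊x⌋₊ ⊆ Finset.Icc 1 ⌊x + h⌋₊ :=
    Finset.Icc_subset_Icc le_rfl (Nat.floor_le_floor (by linarith))
  have h1 : ∑ n ∈ Finset.Icc 1 ⌊x⌋₊, ArithmeticFunction.vonMangoldt n * (x + h - n) ≤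
      psiOne (x + h) := by
    refine Finset.sum_le_sum_of_subset_of_nonneg hsub fun n hn _ => ?_
    rw [Finset.mem_Icc] at hn
    have := (Nat.le_floor_iff (by linarith)).1 hn.2
    exact mul_nonneg ArithmeticFunction.vonMangoldt_nonneg (by linarith)
  have h2 : ∑ n ∈ Finset.Icc 1 ⌊x⌋₊, ArithmeticFunction.vonMangoldt n * (x + h - n) =
      psiOne x + Chebyshev.psi x * h := by
    rw [psiOne, Chebyshev.psi, Finset.sum_mul, show Finset.Ioc 0 ⌊x⌋₊ = Finset.Icc 1 ⌊x⌋₊ from rfl,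
      ← Finset.sum_add_distrib]
    exact Finset.sum_congr rfl fun n _ => by ring
  linarith

theorem psiOne_sub_le_psi_mul {x h : ℝ} (hh : 0 ≤ h) :
    psiOne x - psiOne (x - h) ≤ Chebyshev.psi x * h := by
  have hsub : Finset.Icc 1 ⌊x - h⌋₊ ⊆ Finset.Icc 1 ⌊x⌋₊ :=
    Finset.Icc_subset_Icc le_rfl (Nat.floor_le_floor (by linarith))
  have h1 : ∑ n ∈ Finset.Icc 1 ⌊x⌋₊, ArithmeticFunction.vonMangoldt n * (x - h - n) ≤
      psiOne (x - h) := by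
    rw [psiOne, ← Finset.sum_sdiff hsub]
    refine add_le_of_nonpos_left (Finset.sum_nonpos fun n hn => ?_)
    rw [Finset.mem_sdiff, Finset.mem_Icc, Finset.mem_Icc] at hn
    refine mul_nonpos_of_nonneg_of_nonpos ArithmeticFunction.vonMangoldt_nonneg ?_
    by_contra! hlt
    exact hn.2 ⟨hn.1.1, Nat.le_floor (by linarith)⟩
  have h2 : ∑ n ∈ Finset.Icc 1 ⌊x⌋₊, ArithmeticFunction.vonMangoldt n * (x - h - n) =
      psiOne x - Chebyshev.psi x * h := by
    rw [psiOne, Chebyshev.psi, Finset.sum_mul, show Finset.Ioc 0 ⌊x⌋₊ = Finset.Icc 1 ⌊x⌋₊ from rfl,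
      ← Finset.sum_sub_distrib]
    exact Finset.sum_congr rfl fun n _ => by ring
  linarith

/-- The prime number theorem with the Vinogradov–Korobov error term. -/
theorem exists_abs_psi_sub_le {δ : ℝ} (hδ : 0 < δ) (hδ1 : δ < 3 / 5) :
    ∃ C : ℝ, 0 < C ∧ ∀ x : ℝ, 1 ≤ x →
      |Chebyshev.psi x - x| ≤ C * (x * Real.exp (-(Real.log x) ^ (3 / 5 - δ))) := by
  set b : ℝ := 3 / 5 - δ / 2 with hb
  set b' : ℝ := 3 / 5 - δ with hb'
  have hb0 : 0 < b := by linarith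
  have hb'0 : 0 < b' := by linarith
  have hev : ∀ᶠ x : ℝ in Filter.atTop, ∀ z, x ≤ z → |psiOne z - z ^ 2 / 2| ≤
      z * (z * Real.exp (-(Real.log z) ^ b)) + z := by
    refine Filter.eventually_forall_ge_atTop.2 ?_
    filter_upwards [eventually_sum_vonMangoldt_sub_one_le (δ := δ / 2) (by linarith) (by linarith),
      Filter.eventually_ge_atTop 1] with z hz hz1
    refine (abs_sum_vonMangoldt_mul_sub_le hz1).trans ?_
    exact add_le_add_left (mul_le_mul_of_nonneg_left hz (by linarith)) _
  have hevL : ∀ᶠ L : ℝ in Filter.atTop, 2 ≤ L ∧ 4 ≤ L ^ b ∧ L ^ b' + Real.log 13 ≤ L ^ b / 4 := by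
    filter_upwards [Filter.eventually_ge_atTop 2,
      (tendsto_rpow_atTop hb0).eventually_ge_atTop 4,
      (tendsto_rpow_atTop hb0).eventually_ge_atTop (8 * Real.log 13),
      eventually_mul_rpow_le_rpow 8 (show b' < b by linarith)] with L h1 h2 h3 h4
    exact ⟨h1, h2, by linarith⟩
  have hmain : ∀ᶠ x : ℝ in Filter.atTop,
      |Chebyshev.psi x - x| ≤ x * Real.exp (-(Real.log x) ^ b') := by
    filter_upwards [(Filter.tendsto_id.atTop_div_const (show (0 : ℝ) < 2 by norm_num)).eventually hev,
      Real.tendsto_log_atTop.eventually hevL, Filter.eventually_ge_atTop 4] with x h1 h2 hx4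
    obtain ⟨hL2, hLb, hLb'⟩ := h2
    set L := Real.log x with hL
    set E := Real.exp (-(L ^ b / 4)) with hE
    have hx0 : 0 < x := by linarith
    have hE0 : 0 < E := Real.exp_pos _
    have hE2 : E ≤ 1 / 2 := by
      have : E ≤ Real.exp (-1) := Real.exp_le_exp.2 (by linarith)
      refine this.trans ?_
      rw [Real.exp_neg]
      rw [inv_le_comm₀ (Real.exp_pos _) (by norm_num)]
      have := Real.add_one_le_exp (1 : ℝ)
      norm_num; linarith
    have hxE : 1 ≤ x * E ^ 2 := by
      rw [hE, ← Real.exp_nat_mul, ← Real.exp_log hx0, ← hL, ← Real.exp_add]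
      refine Real.one_le_exp ?_
      have : L ^ b ≤ L ^ (1 : ℝ) := Real.rpow_le_rpow_of_exponent_le (by linarith) (by linarith)
      rw [Real.rpow_one] at this
      push_cast
      linarith
    have hz : ∀ z, x / 2 ≤ z → z ≤ 2 * x → |psiOne z - z ^ 2 / 2| ≤ 6 * (x * E) ^ 2 := by
      intro z hz1 hz2
      have hz0 : 0 < z := by linarith
      refine (h1 z hz1).trans ?_
      have e1 : Real.exp (-(Real.log z) ^ b) ≤ E ^ 2 := by
        rw [hE, ← Real.exp_nat_mul]
        refine Real.exp_le_exp.2 ?_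
        have e2 : L / 2 ≤ Real.log z := by
          have : Real.log (x / 2) ≤ Real.log z := Real.log_le_log (by linarith) hz1
          rw [Real.log_div hx0.ne' two_ne_zero] at this
          linarith [Real.log_two_lt_d9]
        have e3 : (L / 2) ^ b ≤ Real.log z ^ b := Real.rpow_le_rpow (by linarith) e2 hb0.le
        rw [Real.div_rpow (by linarith) (by norm_num)] at e3
        have e4 : (2 : ℝ) ^ b ≤ 2 ^ (1 : ℝ) :=
          Real.rpow_le_rpow_of_exponent_le (by norm_num) (by linarith)
        rw [Real.rpow_one] at e4
        have e5 : L ^ b / 2 ≤ L ^ b / 2 ^ b :=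
          div_le_div_of_nonneg_left (by linarith) (by positivity) e4
        push_cast
        linarith
      calc z * (z * Real.exp (-(Real.log z) ^ b)) + z ≤ (2 * x) * ((2 * x) * E ^ 2) + 2 * x := by
            gcongr
        _ ≤ 6 * (x * E) ^ 2 := by nlinarith
    set h := x * E with hh
    have hh0 : 0 < h := by positivity
    have hhx : h ≤ x / 2 := by rw [hh]; nlinarith
    have a0 := abs_le.1 (hz x (by linarith) (by linarith))
    have a1 := abs_le.1 (hz (x + h) (by linarith) (by linarith))
    have a2 := abs_le.1 (hz (x - h) (by linarith) (by linarith))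
    have b1 := psi_mul_le_psiOne_sub hx0.le hh0.le
    have b2 := psiOne_sub_le_psi_mul (x := x) hh0.le
    have hup : Chebyshev.psi x ≤ x + 13 * h := by
      refine le_of_mul_le_mul_right (b1.trans ?_) hh0
      nlinarith
    have hlo : x - 13 * h ≤ Chebyshev.psi x := by
      refine le_of_mul_le_mul_right (le_trans ?_ b2) hh0
      nlinarith
    have hfin : 13 * h ≤ x * Real.exp (-L ^ b') := by
      rw [hh, hE, show (13 : ℝ) * (x * Real.exp (-(L ^ b / 4))) =
        x * (Real.exp (Real.log 13) * Real.exp (-(L ^ b / 4))) by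
          rw [Real.exp_log (by norm_num)]; ring, ← Real.exp_add]
      refine mul_le_mul_of_nonneg_left (Real.exp_le_exp.2 ?_) hx0.le
      linarith
    rw [abs_le]
    constructor <;> linarith
  obtain ⟨x₀, hx₀⟩ := Filter.eventually_atTop.1 hmain
  obtain ⟨A, hA⟩ : ∃ A : ℝ, ∀ x : ℝ, 1 ≤ x → x ≤ |x₀| + 1 → |Chebyshev.psi x - x| ≤ A := by
    refine ⟨Chebyshev.psi (|x₀| + 1) + (|x₀| + 1), fun x h1 h2 => ?_⟩
    have := Chebyshev.psi_mono h2
    have h0 := Chebyshev.psi_nonneg x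
    rw [abs_le]
    constructor <;> linarith
  set m := Real.exp (-(Real.log (|x₀| + 1)) ^ b') with hm
  have hm0 : 0 < m := Real.exp_pos _
  refine ⟨|A| / m + 1, by positivity, fun x h1 => ?_⟩
  have hp : 0 ≤ x * Real.exp (-(Real.log x) ^ b') := by positivity
  rcases le_total x (|x₀| + 1) with h | h
  · have e1 : m ≤ Real.exp (-(Real.log x) ^ b') := by
      refine Real.exp_le_exp.2 (neg_le_neg ?_)
      exact Real.rpow_le_rpow (Real.log_nonneg h1) (Real.log_le_log (by linarith) h) hb'0.le
    calc |Chebyshev.psi x - x| ≤ |A| := (hA x h1 h).trans (le_abs_self A)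
      _ = |A| / m * (1 * m) := by field_simp
      _ ≤ |A| / m * (x * Real.exp (-(Real.log x) ^ b')) := by gcongr
      _ ≤ _ := by nlinarith
  · have := hx₀ x (by linarith [le_abs_self x₀])
    have e2 : 0 ≤ |A| / m := by positivity
    nlinarith

/-- The Dickman function, extended by `1` to the negative axis. -/
structure IsDickman (ρ : ℝ → ℝ) : Prop where
  continuous : Continuous ρ
  eq_one : ∀ u, u ≤ 1 → ρ u = 1
  hasDerivAt : ∀ u, 1 < u → HasDerivAt ρ (-ρ (u - 1) / u) u

theorem IsDickman.of_continuousOn {ρ : ℝ → ℝ} (h1 : ContinuousOn ρ (Set.Ici 0))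
    (h2 : ∀ u, 0 ≤ u → u ≤ 1 → ρ u = 1)
    (h3 : ∀ u, 1 < u → HasDerivAt ρ (-ρ (u - 1) / u) u) :
    IsDickman fun u => ρ (max u 0) := by
  refine ⟨?_, fun u hu => h2 _ (le_max_right _ _) (max_le hu zero_le_one), fun u hu => ?_⟩
  · exact h1.comp_continuous (by fun_prop) fun u => Set.mem_Ici.2 (le_max_right _ _)
  · rw [max_eq_left (by linarith)]
    refine (h3 u hu).congr_of_eventuallyEq ?_
    filter_upwards [lt_mem_nhds (show 0 < u by linarith)] with v hv
    rw [max_eq_left hv.le]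

namespace IsDickman

theorem mul_eq_integral {ρ : ℝ → ℝ} (h : IsDickman ρ)
    {u : ℝ} (hu : 1 ≤ u) : u * ρ u = ∫ t in (u - 1)..u, ρ t := by
  set P : ℝ → ℝ := fun u => ∫ t in (0 : ℝ)..u, ρ t with hP
  have hPd (u : ℝ) : HasDerivAt P (ρ u) u :=
    intervalIntegral.integral_hasDerivAt_right (h.continuous.intervalIntegrable _ _)
      h.continuous.aestronglyMeasurable.stronglyMeasurableAtFilter h.continuous.continuousAt
  have hInt (u : ℝ) : ∫ t in (u - 1)..u, ρ t = P u - P (u - 1) := by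
    rw [hP]
    exact (intervalIntegral.integral_interval_sub_left (h.continuous.intervalIntegrable _ _)
      (h.continuous.intervalIntegrable _ _)).symm
  set F : ℝ → ℝ := fun u => u * ρ u - (P u - P (u - 1)) with hF
  have hFd (u : ℝ) (hu : 1 < u) : HasDerivAt F 0 u := by
    have e1 := ((hasDerivAt_id u).mul (h.hasDerivAt u hu)).sub
      ((hPd u).sub ((hPd (u - 1)).comp_sub_const u 1))
    refine e1.congr_deriv ?_
    have : u ≠ 0 := by linarith
    simp only [id]
    field_simp
    ring
  have hPc : Continuous P := continuous_iff_continuousAt.2 fun u => (hPd u).continuousAt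
  have hFc : Continuous F := (continuous_id.mul h.continuous).sub
    (hPc.sub (hPc.comp (continuous_id.sub continuous_const)))
  have hF1 : F 1 = 0 := by
    have : P 1 - P (1 - 1) = 1 := by
      rw [← hInt, intervalIntegral.integral_congr (g := fun _ => (1 : ℝ))]
      · simp
      · intro t ht
        rw [Set.uIcc_of_le (by norm_num)] at ht
        exact h.eq_one t ht.2
    simp only [hF]
    rw [this, h.eq_one 1 le_rfl]
    norm_num
  have : ∀ x ∈ Set.Icc 1 u, F x = F 1 := by
    refine constant_of_has_deriv_right_zero hFc.continuousOn ?_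
    intro x hx
    rcases hx.1.eq_or_lt with rfl | h1
    · refine (hasDerivWithinAt_Ioi_iff_Ici).1 ?_
      refine hasDerivWithinAt_Ioi_iff_Ici.2 ?_
      refine hasDerivWithinAt_Ici_of_tendsto_deriv (s := Set.Ioi 1) (f := F) (e := 0) ?_ ?_ ?_ ?_
      · exact fun y hy => (hFd y hy).differentiableAt.differentiableWithinAt
      · exact hFc.continuousWithinAt
      · exact self_mem_nhdsWithin
      · refine tendsto_const_nhds.congr' ?_
        filter_upwards [self_mem_nhdsWithin] with y hy using (hFd y hy).deriv.symm
    · exact (hFd x h1).hasDerivWithinAt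
  have := this u ⟨hu, le_rfl⟩
  rw [hF1] at this
  rw [hInt]
  simp only [hF] at this
  linarith

theorem pos {ρ : ℝ → ℝ} (h : IsDickman ρ) (u : ℝ) : 0 < ρ u := by
  by_contra! hu
  set S : Set ℝ := {v | ρ v ≤ 0} with hS
  have hSc : IsClosed S := isClosed_le h.continuous continuous_const
  have hb : BddBelow S := by
    refine ⟨1, fun v hv => ?_⟩
    by_contra! h1
    have : ρ v ≤ 0 := hv
    rw [h.eq_one v h1.le] at this
    linarith
  have hmem := hSc.csInf_mem ⟨u, hu⟩ hb
  set w := sInf S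
  have hw : ρ w ≤ 0 := hmem
  have hw1 : 1 < w := by
    by_contra! h1
    rw [h.eq_one w h1] at hw
    linarith
  have hlt : ∀ v, v < w → 0 < ρ v := fun v hv => by
    by_contra! h2
    exact absurd (csInf_le hb h2) (not_le.2 hv)
  have e1 := h.mul_eq_integral hw1.le
  have e2 : 0 < ∫ t in (w - 1)..w, ρ t :=
    intervalIntegral.intervalIntegral_pos_of_pos_on (h.continuous.intervalIntegrable _ _)
      (fun x hx => hlt x hx.2) (by linarith)
  nlinarith

theorem strictAntiOn {ρ : ℝ → ℝ} (h : IsDickman ρ) : StrictAntiOn ρ (Set.Ici 1) := by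
  refine strictAntiOn_of_deriv_neg (convex_Ici 1) h.continuous.continuousOn fun x hx => ?_
  rw [interior_Ici, Set.mem_Ioi] at hx
  rw [(h.hasDerivAt x hx).deriv]
  exact div_neg_of_neg_of_pos (neg_neg_of_pos (h.pos _)) (by linarith)

theorem antitone {ρ : ℝ → ℝ} (h : IsDickman ρ) : Antitone ρ := by
  intro u v huv
  rcases le_or_gt v 1 with hv | hv
  · rw [h.eq_one v hv, h.eq_one u (huv.trans hv)]
  rcases le_or_gt u 1 with hu | hu
  · rw [h.eq_one u hu, ← h.eq_one 1 le_rfl]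
    exact h.strictAntiOn.antitoneOn (Set.mem_Ici.2 le_rfl) (Set.mem_Ici.2 hv.le) hv.le
  · exact h.strictAntiOn.antitoneOn (Set.mem_Ici.2 hu.le) (Set.mem_Ici.2 hv.le) huv

theorem le_one {ρ : ℝ → ℝ} (h : IsDickman ρ) (u : ℝ) : ρ u ≤ 1 := by
  rcases le_or_gt u 1 with hu | hu
  · rw [h.eq_one u hu]
  · rw [← h.eq_one 1 le_rfl]
    exact h.antitone hu.le

theorem integral_sub_mul_eq {ρ : ℝ → ℝ} (h : IsDickman ρ) {u : ℝ} (hu : 2 ≤ u) :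
    ∫ t in (u - 1)..u, (ρ (t - 1) / (t * ρ t) - ρ (u - 1 - 1) / ((u - 1) * ρ (u - 1))) * ρ t =
      (ρ (u - 1) / (u * ρ u) - ρ (u - 1 - 1) / ((u - 1) * ρ (u - 1)) - 1 / u) * (u * ρ u) := by
  have hcont : ContinuousOn (fun t => ρ (t - 1) / t) (Set.uIcc (u - 1) u) := by
    refine ContinuousOn.div (h.continuous.comp (by fun_prop)).continuousOn continuousOn_id
      fun t ht => ?_
    rw [Set.uIcc_of_le (by linarith)] at ht
    exact (show 0 < t by linarith [ht.1]).ne'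
  have e1 : ∫ t in (u - 1)..u, ρ (t - 1) / t = ρ (u - 1) - ρ u := by
    have := MeasureTheory.integral_eq_of_hasDerivAt_off_countable_of_le (fun t => -ρ t)
      (fun t => ρ (t - 1) / t) (show u - 1 ≤ u by linarith) Set.countable_empty
      h.continuous.neg.continuousOn (fun x hx => by
        refine (h.hasDerivAt x (by linarith [hx.1.1])).neg.congr_deriv ?_
        rw [neg_div, neg_neg]) hcont.intervalIntegrable
    rw [this]; ring
  set c := ρ (u - 1 - 1) / ((u - 1) * ρ (u - 1))
  have e2 : ∫ t in (u - 1)..u, (ρ (t - 1) / (t * ρ t) - c) * ρ t =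
      ∫ t in (u - 1)..u, (ρ (t - 1) / t - c * ρ t) := by
    refine intervalIntegral.integral_congr fun t ht => ?_
    have := (h.pos t).ne'
    field_simp
  rw [e2, intervalIntegral.integral_sub hcont.intervalIntegrable
    ((h.continuous.intervalIntegrable _ _).const_mul c), e1, intervalIntegral.integral_const_mul,
    ← h.mul_eq_integral (by linarith)]
  have := (h.pos u).ne'
  have : u ≠ 0 := by linarith
  field_simp
  ring

theorem hasDerivAt_ratio {ρ : ℝ → ℝ} (h : IsDickman ρ)
    {u a : ℝ} (hu : 1 < u) (ha : HasDerivAt (fun u => ρ (u - 1)) a u) :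
    HasDerivAt (fun u => ρ (u - 1) / (u * ρ u))
      ((a * (u * ρ u) - ρ (u - 1) * (ρ u - ρ (u - 1))) / (u * ρ u) ^ 2) u := by
  have h0 : u * ρ u ≠ 0 := by
    have := h.pos u
    positivity
  have e1 := ha.div ((hasDerivAt_id u).mul (h.hasDerivAt u hu)) h0
  refine e1.congr_deriv ?_
  have : u ≠ 0 := by linarith
  simp only [id, Pi.mul_apply]
  congr 2
  field_simp
  ring

theorem continuousOn_ratio {ρ : ℝ → ℝ} (h : IsDickman ρ)
    : ContinuousOn (fun u => ρ (u - 1) / (u * ρ u)) (Set.Ioi 0) :=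
  ContinuousOn.div (h.continuous.comp (by fun_prop)).continuousOn
    (continuousOn_id.mul h.continuous.continuousOn)
    fun u hu => (mul_pos hu (h.pos u)).ne'

theorem strictMonoOn_ratio_Icc_one_two {ρ : ℝ → ℝ} (h : IsDickman ρ) :
    StrictMonoOn (fun u => ρ (u - 1) / (u * ρ u)) (Set.Icc 1 2) := by
  refine strictMonoOn_of_deriv_pos (convex_Icc 1 2)
    (h.continuousOn_ratio.mono fun x hx => Set.mem_Ioi.2 (by linarith [hx.1])) fun x hx => ?_
  rw [interior_Icc] at hx
  have hx0 : 0 < x := by linarith [hx.1]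
  have h1 : HasDerivAt (fun u => ρ (u - 1)) 0 x := by
    refine (hasDerivAt_const x (1 : ℝ)).congr_of_eventuallyEq ?_
    filter_upwards [gt_mem_nhds hx.2] with y hy
    exact h.eq_one _ (by linarith)
  rw [(h.hasDerivAt_ratio hx.1 h1).deriv, h.eq_one (x - 1) (by linarith [hx.2])]
  have h2 : ρ x < 1 := by
    rw [← h.eq_one 1 le_rfl]
    exact h.strictAntiOn (Set.mem_Ici.2 le_rfl) (Set.mem_Ici.2 hx.1.le) hx.1
  have := h.pos x
  refine div_pos ?_ (by positivity)
  linarith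

theorem ratio_sub_pos {ρ : ℝ → ℝ} (h : IsDickman ρ) {u : ℝ} (hu : 2 ≤ u) :
    0 < ρ (u - 1) / (u * ρ u) - ρ (u - 1 - 1) / ((u - 1) * ρ (u - 1)) - 1 / u ∧
      StrictMonoOn (fun u => ρ (u - 1) / (u * ρ u)) (Set.Icc 1 u) := by
  set r : ℝ → ℝ := fun u => ρ (u - 1) / (u * ρ u) with hr
  have hmono (w : ℝ) (hw : 2 ≤ w) (hlt : ∀ v, 2 ≤ v → v < w → 0 < r v - r (v - 1) - 1 / v) :
      StrictMonoOn r (Set.Icc 1 w) := by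
    have h2w : StrictMonoOn r (Set.Icc 2 w) := by
      refine strictMonoOn_of_deriv_pos (convex_Icc 2 w)
        (h.continuousOn_ratio.mono fun x hx => Set.mem_Ioi.2 (by linarith [hx.1])) fun x hx => ?_
      rw [interior_Icc] at hx
      have hx0 : 0 < x := by linarith [hx.1]
      have hx1 : 0 < x - 1 := by linarith [hx.1]
      have h1 : HasDerivAt (fun u => ρ (u - 1)) (-ρ (x - 1 - 1) / (x - 1)) x :=
        (h.hasDerivAt (x - 1) (by linarith [hx.1])).comp_sub_const x 1
      rw [(h.hasDerivAt_ratio (by linarith [hx.1]) h1).deriv]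
      have hq := hlt x hx.1.le hx.2
      have p0 := h.pos x
      have p1 := h.pos (x - 1)
      have e : -ρ (x - 1 - 1) / (x - 1) * (x * ρ x) - ρ (x - 1) * (ρ x - ρ (x - 1)) =
          (r x - r (x - 1) - 1 / x) * (x * ρ x * ρ (x - 1)) := by
        simp only [hr]
        field_simp
        ring
      rw [e]
      positivity
    have := (h.strictMonoOn_ratio_Icc_one_two).union h2w (isGreatest_Icc (by norm_num))
      (isLeast_Icc hw)
    rwa [Set.Icc_union_Icc_eq_Icc (by norm_num) hw] at this
  have hpos : ∀ v, 2 ≤ v → 0 < r v - r (v - 1) - 1 / v := by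
    by_contra! hne
    set S : Set ℝ := {v | 2 ≤ v ∧ r v - r (v - 1) - 1 / v ≤ 0} with hS
    have hSc : IsClosed S := by
      have hc : ContinuousOn (fun v => r v - r (v - 1) - 1 / v) (Set.Ici 2) := by
        refine ContinuousOn.sub (ContinuousOn.sub ?_ ?_) ?_
        · exact h.continuousOn_ratio.mono fun x hx => Set.mem_Ioi.2 (by
            rw [Set.mem_Ici] at hx; linarith)
        · exact h.continuousOn_ratio.comp (by fun_prop) fun x hx => Set.mem_Ioi.2 (by
            rw [Set.mem_Ici] at hx; linarith)
        · exact continuousOn_const.div continuousOn_id fun x hx => by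
            rw [Set.mem_Ici] at hx; exact (show (0 : ℝ) < x by linarith).ne'
      exact hc.preimage_isClosed_of_isClosed isClosed_Ici isClosed_Iic
    have hb : BddBelow S := ⟨2, fun v hv => hv.1⟩
    obtain ⟨v, hv2, hv⟩ := hne
    have hmem := hSc.csInf_mem ⟨v, hv2, hv⟩ hb
    set w := sInf S
    have hlt : ∀ v, 2 ≤ v → v < w → 0 < r v - r (v - 1) - 1 / v := fun v hv2 hv => by
      by_contra! h2
      exact absurd (csInf_le hb ⟨hv2, h2⟩) (not_le.2 hv)
    have hm := hmono w hmem.1 hlt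
    have hw2 := hmem.1
    have e1 := h.integral_sub_mul_eq hmem.1
    have e2 : 0 < ∫ t in (w - 1)..w,
        (ρ (t - 1) / (t * ρ t) - ρ (w - 1 - 1) / ((w - 1) * ρ (w - 1))) * ρ t := by
      refine intervalIntegral.intervalIntegral_pos_of_pos_on ?_ (fun x hx => ?_) (by linarith)
      · refine ContinuousOn.intervalIntegrable ?_
        rw [Set.uIcc_of_le (by linarith)]
        exact ((h.continuousOn_ratio.mono fun x hx => Set.mem_Ioi.2 (by linarith [hx.1])).sub
          continuousOn_const).mul h.continuous.continuousOn
      · refine mul_pos (sub_pos.2 ?_) (h.pos x)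
        exact hm ⟨by linarith, by linarith⟩ ⟨by linarith [hx.1], hx.2.le⟩ hx.1
    rw [e1] at e2
    have h3 : 0 < w * ρ w := mul_pos (by linarith) (h.pos w)
    exact absurd ((mul_pos_iff_of_pos_right h3).1 e2) (not_lt.2 hmem.2)
  exact ⟨hpos u hu, hmono u hu fun v hv _ => hpos v hv⟩

theorem ratio_mono {ρ : ℝ → ℝ} (h : IsDickman ρ) {u v : ℝ} (hu : 1 ≤ u) (huv : u ≤ v) :
    ρ (u - 1) / (u * ρ u) ≤ ρ (v - 1) / (v * ρ v) :=
  (h.ratio_sub_pos (le_max_right v 2)).2.monotoneOn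
    ⟨hu, huv.trans (le_max_left _ _)⟩ ⟨hu.trans huv, le_max_left _ _⟩ huv

theorem half_mul_le_mul_add_half {ρ : ℝ → ℝ} (h : IsDickman ρ)
    {u : ℝ} (hu : 1 ≤ u) : ρ u ≤ (2 * u + 1) * ρ (u + 1 / 2) := by
  have hI (a b : ℝ) := h.continuous.intervalIntegrable (μ := MeasureTheory.volume) a b
  have e1 := h.mul_eq_integral (u := u + 1 / 2) (by linarith)
  have e2 : ∫ t in (u - 1 / 2)..u, ρ u ≤ ∫ t in (u - 1 / 2)..u, ρ t :=
    intervalIntegral.integral_mono_on (by linarith) (by simp) (hI _ _)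
      fun x hx => h.antitone hx.2
  have e3 : 0 ≤ ∫ t in u..(u + 1 / 2), ρ t :=
    intervalIntegral.integral_nonneg (by linarith) fun x _ => (h.pos x).le
  rw [show u + 1 / 2 - 1 = u - 1 / 2 by ring,
    ← intervalIntegral.integral_add_adjacent_intervals (hI _ u) (hI _ _)] at e1
  simp only [intervalIntegral.integral_const, smul_eq_mul] at e2
  linarith

theorem integral_half_le {ρ : ℝ → ℝ} (h : IsDickman ρ) {u : ℝ} (hu : 1 ≤ u) :
    ∫ t in (u - 1 / 2)..u, ρ t ≤ 1 / 2 * (u * ρ u) := by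
  have hI (a b : ℝ) := h.continuous.intervalIntegrable (μ := MeasureTheory.volume) a b
  have e1 := h.mul_eq_integral hu
  have e2 : ∫ t in (u - 1 / 2)..u, ρ t ≤ ∫ t in (u - 1 / 2)..u, ρ (u - 1 / 2) :=
    intervalIntegral.integral_mono_on (by linarith) (hI _ _) (by simp)
      fun x hx => h.antitone hx.1
  have e3 : ∫ t in (u - 1)..(u - 1 / 2), ρ (u - 1 / 2) ≤ ∫ t in (u - 1)..(u - 1 / 2), ρ t :=
    intervalIntegral.integral_mono_on (by linarith) (by simp) (hI _ _)
      fun x hx => h.antitone hx.2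
  rw [← intervalIntegral.integral_add_adjacent_intervals (hI _ (u - 1 / 2)) (hI _ _)] at e1
  simp only [intervalIntegral.integral_const, smul_eq_mul] at e2 e3
  linarith

theorem ratio_le {ρ : ℝ → ℝ} (h : IsDickman ρ)
    {u : ℝ} (hu : 1 ≤ u) : ρ (u - 1) / (u * ρ u) ≤ 2 * log (2 * u + 1) := by
  set r := ρ (u - 1) / (u * ρ u)
  have hanti : AntitoneOn (fun t => ρ t * exp (r * t)) (Set.Icc u (u + 1 / 2)) := by
    refine antitoneOn_of_deriv_nonpos (convex_Icc _ _)
      (h.continuous.mul (by fun_prop)).continuousOn (fun x hx => ?_) fun x hx => ?_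
    all_goals
      rw [interior_Icc] at hx
      have hd := (h.hasDerivAt x (by linarith [hx.1])).mul
        ((hasDerivAt_id x).const_mul r).exp
    · exact hd.differentiableAt.differentiableWithinAt
    · refine hd.deriv.trans_le ?_
      have hx0 : 0 < x := by linarith [hx.1]
      have hm := h.ratio_mono hu hx.1.le
      rw [le_div_iff₀ (mul_pos hx0 (h.pos x))] at hm
      have e : -ρ (x - 1) / x + r * ρ x ≤ 0 := by
        rw [neg_div, neg_add_nonpos_iff, le_div_iff₀ hx0]
        calc _ = r * (x * ρ x) := by ring
          _ ≤ _ := hm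
      have := exp_pos (r * x)
      simp only [id]
      nlinarith
  have e1 := hanti (Set.left_mem_Icc.2 (by linarith)) (Set.right_mem_Icc.2 (by linarith))
    (show u ≤ u + 1 / 2 by linarith)
  have e2 := h.half_mul_le_mul_add_half hu
  have e3 : ρ (u + 1 / 2) * exp (r / 2) * exp (r * u) ≤
      ρ (u + 1 / 2) * (2 * u + 1) * exp (r * u) := by
    calc _ = ρ (u + 1 / 2) * exp (r * (u + 1 / 2)) := by
          rw [mul_assoc, ← exp_add]; congr 2; ring
      _ ≤ ρ u * exp (r * u) := e1
      _ ≤ _ := mul_le_mul_of_nonneg_right (by linarith) (exp_pos _).le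
  have e4 := le_of_mul_le_mul_left (le_of_mul_le_mul_right e3 (exp_pos _)) (h.pos _)
  have := (le_log_iff_exp_le (by linarith)).2 e4
  linarith

theorem le_mul_exp {ρ : ℝ → ℝ} (h : IsDickman ρ)
    {u s R : ℝ} (hu : 1 ≤ u) (hs : 0 ≤ s) (hR : 2 * log (2 * u + 1) ≤ R) :
    ρ (u - s) ≤ ρ u * exp (R * s) := by
  have hmono : MonotoneOn (fun t => ρ t * exp (R * t)) (Set.Icc 1 u) := by
    refine monotoneOn_of_deriv_nonneg (convex_Icc _ _)
      (h.continuous.mul (by fun_prop)).continuousOn (fun x hx => ?_) fun x hx => ?_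
    all_goals
      rw [interior_Icc] at hx
      have hd := (h.hasDerivAt x hx.1).mul ((hasDerivAt_id x).const_mul R).exp
    · exact hd.differentiableAt.differentiableWithinAt
    · refine le_of_le_of_eq ?_ hd.deriv.symm
      have hx0 : 0 < x := by linarith [hx.1]
      have hm := (h.ratio_mono hx.1.le hx.2.le).trans ((h.ratio_le hu).trans hR)
      rw [div_le_iff₀ (mul_pos hx0 (h.pos x))] at hm
      have e : 0 ≤ -ρ (x - 1) / x + R * ρ x := by
        rw [neg_div, neg_add_eq_sub, sub_nonneg, div_le_iff₀ hx0]
        calc _ ≤ R * (x * ρ x) := hm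
          _ = _ := by ring
      have := exp_pos (R * x)
      simp only [id]
      nlinarith
  have hR0 : 0 ≤ R := le_trans (by have := log_nonneg (show 1 ≤ 2 * u + 1 by linarith); linarith) hR
  have key (v : ℝ) (hv : 1 ≤ v) (hvu : v ≤ u) : ρ v ≤ ρ u * exp (R * (u - v)) := by
    have := hmono ⟨hv, hvu⟩ ⟨hu, le_rfl⟩ hvu
    refine le_of_mul_le_mul_right ?_ (exp_pos (R * v))
    calc ρ v * exp (R * v) ≤ ρ u * exp (R * u) := this
      _ = _ := by rw [mul_assoc, ← exp_add]; ring_nf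
  rcases le_or_gt 1 (u - s) with h1 | h1
  · have := key _ h1 (by linarith)
    rwa [sub_sub_cancel] at this
  · have := key 1 le_rfl hu
    rw [h.eq_one _ h1.le, ← h.eq_one 1 le_rfl]
    refine this.trans (mul_le_mul_of_nonneg_left (exp_le_exp.2 ?_) (h.pos u).le)
    exact mul_le_mul_of_nonneg_left (by linarith) hR0

end IsDickman

theorem exists_exp_neg_rpow_le {a b : ℝ} (ha : 0 < a) (hab : a < b) :
    ∃ C : ℝ, 0 < C ∧ ∀ v : ℝ, 0 ≤ v → exp (-v ^ b) ≤ C * (exp (-v ^ a) * ((1 + v) ^ 2)⁻¹) := by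
  have hev : ∀ᶠ v : ℝ in Filter.atTop, 2 * v ^ a ≤ v ^ b ∧ 4 * v ^ (2 : ℝ) ≤ exp (v ^ a) ∧ 1 ≤ v := by
    filter_upwards [eventually_mul_rpow_le_rpow 2 hab, eventually_mul_rpow_le_exp 4 2 ha,
      Filter.eventually_ge_atTop 1] with v h1 h2 h3 using ⟨h1, h2, h3⟩
  obtain ⟨V, hV⟩ := Filter.eventually_atTop.1 hev
  set W := max V 1
  have hW : 1 ≤ W := le_max_right _ _
  refine ⟨exp (W ^ a) * (1 + W) ^ 2, by positivity, fun v hv => ?_⟩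
  rcases le_or_gt v W with h1 | h1
  · have e1 : exp (-v ^ b) ≤ 1 := exp_le_one_iff.2 (by have := rpow_nonneg hv b; linarith)
    refine e1.trans ?_
    rw [← mul_assoc, ← div_eq_mul_inv, le_div_iff₀ (by positivity), one_mul]
    have e2 : (1 + v) ^ 2 ≤ (1 + W) ^ 2 := pow_le_pow_left₀ (by linarith) (by linarith) 2
    have e3 : 1 ≤ exp (W ^ a) * exp (-v ^ a) := by
      rw [← exp_add]
      exact one_le_exp (by have := rpow_le_rpow hv h1 ha.le; linarith)
    have : 0 ≤ (1 + W) ^ 2 := by positivity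
    nlinarith
  · obtain ⟨h2, h3, h4⟩ := hV v ((le_max_left _ _).trans h1.le)
    have e1 : 1 ≤ exp (W ^ a) * (1 + W) ^ 2 :=
      one_le_mul_of_one_le_of_one_le (one_le_exp (by positivity)) (by nlinarith)
    have e2 : exp (-v ^ b) ≤ exp (-v ^ a) * ((1 + v) ^ 2)⁻¹ := by
      rw [← div_eq_mul_inv, le_div_iff₀ (by positivity)]
      rw [rpow_two] at h3
      calc exp (-v ^ b) * (1 + v) ^ 2 ≤ exp (-v ^ b) * exp (v ^ a) :=
            mul_le_mul_of_nonneg_left (by nlinarith) (exp_pos _).le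
        _ ≤ exp (-v ^ a) := by
          rw [← exp_add]
          exact exp_le_exp.2 (by linarith)
    exact e2.trans (le_mul_of_one_le_left (by positivity) e1)

/-- The sum of `Λ d / d` over `d ≤ z`. -/
noncomputable def mertensSum (z : ℝ) : ℝ :=
  ∑ d ∈ Finset.Ioc 0 ⌊z⌋₊, ArithmeticFunction.vonMangoldt d / d

theorem mertensSum_sub_eq {w z : ℝ} (hw : 1 ≤ w) (hwz : w ≤ z) :
    mertensSum z - mertensSum w = Chebyshev.psi z / z - Chebyshev.psi w / w +
      ∫ t in w..z, Chebyshev.psi t / t ^ 2 := by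
  have hd (t : ℝ) (ht : t ∈ Set.Icc w z) : HasDerivAt (fun t : ℝ => t⁻¹) (-(t ^ 2)⁻¹) t :=
    hasDerivAt_inv (by linarith [ht.1])
  have hderiv : ContinuousOn (fun t : ℝ => -(t ^ 2)⁻¹) (Set.Icc w z) := by
    refine ContinuousOn.neg (ContinuousOn.inv₀ (by fun_prop) fun t ht => ?_)
    have : 0 < t := by linarith [ht.1]
    positivity
  have e := sum_mul_eq_sub_sub_integral_mul (f := fun t : ℝ => t⁻¹)
    (fun n => ArithmeticFunction.vonMangoldt n) (by linarith) hwz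
    (fun t ht => (hd t ht).differentiableAt)
    ((hderiv.integrableOn_Icc).congr_fun (fun t ht => (hd t ht).deriv.symm) measurableSet_Icc)
  simp only [← Chebyshev.psi_eq_sum_Icc] at e
  rw [← intervalIntegral.integral_of_le hwz] at e
  have e2 : ∫ t in w..z, deriv (fun t : ℝ => t⁻¹) t * Chebyshev.psi t =
      -∫ t in w..z, Chebyshev.psi t / t ^ 2 := by
    rw [← intervalIntegral.integral_neg]
    refine intervalIntegral.integral_congr fun t ht => ?_
    rw [Set.uIcc_of_le hwz] at ht
    simp only [(hd t ht).deriv]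
    rw [div_eq_mul_inv]; ring
  have e3 : mertensSum z = mertensSum w +
      ∑ k ∈ Finset.Ioc ⌊w⌋₊ ⌊z⌋₊, (k : ℝ)⁻¹ * ArithmeticFunction.vonMangoldt k := by
    rw [mertensSum, mertensSum, ← Finset.Ioc_union_Ioc_eq_Ioc (Nat.zero_le _)
      (Nat.floor_le_floor hwz), Finset.sum_union (Finset.Ioc_disjoint_Ioc_of_le le_rfl)]
    congr 1
    exact Finset.sum_congr rfl fun k _ => by rw [div_eq_inv_mul]
  rw [e3, e, e2, div_eq_inv_mul, div_eq_inv_mul]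
  ring

theorem integral_inv_mul_sq_le {w z : ℝ} (hw : 1 ≤ w) (hwz : w ≤ z) :
    IntervalIntegrable (fun t => ((1 + log t) ^ 2)⁻¹ / t) MeasureTheory.volume w z ∧
    ∫ t in w..z, ((1 + log t) ^ 2)⁻¹ / t ≤ 1 := by
  have hc : ContinuousOn (fun t => ((1 + log t) ^ 2)⁻¹ / t) (Set.uIcc w z) := by
    rw [Set.uIcc_of_le hwz]
    have h0 (t : ℝ) (ht : t ∈ Set.Icc w z) : t ≠ 0 := by linarith [ht.1]
    refine ContinuousOn.div (ContinuousOn.inv₀ ?_ fun t ht => ?_) continuousOn_id h0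
    · exact (continuousOn_const.add (continuousOn_log.mono h0)).pow 2
    · have := log_nonneg (hw.trans ht.1)
      positivity
  refine ⟨hc.intervalIntegrable, ?_⟩
  have := intervalIntegral.integral_eq_sub_of_hasDerivAt
    (f := fun t => -(1 + log t)⁻¹) (a := w) (b := z) (fun t ht => by
      rw [Set.uIcc_of_le hwz] at ht
      have := log_nonneg (hw.trans ht.1)
      have h0 : t ≠ 0 := by linarith [ht.1]
      refine ((((hasDerivAt_log h0).const_add 1).inv (by positivity)).neg).congr_deriv ?_
      rw [neg_div, neg_neg]
      field_simp) hc.intervalIntegrable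
  rw [this]
  have h1 := log_nonneg hw
  have h2 := log_nonneg (hw.trans hwz)
  have h3 : (1 + log w)⁻¹ ≤ 1 := inv_le_one_of_one_le₀ (by linarith)
  have h4 : 0 ≤ (1 + log z)⁻¹ := by positivity
  linarith

/-- Mertens' theorem with a Vinogradov–Korobov error term. -/
theorem exists_abs_mertensSum_sub_le {b : ℝ} (hb : 0 < b) (hb1 : b < 3 / 5) :
    ∃ C : ℝ, 0 < C ∧ ∀ w z : ℝ, 1 ≤ w → w ≤ z →
      |mertensSum z - mertensSum w - log (z / w)| ≤ C * exp (-log w ^ b) := by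
  obtain ⟨A, hA, hpsi⟩ := exists_abs_psi_sub_le (δ := (3 / 5 - b) / 2) (by linarith) (by linarith)
  set b' := 3 / 5 - (3 / 5 - b) / 2
  obtain ⟨B, hB, hexp⟩ := exists_exp_neg_rpow_le hb (show b < b' by grind)
  have hE (t : ℝ) (ht : 1 ≤ t) : |Chebyshev.psi t / t - 1| ≤
      A * B * (exp (-log t ^ b) * ((1 + log t) ^ 2)⁻¹) := by
    have ht0 : 0 < t := by linarith
    rw [div_sub_one ht0.ne', abs_div, abs_of_pos ht0, div_le_iff₀ ht0]
    calc _ ≤ _ := hpsi t ht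
      _ ≤ A * (t * (B * (exp (-log t ^ b) * ((1 + log t) ^ 2)⁻¹))) := by
        have := hexp _ (log_nonneg ht)
        exact mul_le_mul_of_nonneg_left (mul_le_mul_of_nonneg_left this ht0.le) hA.le
      _ = _ := by ring
  refine ⟨3 * (A * B), by positivity, fun w z hw hwz => ?_⟩
  have hE2 (t : ℝ) (ht : w ≤ t) : |Chebyshev.psi t / t - 1| ≤
      A * B * exp (-log w ^ b) * ((1 + log t) ^ 2)⁻¹ := by
    refine (hE t (hw.trans ht)).trans ?_
    rw [← mul_assoc]
    have := rpow_le_rpow (log_nonneg hw) (log_le_log (by linarith) ht) hb.le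
    refine mul_le_mul_of_nonneg_right (mul_le_mul_of_nonneg_left
      (exp_le_exp.2 (by linarith)) (by positivity)) (by positivity)
  have hE3 (t : ℝ) (ht : w ≤ t) : |Chebyshev.psi t / t - 1| ≤ A * B * exp (-log w ^ b) := by
    refine (hE2 t ht).trans (mul_le_of_le_one_right (by positivity) ?_)
    have := log_nonneg (hw.trans ht)
    exact inv_le_one_of_one_le₀ (one_le_pow₀ (by linarith))
  obtain ⟨hI, hI1⟩ := integral_inv_mul_sq_le hw hwz
  have hpI : IntervalIntegrable (fun t => Chebyshev.psi t / t ^ 2) MeasureTheory.volume w z := by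
    have e1 : IntervalIntegrable (fun t => Chebyshev.psi t) MeasureTheory.volume w z :=
      Chebyshev.psi_mono.intervalIntegrable
    have := e1.mul_continuousOn (g := fun t => (t ^ 2)⁻¹) (by
      rw [Set.uIcc_of_le hwz]
      refine ContinuousOn.inv₀ (by fun_prop) fun t ht => ?_
      have : 0 < t := by linarith [ht.1]
      positivity)
    simpa only [div_eq_mul_inv] using this
  have hlogI : IntervalIntegrable (fun t : ℝ => 1 / t) MeasureTheory.volume w z :=
    intervalIntegral.intervalIntegrable_one_div (fun t ht => by
      rw [Set.uIcc_of_le hwz] at ht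
      linarith [ht.1]) continuousOn_id
  have hlog : log (z / w) = ∫ t in w..z, 1 / t :=
    (integral_one_div_of_pos (by linarith) (by linarith)).symm
  have e4 : mertensSum z - mertensSum w - log (z / w) =
      (Chebyshev.psi z / z - 1) - (Chebyshev.psi w / w - 1) +
        ∫ t in w..z, (Chebyshev.psi t / t ^ 2 - 1 / t) := by
    rw [intervalIntegral.integral_sub hpI hlogI, ← hlog, mertensSum_sub_eq hw hwz]
    ring
  have e5 : |∫ t in w..z, (Chebyshev.psi t / t ^ 2 - 1 / t)| ≤ A * B * exp (-log w ^ b) := by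
    rw [← norm_eq_abs]
    calc _ ≤ ∫ t in w..z, A * B * exp (-log w ^ b) * (((1 + log t) ^ 2)⁻¹ / t) := by
          refine intervalIntegral.norm_integral_le_of_norm_le hwz ?_ (hI.const_mul _)
          refine Filter.Eventually.of_forall fun t ht => ?_
          have ht0 : 0 < t := by linarith [ht.1]
          have e : Chebyshev.psi t / t ^ 2 - 1 / t = (Chebyshev.psi t / t - 1) / t := by
            field_simp
          rw [e, norm_div, norm_eq_abs, norm_of_nonneg ht0.le, ← mul_div_assoc]
          exact div_le_div_of_nonneg_right (hE2 t ht.1.le) ht0.le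
      _ ≤ _ := by
        rw [intervalIntegral.integral_const_mul]
        exact mul_le_of_le_one_right (by positivity) hI1
  rw [e4]
  have e6 := hE3 w le_rfl
  have e7 := hE3 z hwz
  rw [abs_le] at *
  constructor <;> linarith

theorem sum_mul_integral_eq (N : Finset ℕ) (a s : ℕ → ℝ) {σ : ℝ} {g : ℝ → ℝ}
    (hσ : 0 ≤ σ) (hs : ∀ d ∈ N, s d ∈ Set.Icc 0 σ)
    (hg : IntervalIntegrable g MeasureTheory.volume 0 σ) :
    ∑ d ∈ N, a d * ∫ v in (0 : ℝ)..s d, g v =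
      ∫ v in (0 : ℝ)..σ, g v * ∑ d ∈ N with v < s d, a d := by
  have e1 (v : ℝ) : g v * ∑ d ∈ N with v < s d, a d =
      ∑ d ∈ N, a d * (Set.Iio (s d)).indicator g v := by
    rw [Finset.sum_filter, Finset.mul_sum]
    refine Finset.sum_congr rfl fun d _ => ?_
    rw [Set.indicator_apply]
    by_cases h : v < s d <;> simp [h, mul_comm]
  have hgd (d : ℕ) : IntervalIntegrable ((Set.Iio (s d)).indicator g) MeasureTheory.volume 0 σ := by
    rw [intervalIntegrable_iff] at hg ⊢
    exact MeasureTheory.Integrable.indicator hg measurableSet_Iio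
  simp only [e1]
  rw [intervalIntegral.integral_finsetSum fun d _ => (hgd d).const_mul (a d)]
  refine Finset.sum_congr rfl fun d hd => ?_
  obtain ⟨h0, h1⟩ := hs d hd
  rw [intervalIntegral.integral_const_mul, intervalIntegral.integral_of_le h0,
    intervalIntegral.integral_of_le hσ, MeasureTheory.setIntegral_indicator measurableSet_Iio,
    MeasureTheory.integral_Ioc_eq_integral_Ioo]
  congr 3
  ext v
  simp only [Set.mem_Ioo, Set.mem_inter_iff, Set.mem_Ioc, Set.mem_Iio]
  constructor
  · rintro ⟨h2, h3⟩
    exact ⟨⟨h2, by linarith⟩, h3⟩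
  · rintro ⟨⟨h2, _⟩, h3⟩
    exact ⟨h2, h3⟩

/-- The derivative of `v ↦ ρ (u - v)`. -/
noncomputable def dickmanDensity (ρ : ℝ → ℝ) (u : ℝ) : ℝ → ℝ :=
  (Set.Iio (u - 1)).indicator fun v => ρ (u - v - 1) / max (u - v) 1

namespace IsDickman

theorem intervalIntegrable_density {ρ : ℝ → ℝ} (h : IsDickman ρ) (u a b : ℝ) :
    IntervalIntegrable (dickmanDensity ρ u) MeasureTheory.volume a b := by
  have hc : Continuous fun v => ρ (u - v - 1) / max (u - v) 1 :=
    (h.continuous.comp (by fun_prop)).div (by fun_prop) fun v => by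
      have := le_max_right (u - v) 1
      linarith
  have := hc.intervalIntegrable (μ := MeasureTheory.volume) a b
  rw [intervalIntegrable_iff] at this ⊢
  exact MeasureTheory.Integrable.indicator this measurableSet_Iio

theorem hasDerivAt_sub {ρ : ℝ → ℝ} (h : IsDickman ρ) {u v : ℝ} (hv : v ≠ u - 1) :
    HasDerivAt (fun v => ρ (u - v)) (dickmanDensity ρ u v) v := by
  rcases hv.lt_or_gt with h1 | h1
  · have e := (h.hasDerivAt (u - v) (by linarith)).comp_const_sub u v
    rw [dickmanDensity, Set.indicator_of_mem (Set.mem_Iio.2 h1), max_eq_left (by linarith)]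
    refine e.congr_deriv ?_
    rw [neg_div, neg_neg]
  · rw [dickmanDensity, Set.indicator_of_notMem (by simpa using h1.le)]
    refine (hasDerivAt_const v (1 : ℝ)).congr_of_eventuallyEq ?_
    filter_upwards [lt_mem_nhds h1] with w hw
    exact h.eq_one _ (by linarith)

theorem eq_add_integral_density {ρ : ℝ → ℝ} (h : IsDickman ρ) (u : ℝ) {s : ℝ} (hs : 0 ≤ s) :
    ρ (u - s) = ρ u + ∫ v in (0 : ℝ)..s, dickmanDensity ρ u v := by
  have := MeasureTheory.integral_eq_of_hasDerivAt_off_countable_of_le (fun v => ρ (u - v))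
    (dickmanDensity ρ u) hs (Set.countable_singleton (u - 1))
    (h.continuous.comp (by fun_prop)).continuousOn (fun v hv => h.hasDerivAt_sub hv.2)
    (h.intervalIntegrable_density u 0 s)
  rw [this, sub_zero]
  ring

theorem integral_density_mul {ρ : ℝ → ℝ} (h : IsDickman ρ) (u : ℝ) {σ : ℝ} (hσ : 0 ≤ σ) :
    ∫ v in (0 : ℝ)..σ, dickmanDensity ρ u v * (σ - v) =
      (∫ t in (u - σ)..u, ρ t) - σ * ρ u := by
  have hc : Continuous fun v => ρ (u - v) := h.continuous.comp (by fun_prop)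
  have hP (v : ℝ) : HasDerivAt (fun w => ∫ t in (0 : ℝ)..w, ρ (u - t)) (ρ (u - v)) v :=
    intervalIntegral.integral_hasDerivAt_right (hc.intervalIntegrable _ _)
      hc.aestronglyMeasurable.stronglyMeasurableAtFilter hc.continuousAt
  have := MeasureTheory.integral_eq_of_hasDerivAt_off_countable_of_le
    (fun v => ρ (u - v) * (σ - v) + ∫ t in (0 : ℝ)..v, ρ (u - t))
    (fun v => dickmanDensity ρ u v * (σ - v)) hσ (Set.countable_singleton (u - 1))
    ((hc.mul (by fun_prop)).add
      (continuous_iff_continuousAt.2 fun v => (hP v).continuousAt)).continuousOn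
    (fun v hv => by
      have e1 := ((h.hasDerivAt_sub hv.2).mul ((hasDerivAt_id v).const_sub σ)).add (hP v)
      refine e1.congr_deriv ?_
      simp only [id]
      ring)
    ((h.intervalIntegrable_density u 0 σ).mul_continuousOn (by fun_prop))
  rw [this, intervalIntegral.integral_comp_sub_left (fun t => ρ t) u]
  simp
  ring

theorem density_nonneg {ρ : ℝ → ℝ} (h : IsDickman ρ) (u v : ℝ) : 0 ≤ dickmanDensity ρ u v := by
  refine Set.indicator_nonneg (fun v _ => ?_) v
  exact div_nonneg (h.pos _).le (le_trans zero_le_one (le_max_right _ _))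

theorem density_le {ρ : ℝ → ℝ} (h : IsDickman ρ)
    {u v R : ℝ} (hu : 1 ≤ u) (hv : 0 ≤ v) (hR : 2 * log (2 * u + 1) ≤ R) :
    dickmanDensity ρ u v ≤ R * (ρ u * exp (R * v)) := by
  have hR0 : 0 ≤ R := le_trans (by have := log_nonneg (show 1 ≤ 2 * u + 1 by linarith); linarith) hR
  have hpos := h.pos u
  by_cases h1 : v < u - 1
  · rw [dickmanDensity, Set.indicator_of_mem (Set.mem_Iio.2 h1), max_eq_left (by linarith)]
    have h2 : 1 < u - v := by linarith
    have e1 := (h.ratio_le h2.le).trans (show _ ≤ 2 * log (2 * u + 1) by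
      have := log_le_log (by linarith) (show 2 * (u - v) + 1 ≤ 2 * u + 1 by linarith)
      linarith)
    have e2 := h.pos (u - v)
    rw [div_mul_eq_div_div, div_le_iff₀ e2] at e1
    calc _ ≤ 2 * log (2 * u + 1) * ρ (u - v) := e1
      _ ≤ R * ρ (u - v) := mul_le_mul_of_nonneg_right hR e2.le
      _ ≤ _ := mul_le_mul_of_nonneg_left (h.le_mul_exp hu hv hR) hR0
  · rw [dickmanDensity, Set.indicator_of_notMem (by simpa using h1)]
    positivity

end IsDickman

theorem integral_mul_exp_neg_le {R σ : ℝ} :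
    ∫ v in (0 : ℝ)..σ, R * exp (-(R * v)) ≤ 1 := by
  have := intervalIntegral.integral_eq_sub_of_hasDerivAt (f := fun v => -exp (-(R * v)))
    (f' := fun v => R * exp (-(R * v))) (a := 0) (b := σ) (fun v _ => by
      refine (((hasDerivAt_id v).const_mul R).neg.exp.neg).congr_deriv ?_
      simp only [id, Pi.neg_apply]
      ring) (Continuous.intervalIntegrable (by fun_prop) _ _)
  rw [this]
  have := exp_pos (-(R * σ))
  simp
  linarith

/-- The Dickman function summed against the von Mangoldt weights. -/
theorem exists_abs_sum_dickman_sub_le {ρ : ℝ → ℝ} (h : IsDickman ρ) {b : ℝ} (hb : 0 < b)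
    (hb1 : b < 3 / 5) : ∃ C : ℝ, 0 < C ∧ ∀ L u σ : ℝ, 0 < L → 1 ≤ u → 0 ≤ σ → σ ≤ 1 →
      4 * log (2 * u + 1) ≤ L ^ b →
      |∑ d ∈ Finset.Ioc 0 ⌊exp (σ * L)⌋₊,
          ArithmeticFunction.vonMangoldt d / d * ρ (u - log d / L) -
        L * ∫ t in (u - σ)..u, ρ t| ≤ C * ρ u := by
  obtain ⟨C, hC, hM⟩ := exists_abs_mertensSum_sub_le hb hb1
  refine ⟨2 * C, by positivity, fun L u σ hL hu hσ hσ1 hR => ?_⟩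
  set R := 2 * log (2 * u + 1) with hRdef
  have hR0 : 0 ≤ R := by have := log_nonneg (show 1 ≤ 2 * u + 1 by linarith); linarith
  set z := exp (σ * L) with hz
  have hz1 : 1 ≤ z := one_le_exp (by positivity)
  set N := Finset.Ioc 0 ⌊z⌋₊ with hN
  set g := dickmanDensity ρ u with hg
  have hρ := h.pos u
  have hmem (d : ℕ) (hd : d ∈ N) : 0 < (d : ℝ) ∧ log d / L ∈ Set.Icc 0 σ := by
    rw [hN, Finset.mem_Ioc] at hd
    have hd0 : (0 : ℝ) < d := by exact_mod_cast hd.1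
    have hd1 : (1 : ℝ) ≤ d := by exact_mod_cast hd.1
    refine ⟨hd0, div_nonneg (log_nonneg hd1) hL.le, ?_⟩
    rw [div_le_iff₀ hL]
    have := (Nat.le_floor_iff (by positivity)).1 hd.2
    calc log d ≤ log z := log_le_log hd0 this
      _ = σ * L := by rw [hz, log_exp]
  have e1 : ∑ d ∈ N, ArithmeticFunction.vonMangoldt d / d * ρ (u - log d / L) =
      ρ u * mertensSum z + ∫ v in (0 : ℝ)..σ,
        g v * ∑ d ∈ N with v < log ((d : ℕ) : ℝ) / L, ArithmeticFunction.vonMangoldt d / d := by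
    rw [← sum_mul_integral_eq N _ _ hσ (fun d hd => (hmem d hd).2)
      (h.intervalIntegrable_density u 0 σ), mertensSum, Finset.mul_sum, ← Finset.sum_add_distrib]
    refine Finset.sum_congr rfl fun d hd => ?_
    rw [h.eq_add_integral_density u (hmem d hd).2.1]
    ring
  set A : ℝ → ℝ := fun v => ∑ d ∈ N with v < log ((d : ℕ) : ℝ) / L,
    ArithmeticFunction.vonMangoldt d / d with hA
  have hAM (v : ℝ) (hv : 0 ≤ v) (hvσ : v ≤ σ) :
      |A v - L * (σ - v)| ≤ C * exp (-(2 * R * v)) := by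
    have hw1 : 1 ≤ exp (v * L) := one_le_exp (by positivity)
    have hwz : exp (v * L) ≤ z := exp_le_exp.2 (mul_le_mul_of_nonneg_right hvσ hL.le)
    have e2 : A v = mertensSum z - mertensSum (exp (v * L)) := by
      rw [eq_sub_iff_add_eq', mertensSum, mertensSum, ← Finset.Ioc_union_Ioc_eq_Ioc (Nat.zero_le _)
        (Nat.floor_le_floor hwz), Finset.sum_union (Finset.Ioc_disjoint_Ioc_of_le le_rfl)]
      congr 1
      refine Finset.sum_congr ?_ fun _ _ => rfl
      ext d
      simp only [hN, Finset.mem_filter, Finset.mem_Ioc, Nat.floor_lt (exp_pos (v * L)).le]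
      constructor
      · rintro ⟨⟨h1, h2⟩, h3⟩
        rw [lt_div_iff₀ hL, lt_log_iff_exp_lt (by exact_mod_cast h1)] at h3
        exact ⟨h3, h2⟩
      · rintro ⟨h1, h2⟩
        have h3 : (0 : ℝ) < d := (exp_pos _).trans h1
        refine ⟨⟨by exact_mod_cast h3, h2⟩, ?_⟩
        rwa [lt_div_iff₀ hL, lt_log_iff_exp_lt h3]
    have e3 := hM _ _ hw1 hwz
    rw [log_exp, hz, ← exp_sub, log_exp, ← hz, ← e2] at e3
    rw [show L * (σ - v) = σ * L - v * L by ring]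
    refine e3.trans (mul_le_mul_of_nonneg_left (exp_le_exp.2 (neg_le_neg ?_)) hC.le)
    rw [mul_rpow hv hL.le]
    have e4 : v ≤ v ^ b := by
      rcases hv.eq_or_lt with rfl | h0
      · exact rpow_nonneg le_rfl _
      · calc v = v ^ (1 : ℝ) := (rpow_one v).symm
          _ ≤ v ^ b := rpow_le_rpow_of_exponent_ge h0 (by linarith) (by linarith)
    calc 2 * R * v = v * (4 * log (2 * u + 1)) := by rw [hRdef]; ring
      _ ≤ v * L ^ b := mul_le_mul_of_nonneg_left hR hv
      _ ≤ v ^ b * L ^ b := mul_le_mul_of_nonneg_right e4 (by positivity)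
  have hgI := h.intervalIntegrable_density u 0 σ
  have hAI : IntervalIntegrable (fun v => g v * A v) MeasureTheory.volume 0 σ := by
    have : ∀ v, g v * A v = ∑ d ∈ N, (ArithmeticFunction.vonMangoldt d / d) *
        (Set.Iio (log ((d : ℕ) : ℝ) / L)).indicator g v := fun v => by
      simp only [hA]
      rw [Finset.sum_filter, Finset.mul_sum]
      refine Finset.sum_congr rfl fun d _ => ?_
      rw [Set.indicator_apply]
      by_cases h : v < log d / L <;> simp [h, mul_comm]
    simp only [this]
    have hs := IntervalIntegrable.sum (μ := MeasureTheory.volume) (a := 0) (b := σ) N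
      (f := fun d v => (ArithmeticFunction.vonMangoldt d / d) *
        (Set.Iio (log ((d : ℕ) : ℝ) / L)).indicator g v)
      fun d _ => IntervalIntegrable.const_mul ?_ _
    · simpa only [Finset.sum_fn] using hs
    rw [intervalIntegrable_iff] at hgI ⊢
    exact MeasureTheory.Integrable.indicator hgI measurableSet_Iio
  have e5 : ∑ d ∈ N, ArithmeticFunction.vonMangoldt d / d * ρ (u - log d / L) -
      L * ∫ t in (u - σ)..u, ρ t = ρ u * (mertensSum z - L * σ) +
        ∫ v in (0 : ℝ)..σ, (g v * A v - L * (g v * (σ - v))) := by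
    rw [intervalIntegral.integral_sub hAI
      ((hgI.mul_continuousOn (by fun_prop)).const_mul L), intervalIntegral.integral_const_mul,
      h.integral_density_mul u hσ, e1]
    ring
  have e6 : |mertensSum z - L * σ| ≤ C := by
    have := hM 1 z le_rfl hz1
    rw [div_one, hz, log_exp, ← hz, log_one, zero_rpow hb.ne', neg_zero, exp_zero] at this
    have e : mertensSum 1 = 0 := by simp [mertensSum]
    rw [e, sub_zero, mul_one] at this
    rwa [mul_comm L]
  have e7 : |∫ v in (0 : ℝ)..σ, (g v * A v - L * (g v * (σ - v)))| ≤ C * ρ u := by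
    rw [← norm_eq_abs]
    calc _ ≤ ∫ v in (0 : ℝ)..σ, C * ρ u * (R * exp (-(R * v))) := by
          refine intervalIntegral.norm_integral_le_of_norm_le hσ ?_
            (Continuous.intervalIntegrable (by fun_prop) _ _)
          refine Filter.Eventually.of_forall fun v hv => ?_
          have e : g v * A v - L * (g v * (σ - v)) = g v * (A v - L * (σ - v)) := by ring
          rw [e, norm_mul, norm_of_nonneg (h.density_nonneg u v), norm_eq_abs]
          calc _ ≤ R * (ρ u * exp (R * v)) * (C * exp (-(2 * R * v))) :=
                mul_le_mul (h.density_le hu hv.1.le le_rfl) (hAM v hv.1.le hv.2) (abs_nonneg _)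
                  (by positivity)
            _ = C * ρ u * (R * (exp (R * v) * exp (-(2 * R * v)))) := by ring
            _ = _ := by rw [← exp_add]; ring_nf
      _ ≤ C * ρ u := by
        rw [intervalIntegral.integral_const_mul]
        exact mul_le_of_le_one_right (by positivity) integral_mul_exp_neg_le
  rw [e5]
  calc _ ≤ |ρ u * (mertensSum z - L * σ)| + C * ρ u := (abs_add_le _ _).trans (by linarith)
    _ ≤ ρ u * C + C * ρ u := by
      rw [abs_mul, abs_of_pos hρ]
      linarith [mul_le_mul_of_nonneg_left e6 hρ.le]
    _ = _ := by ring

/-- Every prime factor of `k` is at most `m`. -/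
def IsSmooth (m k : ℕ) : Prop := ∀ p : ℕ, p.Prime → p ∣ k → p ≤ m

theorem IsSmooth.mul {m a b : ℕ} (ha : IsSmooth m a) (hb : IsSmooth m b) : IsSmooth m (a * b) :=
  fun p hp hpd => (hp.dvd_mul.1 hpd).elim (ha p hp) (hb p hp)

theorem IsSmooth.of_dvd {m a b : ℕ} (hb : IsSmooth m b) (hab : a ∣ b) : IsSmooth m a :=
  fun p hp hpd => hb p hp (hpd.trans hab)

theorem isSmooth_of_le {m a : ℕ} (ha : 0 < a) (ham : a ≤ m) : IsSmooth m a :=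
  fun _ _ hpd => (Nat.le_of_dvd ha hpd).trans ham

theorem cast_Psi_eq (n m : ℕ) :
    (Psi n m : ℝ) = ∑ k ∈ Finset.Ioc 0 n, if IsSmooth m k then (1 : ℝ) else 0 := by
  rw [Finset.sum_boole, Psi]
  congr 2

theorem Psi_le (n m : ℕ) : Psi n m ≤ n := by
  refine (Finset.card_filter_le _ _).trans ?_
  simp

theorem Psi_of_le {n m : ℕ} (h : n ≤ m) : Psi n m = n := by
  rw [Psi, Finset.filter_true_of_mem, Nat.card_Icc, Nat.add_sub_cancel]
  intro k hk p _ hpd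
  rw [Finset.mem_Icc] at hk
  exact (Nat.le_of_dvd hk.1 hpd).trans (hk.2.trans h)

/-- The von Mangoldt function, restricted to smooth integers. -/
noncomputable def smoothVonMangoldt (m : ℕ) : ArithmeticFunction ℝ :=
  ⟨fun n => if IsSmooth m n then ArithmeticFunction.vonMangoldt n else 0, by simp⟩

/-- The indicator function of the smooth integers. -/
noncomputable def smoothIndicator (m : ℕ) : ArithmeticFunction ℝ :=
  ⟨fun n => if n ≠ 0 ∧ IsSmooth m n then 1 else 0, by simp⟩

theorem smoothVonMangoldt_mul_apply (m n : ℕ) :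
    (smoothVonMangoldt m * smoothIndicator m) n = if IsSmooth m n then log n else 0 := by
  rcases eq_or_ne n 0 with rfl | hn
  · simp
  rw [ArithmeticFunction.mul_apply]
  split_ifs with hs
  · rw [← ArithmeticFunction.vonMangoldt_sum,
      Nat.sum_divisorsAntidiagonal fun a b => smoothVonMangoldt m a * smoothIndicator m b]
    refine Finset.sum_congr rfl fun d hd => ?_
    have hd' := Nat.dvd_of_mem_divisors hd
    have h1 : n / d ≠ 0 := (Nat.div_pos (Nat.le_of_dvd (Nat.pos_of_ne_zero hn) hd')
      (Nat.pos_of_mem_divisors hd)).ne'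
    simp only [smoothVonMangoldt, smoothIndicator, ArithmeticFunction.coe_mk]
    rw [if_pos (hs.of_dvd hd'), if_pos ⟨h1, hs.of_dvd (Nat.div_dvd_of_dvd hd')⟩, mul_one]
  · refine Finset.sum_eq_zero fun x hx => ?_
    simp only [smoothVonMangoldt, smoothIndicator, ArithmeticFunction.coe_mk]
    by_cases h1 : IsSmooth m x.1
    · by_cases h2 : IsSmooth m x.2
      · exact absurd ((Nat.mem_divisorsAntidiagonal.1 hx).1 ▸ h1.mul h2) hs
      · simp [h2]
    · rw [if_neg h1, zero_mul]

theorem sum_log_smooth_eq (N m : ℕ) :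
    ∑ n ∈ Finset.Ioc 0 N with IsSmooth m n, log n =
      ∑ d ∈ Finset.Ioc 0 N with IsSmooth m d, ArithmeticFunction.vonMangoldt d * Psi (N / d) m := by
  have e := ArithmeticFunction.sum_Ioc_mul_eq_sum_sum (smoothVonMangoldt m) (smoothIndicator m) N
  simp only [smoothVonMangoldt_mul_apply] at e
  rw [Finset.sum_filter, Finset.sum_filter, e]
  refine Finset.sum_congr rfl fun d _ => ?_
  rw [cast_Psi_eq]
  have : ∑ k ∈ Finset.Ioc 0 (N / d), smoothIndicator m k =
      ∑ k ∈ Finset.Ioc 0 (N / d), if IsSmooth m k then (1 : ℝ) else 0 := by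
    refine Finset.sum_congr rfl fun k hk => ?_
    rw [Finset.mem_Ioc] at hk
    simp only [smoothIndicator, ArithmeticFunction.coe_mk, hk.1.ne', ne_eq, not_false_eq_true,
      true_and]
  rw [this]
  simp only [smoothVonMangoldt, ArithmeticFunction.coe_mk]
  split_ifs <;> simp

/-- Hildebrand's identity. -/
theorem Psi_mul_log_eq {x : ℝ} (hx : 1 ≤ x) (m : ℕ) :
    (Psi ⌊x⌋₊ m : ℝ) * log x = ∑ n ∈ Finset.Ioc 0 ⌊x⌋₊ with IsSmooth m n, log (x / n) +
      ∑ d ∈ Finset.Ioc 0 ⌊x⌋₊ with IsSmooth m d,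
        ArithmeticFunction.vonMangoldt d * Psi ⌊x / d⌋₊ m := by
  simp only [Nat.floor_div_natCast]
  rw [← sum_log_smooth_eq, ← Finset.sum_add_distrib, cast_Psi_eq, ← Finset.sum_filter,
    Finset.sum_mul]
  refine Finset.sum_congr rfl fun n hn => ?_
  simp only [Finset.mem_filter, Finset.mem_Ioc] at hn
  have : (n : ℝ) ≠ 0 := by exact_mod_cast hn.1.1.ne'
  rw [log_div (by linarith) this]
  ring

theorem sum_log_div_le {x : ℝ} (m : ℕ) {J : ℕ} (hJ : log x < J) :
    ∑ n ∈ Finset.Ioc 0 ⌊x⌋₊ with IsSmooth m n, log (x / n) ≤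
      ∑ j ∈ Finset.range J, (Psi ⌊x / exp j⌋₊ m : ℝ) := by
  have e (j : ℕ) : (Psi ⌊x / exp j⌋₊ m : ℝ) ≥
      ∑ n ∈ Finset.Ioc 0 ⌊x⌋₊ with IsSmooth m n, if (n : ℝ) * exp j ≤ x then (1 : ℝ) else 0 := by
    rw [cast_Psi_eq, Finset.sum_boole, Finset.sum_boole, Finset.filter_filter, ge_iff_le,
      Nat.cast_le]
    refine Finset.card_le_card fun n hn => ?_
    simp only [Finset.mem_filter, Finset.mem_Ioc] at hn ⊢
    refine ⟨⟨hn.1.1, Nat.le_floor ?_⟩, hn.2.1⟩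
    rw [le_div_iff₀ (exp_pos _)]
    exact hn.2.2
  refine le_trans ?_ (Finset.sum_le_sum fun j _ => e j)
  rw [Finset.sum_comm]
  refine Finset.sum_le_sum fun n hn => ?_
  simp only [Finset.mem_filter, Finset.mem_Ioc] at hn
  have hn0 : (0 : ℝ) < n := by exact_mod_cast hn.1.1
  have hn1 : (1 : ℝ) ≤ n := by exact_mod_cast hn.1.1
  have hnx : (n : ℝ) ≤ x := (Nat.le_floor_iff' hn.1.1.ne').1 hn.1.2
  have hx0 : 0 < x := hn0.trans_le hnx
  have hl0 : 0 ≤ log (x / n) := log_nonneg ((one_le_div hn0).2 hnx)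
  have hlx : log (x / n) ≤ log x := by
    rw [log_div hx0.ne' hn0.ne']
    linarith [log_nonneg hn1]
  rw [Finset.sum_boole]
  have hsub : Finset.range (⌊log (x / n)⌋₊ + 1) ⊆
      (Finset.range J).filter fun j : ℕ => (n : ℝ) * exp j ≤ x := by
    intro j hj
    rw [Finset.mem_range, Nat.lt_succ_iff, Nat.le_floor_iff hl0] at hj
    simp only [Finset.mem_filter, Finset.mem_range]
    refine ⟨?_, ?_⟩
    · exact_mod_cast hj.trans_lt (hlx.trans_lt hJ)
    · rw [mul_comm, ← le_div_iff₀ hn0, ← le_log_iff_exp_le (by positivity)]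
      exact hj
  have hcard := Finset.card_le_card hsub
  rw [Finset.card_range] at hcard
  calc log (x / n) ≤ ((⌊log (x / n)⌋₊ + 1 : ℕ) : ℝ) := by
        push_cast
        exact (Nat.lt_floor_add_one _).le
    _ ≤ _ := by exact_mod_cast hcard

theorem exists_sum_not_prime_le : ∃ K : ℝ, 0 < K ∧ ∀ N : ℕ,
    ∑ d ∈ Finset.Ioc 0 N with ¬ d.Prime,
      ArithmeticFunction.vonMangoldt d * (d : ℝ) ^ (-(3 / 4) : ℝ) ≤ K := by
  have hsum : Summable fun n : ℕ => (n : ℝ) ^ (-(5 / 4) : ℝ) :=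
    summable_nat_rpow.2 (by norm_num)
  set T := ∑' n : ℕ, (n : ℝ) ^ (-(5 / 4) : ℝ)
  have hT : 0 ≤ T := tsum_nonneg fun n => by positivity
  refine ⟨12 * T + 1, by positivity, fun N => ?_⟩
  set f : ℕ → ℝ := fun d => if d.Prime then 0 else
    ArithmeticFunction.vonMangoldt d * (d : ℝ) ^ (-(3 / 4) : ℝ) with hf
  have e1 : ∑ d ∈ Finset.Ioc 0 N with ¬ d.Prime,
      ArithmeticFunction.vonMangoldt d * (d : ℝ) ^ (-(3 / 4) : ℝ) =
      ∑ d ∈ Finset.Ioc 0 ⌊(N : ℝ)⌋₊ with IsPrimePow d, f d := by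
    rw [Nat.floor_natCast, Finset.sum_filter, Finset.sum_filter]
    refine Finset.sum_congr rfl fun d _ => ?_
    simp only [hf]
    by_cases h1 : d.Prime
    · simp [h1]
    · by_cases h2 : IsPrimePow d
      · simp [h1, h2]
      · simp [h1, h2, ArithmeticFunction.vonMangoldt_eq_zero_iff.2 h2]
  have e2 (p k : ℕ) (hp : p.Prime) (hk : 1 ≤ k) : f (p ^ k) =
      if 2 ≤ k then log p * ((p : ℝ) ^ (-(3 / 4) : ℝ)) ^ k else 0 := by
    simp only [hf]
    split_ifs with h1 h2 h2
    · exact absurd h1 (Nat.Prime.not_prime_pow h2)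
    · rfl
    · rw [ArithmeticFunction.vonMangoldt_apply_pow (by omega),
        ArithmeticFunction.vonMangoldt_apply_prime hp, Nat.cast_pow, ← rpow_natCast, ← rpow_natCast,
        ← rpow_mul (by positivity), ← rpow_mul (by positivity), mul_comm (k : ℝ)]
    · obtain rfl : k = 1 := by omega
      exact absurd (by simpa using hp) h1
  rw [e1, Chebyshev.sum_PrimePow_eq_sum_sum _ (Nat.cast_nonneg _)]
  set M := ⌊log (N : ℝ) / log 2⌋₊
  calc _ ≤ ∑ k ∈ Finset.Icc 1 M, ∑ p ∈ Finset.Ioc 0 N with p.Prime,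
        if 2 ≤ k then log p * ((p : ℝ) ^ (-(3 / 4) : ℝ)) ^ k else 0 := by
        refine Finset.sum_le_sum fun k hk => ?_
        rw [Finset.mem_Icc] at hk
        have hsub : (Finset.Ioc 0 ⌊(N : ℝ) ^ ((1 : ℝ) / k)⌋₊).filter (fun p => p.Prime) ⊆
            (Finset.Ioc 0 N).filter fun p => p.Prime := by
          refine Finset.filter_subset_filter _ (Finset.Ioc_subset_Ioc le_rfl ?_)
          rcases Nat.eq_zero_or_pos N with rfl | hN
          · have : (1 : ℝ) / k ≠ 0 := by
              have : (0 : ℝ) < k := by exact_mod_cast hk.1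
              positivity
            rw [Nat.cast_zero, zero_rpow this, Nat.floor_zero]
          · refine Nat.floor_le_of_le ?_
            have hN1 : (1 : ℝ) ≤ N := by exact_mod_cast hN
            calc (N : ℝ) ^ ((1 : ℝ) / k) ≤ (N : ℝ) ^ (1 : ℝ) := by
                  refine rpow_le_rpow_of_exponent_le hN1 ?_
                  have : (1 : ℝ) ≤ k := by exact_mod_cast hk.1
                  exact (div_le_one (by linarith)).2 this
              _ = N := rpow_one _
        refine (Finset.sum_congr rfl fun p hp => ?_).trans_le
          (Finset.sum_le_sum_of_subset_of_nonneg hsub fun p _ _ => ?_)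
        · simp only [Finset.mem_filter] at hp
          exact e2 p k hp.2 hk.1
        · split_ifs
          · have := log_natCast_nonneg p
            positivity
          · exact le_rfl
    _ = ∑ p ∈ Finset.Ioc 0 N with p.Prime, log p *
        ∑ k ∈ Finset.Ico 2 (M + 1), ((p : ℝ) ^ (-(3 / 4) : ℝ)) ^ k := by
      rw [Finset.sum_comm]
      refine Finset.sum_congr rfl fun p _ => ?_
      rw [← Finset.sum_filter, Finset.mul_sum]
      refine Finset.sum_congr ?_ fun _ _ => rfl
      ext k
      simp only [Finset.mem_filter, Finset.mem_Icc, Finset.mem_Ico]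
      omega
    _ ≤ ∑ p ∈ Finset.Ioc 0 N with p.Prime, 12 * (p : ℝ) ^ (-(5 / 4) : ℝ) := by
      refine Finset.sum_le_sum fun p hp => ?_
      simp only [Finset.mem_filter] at hp
      have hp2 : (2 : ℝ) ≤ p := by exact_mod_cast hp.2.two_le
      have hp0 : (0 : ℝ) < p := by linarith
      have hq : (p : ℝ) ^ (-(3 / 4) : ℝ) ≤ 2 / 3 := by
        have e : (p : ℝ) ^ (-(3 / 4) : ℝ) ≤ 2 ^ (-(3 / 4) : ℝ) :=
          rpow_le_rpow_of_nonpos two_pos hp2 (by norm_num)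
        refine e.trans ?_
        refine le_of_pow_le_pow_left₀ (n := 4) (by norm_num) (by norm_num) ?_
        rw [← rpow_mul_natCast (by norm_num)]
        norm_num
      have h1 := geom_sum_Ico_le_of_lt_one (m := 2) (n := M + 1)
        (rpow_nonneg hp0.le (-(3 / 4) : ℝ)) (by linarith)
      have h2 := log_le_rpow_div hp0.le (show (0 : ℝ) < 1 / 4 by norm_num)
      have h3 : ((p : ℝ) ^ (-(3 / 4) : ℝ)) ^ 2 / (1 - (p : ℝ) ^ (-(3 / 4) : ℝ)) ≤
          3 * (p : ℝ) ^ (-(3 / 2) : ℝ) := by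
        rw [div_le_iff₀ (by linarith), ← rpow_mul_natCast hp0.le]
        norm_num
        have : 0 < (p : ℝ) ^ (-(3 / 2) : ℝ) := by positivity
        nlinarith
      calc _ ≤ ((p : ℝ) ^ (1 / 4 : ℝ) / (1 / 4)) * (3 * (p : ℝ) ^ (-(3 / 2) : ℝ)) :=
            mul_le_mul h2 (h1.trans h3) (Finset.sum_nonneg fun k _ => by positivity)
              (by positivity)
        _ = 12 * ((p : ℝ) ^ (1 / 4 : ℝ) * (p : ℝ) ^ (-(3 / 2) : ℝ)) := by ring
        _ = _ := by rw [← rpow_add hp0]; norm_num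
    _ ≤ 12 * T := by
      rw [← Finset.mul_sum]
      exact mul_le_mul_of_nonneg_left (hsum.sum_le_tsum _ fun n _ => by positivity) (by norm_num)
    _ ≤ _ := by linarith

/-- `S` bounds the relative error of the Dickman approximation up to `m ^ w`. -/
def RelErrorBound (ρ : ℝ → ℝ) (m : ℕ) (S w : ℝ) : Prop :=
  ∀ t : ℝ, 1 ≤ t → log t ≤ w * log m →
    |(Psi ⌊t⌋₊ m : ℝ) - t * ρ (log t / log m)| ≤
      S * (t * ρ (log t / log m)) + if t ≤ m then 1 else 0

namespace IsDickman

theorem Psi_div_le {ρ : ℝ → ℝ} (h : IsDickman ρ)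
    {m : ℕ} {x u A s : ℝ} (hm : 0 < log m) (hx : 1 ≤ x) (hu : 1 ≤ u)
    (hxu : log x = u * log m) (hA : 0 ≤ A) (hR : 8 * log (2 * u + 1) ≤ log m)
    (hU : ∀ t, 1 ≤ t → t ≤ x → (Psi ⌊t⌋₊ m : ℝ) ≤ A * (t * ρ (log t / log m))) (hs : 1 ≤ s) :
    (Psi ⌊x / s⌋₊ m : ℝ) ≤ A * (x * ρ u) * s ^ (-(3 / 4) : ℝ) := by
  have hs0 : 0 < s := by linarith
  have hx0 : 0 < x := by linarith
  have hρ := h.pos u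
  rcases le_or_gt s x with h1 | h1
  · refine (hU (x / s) ((one_le_div hs0).2 h1) (div_le_self hx0.le hs)).trans ?_
    rw [mul_assoc]
    refine mul_le_mul_of_nonneg_left ?_ hA
    rw [log_div hx0.ne' hs0.ne', hxu, sub_div, mul_div_cancel_right₀ _ hm.ne']
    have hls := log_nonneg hs
    have e1 := h.le_mul_exp hu (div_nonneg hls hm.le) (le_refl (2 * log (2 * u + 1)))
    have e2 : exp (2 * log (2 * u + 1) * (log s / log m)) ≤ s ^ (1 / 4 : ℝ) := by
      rw [rpow_def_of_pos hs0]
      refine exp_le_exp.2 ?_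
      rw [← mul_div_assoc, div_le_iff₀ hm]
      nlinarith
    calc x / s * ρ (u - log s / log m) ≤ x / s * (ρ u * s ^ (1 / 4 : ℝ)) :=
          mul_le_mul_of_nonneg_left (e1.trans (mul_le_mul_of_nonneg_left e2 hρ.le)) (by positivity)
      _ = x * ρ u * (s ^ (-1 : ℝ) * s ^ (1 / 4 : ℝ)) := by rw [rpow_neg_one]; ring
      _ = _ := by rw [← rpow_add hs0]; norm_num
  · rw [Nat.floor_eq_zero.2 ((div_lt_one hs0).2 h1)]
    have : Psi 0 m = 0 := by simp [Psi]
    rw [this, Nat.cast_zero]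
    positivity

theorem sum_log_le {ρ : ℝ → ℝ} (h : IsDickman ρ)
    {m : ℕ} {x u A : ℝ} (hm : 0 < log m) (hx : 1 ≤ x) (hu : 1 ≤ u)
    (hxu : log x = u * log m) (hA : 0 ≤ A) (hR : 8 * log (2 * u + 1) ≤ log m)
    (hU : ∀ t, 1 ≤ t → t ≤ x → (Psi ⌊t⌋₊ m : ℝ) ≤ A * (t * ρ (log t / log m))) :
    ∑ n ∈ Finset.Ioc 0 ⌊x⌋₊ with IsSmooth m n, log (x / n) ≤ 3 * (A * (x * ρ u)) := by
  obtain ⟨J, hJ⟩ := exists_nat_gt (log x)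
  refine (sum_log_div_le m hJ).trans ?_
  have hρ := h.pos u
  have hB : 0 ≤ A * (x * ρ u) := by positivity
  calc _ ≤ ∑ j ∈ Finset.Ico 0 J, A * (x * ρ u) * (2 / 3 : ℝ) ^ j := by
        rw [Finset.range_eq_Ico]
        refine Finset.sum_le_sum fun j _ => ?_
        refine (h.Psi_div_le hm hx hu hxu hA hR hU (one_le_exp (Nat.cast_nonneg j))).trans ?_
        refine mul_le_mul_of_nonneg_left ?_ hB
        rw [← exp_mul, show (j : ℝ) * -(3 / 4) = j * (-(3 / 4) : ℝ) by ring, exp_nat_mul]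
        refine pow_le_pow_left₀ (by positivity) ?_ j
        rw [exp_neg, inv_le_comm₀ (exp_pos _) (by norm_num)]
        have := add_one_le_exp (3 / 4 : ℝ)
        linarith
    _ ≤ _ := by
      rw [← Finset.mul_sum]
      have := geom_sum_Ico_le_of_lt_one (m := 0) (n := J) (show (0 : ℝ) ≤ 2 / 3 by norm_num)
        (by norm_num)
      norm_num at this
      rw [mul_comm 3]
      exact mul_le_mul_of_nonneg_left (by rwa [Finset.range_eq_Ico] at this) hB

theorem sum_not_le_le {ρ : ℝ → ℝ} (h : IsDickman ρ)
    {m : ℕ} {x u A K : ℝ} (hm : 0 < log m) (hx : 1 ≤ x) (hu : 1 ≤ u)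
    (hxu : log x = u * log m) (hA : 0 ≤ A) (hR : 8 * log (2 * u + 1) ≤ log m)
    (hU : ∀ t, 1 ≤ t → t ≤ x → (Psi ⌊t⌋₊ m : ℝ) ≤ A * (t * ρ (log t / log m)))
    (hK : ∀ N : ℕ, ∑ d ∈ Finset.Ioc 0 N with ¬ d.Prime,
      ArithmeticFunction.vonMangoldt d * (d : ℝ) ^ (-(3 / 4) : ℝ) ≤ K) :
    ∑ d ∈ Finset.Ioc 0 ⌊x⌋₊ with IsSmooth m d ∧ ¬ d ≤ m,
      ArithmeticFunction.vonMangoldt d * Psi ⌊x / d⌋₊ m ≤ K * (A * (x * ρ u)) := by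
  have hρ := h.pos u
  have hB : 0 ≤ A * (x * ρ u) := by positivity
  calc _ ≤ ∑ d ∈ Finset.Ioc 0 ⌊x⌋₊ with IsSmooth m d ∧ ¬ d ≤ m,
        ArithmeticFunction.vonMangoldt d * (d : ℝ) ^ (-(3 / 4) : ℝ) * (A * (x * ρ u)) := by
        refine Finset.sum_le_sum fun d hd => ?_
        simp only [Finset.mem_filter, Finset.mem_Ioc] at hd
        rw [mul_assoc]
        refine mul_le_mul_of_nonneg_left ?_ ArithmeticFunction.vonMangoldt_nonneg
        rw [mul_comm]
        exact h.Psi_div_le hm hx hu hxu hA hR hU (by exact_mod_cast hd.1.1)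
    _ ≤ ∑ d ∈ Finset.Ioc 0 ⌊x⌋₊ with ¬ d.Prime,
        ArithmeticFunction.vonMangoldt d * (d : ℝ) ^ (-(3 / 4) : ℝ) * (A * (x * ρ u)) := by
        refine Finset.sum_le_sum_of_subset_of_nonneg (fun d hd => ?_) fun d _ _ => ?_
        · simp only [Finset.mem_filter] at hd ⊢
          exact ⟨hd.1, fun hp => hd.2.2 (hd.2.1 d hp dvd_rfl)⟩
        · have := ArithmeticFunction.vonMangoldt_nonneg (n := d)
          positivity
    _ ≤ _ := by
      rw [← Finset.sum_mul]
      exact mul_le_mul_of_nonneg_right (hK _) hB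

end IsDickman

theorem sum_ite_mul_eq {M N : ℕ} (hMN : M ≤ N) (S D : ℝ) (a : ℕ → ℝ) :
    ∑ d ∈ Finset.Ioc 0 N, (if d ≤ M then S else D) * a d =
      (S - D) * ∑ d ∈ Finset.Ioc 0 M, a d + D * ∑ d ∈ Finset.Ioc 0 N, a d := by
  have e : Finset.Ioc 0 M = (Finset.Ioc 0 N).filter (fun d => d ≤ M) := by
    ext d
    simp only [Finset.mem_Ioc, Finset.mem_filter]
    omega
  rw [e, Finset.sum_filter, Finset.mul_sum, Finset.mul_sum, ← Finset.sum_add_distrib]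
  refine Finset.sum_congr rfl fun d _ => ?_
  split_ifs <;> ring

theorem RelErrorBound.Psi_le {ρ : ℝ → ℝ} (h : IsDickman ρ) {m : ℕ} {S w t : ℝ}
    (hm : 0 < log m) (hS : 0 ≤ S) (hB : RelErrorBound ρ m S w) (ht : 1 ≤ t)
    (htw : log t ≤ w * log m) : (Psi ⌊t⌋₊ m : ℝ) ≤ (1 + S) * (t * ρ (log t / log m)) := by
  have h1 := hB t ht htw
  have hρ := h.pos (log t / log m)
  split_ifs at h1 with h2
  · have e : ρ (log t / log m) = 1 :=
      h.eq_one _ ((div_le_one hm).2 (log_le_log (by linarith) h2))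
    rw [e, mul_one]
    have : (Psi ⌊t⌋₊ m : ℝ) ≤ t :=
      le_trans (by exact_mod_cast Vinogradov.Psi_le _ _) (Nat.floor_le (by linarith))
    nlinarith
  · have := (abs_le.1 h1).2
    linarith

theorem sum_indicator_le {ρ : ℝ → ℝ} (h : IsDickman ρ) {m : ℕ} {x u : ℝ} (hm : 0 < log m)
    (hx : (m : ℝ) ≤ x) (hxu : log x = u * log m) :
    ∑ d ∈ Finset.Ioc 0 m, ArithmeticFunction.vonMangoldt d * (if x / d ≤ m then 1 else 0) ≤
      6 / ρ 2 * (x * ρ u) := by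
  have hm1 : (1 : ℝ) < m := (log_pos_iff (Nat.cast_nonneg m)).1 hm
  have hx0 : 0 < x := by linarith
  have hρ := h.pos u
  have hρ2 := h.pos 2
  rcases le_or_gt u 2 with hu | hu
  · have e1 : ρ 2 ≤ ρ u := h.antitone hu
    calc _ ≤ ∑ d ∈ Finset.Ioc 0 m, ArithmeticFunction.vonMangoldt d := by
          refine Finset.sum_le_sum fun d _ => mul_le_of_le_one_right
            ArithmeticFunction.vonMangoldt_nonneg ?_
          split_ifs <;> norm_num
      _ = Chebyshev.psi m := by simp [Chebyshev.psi]
      _ ≤ (log 4 + 4) * m := Chebyshev.psi_le_const_mul_self (Nat.cast_nonneg m)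
      _ ≤ 6 * x := by
          have : log 4 ≤ 2 := by
            rw [show (4 : ℝ) = 2 ^ 2 by norm_num, log_pow]
            have := log_two_lt_d9
            push_cast
            linarith
          nlinarith
      _ ≤ _ := by
          rw [div_mul_eq_mul_div, le_div_iff₀ hρ2]
          nlinarith
  · rw [Finset.sum_eq_zero]
    · positivity
    · intro d hd
      rw [if_neg, mul_zero]
      simp only [Finset.mem_Ioc] at hd
      have hd0 : (0 : ℝ) < d := by exact_mod_cast hd.1
      have hdm : (d : ℝ) ≤ m := by exact_mod_cast hd.2
      rw [not_le, lt_div_iff₀ hd0]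
      have : (m : ℝ) * m < x := by
        rw [← log_lt_log_iff (by positivity) hx0, log_mul (by positivity) (by positivity), hxu]
        nlinarith
      nlinarith

theorem abs_sum_prime_powers_sub_le {ρ : ℝ → ℝ} (h : IsDickman ρ) {m : ℕ} {x u w D S C : ℝ}
    (hm : 0 < log m) (hx : (m : ℝ) ≤ x) (hu : 1 ≤ u) (huw : u ≤ w + 1 / 2)
    (hxu : log x = u * log m) (hD : 0 ≤ D) (hDS : D ≤ S)
    (hBD : RelErrorBound ρ m D w) (hBS : RelErrorBound ρ m S (w + 1 / 2))
    (hC : ∀ σ : ℝ, 0 ≤ σ → σ ≤ 1 →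
      |∑ d ∈ Finset.Ioc 0 ⌊exp (σ * log m)⌋₊, ArithmeticFunction.vonMangoldt d / d *
        ρ (u - log d / log m) - log m * ∫ t in (u - σ)..u, ρ t| ≤ C * ρ u) :
    |∑ d ∈ Finset.Ioc 0 m, ArithmeticFunction.vonMangoldt d * Psi ⌊x / d⌋₊ m -
      x * ρ u * (u * log m)| ≤
      x * ρ u * (u * log m * (1 / 2 * (S + D)) + (C + 6 / ρ 2) * (1 + S)) := by
  have hm1 : (1 : ℝ) < m := (log_pos_iff (Nat.cast_nonneg m)).1 hm
  have hx0 : 0 < x := by linarith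
  have hρ := h.pos u
  have hρ2 := h.pos 2
  have hS : 0 ≤ S := hD.trans hDS
  set M := ⌊exp (1 / 2 * log m)⌋₊ with hM
  have hMm : M ≤ m := by
    refine Nat.floor_le_of_le ?_
    calc exp (1 / 2 * log m) ≤ exp (log m) := exp_le_exp.2 (by linarith)
      _ = m := exp_log (by linarith)
  set a : ℕ → ℝ := fun d => ArithmeticFunction.vonMangoldt d / d * ρ (u - log d / log m) with ha
  have hC1 := hC 1 zero_le_one le_rfl
  rw [one_mul, exp_log (by linarith), Nat.floor_natCast, ← h.mul_eq_integral hu] at hC1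
  have hC2 := (abs_le.1 (hC (1 / 2) (by norm_num) (by norm_num))).2
  rw [← hM] at hC2
  have hhalf := mul_le_mul_of_nonneg_left (h.integral_half_le hu) hm.le
  have key : ∀ d ∈ Finset.Ioc 0 m,
      |ArithmeticFunction.vonMangoldt d * (Psi ⌊x / d⌋₊ m : ℝ) - x * a d| ≤
        x * ((if d ≤ M then S else D) * a d) +
          ArithmeticFunction.vonMangoldt d * (if x / d ≤ m then 1 else 0) := by
    intro d hd
    simp only [Finset.mem_Ioc] at hd
    have hd0 : (0 : ℝ) < d := by exact_mod_cast hd.1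
    have hdm : (d : ℝ) ≤ m := by exact_mod_cast hd.2
    have hd1 : (1 : ℝ) ≤ d := by exact_mod_cast hd.1
    have hΛ := ArithmeticFunction.vonMangoldt_nonneg (n := d)
    have hxd : 1 ≤ x / d := (one_le_div hd0).2 (hdm.trans hx)
    have hlog : log (x / d) = u * log m - log d := by rw [log_div hx0.ne' hd0.ne', hxu]
    have hdiv : log (x / d) / log m = u - log d / log m := by
      rw [hlog, sub_div, mul_div_cancel_right₀ _ hm.ne']
    have hld := log_nonneg hd1
    have main : |(Psi ⌊x / d⌋₊ m : ℝ) - x / d * ρ (u - log d / log m)| ≤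
        (if d ≤ M then S else D) * (x / d * ρ (u - log d / log m)) +
          if x / d ≤ m then 1 else 0 := by
      rw [← hdiv]
      split_ifs with hdM
      · have := hBS (x / d) hxd (by rw [hlog]; nlinarith)
        simpa [*] using this
      · have := hBS (x / d) hxd (by rw [hlog]; nlinarith)
        simpa [*] using this
      · refine (hBD (x / d) hxd ?_).trans (by simp [*])
        have : exp (1 / 2 * log m) < d := by
          rw [hM, not_le, Nat.floor_lt (exp_pos _).le] at hdM
          exact hdM
        have := (lt_log_iff_exp_lt hd0).2 this
        rw [hlog]
        nlinarith
      · refine (hBD (x / d) hxd ?_).trans (by simp [*])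
        have : exp (1 / 2 * log m) < d := by
          rw [hM, not_le, Nat.floor_lt (exp_pos _).le] at hdM
          exact hdM
        have := (lt_log_iff_exp_lt hd0).2 this
        rw [hlog]
        nlinarith
    have e : ArithmeticFunction.vonMangoldt d * (Psi ⌊x / d⌋₊ m : ℝ) - x * a d =
        ArithmeticFunction.vonMangoldt d *
          ((Psi ⌊x / d⌋₊ m : ℝ) - x / d * ρ (u - log d / log m)) := by
      simp only [ha]
      field_simp
    rw [e, abs_mul, abs_of_nonneg hΛ]
    refine (mul_le_mul_of_nonneg_left main hΛ).trans (le_of_eq ?_)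
    simp only [ha]
    rw [mul_add]
    congr 1
    field_simp
  have tot : |∑ d ∈ Finset.Ioc 0 m, ArithmeticFunction.vonMangoldt d * (Psi ⌊x / d⌋₊ m : ℝ) -
      x * ∑ d ∈ Finset.Ioc 0 m, a d| ≤
      x * ((S - D) * ∑ d ∈ Finset.Ioc 0 M, a d + D * ∑ d ∈ Finset.Ioc 0 m, a d) +
        6 / ρ 2 * (x * ρ u) := by
    rw [Finset.mul_sum, ← Finset.sum_sub_distrib]
    refine (Finset.abs_sum_le_sum_abs _ _).trans ((Finset.sum_le_sum key).trans ?_)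
    rw [Finset.sum_add_distrib, ← Finset.mul_sum, sum_ite_mul_eq hMm]
    exact add_le_add le_rfl (sum_indicator_le h hm hx hxu)
  set A := ∑ d ∈ Finset.Ioc 0 m, a d with hA
  set B := ∑ d ∈ Finset.Ioc 0 M, a d with hBdef
  have hCnn : 0 ≤ C := by
    have := (abs_nonneg _).trans hC1
    exact nonneg_of_mul_nonneg_left this hρ
  have hAabs : |A - log m * (u * ρ u)| ≤ C * ρ u := hC1
  have hA2 := (abs_le.1 hAabs).2
  have hB2 : B ≤ log m * (1 / 2 * (u * ρ u)) + C * ρ u := by linarith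
  have hsplit : |∑ d ∈ Finset.Ioc 0 m, ArithmeticFunction.vonMangoldt d * (Psi ⌊x / d⌋₊ m : ℝ) -
      x * ρ u * (u * log m)| ≤
      (x * ((S - D) * B + D * A) + 6 / ρ 2 * (x * ρ u)) + x * (C * ρ u) := by
    refine (abs_sub_le _ (x * A) _).trans (add_le_add tot ?_)
    rw [show x * A - x * ρ u * (u * log m) = x * (A - log m * (u * ρ u)) by ring, abs_mul,
      abs_of_pos hx0]
    exact mul_le_mul_of_nonneg_left hAabs hx0.le
  refine hsplit.trans ?_
  have e1 : (S - D) * B ≤ (S - D) * (log m * (1 / 2 * (u * ρ u)) + C * ρ u) :=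
    mul_le_mul_of_nonneg_left hB2 (by linarith)
  have e2 : D * A ≤ D * (log m * (u * ρ u) + C * ρ u) :=
    mul_le_mul_of_nonneg_left (by linarith) hD
  have e3 : x * ((S - D) * B + D * A) ≤ x * ((S - D) * (log m * (1 / 2 * (u * ρ u)) + C * ρ u) +
      D * (log m * (u * ρ u) + C * ρ u)) :=
    mul_le_mul_of_nonneg_left (add_le_add e1 e2) hx0.le
  have e4 : 0 ≤ 6 / ρ 2 * (x * ρ u) * S := by positivity
  have e5 : x * ρ u * (u * log m * (1 / 2 * (S + D)) + (C + 6 / ρ 2) * (1 + S)) =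
      x * ((S - D) * (log m * (1 / 2 * (u * ρ u)) + C * ρ u) +
      D * (log m * (u * ρ u) + C * ρ u)) + 6 / ρ 2 * (x * ρ u) + x * (C * ρ u) +
      6 / ρ 2 * (x * ρ u) * S := by ring
  rw [e5]
  linarith

theorem IsDickman.exists_relErrorBound_step {ρ : ℝ → ℝ} (h : IsDickman ρ) {b : ℝ} (hb : 0 < b)
    (hb' : b < 3 / 5) : ∃ C : ℝ, 0 < C ∧ ∀ (m : ℕ) (w D S : ℝ), 0 < log m → 1 ≤ w → 0 ≤ D →
      D ≤ S → RelErrorBound ρ m D w → RelErrorBound ρ m S (w + 1 / 2) →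
      4 * log (2 * (w + 1 / 2) + 1) ≤ (log m) ^ b → 8 * log (2 * (w + 1 / 2) + 1) ≤ log m →
      RelErrorBound ρ m (1 / 2 * (S + D) + C * (1 + S) / (w * log m)) (w + 1 / 2) := by
  obtain ⟨C, hC, hCs⟩ := exists_abs_sum_dickman_sub_le h hb hb'
  obtain ⟨K, hK, hKs⟩ := exists_sum_not_prime_le
  have hρ2 := h.pos 2
  refine ⟨C + 6 / ρ 2 + 3 + K, by positivity, ?_⟩
  intro m w D S hm hw hD hDS hBD hBS hL1 hL2 t ht htw
  have hm1 : (1 : ℝ) < m := (log_pos_iff (Nat.cast_nonneg m)).1 hm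
  have hS : 0 ≤ S := hD.trans hDS
  have ht0 : 0 < t := by linarith
  have hρt := h.pos (log t / log m)
  have hind : (0 : ℝ) ≤ if t ≤ m then 1 else 0 := by split_ifs <;> norm_num
  rcases le_or_gt (log t) (w * log m) with hcase | hcase
  · refine (hBD t ht hcase).trans (add_le_add (mul_le_mul_of_nonneg_right ?_ (by positivity)) le_rfl)
    have : 0 ≤ (C + 6 / ρ 2 + 3 + K) * (1 + S) / (w * log m) := by positivity
    linarith
  · refine le_add_of_le_of_nonneg ?_ hind
    set u := log t / log m with hu
    have hxu : log t = u * log m := by rw [hu, div_mul_cancel₀ _ hm.ne']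
    have hwu : w ≤ u := by rw [hu, le_div_iff₀ hm]; exact hcase.le
    have huw : u ≤ w + 1 / 2 := by rw [hu, div_le_iff₀ hm]; exact htw
    have hu1 : 1 ≤ u := hw.trans hwu
    have hmt : (m : ℝ) ≤ t := by
      rw [← log_le_log_iff (by linarith) ht0]
      nlinarith
    have hlogmono : log (2 * u + 1) ≤ log (2 * (w + 1 / 2) + 1) :=
      log_le_log (by linarith) (by linarith)
    have hU : ∀ s, 1 ≤ s → s ≤ t → (Psi ⌊s⌋₊ m : ℝ) ≤ (1 + S) * (s * ρ (log s / log m)) :=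
      fun s hs hst => hBS.Psi_le h hm hS hs ((log_le_log (by linarith) hst).trans htw)
    have hA : 0 ≤ 1 + S := by linarith
    have hT1 := h.sum_log_le hm ht hu1 hxu hA (by linarith) hU
    have hT1' : 0 ≤ ∑ n ∈ Finset.Ioc 0 ⌊t⌋₊ with IsSmooth m n, log (t / n) := by
      refine Finset.sum_nonneg fun n hn => ?_
      simp only [Finset.mem_filter, Finset.mem_Ioc] at hn
      have : (0 : ℝ) < n := by exact_mod_cast hn.1.1
      exact log_nonneg ((one_le_div this).2 ((Nat.le_floor_iff ht0.le).1 hn.1.2))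
    have hT2 := h.sum_not_le_le hm ht hu1 hxu hA (by linarith) hU hKs
    have hT2' : 0 ≤ ∑ d ∈ Finset.Ioc 0 ⌊t⌋₊ with IsSmooth m d ∧ ¬ d ≤ m,
        ArithmeticFunction.vonMangoldt d * (Psi ⌊t / d⌋₊ m : ℝ) :=
      Finset.sum_nonneg fun d _ =>
        mul_nonneg ArithmeticFunction.vonMangoldt_nonneg (Nat.cast_nonneg _)
    have hT3 := abs_sum_prime_powers_sub_le h hm hmt hu1 huw hxu hD hDS hBD hBS
      (fun σ h0 h1 => hCs (log m) u σ hm hu1 h0 h1 (by linarith))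
    have hsplit : ∑ d ∈ Finset.Ioc 0 ⌊t⌋₊ with IsSmooth m d,
        ArithmeticFunction.vonMangoldt d * (Psi ⌊t / d⌋₊ m : ℝ) =
        ∑ d ∈ Finset.Ioc 0 m, ArithmeticFunction.vonMangoldt d * (Psi ⌊t / d⌋₊ m : ℝ) +
        ∑ d ∈ Finset.Ioc 0 ⌊t⌋₊ with IsSmooth m d ∧ ¬ d ≤ m,
          ArithmeticFunction.vonMangoldt d * (Psi ⌊t / d⌋₊ m : ℝ) := by
      rw [← Finset.sum_filter_add_sum_filter_not _ (fun d => d ≤ m), Finset.filter_filter,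
        Finset.filter_filter]
      congr 1
      refine Finset.sum_congr ?_ fun _ _ => rfl
      ext d
      simp only [Finset.mem_filter, Finset.mem_Ioc]
      constructor
      · rintro ⟨⟨h1, -⟩, -, h2⟩
        exact ⟨h1, h2⟩
      · rintro ⟨h1, h2⟩
        exact ⟨⟨h1, h2.trans (Nat.le_floor hmt)⟩, isSmooth_of_le h1 h2, h2⟩
    have hid := Psi_mul_log_eq ht m
    rw [hsplit, hxu] at hid
    have hX : 0 < t * ρ u := by positivity
    have huL : 0 < u * log m := by positivity
    have htot : |(Psi ⌊t⌋₊ m : ℝ) - t * ρ u| * (u * log m) ≤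
        t * ρ u * (u * log m * (1 / 2 * (S + D)) + (C + 6 / ρ 2 + 3 + K) * (1 + S)) := by
      rw [← abs_of_pos huL, ← abs_mul, abs_of_pos huL, sub_mul, hid]
      have e : t * ρ u * (u * log m * (1 / 2 * (S + D)) + (C + 6 / ρ 2 + 3 + K) * (1 + S)) =
        t * ρ u * (u * log m * (1 / 2 * (S + D)) + (C + 6 / ρ 2) * (1 + S)) +
          3 * ((1 + S) * (t * ρ u)) + K * ((1 + S) * (t * ρ u)) := by ring
      rw [e]
      rw [abs_le] at hT3 ⊢
      have n1 : 0 ≤ (1 + S) * (t * ρ u) := by positivity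
      have n2 : 0 ≤ K * ((1 + S) * (t * ρ u)) := by positivity
      constructor <;> linarith [hT3.1, hT3.2]
    rw [← le_div_iff₀ huL] at htot
    refine htot.trans ?_
    rw [mul_div_assoc, mul_comm]
    refine mul_le_mul_of_nonneg_right ?_ hX.le
    rw [add_div, mul_div_cancel_left₀ _ huL.ne']
    refine add_le_add le_rfl (div_le_div_of_nonneg_left (by positivity) (by positivity) ?_)
    exact mul_le_mul_of_nonneg_right hwu hm.le

theorem IsDickman.exists_relErrorBound {ρ : ℝ → ℝ} (h : IsDickman ρ) (m : ℕ) (hm : 0 < log m)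
    (D w : ℝ) : ∃ S, D ≤ S ∧ RelErrorBound ρ m S w := by
  have hρw := h.pos w
  refine ⟨max D (1 / ρ w), le_max_left _ _, fun t ht htw => ?_⟩
  have ht0 : 0 < t := by linarith
  have hρ := h.pos (log t / log m)
  have h1 := h.le_one (log t / log m)
  have h2 : ρ w ≤ ρ (log t / log m) := h.antitone ((div_le_iff₀ hm).2 htw)
  have hind : (0 : ℝ) ≤ if t ≤ m then 1 else 0 := by split_ifs <;> norm_num
  refine le_add_of_le_of_nonneg ?_ hind
  have h3 : (Psi ⌊t⌋₊ m : ℝ) ≤ t :=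
    le_trans (by exact_mod_cast Vinogradov.Psi_le _ _) (Nat.floor_le ht0.le)
  have h4 : (0 : ℝ) ≤ Psi ⌊t⌋₊ m := Nat.cast_nonneg _
  have h5 : t * ρ (log t / log m) ≤ t := mul_le_of_le_one_right ht0.le h1
  have h6 : 0 < t * ρ (log t / log m) := by positivity
  have h7 : |(Psi ⌊t⌋₊ m : ℝ) - t * ρ (log t / log m)| ≤ t := by
    rw [abs_le]; constructor <;> linarith
  refine h7.trans ?_
  calc t ≤ 1 / ρ w * (t * ρ (log t / log m)) := by
        rw [one_div_mul_eq_div, le_div_iff₀ hρw]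
        exact mul_le_mul_of_nonneg_left h2 ht0.le
    _ ≤ _ := mul_le_mul_of_nonneg_right (le_max_right _ _) h6.le

theorem IsDickman.relErrorBound_csInf {ρ : ℝ → ℝ} (h : IsDickman ρ) {m : ℕ} {D w : ℝ}
    (hne : {S | D ≤ S ∧ RelErrorBound ρ m S w}.Nonempty) :
    RelErrorBound ρ m (sInf {S | D ≤ S ∧ RelErrorBound ρ m S w}) w := by
  intro t ht htw
  have hρ := h.pos (log t / log m)
  have hX : 0 < t * ρ (log t / log m) := by positivity
  rw [← sub_le_iff_le_add, ← div_le_iff₀ hX]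
  refine le_csInf hne fun S hS => ?_
  rw [div_le_iff₀ hX, sub_le_iff_le_add]
  exact hS.2 t ht htw

theorem IsDickman.exists_relErrorBound_of_step {ρ : ℝ → ℝ} (h : IsDickman ρ) {m : ℕ}
    {D w q : ℝ} (hm : 0 < log m) (hD : 0 ≤ D) (hq : 0 ≤ q)
    (hstep : ∀ S, D ≤ S → RelErrorBound ρ m S w →
      RelErrorBound ρ m (1 / 2 * (S + D) + q * (1 + S)) w) :
    ∃ S, 0 ≤ S ∧ RelErrorBound ρ m S w ∧ (1 - 2 * q) * (1 + S) ≤ 1 + D := by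
  have hne : {S | D ≤ S ∧ RelErrorBound ρ m S w}.Nonempty := h.exists_relErrorBound m hm D w
  set S := sInf {S | D ≤ S ∧ RelErrorBound ρ m S w} with hS
  have hDS : D ≤ S := le_csInf hne fun _ hs => hs.1
  have hv : RelErrorBound ρ m S w := h.relErrorBound_csInf hne
  refine ⟨S, hD.trans hDS, hv, ?_⟩
  have hq1 : 0 ≤ q * (1 + S) := mul_nonneg hq (by linarith)
  have : S ≤ 1 / 2 * (S + D) + q * (1 + S) :=
    csInf_le ⟨D, fun _ hs => hs.1⟩ ⟨by linarith, hstep S hDS hv⟩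
  linarith

theorem relErrorBound_zero_one {ρ : ℝ → ℝ} (h : IsDickman ρ) {m : ℕ} (hm : 0 < log m) :
    RelErrorBound ρ m 0 1 := by
  intro t ht htm
  have hm1 : (1 : ℝ) < m := (log_pos_iff (Nat.cast_nonneg m)).1 hm
  have ht0 : 0 < t := by linarith
  rw [one_mul, log_le_log_iff ht0 (by linarith)] at htm
  rw [h.eq_one _ ((div_le_one hm).2 (log_le_log ht0 htm)), if_pos htm,
    Psi_of_le (Nat.floor_le_of_le htm), mul_one, zero_mul, zero_add, abs_le]
  have := Nat.floor_le ht0.le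
  have := Nat.lt_floor_add_one t
  constructor <;> linarith

theorem inv_nat_le_log_succ_sub_log {k : ℕ} (hk : 1 ≤ k) :
    1 / (k : ℝ) ≤ 2 * (log (k + 1) - log k) := by
  have hk0 : (1 : ℝ) ≤ k := by exact_mod_cast hk
  rw [← log_div (by positivity) (by positivity)]
  have := one_sub_inv_le_log_of_pos (show 0 < ((k : ℝ) + 1) / k by positivity)
  have e : 1 - (((k : ℝ) + 1) / k)⁻¹ = 1 / (k + 1) := by
    field_simp
    ring
  rw [e] at this
  have : 1 / (k : ℝ) ≤ 2 * (1 / (k + 1)) := by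
    rw [mul_one_div, div_le_div_iff₀ (by positivity) (by positivity)]
    linarith
  linarith

theorem inv_one_sub_le_exp {v : ℝ} (h0 : 0 ≤ v) (h1 : v ≤ 1 / 2) :
    1 ≤ (1 - v) * exp (2 * v) := by
  have := add_one_le_exp (2 * v)
  nlinarith

theorem IsDickman.exists_relErrorBound_nat {ρ : ℝ → ℝ} (h : IsDickman ρ) {b : ℝ} (hb : 0 < b)
    (hb' : b < 3 / 5) : ∃ C : ℝ, 0 < C ∧ ∀ m K : ℕ, C ≤ log m → 2 ≤ K →
      4 * log (K + 1) ≤ (log m) ^ b → 8 * log (K + 1) ≤ log m →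
      ∃ D, 0 ≤ D ∧ RelErrorBound ρ m D (K / 2) ∧ 1 + D ≤ exp (4 * C / log m * log K) := by
  obtain ⟨C, hC, hstep⟩ := h.exists_relErrorBound_step hb hb'
  refine ⟨4 * C, by positivity, fun m K hm hK => ?_⟩
  have hm0 : 0 < log m := by linarith
  induction K, hK using Nat.le_induction with
  | base =>
    intro _ _
    refine ⟨0, le_rfl, ?_, ?_⟩
    · have := relErrorBound_zero_one h hm0
      norm_num
      exact this
    · rw [add_zero]
      exact one_le_exp (by have := log_nonneg (show (1 : ℝ) ≤ (2 : ℕ) by norm_num); positivity)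
  | succ k hk ih =>
    intro hL1 hL2
    have hk2 : (2 : ℝ) ≤ k := by exact_mod_cast hk
    have hmono : log ((k : ℝ) + 1) ≤ log (((k + 1 : ℕ) : ℝ) + 1) :=
      log_le_log (by positivity) (by push_cast; linarith)
    obtain ⟨D, hD0, hDB, hDe⟩ := ih (by linarith) (by linarith)
    have hkey : 2 * ((k : ℝ) / 2 + 1 / 2) + 1 = ((k + 1 : ℕ) : ℝ) + 1 := by push_cast; ring
    have hw : (k : ℝ) / 2 + 1 / 2 = ((k + 1 : ℕ) : ℝ) / 2 := by push_cast; ring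
    have hq : 0 ≤ C / ((k : ℝ) / 2 * log m) := by positivity
    obtain ⟨S, hS0, hSB, hSe⟩ := h.exists_relErrorBound_of_step (w := (k : ℝ) / 2 + 1 / 2)
      hm0 hD0 hq (fun S hDS hSB => by
        have := hstep m (k / 2) D S hm0 (by linarith) hD0 hDS hDB hSB (by rwa [hkey])
          (by rwa [hkey])
        rwa [mul_div_right_comm] at this)
    refine ⟨S, hS0, by rwa [hw] at hSB, ?_⟩
    set v := 2 * (C / ((k : ℝ) / 2 * log m)) with hv
    have hv0 : 0 ≤ v := by positivity
    have hve : v = 4 * C / log m * (1 / k) := by rw [hv]; field_simp; ring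
    have hv1 : v ≤ 1 / 2 := by
      have e1 : 4 * C / log m ≤ 1 := (div_le_one hm0).2 hm
      have e2 : 1 / (k : ℝ) ≤ 1 / 2 := one_div_le_one_div_of_le two_pos hk2
      rw [hve]
      have : 0 ≤ 1 / (k : ℝ) := by positivity
      nlinarith [show 0 ≤ 4 * C / log m by positivity]
    have hexp := inv_one_sub_le_exp hv0 hv1
    have hinv := inv_nat_le_log_succ_sub_log (k := k) (by omega)
    calc 1 + S ≤ ((1 - v) * exp (2 * v)) * (1 + S) :=
          le_mul_of_one_le_left (by linarith) hexp
      _ = exp (2 * v) * ((1 - v) * (1 + S)) := by ring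
      _ ≤ exp (2 * v) * exp (4 * (4 * C) / log m * log k) :=
          mul_le_mul_of_nonneg_left (hSe.trans hDe) (exp_pos _).le
      _ ≤ _ := by
          rw [← exp_add]
          refine exp_le_exp.2 ?_
          have e : 0 ≤ 4 * (4 * C) / log m := by positivity
          have := mul_le_mul_of_nonneg_left hinv (show 0 ≤ 2 * (4 * C / log m) by positivity)
          push_cast
          rw [hve]
          calc _ ≤ 2 * (4 * C / log m) * (2 * (log (k + 1) - log k)) +
                4 * (4 * C) / log m * log k := by linarith
            _ = _ := by ring

/-- The bound for large `m`, for a bundled Dickman function. -/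
theorem IsDickman.exists_abs_Psi_sub_le {ρ : ℝ → ℝ} (h : IsDickman ρ) {a : ℝ} (ha : 0 < a)
    (ha' : a < 3 / 5) : ∃ L₀ C : ℝ, 0 < L₀ ∧ 0 < C ∧ ∀ n m : ℕ, 1 ≤ n → L₀ ≤ log m →
      Upsilon n m ≤ exp ((log m) ^ a) →
      |(Psi n m : ℝ) - n * ρ (Upsilon n m)| ≤
        C * (n * ρ (Upsilon n m) * log (Upsilon n m + 1) / log m) := by
  obtain ⟨b, hab, hb⟩ := exists_between ha'
  obtain ⟨C, hC, hmain⟩ := h.exists_relErrorBound_nat (ha.trans hab) hb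
  obtain ⟨L₁, hL₁⟩ := Filter.eventually_atTop.1 ((eventually_mul_rpow_le_rpow 12 hab).and
    (eventually_mul_rpow_le_rpow 24 (show a < 1 by linarith)))
  refine ⟨max 1 (max C L₁), exp (C / 2) * (8 * C), by positivity, by positivity, ?_⟩
  intro n m hn hL hU
  have hL1 : 1 ≤ log m := (le_max_left _ _).trans hL
  have hLC : C ≤ log m := (le_max_left _ _).trans ((le_max_right _ _).trans hL)
  obtain ⟨hc1, hc2⟩ := hL₁ (log m) ((le_max_right _ _).trans ((le_max_right _ _).trans hL))
  rw [rpow_one] at hc2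
  have hm0 : 0 < log m := by linarith
  have hm1 : (1 : ℝ) < m := (log_pos_iff (Nat.cast_nonneg m)).1 hm0
  have hn1 : (1 : ℝ) ≤ n := by exact_mod_cast hn
  set u := Upsilon n m with hu
  have hue : u = log n / log m := rfl
  have hρ := h.pos u
  have hu0 : 0 ≤ u := by rw [hue]; exact div_nonneg (log_nonneg hn1) hm0.le
  have hlu : 0 ≤ log (u + 1) := log_nonneg (by linarith)
  rcases le_or_gt n m with hnm | hnm
  · have hu1 : u ≤ 1 := by
      rw [hue, div_le_one hm0]
      exact log_le_log (by linarith) (by exact_mod_cast hnm)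
    rw [Psi_of_le hnm, h.eq_one u hu1, mul_one, sub_self, abs_zero]
    positivity
  · have hnm' : (m : ℝ) < n := by exact_mod_cast hnm
    have hu1 : 1 < u := by
      rw [hue, one_lt_div hm0]
      exact log_lt_log (by linarith) hnm'
    set K := ⌈2 * u⌉₊ with hK
    have hK1 : 2 * u ≤ K := Nat.le_ceil _
    have hK2 : (K : ℝ) < 2 * u + 1 := Nat.ceil_lt_add_one (by linarith)
    have hK3 : 2 ≤ K := by
      have : (2 : ℝ) ≤ K := by linarith
      exact_mod_cast this
    have hLa : 1 ≤ (log m) ^ a := one_le_rpow hL1 ha.le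
    have hlogK : log (K + 1) ≤ 3 * (log m) ^ a := by
      have h4 : log 4 ≤ 2 := by
        rw [show (4 : ℝ) = 2 ^ 2 by norm_num, log_pow]
        have := log_two_lt_d9
        push_cast
        linarith
      calc log (K + 1) ≤ log (4 * exp ((log m) ^ a)) :=
            log_le_log (by positivity) (by linarith)
        _ = log 4 + (log m) ^ a := by rw [log_mul (by norm_num) (exp_pos _).ne', log_exp]
        _ ≤ _ := by linarith
    obtain ⟨D, hD0, hDB, hDe⟩ := hmain m K hLC hK3 (by linarith) (by linarith)
    have hB := hDB n hn1 (by
      have : log n = u * log m := by rw [hue, div_mul_cancel₀ _ hm0.ne']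
      rw [this]
      exact mul_le_mul_of_nonneg_right (by linarith) hm0.le)
    rw [if_neg (by linarith), add_zero, Nat.floor_natCast, ← hue] at hB
    refine hB.trans ?_
    set v := 4 * C / log m * log K with hv
    have hKpos : (0 : ℝ) < K := by linarith
    have hlK0 : 0 ≤ log K := log_nonneg (by linarith)
    have hv0 : 0 ≤ v := by positivity
    have hvC : v ≤ C / 2 := by
      have e1 : log K ≤ log (K + 1) := log_le_log hKpos (by linarith)
      have e2 : log K ≤ log m / 8 := by linarith
      calc v ≤ 4 * C / log m * (log m / 8) := mul_le_mul_of_nonneg_left e2 (by positivity)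
        _ = C / 2 := by field_simp; norm_num
    have hDv : D ≤ exp (C / 2) * v := by
      have e1 : exp v - 1 ≤ v * exp v := by
        have := add_one_le_exp (-v)
        rw [exp_neg] at this
        have h2 := mul_le_mul_of_nonneg_right this (exp_pos v).le
        rw [inv_mul_cancel₀ (exp_pos v).ne'] at h2
        linarith
      have e2 := mul_le_mul_of_nonneg_left (exp_le_exp.2 hvC) hv0
      linarith
    have hlK : log K ≤ 2 * log (u + 1) := by
      rw [show 2 * log (u + 1) = log ((u + 1) ^ 2) by rw [log_pow]; norm_num]
      exact log_le_log hKpos (by nlinarith)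
    have hvu : v ≤ 8 * C * (log (u + 1) / log m) := by
      calc v ≤ 4 * C / log m * (2 * log (u + 1)) :=
            mul_le_mul_of_nonneg_left hlK (by positivity)
        _ = _ := by ring
    calc D * (n * ρ u) ≤ exp (C / 2) * (8 * C * (log (u + 1) / log m)) * (n * ρ u) :=
          mul_le_mul_of_nonneg_right
            (hDv.trans (mul_le_mul_of_nonneg_left hvu (exp_pos _).le)) (by positivity)
      _ = _ := by ring

theorem IsDickman.exists_abs_Psi_sub_le_of_log_le {ρ : ℝ → ℝ} (h : IsDickman ρ) {a : ℝ}
    (ha : 0 < a) {L₀ : ℝ} (hL₀ : 0 < L₀) : ∃ C : ℝ, 0 < C ∧ ∀ n m : ℕ, 2 ≤ n → 2 ≤ m →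
      log m ≤ L₀ → Upsilon n m ≤ exp ((log m) ^ a) →
      |(Psi n m : ℝ) - n * ρ (Upsilon n m)| ≤
        C * (n * ρ (Upsilon n m) * log (Upsilon n m + 1) / log m) := by
  set U := exp (L₀ ^ a) with hU
  set c := log (log 2 / L₀ + 1) with hc
  have hl2 : 0 < log 2 := log_pos one_lt_two
  have hc0 : 0 < c := log_pos (by have := div_pos hl2 hL₀; linarith)
  have hρU := h.pos U
  refine ⟨L₀ / (ρ U * c), by positivity, fun n m hn hm hL hu => ?_⟩
  have hn2 : (2 : ℝ) ≤ n := by exact_mod_cast hn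
  have hm2 : (2 : ℝ) ≤ m := by exact_mod_cast hm
  have hm0 : 0 < log m := log_pos (by linarith)
  set u := Upsilon n m with hud
  have hue : u = log n / log m := rfl
  have hρ := h.pos u
  have h1 : ρ U ≤ ρ u :=
    h.antitone (hu.trans (exp_le_exp.2 (rpow_le_rpow hm0.le hL ha.le)))
  have h2 : c ≤ log (u + 1) := by
    refine log_le_log (by positivity) (add_le_add ?_ le_rfl)
    rw [hue]
    exact div_le_div₀ (log_nonneg (by linarith)) (log_le_log two_pos hn2) hm0 hL
  have h3 : (Psi n m : ℝ) ≤ n := by exact_mod_cast Vinogradov.Psi_le n m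
  have h4 : (0 : ℝ) ≤ Psi n m := Nat.cast_nonneg _
  have h5 : (n : ℝ) * ρ u ≤ n := mul_le_of_le_one_right (by linarith) (h.le_one u)
  have h6 : 0 < (n : ℝ) * ρ u := by positivity
  calc |(Psi n m : ℝ) - n * ρ u| ≤ n := by rw [abs_le]; constructor <;> linarith
    _ = L₀ / (ρ U * c) * (n * ρ U * c / L₀) := by field_simp
    _ ≤ _ := by
      refine mul_le_mul_of_nonneg_left ?_ (by positivity)
      refine div_le_div₀ (mul_nonneg h6.le (hc0.le.trans h2)) ?_ hm0 hL
      exact mul_le_mul (mul_le_mul_of_nonneg_left h1 (by linarith)) h2 hc0.le h6.le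

end Vinogradov

/-- (Hildebrand, 1986) For every `ε ∈ (0, 3/5)` there is a constant `C_ε > 0` such that for all
integers `n ≥ 2`, `m ≥ 2` with `Υ(n,m) ≤ exp((log m)^(3/5 − ε))`, one has
`|Ψ(n,m) − n ρ(Υ(n,m))| ≤ C_ε n ρ(Υ(n,m)) log(Υ(n,m)+1)/log m`,
where `ρ` is the Dickman function. -/
theorem hildebrand_smooth_approx
    (ρ : ℝ → ℝ)
    (hρ_cont : ContinuousOn ρ (Set.Ici (0 : ℝ)))
    (hρ_init : ∀ u : ℝ, 0 ≤ u → u ≤ 1 → ρ u = 1)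
    (hρ_delay : ∀ u : ℝ, 1 < u → HasDerivAt ρ (-ρ (u - 1) / u) u)
    (ε : ℝ) (hε : 0 < ε) (hε' : ε < 3 / 5) :
    ∃ C : ℝ, 0 < C ∧ ∀ n m : ℕ, 2 ≤ n → 2 ≤ m →
      Upsilon n m ≤ Real.exp ((Real.log m) ^ ((3 : ℝ) / 5 - ε)) →
      |(Psi n m : ℝ) - n * ρ (Upsilon n m)|
        ≤ C * (n * ρ (Upsilon n m) * Real.log (Upsilon n m + 1) / Real.log m) := by
  have h := Vinogradov.IsDickman.of_continuousOn hρ_cont hρ_init hρ_delay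
  obtain ⟨L₀, C₁, hL₀, hC₁, h₁⟩ :=
    h.exists_abs_Psi_sub_le (a := (3 : ℝ) / 5 - ε) (by linarith) (by linarith)
  obtain ⟨C₂, hC₂, h₂⟩ :=
    h.exists_abs_Psi_sub_le_of_log_le (a := (3 : ℝ) / 5 - ε) (by linarith) hL₀
  refine ⟨max C₁ C₂, lt_max_of_lt_left hC₁, fun n m hn hm hU => ?_⟩
  have hn1 : (1 : ℝ) ≤ n := by exact_mod_cast one_le_two.trans hn
  have hm1 : (1 : ℝ) ≤ m := by exact_mod_cast one_le_two.trans hm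
  have hu : 0 ≤ Upsilon n m := div_nonneg (log_nonneg hn1) (log_nonneg hm1)
  have hX : 0 ≤ n * ρ (Upsilon n m) * Real.log (Upsilon n m + 1) / Real.log m := by
    have hρ := (h.pos (Upsilon n m)).le
    simp only [max_eq_left hu] at hρ
    exact div_nonneg (mul_nonneg (mul_nonneg (Nat.cast_nonneg n) hρ)
      (log_nonneg (by linarith))) (log_nonneg hm1)
  rcases le_total L₀ (Real.log m) with hL | hL
  · have key := h₁ n m (one_le_two.trans hn) hL hU
    simp only [max_eq_left hu] at key
    exact key.trans (mul_le_mul_of_nonneg_right (le_max_left _ _) hX)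
  · have key := h₂ n m hn hm hL hU
    simp only [max_eq_left hu] at key
    exact key.trans (mul_le_mul_of_nonneg_right (le_max_right _ _) hX)
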